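/- For every planar graph H and every positive integer N_0, there exists a positive integer N such that for every H-minor free graph G, every 2-list-assignment L of G, and every pre-L-coloring c_0 of G with weak diameter in G at most N_0, c_0 can be extended to an L-coloring of G with weak diameter in G at most N. -/

import Mathlib

open SimpleGraph

universe u v

/-- `a` and `b` lie in a common monochromatic component of the coloring `c`
restricted to the set `S` of colored vertices. -/
def MonoReach {β : Type*} {α : Type*} (G : SimpleGraph β) (S : Set β) (c : β → α)
    (a b : β) : Prop :=
  ∃ w : G.Walk a b, ∀ v ∈ w.support, v ∈ S ∧ c v = c a

/-- The coloring `c` (with domain `S`) has weak diameter in `G` at most `N`. -/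
def HasWeakDiamLE {β : Type*} {α : Type*} (G : SimpleGraph β) (S : Set β) (c : β → α)
    (N : ℕ) : Prop :=
  ∀ a b : β, MonoReach G S c a b → G.dist a b ≤ N

/-- `H` is a minor of `G`. -/
def IsMinor {W : Type*} {V : Type*} (H : SimpleGraph W) (G : SimpleGraph V) : Prop :=
  ∃ B : W → Set V,
    (∀ w, (B w).Nonempty) ∧
    (∀ w, (G.induce (B w)).Connected) ∧
    (∀ w₁ w₂, w₁ ≠ w₂ → Disjoint (B w₁) (B w₂)) ∧
    (∀ ⦃w₁ w₂⦄, H.Adj w₁ w₂ → ∃ x ∈ B w₁, ∃ y ∈ B w₂, G.Adj x y)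

/-- A graph is planar iff it has no `K₅` minor and no `K₃,₃` minor
(Wagner's characterization of planarity). -/
def IsPlanar {W : Type*} (H : SimpleGraph W) : Prop :=
  ¬ IsMinor (⊤ : SimpleGraph (Fin 5)) H ∧
    ¬ IsMinor (completeBipartiteGraph (Fin 3) (Fin 3)) H

/-! ### Connected vertex sets -/

/-- Reachability inside a vertex set. -/
def ReachIn {V : Type*} (G : SimpleGraph V) (S : Set V) : V → V → Prop :=
  Relation.ReflTransGen (fun x y => G.Adj x y ∧ x ∈ S ∧ y ∈ S)

/-- A nonempty vertex set inducing a connected subgraph. -/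
def Conn {V : Type*} (G : SimpleGraph V) (S : Set V) : Prop :=
  S.Nonempty ∧ ∀ a ∈ S, ∀ b ∈ S, ReachIn G S a b

/-- Some edge joins the two sets. -/
def Touch {V : Type*} (G : SimpleGraph V) (A B : Set V) : Prop :=
  ∃ x ∈ A, ∃ y ∈ B, G.Adj x y

/-- The component of `v` in the subgraph induced on `S`. -/
def cmpt {V : Type*} (G : SimpleGraph V) (S : Set V) (v : V) : Set V :=
  {u | ReachIn G S v u}

/-- The outer neighbourhood of a vertex set. -/
def Nb {V : Type*} (G : SimpleGraph V) (C : Set V) : Set V :=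
  {y | y ∉ C ∧ ∃ x ∈ C, G.Adj x y}

section Basic

variable {V : Type*} {G G' : SimpleGraph V} {S T A B C : Set V} {a b x y z : V}

theorem ReachIn.symm (h : ReachIn G S a b) : ReachIn G S b a := by
  induction h with
  | refl => exact .refl
  | tail _ h ih => exact .head ⟨h.1.symm, h.2.2, h.2.1⟩ ih

theorem ReachIn.trans (h : ReachIn G S a b) (h' : ReachIn G S b x) : ReachIn G S a x :=
  Relation.ReflTransGen.trans h h'

theorem ReachIn.mono (h : ReachIn G S a b) (hG : G ≤ G') (hS : S ⊆ T) : ReachIn G' T a b :=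
  Relation.ReflTransGen.mono (p := fun x y => G'.Adj x y ∧ x ∈ T ∧ y ∈ T)
    (fun _ _ h => ⟨hG h.1, hS h.2.1, hS h.2.2⟩) _ _ h

theorem ReachIn.mem (h : ReachIn G S a b) (ha : a ∈ S) : b ∈ S := by
  induction h with
  | refl => exact ha
  | tail _ h _ => exact h.2.2

theorem ReachIn.single (h : G.Adj a b) (ha : a ∈ S) (hb : b ∈ S) : ReachIn G S a b :=
  Relation.ReflTransGen.single ⟨h, ha, hb⟩

/-- A set closed under adjacency inside `S` is closed under reachability. -/
theorem ReachIn.closed (h : ReachIn G S a b) (ha : a ∈ T)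
    (hT : ∀ x ∈ T, ∀ y ∈ S, G.Adj x y → y ∈ T) : b ∈ T := by
  induction h with
  | refl => exact ha
  | tail _ h ih => exact hT _ ih _ h.2.2 h.1

theorem Touch.symm (h : Touch G A B) : Touch G B A := by
  obtain ⟨x, hx, y, hy, h⟩ := h
  exact ⟨y, hy, x, hx, h.symm⟩

theorem Touch.mono {A' B' : Set V} (h : Touch G A B) (hA : A ⊆ A') (hB : B ⊆ B') :
    Touch G A' B' := by
  obtain ⟨x, hx, y, hy, h⟩ := h
  exact ⟨x, hA hx, y, hB hy, h⟩

theorem Touch.mono_graph (h : Touch G A B) (hG : G ≤ G') : Touch G' A B := by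
  obtain ⟨x, hx, y, hy, h⟩ := h
  exact ⟨x, hx, y, hy, hG h⟩

theorem conn_singleton (a : V) : Conn G {a} := by
  refine ⟨⟨a, rfl⟩, ?_⟩
  rintro x rfl y rfl
  exact .refl

theorem Conn.nonempty (h : Conn G S) : S.Nonempty := h.1

theorem conn_of_root (ha : a ∈ S) (h : ∀ b ∈ S, ReachIn G S a b) : Conn G S :=
  ⟨⟨a, ha⟩, fun _ hx _ hy => (h _ hx).symm.trans (h _ hy)⟩

theorem Conn.mono_graph (h : Conn G S) (hG : G ≤ G') : Conn G' S :=
  ⟨h.1, fun a ha b hb => (h.2 a ha b hb).mono hG le_rfl⟩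

/-- A nonempty subset closed under adjacency is everything. -/
theorem Conn.subset_of_closed (h : Conn G S) (hTS : (S ∩ T).Nonempty)
    (hT : ∀ x ∈ T, x ∈ S → ∀ y ∈ S, G.Adj x y → y ∈ T) : S ⊆ T := by
  obtain ⟨a, haS, haT⟩ := hTS
  intro b hb
  have := (h.2 a haS b hb).closed (T := T ∩ S) ⟨haT, haS⟩
    (fun x hx y hy hxy => ⟨hT x hx.1 hx.2 y hy hxy, hy⟩)
  exact this.1

theorem Conn.union (hS : Conn G S) (hT : Conn G T) (h : (S ∩ T).Nonempty) :
    Conn G (S ∪ T) := by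
  obtain ⟨a, haS, haT⟩ := h
  refine conn_of_root (a := a) (Or.inl haS) ?_
  rintro b (hb | hb)
  · exact (hS.2 a haS b hb).mono le_rfl Set.subset_union_left
  · exact (hT.2 a haT b hb).mono le_rfl Set.subset_union_right

theorem Conn.union_touch (hS : Conn G S) (hT : Conn G T) (h : Touch G S T) :
    Conn G (S ∪ T) := by
  obtain ⟨a, ha, c, hc, hac⟩ := h
  refine conn_of_root (a := a) (Or.inl ha) ?_
  rintro b (hb | hb)
  · exact (hS.2 a ha b hb).mono le_rfl Set.subset_union_left
  · exact (ReachIn.single hac (Or.inl ha) (Or.inr hc)).trans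
      ((hT.2 c hc b hb).mono le_rfl Set.subset_union_right)

theorem Conn.insert (hS : Conn G S) (ha : a ∈ S) (h : G.Adj a x) : Conn G (insert x S) := by
  rw [Set.insert_eq, Set.union_comm]
  exact hS.union_touch (conn_singleton x) ⟨a, ha, x, rfl, h⟩

theorem conn_pair (h : G.Adj a b) : Conn G {a, b} := by
  have := (conn_singleton (G := G) b).insert rfl h.symm
  exact this

/-- A union of connected sets, each meeting or touching a connected core. -/
theorem Conn.union_iUnion {ι : Type*} {F : ι → Set V} (hS : Conn G S)
    (hF : ∀ i, Conn G (F i)) (h : ∀ i, (S ∩ F i).Nonempty ∨ Touch G S (F i)) :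
    Conn G (S ∪ ⋃ i, F i) := by
  obtain ⟨a, ha⟩ := hS.1
  refine conn_of_root (a := a) (Or.inl ha) ?_
  rintro b (hb | hb)
  · exact (hS.2 a ha b hb).mono le_rfl Set.subset_union_left
  · obtain ⟨i, hi⟩ := Set.mem_iUnion.1 hb
    have hc : Conn G (S ∪ F i) := by
      rcases h i with h | h
      · exact hS.union (hF i) h
      · exact hS.union_touch (hF i) h
    exact (hc.2 a (Or.inl ha) b (Or.inr hi)).mono le_rfl
      (Set.union_subset_union_right _ (Set.subset_iUnion F i))

theorem mem_cmpt (a : V) : a ∈ cmpt G S a := Relation.ReflTransGen.refl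

theorem cmpt_subset (ha : a ∈ S) : cmpt G S a ⊆ S := fun _ h => ReachIn.mem h ha

theorem cmpt_closed (hx : x ∈ cmpt G S a) (hxS : x ∈ S) (hy : y ∈ S) (h : G.Adj x y) :
    y ∈ cmpt G S a :=
  ReachIn.trans hx (ReachIn.single h hxS hy)

theorem cmpt_conn (a : V) : Conn G (cmpt G S a) := by
  refine conn_of_root (mem_cmpt a) ?_
  intro b hb
  have : ∀ b, ReachIn G S a b → ReachIn G (cmpt G S a) a b := by
    intro b h
    induction h with
    | refl => exact .refl
    | tail h1 h2 ih => exact ih.tail ⟨h2.1, h1, h1.tail h2⟩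
  exact this b hb

theorem Conn.subset_cmpt (hT : Conn G T) (hTS : T ⊆ S) (hx : x ∈ T) (hxa : x ∈ cmpt G S a) :
    T ⊆ cmpt G S a := fun y hy =>
  ReachIn.trans hxa ((hT.2 x hx y hy).mono le_rfl hTS)

theorem Conn.subset_cmpt_self (hT : Conn G T) (hTS : T ⊆ S) (hx : x ∈ T) : T ⊆ cmpt G S x :=
  hT.subset_cmpt hTS hx (mem_cmpt x)

theorem cmpt_eq_of_mem (h : x ∈ cmpt G S a) : cmpt G S x = cmpt G S a := by
  ext y
  exact ⟨fun hy => ReachIn.trans h hy, fun hy => ReachIn.trans (ReachIn.symm h) hy⟩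

/-- A connected set meeting `T` but not contained in `T` has an edge leaving `T`. -/
theorem Conn.exists_crossing (h : Conn G S) (h1 : (S ∩ T).Nonempty) (h2 : ¬ S ⊆ T) :
    ∃ x ∈ S, x ∈ T ∧ ∃ y ∈ S, y ∉ T ∧ G.Adj x y := by
  by_contra! hc
  exact h2 (h.subset_of_closed h1 fun x hx hxS y hy hxy => by
    by_contra hyT
    exact hc x hxS hx y hy hyT hxy)

theorem conn_iff_induce : Conn G S ↔ S.Nonempty ∧ (G.induce S).Connected := by
  constructor
  · intro h
    refine ⟨h.1, ?_⟩
    have key : ∀ a b, ReachIn G S a b → ∀ (ha : a ∈ S) (hb : b ∈ S),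
        (G.induce S).Reachable ⟨a, ha⟩ ⟨b, hb⟩ := by
      intro a b h
      induction h with
      | refl => intro _ _; exact Reachable.refl _
      | tail _ h ih =>
        intro ha hb
        refine (ih ha h.2.1).trans (Adj.reachable ?_)
        simpa using h.1
    have : Nonempty S := h.1.to_subtype
    exact ⟨fun a b => key a b (h.2 a a.2 b b.2) a.2 b.2⟩
  · rintro ⟨h1, h2⟩
    refine ⟨h1, fun a ha b hb => ?_⟩
    obtain ⟨w⟩ := h2.preconnected ⟨a, ha⟩ ⟨b, hb⟩
    have key : ∀ x y : S, (G.induce S).Walk x y → ReachIn G S x y := by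
      intro x y w
      induction w with
      | nil => exact .refl
      | cons h _ ih => exact .head ⟨by simpa using h, Subtype.coe_prop _, Subtype.coe_prop _⟩ ih
    exact key _ _ w

/-- Any two disjoint connected subsets of a connected set: the first can be enlarged until it
touches the second. -/
theorem Conn.enlarge (hS : Conn G S) (hA : Conn G A) (hB : Conn G B) (hAS : A ⊆ S)
    (hBS : B ⊆ S) (hAB : Disjoint A B) :
    ∃ A', Conn G A' ∧ A ⊆ A' ∧ A' ⊆ S ∧ Disjoint A' B ∧ Touch G A' B := by
  obtain ⟨a, ha⟩ := hA.1
  have haB : a ∈ S \ B := ⟨hAS ha, Set.disjoint_left.1 hAB ha⟩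
  have hsub := cmpt_subset (G := G) haB
  refine ⟨cmpt G (S \ B) a, cmpt_conn a, hA.subset_cmpt_self
    (fun x hx => ⟨hAS hx, Set.disjoint_left.1 hAB hx⟩) ha, hsub.trans Set.sdiff_subset,
    Set.disjoint_left.2 fun x hx => (hsub hx).2, ?_⟩
  obtain ⟨x, hx, hxc, y, hy, hyc, hxy⟩ := hS.exists_crossing (T := cmpt G (S \ B) a)
    ⟨a, hAS ha, mem_cmpt a⟩ (fun h => by
      obtain ⟨b, hb⟩ := hB.1
      exact (hsub (h (hBS hb))).2 hb)
  refine ⟨x, hxc, y, ?_, hxy⟩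
  by_contra hyB
  exact hyc (cmpt_closed hxc (hsub hxc) ⟨hy, hyB⟩ hxy)

/-! ### Paths as functions on the natural numbers -/

/-- The image of an interval under a path function is connected. -/
theorem conn_seg {p : ℕ → V} {i j : ℕ} (hij : i ≤ j)
    (h : ∀ k, i ≤ k → k < j → G.Adj (p k) (p (k + 1))) : Conn G (p '' Set.Icc i j) := by
  induction j, hij using Nat.le_induction with
  | base => simpa using conn_singleton (p i)
  | succ j hj ih =>
    have h1 := ih fun k hk hkj => h k hk (by omega)
    have h2 := h1.insert (x := p (j + 1)) ⟨j, ⟨hj, le_rfl⟩, rfl⟩ (h j hj (by omega))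
    convert h2 using 1
    rw [← Set.image_insert_eq]
    congr 1
    ext k
    simp only [Set.mem_Icc, Set.mem_insert_iff]
    omega

/-- `p` restricted to `[0, l]` is a path of `G` inside `S`. -/
structure IsPathIn (G : SimpleGraph V) (S : Set V) (p : ℕ → V) (l : ℕ) : Prop where
  adj : ∀ i < l, G.Adj (p i) (p (i + 1))
  mem : ∀ i ≤ l, p i ∈ S
  inj : ∀ i ≤ l, ∀ j ≤ l, p i = p j → i = j

theorem IsPathIn.mono {p : ℕ → V} {l : ℕ} (h : IsPathIn G S p l) (hG : G ≤ G') (hS : S ⊆ T) :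
    IsPathIn G' T p l :=
  ⟨fun i hi => hG (h.adj i hi), fun i hi => hS (h.mem i hi), h.inj⟩

theorem IsPathIn.conn_seg {p : ℕ → V} {l i j : ℕ} (h : IsPathIn G S p l) (hij : i ≤ j)
    (hj : j ≤ l) : Conn G (p '' Set.Icc i j) :=
  _root_.conn_seg hij fun k _ hk => h.adj k (by omega)

theorem IsPathIn.seg_subset {p : ℕ → V} {l i j : ℕ} (h : IsPathIn G S p l) (hj : j ≤ l) :
    p '' Set.Icc i j ⊆ S := by
  rintro _ ⟨k, hk, rfl⟩
  exact h.mem k (hk.2.trans hj)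

/-- Shortest walks between two sets inside a third are paths touching the two sets only at
their ends. -/
theorem exists_path (hS : ∃ a ∈ A, ∃ b ∈ B, a ∈ S ∧ ReachIn G S a b) :
    ∃ (p : ℕ → V) (l : ℕ), IsPathIn G S p l ∧ p 0 ∈ A ∧ p l ∈ B ∧
      (∀ i ≤ l, p i ∈ A → i = 0) ∧ (∀ i ≤ l, p i ∈ B → i = l) ∧
      (∀ i j, i ≤ j → j ≤ l → G.Adj (p i) (p j) → j = i + 1) := by
  classical
  let Q : ℕ → Prop := fun l => ∃ p : ℕ → V, (∀ i < l, G.Adj (p i) (p (i + 1))) ∧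
    (∀ i ≤ l, p i ∈ S) ∧ p 0 ∈ A ∧ p l ∈ B
  have hQ : ∃ l, Q l := by
    obtain ⟨a, ha, b, hb, haS, h⟩ := hS
    have : ∀ b, ReachIn G S a b → ∃ (l : ℕ) (p : ℕ → V),
        (∀ i < l, G.Adj (p i) (p (i + 1))) ∧ (∀ i ≤ l, p i ∈ S) ∧ p 0 = a ∧ p l = b := by
      intro b h
      induction h with
      | refl => exact ⟨0, fun _ => a, by simp, fun _ _ => haS, rfl, rfl⟩
      | @tail b c _ h ih =>
        obtain ⟨l, p, h1, h2, h3, h4⟩ := ih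
        refine ⟨l + 1, fun i => if i ≤ l then p i else c, ?_, ?_, by simpa using h3, by simp⟩
        · intro i hi
          by_cases hil : i < l
          · simp only [show i ≤ l by omega, show i + 1 ≤ l by omega, if_true]
            exact h1 i hil
          · obtain rfl : i = l := by omega
            simp only [le_refl, if_true, show ¬ i + 1 ≤ i by omega, if_false, h4]
            exact h.1
        · intro i hi
          by_cases hil : i ≤ l
          · simpa [hil] using h2 i hil
          · simpa [hil] using h.2.2
    obtain ⟨l, p, h1, h2, h3, h4⟩ := this b h
    exact ⟨l, p, h1, h2, h3 ▸ ha, h4 ▸ hb⟩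
  obtain ⟨p, h1, h2, h3, h4⟩ := Nat.find_spec hQ
  set l := Nat.find hQ with hl
  have hmin : ∀ m < l, ¬ Q m := fun m hm => Nat.find_min hQ hm
  -- a shortcut between two positions of the walk contradicts minimality
  have cut : ∀ i j, i < j → j ≤ l → p i ≠ p j := by
    intro i j hij hj he
    refine hmin (l - (j - i)) (by omega) ⟨fun k => if k ≤ i then p k else p (k + (j - i)),
      ?_, ?_, by simpa using h3, ?_⟩
    · intro k hk
      by_cases h5 : k < i
      · simp only [show k ≤ i by omega, show k + 1 ≤ i by omega, if_true]
        exact h1 k (by omega)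
      · by_cases h6 : k = i
        · subst h6
          simp only [le_refl, if_true, show ¬ k + 1 ≤ k by omega, if_false, he]
          have := h1 j (by omega)
          rwa [show k + 1 + (j - k) = j + 1 by omega]
        · simp only [show ¬ k ≤ i by omega, show ¬ k + 1 ≤ i by omega, if_false]
          rw [show k + 1 + (j - i) = k + (j - i) + 1 by omega]
          exact h1 _ (by omega)
    · intro k hk
      by_cases h5 : k ≤ i
      · simpa [h5] using h2 k (by omega)
      · simpa [h5] using h2 (k + (j - i)) (by omega)
    · by_cases h5 : l - (j - i) ≤ i
      · have : l = j := by omega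
        have h6 : l - (j - i) = i := by omega
        simp only [h6, le_refl, if_true, he]
        exact this ▸ h4
      · simp only [h5, if_false]
        rwa [show l - (j - i) + (j - i) = l by omega]
  refine ⟨p, l, ⟨h1, h2, ?_⟩, h3, h4, ?_, ?_, ?_⟩
  · intro i hi j hj he
    rcases lt_trichotomy i j with h | h | h
    · exact absurd he (cut i j h hj)
    · exact h
    · exact absurd he.symm (cut j i h hi)
  · intro i hi hA
    by_contra h0
    refine hmin (l - i) (by omega) ⟨fun k => p (k + i), ?_, ?_, by simpa using hA, ?_⟩
    · intro k hk
      have := h1 (k + i) (by omega)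
      rwa [show k + i + 1 = k + 1 + i by omega] at this
    · intro k hk; exact h2 _ (by omega)
    · simpa [show l - i + i = l by omega] using h4
  · intro i hi hB
    by_contra h0
    exact hmin i (by omega) ⟨p, fun k hk => h1 k (by omega), fun k hk => h2 k (by omega), h3, hB⟩
  · intro i j hij hj hadj
    by_contra hne
    have hij' : i ≠ j := fun h => G.loopless.irrefl _ (h ▸ hadj)
    refine hmin (l - (j - i - 1)) (by omega)
      ⟨fun k => if k ≤ i then p k else p (k + (j - i - 1)), ?_, ?_, by simpa using h3, ?_⟩
    · intro k hk
      by_cases h5 : k < i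
      · simp only [show k ≤ i by omega, show k + 1 ≤ i by omega, if_true]
        exact h1 k (by omega)
      · by_cases h6 : k = i
        · subst h6
          simp only [le_refl, if_true, show ¬ k + 1 ≤ k by omega, if_false]
          rwa [show k + 1 + (j - k - 1) = j by omega]
        · simp only [show ¬ k ≤ i by omega, show ¬ k + 1 ≤ i by omega, if_false]
          rw [show k + 1 + (j - i - 1) = k + (j - i - 1) + 1 by omega]
          exact h1 _ (by omega)
    · intro k hk
      by_cases h5 : k ≤ i
      · simpa [h5] using h2 k (by omega)
      · simpa [h5] using h2 (k + (j - i - 1)) (by omega)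
    · by_cases h5 : l - (j - i - 1) ≤ i
      · omega
      · simp only [h5, if_false]
        rwa [show l - (j - i - 1) + (j - i - 1) = l by omega]

theorem Conn.exists_path (hS : Conn G S) (hA : (S ∩ A).Nonempty) (hB : (S ∩ B).Nonempty) :
    ∃ (p : ℕ → V) (l : ℕ), IsPathIn G S p l ∧ p 0 ∈ A ∧ p l ∈ B ∧
      (∀ i ≤ l, p i ∈ A → i = 0) ∧ (∀ i ≤ l, p i ∈ B → i = l) ∧
      (∀ i j, i ≤ j → j ≤ l → G.Adj (p i) (p j) → j = i + 1) := by
  obtain ⟨a, haS, ha⟩ := hA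
  obtain ⟨b, hbS, hb⟩ := hB
  exact _root_.exists_path ⟨a, ha, b, hb, haS, hS.2 a haS b hbS⟩

end Basic

/-! ### Minors -/

/-- The minor relation in terms of connected branch sets. -/
def HasMinor {W V : Type*} (H : SimpleGraph W) (G : SimpleGraph V) : Prop :=
  ∃ B : W → Set V, (∀ w, Conn G (B w)) ∧ (∀ w₁ w₂, w₁ ≠ w₂ → Disjoint (B w₁) (B w₂)) ∧
    ∀ ⦃w₁ w₂⦄, H.Adj w₁ w₂ → Touch G (B w₁) (B w₂)

section Minor

variable {U V W : Type*} {F : SimpleGraph U} {G G' : SimpleGraph V} {H : SimpleGraph W}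

theorem isMinor_iff : IsMinor H G ↔ HasMinor H G := by
  constructor
  · rintro ⟨B, h1, h2, h3, h4⟩
    exact ⟨B, fun w => conn_iff_induce.2 ⟨h1 w, h2 w⟩, h3, h4⟩
  · rintro ⟨B, h1, h2, h3⟩
    exact ⟨B, fun w => (h1 w).1, fun w => (conn_iff_induce.1 (h1 w)).2, h2, h3⟩

theorem HasMinor.mono (h : HasMinor H G) (hG : G ≤ G') : HasMinor H G' := by
  obtain ⟨B, h1, h2, h3⟩ := h
  exact ⟨B, fun w => (h1 w).mono_graph hG, h2, fun _ _ h => (h3 h).mono_graph hG⟩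

/-- Blowing up a connected set by connected branch sets gives a connected set. -/
theorem Conn.biUnion_branch {B : W → Set V} (hB : ∀ w, Conn G (B w))
    (hadj : ∀ ⦃w₁ w₂⦄, H.Adj w₁ w₂ → Touch G (B w₁) (B w₂)) {S : Set W} (hS : Conn H S) :
    Conn G (⋃ w ∈ S, B w) := by
  obtain ⟨w₀, hw₀⟩ := hS.1
  obtain ⟨a, ha⟩ := (hB w₀).1
  have sub : ∀ w ∈ S, B w ⊆ ⋃ w ∈ S, B w := fun w hw => Set.subset_biUnion_of_mem hw
  refine conn_of_root (sub _ hw₀ ha) ?_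
  have key : ∀ w, ReachIn H S w₀ w → w ∈ S → ∀ b ∈ B w, ReachIn G (⋃ w ∈ S, B w) a b := by
    intro w h
    induction h with
    | refl => intro _ b hb; exact ((hB w₀).2 a ha b hb).mono le_rfl (sub _ hw₀)
    | @tail w w' h1 h2 ih =>
      intro _ b hb
      obtain ⟨x, hx, y, hy, hxy⟩ := hadj h2.1
      exact ((ih h2.2.1 x hx).trans (.single hxy (sub _ h2.2.1 hx) (sub _ h2.2.2 hy))).trans
        (((hB w').2 y hy b hb).mono le_rfl (sub _ h2.2.2))
  intro b hb
  obtain ⟨w, hw, hbw⟩ := Set.mem_iUnion₂.1 hb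
  exact key w (hS.2 w₀ hw₀ w hw) hw b hbw

theorem HasMinor.trans (h : HasMinor F H) (h' : HasMinor H G) : HasMinor F G := by
  obtain ⟨B, h1, h2, h3⟩ := h
  obtain ⟨C, k1, k2, k3⟩ := h'
  refine ⟨fun u => ⋃ w ∈ B u, C w, fun u => (h1 u).biUnion_branch k1 k3, ?_, ?_⟩
  · intro u₁ u₂ hu
    rw [Set.disjoint_left]
    intro x hx hy
    obtain ⟨w, hw, hxw⟩ := Set.mem_iUnion₂.1 hx
    obtain ⟨w', hw', hxw'⟩ := Set.mem_iUnion₂.1 hy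
    have hne : w ≠ w' := fun e => Set.disjoint_left.1 (h2 _ _ hu) hw (e ▸ hw')
    exact Set.disjoint_left.1 (k2 _ _ hne) hxw hxw'
  · intro u₁ u₂ hu
    obtain ⟨w, hw, w', hw', hadj⟩ := h3 hu
    exact (k3 hadj).mono (Set.subset_biUnion_of_mem (u := fun w => C w) hw)
      (Set.subset_biUnion_of_mem (u := fun w => C w) hw')

theorem HasMinor.of_embedding (f : W ↪ V) (hf : ∀ ⦃a b⦄, H.Adj a b → G.Adj (f a) (f b)) :
    HasMinor H G :=
  ⟨fun w => {f w}, fun _ => conn_singleton _, fun _ _ h => by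
    simpa using f.injective.ne h, fun a b h => ⟨f a, rfl, f b, rfl, hf h⟩⟩

end Minor

/-! ### Coloring graphs of bounded elimination width -/

/-- An abstract family of distance bounds. -/
structure IsNear {V : Type*} (D : ℕ → V → V → Prop) : Prop where
  refl : ∀ n a, D n a a
  symm : ∀ n a b, D n a b → D n b a
  tri : ∀ n m a b c, D n a b → D m b c → D (n + m) a c
  mono : ∀ n m a b, n ≤ m → D n a b → D m a b

/-- A tree order on the vertices such that adjacent vertices are comparable. -/
structure TreeOrd {V : Type*} (G : SimpleGraph V) (A : V → V → Prop) : Prop where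
  refl : ∀ a, A a a
  trans : ∀ a b c, A a b → A b c → A a c
  antisymm : ∀ a b, A a b → A b a → a = b
  chain : ∀ a b c, A a c → A b c → A a b ∨ A b a
  comp : ∀ a b, G.Adj a b → A a b ∨ A b a

/-- The descendants of a vertex. -/
def reg {V : Type*} (A : V → V → Prop) (a : V) : Set V := {b | A a b}

/-- The coloring is constant on the set. -/
def MonoOn {V : Type*} (c : V → ℕ) (K : Set V) : Prop := ∀ x ∈ K, ∀ y ∈ K, c x = c y

/-- All monochromatic connected subsets of `S` have small diameter. -/
def MonoDiam {V : Type*} (G : SimpleGraph V) (D : ℕ → V → V → Prop) (S : Set V) (c : V → ℕ)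
    (N : ℕ) : Prop :=
  ∀ K, Conn G K → K ⊆ S → MonoOn c K → ∀ a ∈ K, ∀ b ∈ K, D N a b

/-- Elimination width at most `w`, where leaves are allowed one extra neighbour. -/
def WidthLE {V : Type*} (G : SimpleGraph V) (A : V → V → Prop) (w : ℕ) : Prop :=
  ∀ a, (Nb G (reg A a)).ncard ≤ w ∨ (reg A a = {a} ∧ (Nb G {a}).ncard ≤ w + 1)

/-- The data of a precolored graph of bounded elimination width. -/
structure ColInst {V : Type*} (w lam N₀ : ℕ) (G : SimpleGraph V) (A : V → V → Prop)
    (D : ℕ → V → V → Prop) (L : V → Finset ℕ) (S : Set V) (c₀ : V → ℕ) : Prop where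
  ord : TreeOrd G A
  width : WidthLE G A w
  near : IsNear D
  adj : ∀ a b, G.Adj a b → D lam a b
  card : ∀ a, (L a).card = 2
  mem : ∀ a ∈ S, c₀ a ∈ L a
  diam : MonoDiam G D S c₀ N₀

/-- Every precolored graph of width `w` has an extension of bounded diameter. -/
def Extendable (w : ℕ) : Prop :=
  ∀ lam N₀ : ℕ, ∃ N : ℕ, ∀ (V : Type u) [Finite V] (G : SimpleGraph V) (A : V → V → Prop)
    (D : ℕ → V → V → Prop) (L : V → Finset ℕ) (S : Set V) (c₀ : V → ℕ),
    ColInst w lam N₀ G A D L S c₀ →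
    ∃ c : V → ℕ, (∀ a, c a ∈ L a) ∧ (∀ a ∈ S, c a = c₀ a) ∧ MonoDiam G D Set.univ c N

section Coloring

variable {V : Type*} {G : SimpleGraph V} {A : V → V → Prop} {D : ℕ → V → V → Prop}
  {L : V → Finset ℕ} {S : Set V} {c₀ : V → ℕ} {w lam N₀ : ℕ}

theorem MonoOn.mono {c : V → ℕ} {K K' : Set V} (h : MonoOn c K) (hK : K' ⊆ K) : MonoOn c K' :=
  fun x hx y hy => h x (hK hx) y (hK hy)

theorem MonoOn.congr {c c' : V → ℕ} {K : Set V} (h : MonoOn c K) (hK : ∀ x ∈ K, c x = c' x) :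
    MonoOn c' K := fun x hx y hy => by rw [← hK x hx, ← hK y hy]; exact h x hx y hy

/-- A walk covered by `q` balls of radius `r` has ends at bounded distance. -/
theorem IsNear.walk_cover [Finite V] (hD : IsNear D) {r : ℕ} {p : ℕ → V} {l : ℕ} {Y : Set V}
    {q : ℕ} (hY : Y.ncard ≤ q)
    (hp : ∀ i < l, D lam (p i) (p (i + 1))) (hc : ∀ i ≤ l, ∃ y ∈ Y, D r (p i) y) :
    D (q * (2 * r + lam)) (p 0) (p l) := by
  induction q generalizing p l Y with
  | zero =>
    obtain ⟨y, hy, _⟩ := hc 0 (Nat.zero_le _)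
    have : Y = ∅ := (Set.ncard_eq_zero).1 (Nat.le_zero.1 hY)
    simp [this] at hy
  | succ q ih =>
    classical
    obtain ⟨y, hy, h0⟩ := hc 0 (Nat.zero_le _)
    let s := (Finset.range (l + 1)).filter fun i => D r (p i) y
    have hs : s.Nonempty := ⟨0, by simp [s, h0]⟩
    set m := s.max' hs with hm
    have hms : m ∈ s := s.max'_mem hs
    have hml : m ≤ l := by have := (Finset.mem_filter.1 hms).1; simp at this; omega
    have hmy : D r (p m) y := (Finset.mem_filter.1 hms).2
    have h1 : D (2 * r) (p 0) (p m) :=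
      (two_mul r).symm ▸ hD.tri _ _ _ _ _ h0 (hD.symm _ _ _ hmy)
    rcases hml.lt_or_eq with hlt | heq
    · have h2 : D (q * (2 * r + lam)) (p (m + 1)) (p l) := by
        have := ih (p := fun i => p (m + 1 + i)) (l := l - (m + 1)) (Y := Y \ {y})
          (by rw [Set.ncard_sdiff_singleton_of_mem hy]; omega)
          (fun i hi => by
            have := hp (m + 1 + i) (by omega)
            rwa [show m + 1 + i + 1 = m + 1 + (i + 1) by omega] at this)
          (fun i hi => by
            obtain ⟨z, hz, hz'⟩ := hc (m + 1 + i) (by omega)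
            refine ⟨z, ⟨hz, ?_⟩, hz'⟩
            rintro rfl
            have : m + 1 + i ∈ s := by simp [s, hz']; omega
            have := s.le_max' _ this
            omega)
        simpa [show m + 1 + (l - (m + 1)) = l by omega] using this
      have h3 := hD.tri _ _ _ _ _ (hD.tri _ _ _ _ _ h1 (hp m hlt)) h2
      refine hD.mono _ _ _ _ (by ring_nf; omega) h3
    · rw [heq] at h1
      exact hD.mono _ _ _ _ (by nlinarith) h1

theorem IsNear.conn_cover [Finite V] (hD : IsNear D) {r q : ℕ} {Y K : Set V} (hY : Y.ncard ≤ q)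
    (hadj : ∀ a b, G.Adj a b → D lam a b) (hK : Conn G K)
    (hc : ∀ x ∈ K, ∃ y ∈ Y, D r x y) {a b : V} (ha : a ∈ K) (hb : b ∈ K) :
    D (q * (2 * r + lam)) a b := by
  obtain ⟨p, l, hp, h0, hl, -⟩ := hK.exists_path (A := {a}) (B := {b}) ⟨a, ha, rfl⟩ ⟨b, hb, rfl⟩
  rw [← Set.mem_singleton_iff.1 h0, ← Set.mem_singleton_iff.1 hl]
  exact hD.walk_cover hY (fun i hi => hadj _ _ (hp.adj i hi)) fun i hi => hc _ (hp.mem i hi)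

theorem ncard_Nb_le_one_unique [Finite V] {a x y : V} (h : (Nb G {a}).ncard ≤ 1)
    (hx : G.Adj a x) (hy : G.Adj a y) : x = y := by
  have hx' : x ∈ Nb G {a} := ⟨fun e => G.loopless.irrefl a (e ▸ hx), a, rfl, hx⟩
  have hy' : y ∈ Nb G {a} := ⟨fun e => G.loopless.irrefl a (e ▸ hy), a, rfl, hy⟩
  exact (Set.ncard_le_one).1 h x hx' y hy'

/-- Graphs of width zero are star forests. -/
theorem ColInst.diam_zero [Finite V] (h : ColInst 0 lam N₀ G A D L S c₀) {K : Set V}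
    (hK : Conn G K) {a b : V} (ha : a ∈ K) (hb : b ∈ K) : D (2 * lam) a b := by
  have leaf : ∀ x y, G.Adj x y → (Nb G {x}).ncard ≤ 1 ∨ (Nb G {y}).ncard ≤ 1 := by
    have key : ∀ x y, A x y → G.Adj x y → (Nb G {y}).ncard ≤ 1 := by
      intro x y hA hxy
      rcases h.width y with h1 | h1
      · have hx : x ∈ Nb G (reg A y) :=
          ⟨fun hyx => G.loopless.irrefl x (h.ord.antisymm _ _ hA hyx ▸ hxy), y, h.ord.refl y,
            hxy.symm⟩
        rw [(Set.ncard_eq_zero).1 (Nat.le_zero.1 h1)] at hx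
        exact absurd hx (Set.notMem_empty _)
      · exact h1.2
    intro x y hxy
    rcases h.ord.comp x y hxy with h1 | h1
    · exact Or.inr (key x y h1 hxy)
    · exact Or.inl (key y x h1 hxy.symm)
  have star : ∃ x, ∀ y ∈ K, y = x ∨ G.Adj x y := by
    by_cases h1 : ∃ y, G.Adj a y ∧ (Nb G {a}).ncard ≤ 1
    · obtain ⟨x, hax, hd⟩ := h1
      refine ⟨x, hK.subset_of_closed (T := {y | y = x ∨ G.Adj x y}) ⟨a, ha, Or.inr hax.symm⟩ ?_⟩
      rintro y (rfl | hy) - z - hyz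
      · exact Or.inr hyz
      · rcases leaf x y hy with h2 | h2
        · obtain rfl := ncard_Nb_le_one_unique h2 hy hax.symm
          exact Or.inl (ncard_Nb_le_one_unique hd hyz hax)
        · exact Or.inl (ncard_Nb_le_one_unique h2 hyz hy.symm)
    · refine ⟨a, hK.subset_of_closed (T := {y | y = a ∨ G.Adj a y}) ⟨a, ha, Or.inl rfl⟩ ?_⟩
      rintro y (rfl | hy) - z - hyz
      · exact Or.inr hyz
      · rcases leaf a y hy with h2 | h2
        · exact absurd ⟨y, hy, h2⟩ h1
        · exact Or.inl (ncard_Nb_le_one_unique h2 hyz hy.symm)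
  obtain ⟨x, hx⟩ := star
  have near : ∀ y ∈ K, D lam x y := by
    intro y hy
    rcases hx y hy with rfl | h1
    · exact h.near.refl _ _
    · exact h.adj _ _ h1
  exact (two_mul lam).symm ▸ h.near.tri _ _ _ _ _ (h.near.symm _ _ _ (near a ha)) (near b hb)

theorem ColInst.exists_mem (h : ColInst w lam N₀ G A D L S c₀) (a : V) : ∃ b, b ∈ L a := by
  have : (L a).Nonempty := by
    rw [← Finset.card_pos, h.card a]; norm_num
  exact this

theorem extendable_zero : Extendable.{u} 0 := by
  intro lam N₀
  refine ⟨2 * lam, ?_⟩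
  intro V _ G A D L S c₀ h
  classical
  choose e he using h.exists_mem
  refine ⟨fun a => if a ∈ S then c₀ a else e a, ?_, ?_, ?_⟩
  · intro a
    by_cases ha : a ∈ S
    · simpa [ha] using h.mem a ha
    · simpa [ha] using he a
  · intro a ha; simp [ha]
  · intro K hK _ _ a ha b hb
    exact h.diam_zero hK ha hb

end Coloring

/-! ### Zones around the boundary of a region -/

/-- The vertices of monochromatic precolored connected subsets of `C` touching `Y`. -/
def sAdj {V : Type*} (G : SimpleGraph V) (S : Set V) (c₀ : V → ℕ) (C Y : Set V) : Set V :=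
  {s | ∃ K, Conn G K ∧ K ⊆ S ∩ C ∧ MonoOn c₀ K ∧ s ∈ K ∧ Touch G K Y}

/-- One growth step of the zone. -/
def grow {V : Type*} (G : SimpleGraph V) (S : Set V) (c₀ : V → ℕ) (C Y : Set V) : Set V :=
  Y ∪ sAdj G S c₀ C Y ∪ {v | v ∈ C ∧ v ∉ S ∧ ∃ y ∈ Y ∪ sAdj G S c₀ C Y, G.Adj y v}

/-- The zones around the boundary of `C`. -/
def zone {V : Type*} (G : SimpleGraph V) (S : Set V) (c₀ : V → ℕ) (C : Set V) : ℕ → Set V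
  | 0 => Nb G C
  | j + 1 => grow G S c₀ C (zone G S c₀ C j)

section Zone

variable {V : Type*} {G : SimpleGraph V} {A : V → V → Prop} {D : ℕ → V → V → Prop}
  {L : V → Finset ℕ} {S C : Set V} {c₀ : V → ℕ} {w lam N₀ : ℕ}

theorem zone_succ_subset (j : ℕ) : zone G S c₀ C j ⊆ zone G S c₀ C (j + 1) :=
  fun _ h => Or.inl (Or.inl h)

theorem zone_mono {i j : ℕ} (h : i ≤ j) : zone G S c₀ C i ⊆ zone G S c₀ C j :=
  monotone_nat_of_le_succ (fun j => zone_succ_subset j) h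

theorem zone_subset (j : ℕ) : zone G S c₀ C j ⊆ C ∪ Nb G C := by
  induction j with
  | zero => exact Set.subset_union_right
  | succ j ih =>
    rintro x ((hx | ⟨K, -, hK, -, hx, -⟩) | hx)
    · exact ih hx
    · exact Or.inl (hK hx).2
    · exact Or.inl hx.1

theorem ColInst.zone_near (h : ColInst w lam N₀ G A D L S c₀) (j : ℕ) {v : V}
    (hv : v ∈ zone G S c₀ C j) :
    ∃ x ∈ Nb G C, ReachIn G (zone G S c₀ C j) v x ∧ D (j * (N₀ + 2 * lam)) v x := by
  induction j generalizing v with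
  | zero => exact ⟨v, hv, .refl, h.near.refl _ _⟩
  | succ j ih =>
    have base : ∀ v ∈ zone G S c₀ C j ∪ sAdj G S c₀ C (zone G S c₀ C j),
        ∃ x ∈ Nb G C, ReachIn G (zone G S c₀ C (j + 1)) v x ∧
          D (j * (N₀ + 2 * lam) + N₀ + lam) v x := by
      rintro v (hv | ⟨K, hK, hKS, hKm, hvK, k, hk, y, hy, hky⟩)
      · obtain ⟨x, hx, h1, h2⟩ := ih hv
        exact ⟨x, hx, h1.mono le_rfl (zone_succ_subset j), h.near.mono _ _ _ _ (by omega) h2⟩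
      · obtain ⟨x, hx, h1, h2⟩ := ih hy
        have hKz : K ⊆ zone G S c₀ C (j + 1) := fun s hs =>
          Or.inl (Or.inr ⟨K, hK, hKS, hKm, hs, k, hk, y, hy, hky⟩)
        refine ⟨x, hx, ?_, ?_⟩
        · exact (((hK.2 v hvK k hk).mono le_rfl hKz).trans
            (.single hky (hKz hk) (zone_succ_subset j hy))).trans
            (h1.mono le_rfl (zone_succ_subset j))
        · have h3 := h.diam K hK (fun s hs => (hKS hs).1) hKm v hvK k hk
          refine h.near.mono _ _ _ _ (by omega)
            (h.near.tri _ _ _ _ _ (h.near.tri _ _ _ _ _ h3 (h.adj _ _ hky)) h2)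
    rcases hv with hv | ⟨hvC, hvS, y, hy, hyv⟩
    · obtain ⟨x, hx, h1, h2⟩ := base v hv
      exact ⟨x, hx, h1, h.near.mono _ _ _ _ (by ring_nf; omega) h2⟩
    · obtain ⟨x, hx, h1, h2⟩ := base y hy
      refine ⟨x, hx, ?_, ?_⟩
      · exact (ReachIn.single hyv.symm (Or.inr ⟨hvC, hvS, y, hy, hyv⟩) (Or.inl hy)).trans h1
      · exact h.near.mono _ _ _ _ (by ring_nf; omega)
          (h.near.tri _ _ _ _ _ (h.adj _ _ hyv.symm) h2)

/-- If the `j`-th ring avoids the color of `x`, then the monochromatic connected sets through `x`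
stay inside the zone. -/
theorem zone_confine {f : V → ℕ} (hf : ∀ a ∈ S, f a = c₀ a) {j : ℕ} {Γ : Set V}
    (hΓ : Conn G Γ) (hm : MonoOn f Γ) (hC : Γ ⊆ C ∪ Nb G C) {x : V} (hx : x ∈ Γ)
    (hxN : x ∈ Nb G C)
    (hav : ∀ v ∈ zone G S c₀ C (j + 1), v ∉ zone G S c₀ C j → v ∉ S → f v ≠ f x) :
    Γ ⊆ zone G S c₀ C (j + 1) := by
  have hz : Nb G C ⊆ zone G S c₀ C j := zone_mono (i := 0) (Nat.zero_le j)
  have : Γ ⊆ zone G S c₀ C j ∪ sAdj G S c₀ C (zone G S c₀ C j) := by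
    refine hΓ.subset_of_closed ⟨x, hx, Or.inl (hz hxN)⟩ ?_
    intro a ha haΓ b hb hab
    rcases hC hb with hbC | hbN
    · by_cases hbS : b ∈ S
      · rcases ha with ha | ⟨K, hK, hKS, hKm, haK, hKt⟩
        · exact Or.inr ⟨{b}, conn_singleton b, by simpa using ⟨hbS, hbC⟩,
            by rintro _ rfl _ rfl; rfl, rfl, b, rfl, a, ha, hab.symm⟩
        · refine Or.inr ⟨insert b K, hK.insert haK hab, Set.insert_subset ⟨hbS, hbC⟩ hKS, ?_,
            Set.mem_insert _ _, hKt.mono (Set.subset_insert _ _) le_rfl⟩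
          have hba : c₀ b = c₀ a := by
            rw [← hf b hbS, ← hf a (hKS haK).1]; exact hm b hb a haΓ
          have : ∀ y ∈ insert b K, c₀ y = c₀ a := by
            rintro y (rfl | hy)
            · exact hba
            · exact hKm y hy a haK
          intro y hy z hz
          rw [this y hy, this z hz]
      · left
        by_contra hbz
        exact hav b (Or.inr ⟨hbC, hbS, a, ha, hab⟩) hbz hbS (hm b hb x hx)
    · exact Or.inl (hz hbN)
  exact this.trans Set.subset_union_left

end Zone

/-! ### Peeling the part of a region close to its boundary -/

/-- The zone around a region, together with its root. -/
def coreZone {V : Type*} (G : SimpleGraph V) (A : V → V → Prop) (S : Set V) (c₀ : V → ℕ)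
    (w : ℕ) (v₀ : V) : Set V := zone G S c₀ (reg A v₀) (w + 2) ∪ {v₀}

/-- The vertices of a region whose subregion is attached to the core zone. -/
def upper {V : Type*} (G : SimpleGraph V) (A : V → V → Prop) (S : Set V) (c₀ : V → ℕ)
    (w : ℕ) (v₀ : V) : Set V :=
  {v | A v₀ v ∧ (v = v₀ ∨ (Nb G (reg A v) ∩ coreZone G A S c₀ w v₀).Nonempty)}

/-- `r` maps the vertices of `C` outside `U` to the roots of their hanging regions. -/
def IsRoots {V : Type*} (A : V → V → Prop) (C U : Set V) (r : V → V) : Prop :=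
  ∀ v ∈ C, v ∉ U → A (r v) v ∧ r v ∈ C ∧ r v ∉ U ∧ ∀ a ∈ C, A a (r v) → a ≠ r v → a ∈ U

/-- A vertex of a hanging region linked to an attachment of that region. -/
def Hook {V : Type*} (G : SimpleGraph V) (A : V → V → Prop) (D : ℕ → V → V → Prop) (S : Set V)
    (c₀ : V → ℕ) (C U : Set V) (r : V → V) (q : ℕ) (t x : V) : Prop :=
  t ∈ C ∧ t ∉ U ∧ x ∈ Nb G (reg A (r t)) ∧
    ((t ∉ S ∧ D q t x) ∨ t ∈ sAdj G S c₀ (reg A (r t)) {x})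

/-- The torso of a region: hanging regions are replaced by independent vertices. -/
def torso {V : Type*} (G : SimpleGraph V) (A : V → V → Prop) (D : ℕ → V → V → Prop) (S : Set V)
    (c₀ : V → ℕ) (C U Z : Set V) (r : V → V) (q : ℕ) : SimpleGraph V :=
  SimpleGraph.fromRel fun a b => (a ∈ U ∧ a ∉ Z ∧ b ∈ U ∧ b ∉ Z ∧ G.Adj a b) ∨
    Hook G A D S c₀ C U r q a b

section Roots

variable {V : Type*} {G : SimpleGraph V} {A : V → V → Prop} {C U : Set V} {r : V → V}

theorem TreeOrd.exists_roots [Finite V] (hA : TreeOrd G A) (C U : Set V) :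
    ∃ r, IsRoots A C U r := by
  have : ∀ v, ∃ a, v ∈ C → v ∉ U → A a v ∧ a ∈ C ∧ a ∉ U ∧
      ∀ b ∈ C, A b a → b ≠ a → b ∈ U := by
    intro v
    by_cases hv : v ∈ C ∧ v ∉ U
    · let s : Set V := {a | A a v ∧ a ∈ C ∧ a ∉ U}
      obtain ⟨a, ha, hmin⟩ := Set.exists_min_image s (fun a => {b | A b a}.ncard)
        (Set.toFinite _) ⟨v, hA.refl v, hv.1, hv.2⟩
      refine ⟨a, fun _ _ => ⟨ha.1, ha.2.1, ha.2.2, fun b hbC hba hne => ?_⟩⟩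
      by_contra hbU
      have := hmin b ⟨hA.trans _ _ _ hba ha.1, hbC, hbU⟩
      refine absurd this (not_le.2 (Set.ncard_lt_ncard ⟨fun x hx => hA.trans _ _ _ hx hba, ?_⟩))
      intro hsub
      exact hne (hA.antisymm _ _ hba (hsub (hA.refl a)))
    · exact ⟨v, fun h1 h2 => absurd ⟨h1, h2⟩ hv⟩
  choose r hr using this
  exact ⟨r, hr⟩

variable (hA : TreeOrd G A) (hC : ∀ a b, A a b → a ∈ C → b ∈ C)
  (hU : ∀ a b, A a b → a ∈ C → b ∈ U → a ∈ U) (hr : IsRoots A C U r)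
include hA hC hU hr

theorem IsRoots.region {v b : V} (hv : v ∈ C) (hvU : v ∉ U) (hb : A (r v) b) :
    b ∈ C ∧ b ∉ U ∧ r b = r v := by
  obtain ⟨h1, h2, h3, h4⟩ := hr v hv hvU
  have hbC := hC _ _ hb h2
  have hbU : b ∉ U := fun h => h3 (hU _ _ hb h2 h)
  obtain ⟨k1, k2, k3, k4⟩ := hr b hbC hbU
  refine ⟨hbC, hbU, ?_⟩
  rcases hA.chain _ _ _ hb k1 with h | h
  · by_contra hne
    exact h3 (k4 _ h2 h (Ne.symm hne))
  · by_contra hne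
    exact k3 (h4 _ k2 h hne)

theorem IsRoots.adj {a b : V} (ha : a ∈ C) (haU : a ∉ U) (hb : b ∈ C) (hbU : b ∉ U)
    (h : G.Adj a b) : r a = r b := by
  rcases hA.comp a b h with h | h
  · exact (hr.region hA hC hU ha haU (hA.trans _ _ _ (hr a ha haU).1 h)).2.2.symm
  · exact (hr.region hA hC hU hb hbU (hA.trans _ _ _ (hr b hb hbU).1 h)).2.2

omit hU hr hC in
theorem TreeOrd.anc_of_mem_Nb {a x : V} (hx : x ∈ Nb G (reg A a)) : A x a ∧ x ≠ a := by
  obtain ⟨h1, y, hy, hyx⟩ := hx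
  have hne : x ≠ a := fun e => h1 (e ▸ hA.refl a)
  refine ⟨?_, hne⟩
  rcases hA.comp y x hyx with h | h
  · exact absurd (hA.trans _ _ _ hy h) h1
  · rcases hA.chain _ _ _ h hy with h2 | h2
    · exact h2
    · exact absurd h2 h1

end Roots

section Upper

variable {V : Type*} {G : SimpleGraph V} {A : V → V → Prop} {D : ℕ → V → V → Prop}
  {L : V → Finset ℕ} {S : Set V} {c₀ : V → ℕ} {w lam N₀ : ℕ} {v₀ : V} {r : V → V}
  (h : ColInst (w + 1) lam N₀ G A D L S c₀)
include h

theorem ColInst.mem_upper {a y : V} (ha : A v₀ a) (hy : A a y)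
    (hyZ : y ∈ coreZone G A S c₀ w v₀) : a ∈ upper G A S c₀ w v₀ := by
  rcases hyZ with hyZ | rfl
  · refine ⟨ha, Or.inr ?_⟩
    obtain ⟨x, hx, hr, -⟩ := h.zone_near _ hyZ
    by_contra hne
    have := hr.closed (T := reg A a) hy (fun p hp q hq hpq => by
      by_contra hqa
      exact hne ⟨q, ⟨hqa, p, hp, hpq⟩, Or.inl hq⟩)
    exact hx.1 (h.ord.trans _ _ _ ha this)
  · exact ⟨ha, Or.inl (h.ord.antisymm _ _ hy ha)⟩

theorem ColInst.upper_anc {a b : V} (hab : A a b) (ha : A v₀ a)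
    (hb : b ∈ upper G A S c₀ w v₀) : a ∈ upper G A S c₀ w v₀ := by
  rcases hb.2 with rfl | ⟨y, ⟨hy, x, hx, hxy⟩, hyZ⟩
  · exact h.mem_upper ha hab (Or.inr rfl)
  · by_cases hya : A a y
    · exact h.mem_upper ha hya hyZ
    · exact ⟨ha, Or.inr ⟨y, ⟨hya, x, h.ord.trans _ _ _ hab hx, hxy⟩, hyZ⟩⟩

theorem ColInst.coreZone_upper {a : V} (ha : A v₀ a) (haZ : a ∈ coreZone G A S c₀ w v₀) :
    a ∈ upper G A S c₀ w v₀ := h.mem_upper ha (h.ord.refl a) haZ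

variable (hr : IsRoots A (reg A v₀) (upper G A S c₀ w v₀) r)
include hr

theorem ColInst.hang {v b : V} (hv : A v₀ v) (hvU : v ∉ upper G A S c₀ w v₀)
    (hb : A (r v) b) : A v₀ b ∧ b ∉ upper G A S c₀ w v₀ ∧ r b = r v :=
  hr.region h.ord (fun _ _ h1 h2 => h.ord.trans _ _ _ h2 h1)
    (fun _ _ h1 h2 h3 => h.upper_anc h1 h2 h3) hv hvU hb

theorem ColInst.hang_adj {a b : V} (ha : A v₀ a) (haU : a ∉ upper G A S c₀ w v₀)
    (hb : A v₀ b) (hbU : b ∉ upper G A S c₀ w v₀) (hab : G.Adj a b) : r a = r b :=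
  hr.adj h.ord (fun _ _ h1 h2 => h.ord.trans _ _ _ h2 h1)
    (fun _ _ h1 h2 h3 => h.upper_anc h1 h2 h3) ha haU hb hbU hab

theorem ColInst.Nb_hang {v x : V} (hv : A v₀ v) (hvU : v ∉ upper G A S c₀ w v₀)
    (hx : x ∈ Nb G (reg A (r v))) :
    x ∈ upper G A S c₀ w v₀ ∧ x ∉ coreZone G A S c₀ w v₀ := by
  obtain ⟨h1, h2, h3, h4⟩ := hr v hv hvU
  have hxZ : x ∉ coreZone G A S c₀ w v₀ := fun hxZ => h3 ⟨h2, Or.inr ⟨x, hx, hxZ⟩⟩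
  refine ⟨?_, hxZ⟩
  have hxa := h.ord.anc_of_mem_Nb hx
  by_cases hxC : A v₀ x
  · exact h4 x hxC hxa.1 hxa.2
  · refine absurd (Or.inl ?_) hxZ
    obtain ⟨-, y, hy, hyx⟩ := hx
    exact zone_mono (i := 0) (Nat.zero_le _)
      (show x ∈ Nb G (reg A v₀) from ⟨hxC, y, h.ord.trans _ _ _ h2 hy, hyx⟩)

theorem ColInst.Nb_hang_card [Finite V] {v : V} (hv : A v₀ v)
    (hvU : v ∉ upper G A S c₀ w v₀) : (Nb G (reg A (r v))).ncard ≤ w + 1 := by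
  rcases (Nb G (reg A (r v))).eq_empty_or_nonempty with he | hne
  · simp [he]
  obtain ⟨x, hx, hmax⟩ := Set.exists_max_image _ (fun a => {b | A b a}.ncard)
    (Set.toFinite _) hne
  obtain ⟨hxU, hxZ⟩ := h.Nb_hang hr hv hvU hx
  have hsub : Nb G (reg A (r v)) ⊆ insert x (Nb G (reg A x) \ coreZone G A S c₀ w v₀) := by
    intro y hy
    by_cases hyx : y = x
    · exact Or.inl hyx
    refine Or.inr ⟨⟨fun hxy => ?_, ?_⟩, (h.Nb_hang hr hv hvU hy).2⟩
    · refine absurd (hmax y hy) (not_le.2 (Set.ncard_lt_ncard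
        ⟨fun b hb => h.ord.trans _ _ _ hb hxy, fun hs => hyx ?_⟩))
      exact h.ord.antisymm _ _ (hs (h.ord.refl y)) hxy
    · obtain ⟨-, z, hz, hzy⟩ := hy
      exact ⟨z, h.ord.trans _ _ _ (h.ord.anc_of_mem_Nb hx).1 hz, hzy⟩
  obtain ⟨z, hzN, hzZ⟩ : (Nb G (reg A x) ∩ coreZone G A S c₀ w v₀).Nonempty :=
    hxU.2.resolve_left fun e => hxZ (Or.inr e)
  have hw : (Nb G (reg A x)).ncard ≤ w + 1 := by
    rcases h.width x with h1 | ⟨h1, -⟩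
    · exact h1
    · have : r v ∈ ({x} : Set V) := h1 ▸ (h.ord.anc_of_mem_Nb hx).1
      exact absurd this.symm (h.ord.anc_of_mem_Nb hx).2
  have h2 : (Nb G (reg A x) \ coreZone G A S c₀ w v₀).ncard < (Nb G (reg A x)).ncard :=
    Set.ncard_lt_ncard ⟨Set.sdiff_subset, fun hs => (hs hzN).2 hzZ⟩
  have := (Set.ncard_le_ncard hsub).trans (Set.ncard_insert_le _ _)
  omega

/-- The torso inherits the precoloring instance with smaller width. -/
theorem ColInst.torsoInst [Finite V] (hX : (Nb G (reg A v₀)).ncard ≤ w + 1) (q : ℕ) :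
    ColInst w (lam + q + N₀) N₀
      (torso G A D S c₀ (reg A v₀) (upper G A S c₀ w v₀) (coreZone G A S c₀ w v₀) r q)
      (fun a b => A a b ∧ (a = b ∨ a ∈ upper G A S c₀ w v₀)) D L S c₀ := by
  set U := upper G A S c₀ w v₀ with hUdef
  set Z := coreZone G A S c₀ w v₀ with hZdef
  set C := reg A v₀ with hCdef
  have hook_anc : ∀ t x, Hook G A D S c₀ C U r q t x → A x t ∧ x ∈ U ∧ x ∉ Z := by
    rintro t x ⟨h1, h2, h3, -⟩
    have := h.Nb_hang hr h1 h2 h3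
    exact ⟨h.ord.trans _ _ _ (h.ord.anc_of_mem_Nb h3).1 (hr t h1 h2).1, this⟩
  have hord : TreeOrd (torso G A D S c₀ C U Z r q) (fun a b => A a b ∧ (a = b ∨ a ∈ U)) := by
    refine ⟨fun a => ⟨h.ord.refl a, Or.inl rfl⟩, ?_, fun a b h1 h2 => h.ord.antisymm _ _ h1.1 h2.1,
      ?_, ?_⟩
    · rintro a b c ⟨h1, rfl | h2⟩ ⟨h3, h4⟩
      · exact ⟨h3, h4⟩
      · exact ⟨h.ord.trans _ _ _ h1 h3, Or.inr h2⟩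
    · rintro a b c ⟨h1, rfl | h2⟩ ⟨h3, rfl | h4⟩
      · exact Or.inl ⟨h3, Or.inl rfl⟩
      · exact Or.inr ⟨h3, Or.inr h4⟩
      · exact Or.inl ⟨h1, Or.inr h2⟩
      · rcases h.ord.chain _ _ _ h1 h3 with h5 | h5
        · exact Or.inl ⟨h5, Or.inr h2⟩
        · exact Or.inr ⟨h5, Or.inr h4⟩
    · rintro a b ⟨-, (⟨h1, -, h2, -, h3⟩ | h1) | (⟨h1, -, h2, -, h3⟩ | h1)⟩
      · rcases h.ord.comp _ _ h3 with h4 | h4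
        · exact Or.inl ⟨h4, Or.inr h1⟩
        · exact Or.inr ⟨h4, Or.inr h2⟩
      · exact Or.inr ⟨(hook_anc _ _ h1).1, Or.inr (hook_anc _ _ h1).2.1⟩
      · rcases h.ord.comp _ _ h3 with h4 | h4
        · exact Or.inr ⟨h4, Or.inr h1⟩
        · exact Or.inl ⟨h4, Or.inr h2⟩
      · exact Or.inl ⟨(hook_anc _ _ h1).1, Or.inr (hook_anc _ _ h1).2.1⟩
  have hwidth : WidthLE (torso G A D S c₀ C U Z r q)
      (fun a b => A a b ∧ (a = b ∨ a ∈ U)) w := by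
    intro a
    by_cases ha : a ∈ U
    · have hreg : reg (fun a b => A a b ∧ (a = b ∨ a ∈ U)) a = reg A a := by
        ext b; exact ⟨fun hb => hb.1, fun hb => ⟨hb, Or.inr ha⟩⟩
      have hsub : Nb (torso G A D S c₀ C U Z r q) (reg A a) ⊆ Nb G (reg A a) \ Z := by
        have hk : ∀ t x, Hook G A D S c₀ C U r q t x → A a t → ¬ A a x → x ∈ Nb G (reg A a) := by
          rintro t x ⟨h1, h2, h3, -⟩ hat hax
          obtain ⟨k1, k2, k3, -⟩ := hr t h1 h2
          rcases h.ord.chain _ _ _ k1 hat with h4 | h4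
          · exact absurd (h.upper_anc h4 k2 ha) k3
          · obtain ⟨-, z, hz, hzx⟩ := h3
            exact ⟨hax, z, h.ord.trans _ _ _ h4 hz, hzx⟩
        rintro y ⟨hya, x, hx, -, (⟨-, -, -, h2, h3⟩ | h1) | (⟨-, h1, -, -, h3⟩ | h1)⟩
        · exact ⟨⟨hya, x, hx, h3⟩, h2⟩
        · exact ⟨hk _ _ h1 hx hya, (hook_anc _ _ h1).2.2⟩
        · exact ⟨⟨hya, x, hx, h3.symm⟩, h1⟩
        · exact absurd (h.ord.trans _ _ _ hx (hook_anc _ _ h1).1) hya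
      rw [hreg]
      rcases ha.2 with rfl | ⟨z, hz, hzZ⟩
      · left
        have : Nb G (reg A a) \ Z = ∅ := by
          rw [Set.sdiff_eq_empty]
          exact fun x hx => Or.inl (zone_mono (i := 0) (Nat.zero_le _) hx)
        rw [this] at hsub
        rw [Set.subset_empty_iff.1 hsub]
        simp
      · have h2 : (Nb G (reg A a) \ Z).ncard < (Nb G (reg A a)).ncard :=
          Set.ncard_lt_ncard ⟨Set.sdiff_subset, fun hs => (hs hz).2 hzZ⟩
        have h3 := Set.ncard_le_ncard hsub
        rcases h.width a with h1 | ⟨h1, h4⟩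
        · left; omega
        · right; refine ⟨h1, ?_⟩
          rw [h1] at h2 h3; omega
    · right
      refine ⟨?_, ?_⟩
      · ext b
        constructor
        · rintro ⟨-, rfl | h1⟩
          · rfl
          · exact absurd h1 ha
        · rintro rfl
          exact ⟨h.ord.refl _, Or.inl rfl⟩
      · by_cases haC : a ∈ C
        · refine (Set.ncard_le_ncard ?_).trans (h.Nb_hang_card hr haC ha)
          rintro y ⟨-, x, rfl, -, (⟨h1, -⟩ | h1) | (⟨-, -, h1, -⟩ | h1)⟩
          · exact absurd h1 ha
          · exact h1.2.2.1
          · exact absurd h1 ha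
          · exact absurd (hook_anc _ _ h1).2.1 ha
        · have : Nb (torso G A D S c₀ C U Z r q) {a} = ∅ := by
            rw [Set.eq_empty_iff_forall_notMem]
            rintro y ⟨-, x, rfl, -, (⟨h1, -⟩ | h1) | (⟨-, -, h1, -⟩ | h1)⟩
            · exact absurd h1 ha
            · exact haC h1.1
            · exact absurd h1 ha
            · exact absurd (hook_anc _ _ h1).2.1 ha
          rw [this]; simp
  refine ⟨hord, hwidth, h.near, ?_, h.card, h.mem, ?_⟩
  · have hook_D : ∀ t x, Hook G A D S c₀ C U r q t x → D (lam + q + N₀) t x := by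
      rintro t x ⟨-, -, -, ⟨-, h1⟩ | ⟨K, hK, hKS, hKm, ht, k, hk, y, rfl, hky⟩⟩
      · exact h.near.mono _ _ _ _ (by omega) h1
      · have := h.near.tri _ _ _ _ _ (h.diam K hK (fun s hs => (hKS hs).1) hKm t ht k hk)
          (h.adj _ _ hky)
        exact h.near.mono _ _ _ _ (by omega) this
    rintro a b ⟨-, (⟨-, -, -, -, h3⟩ | h1) | (⟨-, -, -, -, h3⟩ | h1)⟩
    · exact h.near.mono _ _ _ _ (by omega) (h.adj _ _ h3)
    · exact hook_D _ _ h1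
    · exact h.near.mono _ _ _ _ (by omega) (h.adj _ _ h3.symm)
    · exact h.near.symm _ _ _ (hook_D _ _ h1)
  · intro K hK hKS hKm a ha b hb
    let T : Set V := {s | s ∈ S ∧ c₀ s = c₀ a}
    have haT : a ∈ T := ⟨hKS ha, rfl⟩
    have hook_T : ∀ t x, t ∈ T → x ∈ T → Hook G A D S c₀ C U r q t x → ReachIn G T t x := by
      rintro t x ht hx ⟨-, -, -, ⟨h1, -⟩ | ⟨M, hM, hMS, hMm, htM, k, hk, y, rfl, hky⟩⟩
      · exact absurd ht.1 h1
      · have hMT : M ⊆ T := fun s hs => ⟨(hMS hs).1, (hMm s hs t htM).trans ht.2⟩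
        exact ((hM.2 t htM k hk).mono le_rfl hMT).trans (.single hky (hMT hk) hx)
    have hKT : K ⊆ T := fun s hs => ⟨hKS hs, hKm s hs a ha⟩
    have hsub : K ⊆ cmpt G T a := by
      refine hK.subset_of_closed ⟨a, ha, mem_cmpt a⟩ ?_
      intro x hx hxK y hy hxy
      obtain ⟨-, (⟨-, -, -, -, h3⟩ | h1) | (⟨-, -, -, -, h3⟩ | h1)⟩ := hxy
      · exact cmpt_closed hx (hKT hxK) (hKT hy) h3
      · exact ReachIn.trans hx (hook_T _ _ (hKT hxK) (hKT hy) h1)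
      · exact cmpt_closed hx (hKT hxK) (hKT hy) h3.symm
      · exact ReachIn.trans hx (hook_T _ _ (hKT hy) (hKT hxK) h1).symm
    have hcT := cmpt_subset (G := G) haT
    exact h.diam _ (cmpt_conn a) (fun s hs => (hcT hs).1)
      (fun x hx y hy => by rw [(hcT hx).2, (hcT hy).2]) a (mem_cmpt a) b (hsub hb)

end Upper

/-! ### Extending colorings over a region -/

section Region

variable {V : Type*} {G : SimpleGraph V} {A : V → V → Prop} {D : ℕ → V → V → Prop}
  {L : V → Finset ℕ} {S : Set V} {c₀ : V → ℕ} {w lam N₀ : ℕ} {v₀ : V} {r : V → V}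

/-- `f` extends the coloring of the first ring around the region `C` in a controlled way. -/
structure RegionColoring (G : SimpleGraph V) (D : ℕ → V → V → Prop) (L : V → Finset ℕ)
    (S : Set V) (c₀ : V → ℕ) (C : Set V) (g f : V → ℕ) (q N : ℕ) : Prop where
  mem : ∀ a, f a ∈ L a
  ext : ∀ a ∈ S, f a = c₀ a
  ring : ∀ a ∈ zone G S c₀ C 1, f a = g a
  bdry : ∀ K, Conn G K → MonoOn f K → K ⊆ C ∪ Nb G C → (K ∩ Nb G C).Nonempty →
    ∀ a ∈ K, ∀ b ∈ K, D q a b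
  diam : ∀ K, Conn G K → MonoOn f K → K ⊆ C ∪ Nb G C → ∀ a ∈ K, ∀ b ∈ K, D N a b

variable (h : ColInst (w + 1) lam N₀ G A D L S c₀)
  (hr : IsRoots A (reg A v₀) (upper G A S c₀ w v₀) r)
include h hr

/-- Monochromatic connected sets avoiding the core zone but meeting the upper part are
controlled by the torso coloring. -/
theorem ColInst.torso_bound {q Nt : ℕ} {g f : V → ℕ}
    (hg : MonoDiam (torso G A D S c₀ (reg A v₀) (upper G A S c₀ w v₀)
      (coreZone G A S c₀ w v₀) r q) D Set.univ g Nt)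
    (hfU : ∀ a ∈ upper G A S c₀ w v₀, a ∉ coreZone G A S c₀ w v₀ → f a = g a)
    (hfS : ∀ a ∈ S, f a = c₀ a)
    (hring : ∀ t, A v₀ t → t ∉ upper G A S c₀ w v₀ →
      ∀ a ∈ zone G S c₀ (reg A (r t)) 1, f a = g a)
    (hbd : ∀ t, A v₀ t → t ∉ upper G A S c₀ w v₀ →
      ∀ K, Conn G K → MonoOn f K → K ⊆ reg A (r t) ∪ Nb G (reg A (r t)) →
        (K ∩ Nb G (reg A (r t))).Nonempty → ∀ a ∈ K, ∀ b ∈ K, D q a b)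
    {K : Set V} (hK : Conn G K) (hm : MonoOn f K) (hKC : K ⊆ reg A v₀)
    (hKZ : ∀ a ∈ K, a ∉ coreZone G A S c₀ w v₀)
    (hKU : ∃ a ∈ K, a ∈ upper G A S c₀ w v₀) {a b : V} (ha : a ∈ K) (hb : b ∈ K) :
    D (2 * q + Nt) a b := by
  set U := upper G A S c₀ w v₀ with hUdef
  set Z := coreZone G A S c₀ w v₀ with hZdef
  set C := reg A v₀ with hCdef
  set G' := torso G A D S c₀ C U Z r q with hG'
  obtain ⟨o, hoK, hoU⟩ := hKU
  let T : Set V := {x | x ∈ K ∧ (x ∈ U ∨ x ∈ zone G S c₀ (reg A (r x)) 1)}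
  let M : V → Set V := fun v => cmpt G (K ∩ (reg A (r v) ∪ Nb G (reg A (r v)))) v
  have hin : ∀ v ∈ K, v ∉ U → v ∈ K ∩ (reg A (r v) ∪ Nb G (reg A (r v))) := fun v hv hvU =>
    ⟨hv, Or.inl (hr v (hKC hv) hvU).1⟩
  have hMsub : ∀ v ∈ K, v ∉ U → M v ⊆ K ∩ (reg A (r v) ∪ Nb G (reg A (r v))) :=
    fun v hv hvU => cmpt_subset (hin v hv hvU)
  have hMm : ∀ v ∈ K, v ∉ U → MonoOn f (M v) := fun v hv hvU =>
    hm.mono fun x hx => (hMsub v hv hvU hx).1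
  have hMeet : ∀ v ∈ K, v ∉ U → (M v ∩ Nb G (reg A (r v))).Nonempty := by
    intro v hv hvU
    by_contra hne
    have hsub : M v ⊆ reg A (r v) := fun x hx =>
      (hMsub v hv hvU hx).2.resolve_right fun hxN => hne ⟨x, hx, hxN⟩
    have : K ⊆ M v := hK.subset_of_closed ⟨v, hv, mem_cmpt v⟩ fun x hx hxK y hy hxy => by
      refine cmpt_closed hx (hMsub v hv hvU hx) ⟨hy, ?_⟩ hxy
      by_cases hyr : A (r v) y
      · exact Or.inl hyr
      · exact Or.inr ⟨hyr, x, hsub hx, hxy⟩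
    exact (h.hang hr (hKC hv) hvU (hsub (this hoK))).2.1 hoU
  have hMD : ∀ v ∈ K, v ∉ U → ∀ x ∈ M v, ∀ y ∈ M v, D q x y := fun v hv hvU =>
    hbd v (hKC hv) hvU _ (cmpt_conn v) (hMm v hv hvU) (fun x hx => (hMsub v hv hvU hx).2)
      (hMeet v hv hvU)
  have hook_adj : ∀ t x, Hook G A D S c₀ C U r q t x → G'.Adj t x := by
    intro t x ht
    refine ⟨?_, Or.inl (Or.inr ht)⟩
    rintro rfl
    exact ht.2.1 (h.Nb_hang hr ht.1 ht.2.1 ht.2.2.1).1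
  have up_adj : ∀ x y, x ∈ K → y ∈ K → x ∈ U → y ∈ U → G.Adj x y → ReachIn G' T x y := by
    intro x y hx hy hxU hyU hxy
    exact .single ⟨hxy.ne, Or.inl (Or.inl ⟨hxU, hKZ x hx, hyU, hKZ y hy, hxy⟩)⟩
      ⟨hx, Or.inl hxU⟩ ⟨hy, Or.inl hyU⟩
  have link : ∀ v ∈ K, v ∉ U → ∀ x ∈ M v, x ∈ Nb G (reg A (r v)) →
      ∀ y ∈ M v, y ∈ Nb G (reg A (r v)) → ReachIn G' T x y := by
    intro v hv hvU x hx hxN y hy hyN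
    have hNU : ∀ x ∈ Nb G (reg A (r v)), x ∈ U := fun x hx => (h.Nb_hang hr (hKC hv) hvU hx).1
    have hMK : ∀ x ∈ M v, x ∈ K := fun x hx => (hMsub v hv hvU hx).1
    have hreg : ∀ t, A (r v) t → A v₀ t ∧ t ∉ U ∧ r t = r v := fun t ht =>
      h.hang hr (hKC hv) hvU ht
    by_cases hcase : ∃ t ∈ M v, A (r v) t ∧ t ∉ S ∧ t ∈ zone G S c₀ (reg A (r v)) 1
    · obtain ⟨t, htM, htr, htS, htz⟩ := hcase
      obtain ⟨k1, k2, k3⟩ := hreg t htr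
      have htT : t ∈ T := ⟨hMK t htM, Or.inr (k3.symm ▸ htz)⟩
      have key : ∀ z ∈ M v, z ∈ Nb G (reg A (r v)) → ReachIn G' T t z := fun z hz hzN =>
        .single (hook_adj t z ⟨k1, k2, k3.symm ▸ hzN, Or.inl ⟨htS, hMD v hv hvU t htM z hz⟩⟩)
          htT ⟨hMK z hz, Or.inl (hNU z hzN)⟩
      exact (key x hx hxN).symm.trans (key y hy hyN)
    · push Not at hcase
      let P : Set V := {y | (y ∈ Nb G (reg A (r v)) → ReachIn G' T x y) ∧
        (A (r v) y → ∃ B, Conn G B ∧ B ⊆ S ∩ reg A (r v) ∧ MonoOn c₀ B ∧ y ∈ B ∧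
          ∃ z ∈ M v, z ∈ Nb G (reg A (r v)) ∧ Touch G B {z} ∧ ReachIn G' T x z)}
      have hsub : M v ⊆ P := by
        refine (cmpt_conn v).subset_of_closed ⟨x, hx, fun _ => .refl,
          fun hxr => absurd hxr hxN.1⟩ ?_
        intro a ha haM b hbM hab
        have hNb : ∀ z, z ∈ Nb G (reg A (r v)) → z ∈ zone G S c₀ (reg A (r v)) 1 :=
          fun z hz => zone_succ_subset 0 hz
        rcases (hMsub v hv hvU haM).2 with har | haN
        · obtain ⟨B, hB, hBS, hBm, haB, z, hzM, hzN, hBz, hxz⟩ := ha.2 har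
          have hBz' : Touch G B (zone G S c₀ (reg A (r v)) 0) := by
            obtain ⟨p, hp, q, rfl, hpq⟩ := hBz
            exact ⟨p, hp, q, hzN, hpq⟩
          have has : a ∈ sAdj G S c₀ (reg A (r v)) (zone G S c₀ (reg A (r v)) 0) :=
            ⟨B, hB, hBS, hBm, haB, hBz'⟩
          refine ⟨fun hbN => ?_, fun hbr => ?_⟩
          · obtain ⟨k1, k2, k3⟩ := hreg a har
            have haT : a ∈ T := ⟨hMK a haM, Or.inr (k3.symm ▸ Or.inl (Or.inr has))⟩
            have key : ∀ z ∈ M v, z ∈ Nb G (reg A (r v)) → Touch G B {z} →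
                ReachIn G' T a z := fun z hz hzN hBz =>
              .single (hook_adj a z ⟨k1, k2, k3.symm ▸ hzN,
                Or.inr ⟨B, hB, k3.symm ▸ hBS, hBm, haB, hBz⟩⟩)
                haT ⟨hMK z hz, Or.inl (hNU z hzN)⟩
            exact (hxz.trans (key z hzM hzN hBz).symm).trans
              (key b hbM hbN ⟨a, haB, b, rfl, hab⟩)
          · have hbS : b ∈ S := by
              by_contra hbS
              exact hcase b hbM hbr hbS (Or.inr ⟨hbr, hbS, a, Or.inr has, hab⟩)
            have hba : c₀ b = c₀ a := by
              rw [← hfS b hbS, ← hfS a (hBS haB).1]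
              exact hm b (hMK b hbM) a (hMK a haM)
            have hall : ∀ y ∈ insert b B, c₀ y = c₀ a := by
              rintro y (rfl | hy)
              · exact hba
              · exact hBm y hy a haB
            exact ⟨insert b B, hB.insert haB hab, Set.insert_subset ⟨hbS, hbr⟩ hBS,
              fun y hy z hz => by rw [hall y hy, hall z hz], Set.mem_insert _ _, z, hzM, hzN,
              hBz.mono (Set.subset_insert _ _) le_rfl, hxz⟩
        · refine ⟨fun hbN => (ha.1 haN).trans (up_adj a b (hMK a haM) (hMK b hbM)
            (hNU a haN) (hNU b hbN) hab), fun hbr => ?_⟩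
          have hbS : b ∈ S := by
            by_contra hbS
            exact hcase b hbM hbr hbS (Or.inr ⟨hbr, hbS, a, Or.inl haN, hab⟩)
          exact ⟨{b}, conn_singleton b, by simpa using ⟨hbS, hbr⟩,
            by rintro _ rfl _ rfl; rfl, rfl, a, haM, haN, ⟨b, rfl, a, rfl, hab.symm⟩,
            ha.1 haN⟩
      exact (hsub hy).1 hyN
  -- everything in the upper part is reachable from `o` in the torso
  let P : Set V := {y | (y ∈ U → ReachIn G' T o y) ∧
    (y ∉ U → ∀ x ∈ M y, x ∈ Nb G (reg A (r y)) → ReachIn G' T o x)}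
  have hsub : K ⊆ P := by
    refine hK.subset_of_closed ⟨o, hoK, fun _ => .refl, fun ho => absurd hoU ho⟩ ?_
    intro x hx hxK y hyK hxy
    have key : ∀ x ∈ K, x ∈ U → ∀ y ∈ K, y ∉ U → G.Adj x y →
        x ∈ M y ∧ x ∈ Nb G (reg A (r y)) := by
      intro x hxK hxU y hyK hyU hxy
      have hyr := (hr y (hKC hyK) hyU).1
      have hxN : x ∈ Nb G (reg A (r y)) :=
        ⟨fun hxr => (h.hang hr (hKC hyK) hyU hxr).2.1 hxU, y, hyr, hxy.symm⟩
      exact ⟨cmpt_closed (mem_cmpt y) (hin y hyK hyU) ⟨hxK, Or.inr hxN⟩ hxy.symm, hxN⟩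
    by_cases hxU : x ∈ U <;> by_cases hyU : y ∈ U
    · exact ⟨fun _ => (hx.1 hxU).trans (up_adj x y hxK hyK hxU hyU hxy), fun hh => absurd hyU hh⟩
    · refine ⟨fun hh => absurd hh hyU, fun _ z hz hzN => ?_⟩
      obtain ⟨k1, k2⟩ := key x hxK hxU y hyK hyU hxy
      exact (hx.1 hxU).trans (link y hyK hyU x k1 k2 z hz hzN)
    · refine ⟨fun _ => ?_, fun hh => absurd hyU hh⟩
      obtain ⟨k1, k2⟩ := key y hyK hyU x hxK hxU hxy.symm
      exact hx.2 hxU y k1 k2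
    · have he : r x = r y := h.hang_adj hr (hKC hxK) hxU (hKC hyK) hyU hxy
      refine ⟨fun hh => absurd hh hyU, fun _ z hz hzN => hx.2 hxU z ?_ (he ▸ hzN)⟩
      have : y ∈ M x := cmpt_closed (mem_cmpt x) (hin x hxK hxU) (he ▸ hin y hyK hyU) hxy
      have hMe : M y = cmpt G (K ∩ (reg A (r x) ∪ Nb G (reg A (r x)))) y := by
        simp only [M, he]
      rw [hMe] at hz
      exact ReachIn.trans this hz
  have hT1 : cmpt G' T o ⊆ T := cmpt_subset ⟨hoK, Or.inl hoU⟩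
  have hTg : ∀ x ∈ T, f x = g x := by
    rintro x ⟨hxK, hx⟩
    by_cases hxU : x ∈ U
    · exact hfU x hxU (hKZ x hxK)
    · exact hring x (hKC hxK) hxU x (hx.resolve_left hxU)
  have hTm : MonoOn g (cmpt G' T o) :=
    (hm.mono fun x hx => (hT1 hx).1).congr fun x hx => hTg x (hT1 hx)
  have hND := hg _ (cmpt_conn o) (Set.subset_univ _) hTm
  have near : ∀ x ∈ K, ∃ y ∈ cmpt G' T o, D q x y := by
    intro x hx
    by_cases hxU : x ∈ U
    · exact ⟨x, (hsub hx).1 hxU, h.near.refl _ _⟩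
    · obtain ⟨y, hyM, hyN⟩ := hMeet x hx hxU
      exact ⟨y, (hsub hx).2 hxU y hyM hyN, hMD x hx hxU x (mem_cmpt x) y hyM⟩
  obtain ⟨a', ha', haa⟩ := near a ha
  obtain ⟨b', hb', hbb⟩ := near b hb
  refine h.near.mono _ _ _ _ (by omega) (h.near.tri _ _ _ _ _
    (h.near.tri _ _ _ _ _ haa (hND a' ha' b' hb')) (h.near.symm _ _ _ hbb))

end Region

section Recursion

variable {V : Type*} [Finite V] {G : SimpleGraph V} {A : V → V → Prop} {D : ℕ → V → V → Prop}
  {L : V → Finset ℕ} {S : Set V} {c₀ : V → ℕ} {w lam N₀ : ℕ}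

/-- A set with at most `n` elements has its values under `g` listed by `a 1, …, a n`. -/
theorem exists_list_values (g : V → ℕ) {X : Set V} {n : ℕ} (hX : X.ncard ≤ n) :
    ∃ a : ℕ → ℕ, ∀ x ∈ X, ∃ j, 1 ≤ j ∧ j ≤ n ∧ g x = a j := by
  classical
  have hfin := Set.toFinite X
  let e := (hfin.toFinset).equivFin
  have hc : hfin.toFinset.card ≤ n := by rwa [← Set.ncard_eq_toFinset_card X hfin]
  refine ⟨fun j => if hj : j - 1 < hfin.toFinset.card then g (e.symm ⟨j - 1, hj⟩) else 0, ?_⟩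
  intro x hx
  have hx' : x ∈ hfin.toFinset := hfin.mem_toFinset.2 hx
  have hlt := (e ⟨x, hx'⟩).2
  refine ⟨(e ⟨x, hx'⟩ : ℕ) + 1, by omega, by omega, ?_⟩
  simp

omit [Finite V] in
/-- Colorings of the vertices in the outer rings avoiding the prescribed colors. -/
theorem ColInst.exists_ring_coloring (h : ColInst w lam N₀ G A D L S c₀) (C : Set V)
    (a : ℕ → ℕ) : ∃ e : V → ℕ, (∀ v, e v ∈ L v) ∧
      ∀ j v, v ∈ zone G S c₀ C (j + 1) → v ∉ zone G S c₀ C j → e v ≠ a j := by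
  have : ∀ v, ∃ b ∈ L v, ∀ j, v ∈ zone G S c₀ C (j + 1) → v ∉ zone G S c₀ C j → b ≠ a j := by
    intro v
    by_cases hj : ∃ j, v ∈ zone G S c₀ C (j + 1) ∧ v ∉ zone G S c₀ C j
    · obtain ⟨j, h1, h2⟩ := hj
      obtain ⟨b, hb, hba⟩ : ∃ b ∈ L v, b ≠ a j := by
        apply Finset.exists_mem_ne
        rw [h.card]; norm_num
      refine ⟨b, hb, fun i k1 k2 => ?_⟩
      have : i = j := by
        rcases lt_trichotomy i j with hij | hij | hij
        · exact absurd (zone_mono (by omega) k1) h2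
        · exact hij
        · exact absurd (zone_mono (by omega) h1) k2
      rwa [this]
    · obtain ⟨b, hb⟩ := h.exists_mem v
      exact ⟨b, hb, fun i k1 k2 => absurd ⟨i, k1, k2⟩ hj⟩
  choose e h1 h2 using this
  exact ⟨e, h1, fun j v => h2 v j⟩

theorem ColInst.exists_region (h : ColInst (w + 1) lam N₀ G A D L S c₀) {ρ q Nt N : ℕ}
    (hρ : ρ = (w + 2) * (N₀ + 2 * lam)) (hq : q = (w + 1) * (2 * ρ + lam))
    (hN : N = q + (2 * q + Nt) + (w + 2) * (2 * (2 * q + Nt + lam + ρ) + lam))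
    (hext : ∀ (G' : SimpleGraph V) (A' : V → V → Prop),
      ColInst w (lam + q + N₀) N₀ G' A' D L S c₀ →
      ∃ c : V → ℕ, (∀ a, c a ∈ L a) ∧ (∀ a ∈ S, c a = c₀ a) ∧ MonoDiam G' D Set.univ c Nt)
    (v₀ : V) (hX : (Nb G (reg A v₀)).ncard ≤ w + 1) (g : V → ℕ) (hgL : ∀ a, g a ∈ L a)
    (hgS : ∀ a ∈ S, g a = c₀ a) :
    ∃ f, RegionColoring G D L S c₀ (reg A v₀) g f q N := by
  classical
  induction hn : (reg A v₀).ncard using Nat.strong_induction_on generalizing v₀ g with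
  | _ n ih =>
  subst hn
  set C := reg A v₀ with hC
  set U := upper G A S c₀ w v₀ with hU
  set Z := coreZone G A S c₀ w v₀ with hZ
  obtain ⟨r, hr⟩ := h.ord.exists_roots C U
  obtain ⟨t, htL, htS, htD⟩ := hext _ _ (h.torsoInst hr hX q)
  have hv₀U : v₀ ∈ U := ⟨h.ord.refl _, Or.inl rfl⟩
  have hrec : ∀ v, ∃ f, A v₀ v → v ∉ U → RegionColoring G D L S c₀ (reg A (r v)) t f q N := by
    intro v
    by_cases hv : A v₀ v ∧ v ∉ U
    · obtain ⟨k1, k2, k3, -⟩ := hr v hv.1 hv.2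
      obtain ⟨f, hf⟩ := ih (reg A (r v)).ncard (Set.ncard_lt_ncard
        ⟨fun x hx => h.ord.trans _ _ _ k2 hx, fun hs => by
          have := h.ord.antisymm _ _ (hs (h.ord.refl v₀)) k2
          exact k3 (this ▸ hv₀U)⟩) (r v) (h.Nb_hang_card hr hv.1 hv.2) t htL htS rfl
      exact ⟨f, fun _ _ => hf⟩
    · exact ⟨t, fun h1 h2 => absurd ⟨h1, h2⟩ hv⟩
  have hrec' : ∀ ρ₀, ∃ f, ∀ v, A v₀ v → v ∉ U → r v = ρ₀ →
      RegionColoring G D L S c₀ (reg A (r v)) t f q N := by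
    intro ρ₀
    by_cases hv : ∃ v, A v₀ v ∧ v ∉ U ∧ r v = ρ₀
    · obtain ⟨v, h1, h2, h3⟩ := hv
      obtain ⟨f, hf⟩ := hrec v
      exact ⟨f, fun v' _ _ h6 => by rw [h6, ← h3]; exact hf h1 h2⟩
    · exact ⟨t, fun v h1 h2 h3 => absurd ⟨v, h1, h2, h3⟩ hv⟩
  choose F hF0 using hrec'
  have hF : ∀ v, A v₀ v → v ∉ U → RegionColoring G D L S c₀ (reg A (r v)) t (F (r v)) q N :=
    fun v h1 h2 => hF0 (r v) v h1 h2 rfl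
  obtain ⟨a, ha⟩ := exists_list_values g hX
  obtain ⟨e, heL, hea⟩ := h.exists_ring_coloring C a
  let f : V → ℕ := fun v => if v ∈ zone G S c₀ C 1 then g v else if v ∈ S then c₀ v
    else if v ∈ zone G S c₀ C (w + 2) then e v else if v ∈ C ∧ v ∉ U then F (r v) v else t v
  have f1 : ∀ v ∈ zone G S c₀ C 1, f v = g v := fun v hv => by simp [f, hv]
  have f2 : ∀ v ∈ S, f v = c₀ v := fun v hv => by
    by_cases h1 : v ∈ zone G S c₀ C 1
    · simp [f, h1, hgS v hv]
    · simp [f, h1, hv]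
  have f3 : ∀ v, v ∈ zone G S c₀ C (w + 2) → v ∉ zone G S c₀ C 1 → v ∉ S → f v = e v :=
    fun v h1 h2 h3 => by simp [f, h1, h2, h3]
  have z1 : zone G S c₀ C 1 ⊆ zone G S c₀ C (w + 2) := zone_mono (by omega)
  have f4 : ∀ v, A v₀ v → v ∉ U → f v = F (r v) v := fun v h1 h2 => by
    have h3 : v ∉ zone G S c₀ C (w + 2) := fun h3 => h2 (h.coreZone_upper h1 (Or.inl h3))
    have h4 : v ∉ zone G S c₀ C 1 := fun h4 => h3 (z1 h4)
    by_cases h5 : v ∈ S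
    · rw [f2 v h5, (hF v h1 h2).ext v h5]
    · have : v ∈ C := h1
      simp [f, h3, h4, h5, h2, this]
  have f5 : ∀ v, v ∈ U → v ∉ Z → f v = t v := fun v h1 h2 => by
    have h3 : v ∉ zone G S c₀ C (w + 2) := fun h3 => h2 (Or.inl h3)
    have h4 : v ∉ zone G S c₀ C 1 := fun h4 => h3 (z1 h4)
    by_cases h5 : v ∈ S
    · rw [f2 v h5, htS v h5]
    · simp [f, h3, h4, h5, h1]
  have fL : ∀ v, f v ∈ L v := by
    intro v
    simp only [f]
    split_ifs with h1 h2 h3 h4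
    · exact hgL v
    · exact h.mem v h2
    · exact heL v
    · exact (hF v h4.1 h4.2).mem v
    · exact htL v
  -- `f` agrees with the recursive colorings on hanging regions and their boundaries
  have hNbF : ∀ v, A v₀ v → v ∉ U → ∀ x ∈ Nb G (reg A (r v)), f x = F (r v) x := by
    intro v h1 h2 x hx
    obtain ⟨h3, h4⟩ := h.Nb_hang hr h1 h2 hx
    rw [f5 x h3 h4, (hF v h1 h2).ring x (zone_succ_subset 0 hx)]
  have hregF : ∀ v, A v₀ v → v ∉ U → ∀ x ∈ reg A (r v) ∪ Nb G (reg A (r v)),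
      f x = F (r v) x := by
    rintro v h1 h2 x (hx | hx)
    · obtain ⟨k1, k2, k3⟩ := h.hang hr h1 h2 hx
      rw [f4 x k1 k2, k3]
    · exact hNbF v h1 h2 x hx
  have fdiam_hang : ∀ v, A v₀ v → v ∉ U → ∀ K, Conn G K → MonoOn f K →
      K ⊆ reg A (r v) ∪ Nb G (reg A (r v)) → MonoOn (F (r v)) K :=
    fun v h1 h2 K _ hm hK => hm.congr fun x hx => hregF v h1 h2 x (hK hx)
  have hT : ∀ K, Conn G K → MonoOn f K → K ⊆ C → (∀ a ∈ K, a ∉ Z) → (∃ a ∈ K, a ∈ U) →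
      ∀ a ∈ K, ∀ b ∈ K, D (2 * q + Nt) a b := by
    intro K hK hm hKC hKZ hKU a ha b hb
    refine h.torso_bound hr htD f5 f2 ?_ ?_ hK hm hKC hKZ hKU ha hb
    · intro v h1 h2 x hx
      rw [hregF v h1 h2 x (zone_subset 1 hx), (hF v h1 h2).ring x hx]
    · intro v h1 h2 K hK hm hKs hKN a ha b hb
      exact (hF v h1 h2).bdry K hK (fdiam_hang v h1 h2 K hK hm hKs) hKs hKN a ha b hb
  have hB : ∀ K, Conn G K → MonoOn f K → K ⊆ C ∪ Nb G C → (K ∩ Nb G C).Nonempty →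
      ∀ a ∈ K, ∀ b ∈ K, D q a b := by
    rintro K hK hm hKC ⟨x, hxK, hxN⟩ y hy z hz
    obtain ⟨j, hj1, hj2, hj⟩ := ha x hxN
    have hsub : K ⊆ zone G S c₀ C (j + 1) := by
      refine zone_confine f2 hK hm hKC hxK hxN ?_
      intro v h1 h2 h3
      rw [f1 x (zone_succ_subset 0 hxN), hj, f3 v (zone_mono (by omega) h1)
        (fun h4 => h2 (zone_mono hj1 h4)) h3]
      exact hea j v h1 h2
    rw [hq]
    refine h.near.conn_cover hX h.adj hK ?_ hy hz
    intro p hp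
    obtain ⟨s, hs, -, hd⟩ := h.zone_near _ (zone_mono (show j + 1 ≤ w + 2 by omega) (hsub hp))
    exact ⟨s, hs, hρ ▸ hd⟩
  refine ⟨f, fL, f2, f1, hB, ?_⟩
  intro K hK hm hKC x hx y hy
  by_cases hKN : (K ∩ Nb G C).Nonempty
  · exact h.near.mono _ _ _ _ (by omega) (hB K hK hm hKC hKN x hx y hy)
  have hKC' : K ⊆ C := fun p hp => (hKC hp).resolve_right fun hN => hKN ⟨p, hp, hN⟩
  by_cases hKZ : ∃ z ∈ K, z ∈ Z
  · obtain ⟨z, hzK, hzZ⟩ := hKZ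
    have hY : (insert v₀ (Nb G C)).ncard ≤ w + 2 := (Set.ncard_insert_le _ _).trans (by omega)
    have hz : ∀ p ∈ Z, ∃ s ∈ insert v₀ (Nb G C), D ρ p s := by
      rintro p (hp | rfl)
      · obtain ⟨s, hs, -, hd⟩ := h.zone_near _ hp
        exact ⟨s, Or.inr hs, hρ ▸ hd⟩
      · exact ⟨p, Or.inl rfl, h.near.refl _ _⟩
    refine h.near.mono _ _ _ _ (by omega) (h.near.conn_cover (r := 2 * q + Nt + lam + ρ)
      hY h.adj hK ?_ hx hy)
    intro p hp
    by_cases hpZ : p ∈ Z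
    · obtain ⟨s, hs, hd⟩ := hz p hpZ
      exact ⟨s, hs, h.near.mono _ _ _ _ (by omega) hd⟩
    · have hM : cmpt G (K \ Z) p ⊆ K \ Z := cmpt_subset ⟨hp, hpZ⟩
      obtain ⟨m, hmK, hmM, k, hkK, hkM, hmk⟩ := hK.exists_crossing (T := cmpt G (K \ Z) p)
        ⟨p, hp, mem_cmpt p⟩ (fun hs => (hM (hs hzK)).2 hzZ)
      have hkZ : k ∈ Z := by
        by_contra hkZ
        exact hkM (cmpt_closed hmM (hM hmM) ⟨hkK, hkZ⟩ hmk)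
      have hmU : m ∈ U := by
        by_contra hmU
        obtain ⟨k1, k2, k3, -⟩ := hr m (hKC' hmK) hmU
        have hkU : k ∈ U := h.coreZone_upper (hKC' hkK) hkZ
        exact k3 ⟨k2, Or.inr ⟨k, ⟨fun hk => (h.hang hr (hKC' hmK) hmU hk).2.1 hkU, m, k1, hmk⟩,
          hkZ⟩⟩
      have h1 := hT _ (cmpt_conn p) (hm.mono fun x hx => (hM hx).1) (fun x hx => hKC' (hM hx).1)
        (fun x hx => (hM hx).2) ⟨m, hmM, hmU⟩ p (mem_cmpt p) m hmM
      obtain ⟨s, hs, hd⟩ := hz k hkZ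
      exact ⟨s, hs, h.near.tri _ _ _ _ _ (h.near.tri _ _ _ _ _ h1 (h.adj _ _ hmk)) hd⟩
  · push Not at hKZ
    by_cases hKU : ∃ u ∈ K, u ∈ U
    · exact h.near.mono _ _ _ _ (by omega) (hT K hK hm hKC' hKZ hKU x hx y hy)
    · push Not at hKU
      have hsub : K ⊆ reg A (r x) := by
        refine hK.subset_of_closed ⟨x, hx, (hr x (hKC' hx) (hKU x hx)).1⟩ ?_
        intro p hp hpK s hs hps
        have he := h.hang_adj hr (hKC' hpK) (hKU p hpK) (hKC' hs) (hKU s hs) hps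
        have he' := (h.hang hr (hKC' hx) (hKU x hx) hp).2.2
        rw [← he', he]
        exact (hr s (hKC' hs) (hKU s hs)).1
      have hsub' : K ⊆ reg A (r x) ∪ Nb G (reg A (r x)) := hsub.trans Set.subset_union_left
      exact (hF x (hKC' hx) (hKU x hx)).diam K hK
        (fdiam_hang x (hKC' hx) (hKU x hx) K hK hm hsub') hsub' x hx y hy

end Recursion

theorem Extendable.succ {w : ℕ} (hw : Extendable.{u} w) : Extendable.{u} (w + 1) := by
  intro lam N₀
  let ρ := (w + 2) * (N₀ + 2 * lam)
  let q := (w + 1) * (2 * ρ + lam)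
  obtain ⟨Nt, hNt⟩ := hw (lam + q + N₀) N₀
  refine ⟨q + (2 * q + Nt) + (w + 2) * (2 * (2 * q + Nt + lam + ρ) + lam), ?_⟩
  intro V _ G A D L S c₀ h
  classical
  obtain ⟨r, hr⟩ := h.ord.exists_roots Set.univ ∅
  have hroot : ∀ v, A (r v) v ∧ ∀ a, A a (r v) → a = r v := fun v => by
    obtain ⟨h1, -, -, h4⟩ := hr v trivial (Set.notMem_empty _)
    exact ⟨h1, fun a ha => by_contra fun hne => h4 a trivial ha hne⟩
  have hNb : ∀ v, Nb G (reg A (r v)) = ∅ := by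
    intro v
    rw [Set.eq_empty_iff_forall_notMem]
    intro x hx
    have := h.ord.anc_of_mem_Nb hx
    exact this.2 ((hroot v).2 x this.1)
  choose e he using h.exists_mem
  let g : V → ℕ := fun a => if a ∈ S then c₀ a else e a
  have hgL : ∀ a, g a ∈ L a := fun a => by
    by_cases ha : a ∈ S
    · simpa [g, ha] using h.mem a ha
    · simpa [g, ha] using he a
  have hgS : ∀ a ∈ S, g a = c₀ a := fun a ha => by simp [g, ha]
  have hex : ∀ v, ∃ f, ∀ x, r x = v → RegionColoring G D L S c₀ (reg A v) g f q
      (q + (2 * q + Nt) + (w + 2) * (2 * (2 * q + Nt + lam + ρ) + lam)) := by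
    intro v
    by_cases hv : ∃ x, r x = v
    · obtain ⟨x, rfl⟩ := hv
      obtain ⟨f, hf⟩ := h.exists_region (ρ := ρ) (q := q) (Nt := Nt) rfl rfl rfl
        (fun G' A' h' => hNt V G' A' D L S c₀ h') (r x) (by rw [hNb]; simp) g hgL hgS
      exact ⟨f, fun _ _ => hf⟩
    · exact ⟨g, fun x hx => absurd ⟨x, hx⟩ hv⟩
  choose F hF0 using hex
  have hF := fun x => hF0 (r x) x rfl
  refine ⟨fun v => F (r v) v, fun v => (hF v).mem v, fun v hv => (hF v).ext v hv, ?_⟩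
  intro K hK _ hm a ha b hb
  have hadj : ∀ x y, G.Adj x y → r x = r y := fun x y hxy =>
    hr.adj h.ord (fun _ _ _ _ => trivial) (fun _ _ _ _ h3 => absurd h3 (Set.notMem_empty _))
      trivial (Set.notMem_empty _) trivial (Set.notMem_empty _) hxy
  have hsub : K ⊆ {x | r x = r a} := hK.subset_of_closed ⟨a, ha, rfl⟩
    fun x hx _ y _ hxy => (hadj x y hxy).symm.trans hx
  refine (hF a).diam K hK (hm.congr fun x hx => by rw [show r x = r a from hsub hx]) ?_ a ha b hb
  intro x hx
  left
  have := (hroot x).1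
  rwa [show r x = r a from hsub hx] at this

theorem extendable (w : ℕ) : Extendable.{u} w := by
  induction w with
  | zero => exact extendable_zero
  | succ w ih => exact ih.succ

/-- Graphs with a tree order of bounded width have list colorings of bounded weak diameter
extending any precoloring of bounded weak diameter. -/
theorem exists_extension_of_width (w N₀ : ℕ) : ∃ N : ℕ, ∀ (V : Type u) [Finite V]
    (G : SimpleGraph V) (A : V → V → Prop), TreeOrd G A → WidthLE G A w →
    ∀ L : V → Finset ℕ, (∀ x, (L x).card = 2) → ∀ (S : Set V) (c₀ : V → ℕ),
    (∀ x ∈ S, c₀ x ∈ L x) → HasWeakDiamLE G S c₀ N₀ →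
    ∃ c : V → ℕ, (∀ x, c x ∈ L x) ∧ (∀ x ∈ S, c x = c₀ x) ∧ HasWeakDiamLE G Set.univ c N := by
  obtain ⟨N, hN⟩ := extendable.{u} w 1 N₀
  refine ⟨N, ?_⟩
  intro V _ G A hA hW L hL S c₀ hS hd
  let D : ℕ → V → V → Prop := fun n a b => ∃ p : G.Walk a b, p.length ≤ n
  have walk : ∀ (T : Set V) a b, ReachIn G T a b → a ∈ T →
      ∃ p : G.Walk a b, ∀ x ∈ p.support, x ∈ T := by
    intro T a b hab ha
    induction hab with
    | refl => exact ⟨.nil, by simpa using ha⟩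
    | tail _ h ih =>
      obtain ⟨p, hp⟩ := ih
      refine ⟨p.concat h.1, fun x hx => ?_⟩
      rw [Walk.support_concat] at hx
      rw [List.mem_append, List.mem_singleton] at hx
      rcases hx with hx | rfl
      · exact hp x hx
      · exact h.2.2
  have hI : ColInst w 1 N₀ G A D L S c₀ := by
    refine ⟨hA, hW, ?_, ?_, hL, hS, ?_⟩
    · exact ⟨fun n a => ⟨.nil, by simp⟩, fun n a b ⟨p, hp⟩ => ⟨p.reverse, by simpa using hp⟩,
        fun n m a b c ⟨p, hp⟩ ⟨p', hp'⟩ => ⟨p.append p', by rw [Walk.length_append]; omega⟩,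
        fun n m a b hnm ⟨p, hp⟩ => ⟨p, hp.trans hnm⟩⟩
    · intro a b hab
      exact ⟨hab.toWalk, by simp⟩
    · intro K hK hKS hm a ha b hb
      obtain ⟨p, hp⟩ := walk K a b (hK.2 a ha b hb) ha
      have := hd a b ⟨p, fun x hx => ⟨hKS (hp x hx), hm x (hp x hx) a ha⟩⟩
      obtain ⟨p', hp'⟩ := p.reachable.exists_walk_length_eq_dist
      exact ⟨p', hp' ▸ this⟩
  obtain ⟨c, h1, h2, h3⟩ := hN V G A D L S c₀ hI
  refine ⟨c, h1, h2, ?_⟩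
  rintro a b ⟨p, hp⟩
  obtain ⟨p', hp'⟩ := h3 {x | x ∈ p.support}
    (conn_iff_induce.2 ⟨⟨a, p.start_mem_support⟩, p.connected_induce_support⟩) (Set.subset_univ _)
    (fun x hx y hy => by rw [(hp x hx).2, (hp y hy).2]) a p.start_mem_support b
    p.end_mem_support
  exact (dist_le p').trans hp'

/-! ### Menger's theorem for connected sets -/

/-- There are `k` disjoint connected sets meeting both `A` and `B`. -/
def Linked {V : Type*} (G : SimpleGraph V) (A B : Set V) (k : ℕ) : Prop :=
  ∃ P : Fin k → Set V, (∀ i, Conn G (P i)) ∧ (∀ i j, i ≠ j → Disjoint (P i) (P j)) ∧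
    ∀ i, (P i ∩ A).Nonempty ∧ (P i ∩ B).Nonempty

/-- Every connected set meeting `A` and `B` meets `S`. -/
def Separates {V : Type*} (G : SimpleGraph V) (A B S : Set V) : Prop :=
  ∀ P, Conn G P → (P ∩ A).Nonempty → (P ∩ B).Nonempty → (P ∩ S).Nonempty

/-- A connected set through `v` meets `A` and avoids `S`. -/
def OnSide {V : Type*} (G : SimpleGraph V) (A S : Set V) (v : V) : Prop :=
  ∃ U, Conn G U ∧ Disjoint U S ∧ v ∈ U ∧ (U ∩ A).Nonempty

section Menger

variable {V : Type*} {G G' : SimpleGraph V} {A B S T P : Set V} {v s x y : V} {k : ℕ}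

theorem Linked.of_family {ι : Type*} [Finite ι] (hk : k ≤ Nat.card ι) (P : ι → Set V)
    (h1 : ∀ i, Conn G (P i)) (h2 : ∀ i j, i ≠ j → Disjoint (P i) (P j))
    (h3 : ∀ i, (P i ∩ A).Nonempty ∧ (P i ∩ B).Nonempty) : Linked G A B k := by
  have := Fintype.ofFinite ι
  rw [Nat.card_eq_fintype_card] at hk
  obtain ⟨f⟩ : Nonempty (Fin k ↪ ι) :=
    Function.Embedding.nonempty_of_card_le (by simpa using hk)
  exact ⟨fun i => P (f i), fun i => h1 _, fun i j hij => h2 _ _ (f.injective.ne hij),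
    fun i => h3 _⟩

theorem Linked.symm (h : Linked G A B k) : Linked G B A k := by
  obtain ⟨P, h1, h2, h3⟩ := h
  exact ⟨P, h1, h2, fun i => (h3 i).symm⟩

theorem Linked.mono_graph (h : Linked G A B k) (hG : G ≤ G') : Linked G' A B k := by
  obtain ⟨P, h1, h2, h3⟩ := h
  exact ⟨P, fun i => (h1 i).mono_graph hG, h2, h3⟩

theorem Linked.mono_right (h : Linked G A B k) {l : ℕ} (hl : l ≤ k) : Linked G A B l := by
  obtain ⟨P, h1, h2, h3⟩ := h
  exact .of_family (by simpa using hl) P h1 h2 h3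

theorem Separates.symm (h : Separates G A B S) : Separates G B A S :=
  fun P hP hA hB => h P hP hB hA

theorem exists_onSide_of_not_separates (h : ¬ Separates G A B S) :
    ∃ P, Conn G P ∧ (P ∩ A).Nonempty ∧ (P ∩ B).Nonempty ∧ Disjoint P S := by
  unfold Separates at h
  push Not at h
  obtain ⟨P, h1, h2, h3, h4⟩ := h
  exact ⟨P, h1, h2, h3, Set.disjoint_iff_inter_eq_empty.2 h4⟩

theorem Conn.trim (hP : Conn G P) (hA : (P ∩ A).Nonempty) (hT : P ∩ T = {s}) :
    ∃ R ⊆ P, Conn G R ∧ s ∈ R ∧ (R ∩ A).Nonempty ∧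
      ∀ v ∈ R, v ≠ s → ∃ U ⊆ P, Conn G U ∧ Disjoint U T ∧ v ∈ U ∧ (U ∩ A).Nonempty := by
  obtain ⟨p, l, hp, h0, hl, -, hT', -⟩ := hP.exists_path hA (B := T) (by rw [hT]; exact ⟨s, rfl⟩)
  have hs : p l = s := by
    have : p l ∈ P ∩ T := ⟨hp.mem l le_rfl, hl⟩
    rwa [hT] at this
  refine ⟨p '' Set.Icc 0 l, hp.seg_subset le_rfl, hp.conn_seg (Nat.zero_le _) le_rfl,
    ⟨l, by simp, hs⟩, ⟨p 0, ⟨0, by simp, rfl⟩, h0⟩, ?_⟩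
  rintro _ ⟨i, hi, rfl⟩ his
  have hil : i ≠ l := fun h => his (h ▸ hs)
  have hil' : i < l := lt_of_le_of_ne hi.2 hil
  refine ⟨p '' Set.Icc 0 i, hp.seg_subset hi.2, hp.conn_seg (Nat.zero_le _) hi.2, ?_,
    ⟨i, by simp, rfl⟩, ⟨p 0, ⟨0, by simp, rfl⟩, h0⟩⟩
  rw [Set.disjoint_left]
  rintro _ ⟨j, hj, rfl⟩ hjT
  have h1 := hj.2
  have := hT' j (by omega) hjT
  omega

theorem Linked.exists_onto [Finite V] (h : Linked G A T k) (hk : T.ncard = k) :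
    ∃ P : V → Set V, (∀ s ∈ T, Conn G (P s) ∧ P s ∩ T = {s} ∧ (P s ∩ A).Nonempty ∧
      ∀ v ∈ P s, v ≠ s → OnSide G A T v) ∧
      ∀ s ∈ T, ∀ t ∈ T, s ≠ t → Disjoint (P s) (P t) := by
  obtain ⟨P, h1, h2, h3⟩ := h
  choose t ht using fun i => (h3 i).2
  have htinj : Function.Injective t := fun i j hij => by
    by_contra hne
    exact Set.disjoint_left.1 (h2 i j hne) (ht i).1 (hij ▸ (ht j).1)
  have hrange : Set.range t = T := by
    refine Set.eq_of_subset_of_ncard_le ?_ ?_ (Set.toFinite _)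
    · rintro _ ⟨i, rfl⟩
      exact (ht i).2
    · rw [hk, Set.ncard_range_of_injective htinj, Nat.card_fin]
  have hsurj : ∀ s ∈ T, ∃ i, t i = s := fun s hs => by rwa [← hrange] at hs
  have hone : ∀ i, P i ∩ T = {t i} := fun i => by
    refine Set.Subset.antisymm ?_ (by simpa using ht i)
    rintro x ⟨hx, hxT⟩
    obtain ⟨j, rfl⟩ := hsurj x hxT
    by_contra hne
    exact Set.disjoint_left.1 (h2 i j (fun h => hne (h ▸ rfl))) hx (ht j).1
  choose R hR using fun i => (h1 i).trim (h3 i).1 (hone i)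
  have hex : ∀ s, ∃ Q : Set V, ∀ i, t i = s → Q = R i := fun s => by
    by_cases h : ∃ i, t i = s
    · obtain ⟨i, rfl⟩ := h
      exact ⟨R i, fun j hj => by rw [htinj hj]⟩
    · exact ⟨∅, fun i hi => absurd ⟨i, hi⟩ h⟩
  choose Q hQ using hex
  refine ⟨Q, ?_, ?_⟩
  · intro s hs
    obtain ⟨i, rfl⟩ := hsurj s hs
    rw [hQ _ i rfl]
    obtain ⟨hRP, hc, hsR, hA, hside⟩ := hR i
    refine ⟨hc, ?_, hA, fun v hv hvs => ?_⟩
    · refine Set.Subset.antisymm ?_ (by simpa using ⟨hsR, hs⟩)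
      rw [← hone i]
      exact Set.inter_subset_inter_left _ hRP
    · obtain ⟨U, -, hU⟩ := hside v hv hvs
      exact ⟨U, hU⟩
  · intro s hs s' hs' hne
    obtain ⟨i, rfl⟩ := hsurj s hs
    obtain ⟨j, rfl⟩ := hsurj s' hs'
    rw [hQ _ i rfl, hQ _ j rfl]
    exact (h2 i j (fun h => hne (h ▸ rfl))).mono (hR i).1 (hR j).1

theorem OnSide.mono {S' : Set V} (h : OnSide G A S v) (hS : S' ⊆ S) : OnSide G A S' v := by
  obtain ⟨U, h1, h2, h3⟩ := h
  exact ⟨U, h1, h2.mono_right hS, h3⟩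

theorem Separates.not_onSide (h : Separates G A B S) (hA : OnSide G A S v) :
    ¬ OnSide G B S v := by
  rintro ⟨U, hU, hUS, hvU, hUB⟩
  obtain ⟨U', hU', hUS', hvU', hUA⟩ := hA
  obtain ⟨z, hz, hzS⟩ := h (U' ∪ U) (hU'.union hU ⟨v, hvU', hvU⟩)
    (hUA.mono (Set.inter_subset_inter_left _ Set.subset_union_left))
    (hUB.mono (Set.inter_subset_inter_left _ Set.subset_union_right))
  rcases hz with hz | hz
  · exact Set.disjoint_left.1 hUS' hz hzS
  · exact Set.disjoint_left.1 hUS hz hzS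

theorem deleteEdge_adj_of_ne {a b : V} (h : G.Adj a b) (h' : ¬ (a = x ∧ b = y))
    (h'' : ¬ (a = y ∧ b = x)) : (G.deleteEdges {s(x, y)}).Adj a b := by
  rw [deleteEdges_adj]
  refine ⟨h, ?_⟩
  simp only [Set.mem_singleton_iff, Sym2.eq_iff]
  tauto

/-- A connected set crossing a separator of `G - xy` uses the edge `xy`. -/
theorem exists_onSide_ends (hS : Separates (G.deleteEdges {s(x, y)}) A B S)
    (hP : Conn G P) (hA : (P ∩ A).Nonempty) (hB : (P ∩ B).Nonempty) (hPS : Disjoint P S) :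
    OnSide (G.deleteEdges {s(x, y)}) A S x ∧ OnSide (G.deleteEdges {s(x, y)}) B S y ∨
    OnSide (G.deleteEdges {s(x, y)}) A S y ∧ OnSide (G.deleteEdges {s(x, y)}) B S x := by
  set G' := G.deleteEdges {s(x, y)} with hG'
  have key : ∀ A : Set V, (P ∩ A).Nonempty → ∀ b ∈ P, ¬ OnSide G' A S b →
      OnSide G' A S x ∨ OnSide G' A S y := by
    rintro A ⟨a, haP, haA⟩ b hb hbs
    obtain ⟨u, huP, hu, v, hvP, hv, huv⟩ := hP.exists_crossing (T := {v | OnSide G' A S v})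
      ⟨a, haP, {a}, conn_singleton a,
        by simpa using fun h => Set.disjoint_left.1 hPS haP h, rfl, a, rfl, haA⟩
      (fun h => hbs (h hb))
    by_contra! hc
    have hux : u ≠ x := fun h => hc.1 (h ▸ hu)
    have huy : u ≠ y := fun h => hc.2 (h ▸ hu)
    obtain ⟨U, hU, hUS, huU, hUA⟩ := hu
    refine hv ⟨insert v U, hU.insert huU (deleteEdge_adj_of_ne huv (by tauto) (by tauto)), ?_,
      Or.inl rfl, hUA.mono (Set.inter_subset_inter_left _ (Set.subset_insert _ _))⟩
    rw [Set.disjoint_left]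
    rintro z (rfl | hz) hzS
    · exact Set.disjoint_left.1 hPS hvP hzS
    · exact Set.disjoint_left.1 hUS hz hzS
  have self : ∀ {A : Set V} {a}, a ∈ P → a ∈ A → OnSide G' A S a := fun {A a} haP haA =>
    ⟨{a}, conn_singleton a, by simpa using fun h => Set.disjoint_left.1 hPS haP h, rfl, a, rfl,
      haA⟩
  have hA' := hA
  have hB' := hB
  obtain ⟨a, haP, ha⟩ := hA'
  obtain ⟨b, hbP, hb⟩ := hB'
  have h1 := key A hA b hbP (fun h => hS.not_onSide h (self hbP hb))
  have h2 := key B hB a haP (fun h => hS.not_onSide (self haP ha) h)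
  have h3 := fun v => hS.not_onSide (v := v)
  rcases h1 with h1 | h1 <;> rcases h2 with h2 | h2
  · exact absurd h2 (h3 _ h1)
  · exact Or.inl ⟨h1, h2⟩
  · exact Or.inr ⟨h1, h2⟩
  · exact absurd h2 (h3 _ h1)

/-- A separator of `A` from `S ∪ {x}` in `G - xy` separates `A` from `B` in `G`. -/
theorem Separates.of_side (hS : Separates (G.deleteEdges {s(x, y)}) A B S)
    (hy : ¬ OnSide (G.deleteEdges {s(x, y)}) A S y)
    (hT : Separates (G.deleteEdges {s(x, y)}) A (insert x S) T) : Separates G A B T := by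
  set G' := G.deleteEdges {s(x, y)} with hG'
  intro P hP hA hB
  obtain ⟨a, haP, ha⟩ := hA
  have hsub := cmpt_subset (G := G') haP
  have hKA : (cmpt G' P a ∩ A).Nonempty := ⟨a, mem_cmpt a, ha⟩
  suffices h : (cmpt G' P a ∩ insert x S).Nonempty from
    (hT _ (cmpt_conn a) hKA h).mono (Set.inter_subset_inter_left _ hsub)
  by_contra hne
  rw [Set.not_nonempty_iff_eq_empty] at hne
  have hd : Disjoint (cmpt G' P a) S :=
    (Set.disjoint_iff_inter_eq_empty.2 hne).mono_right (Set.subset_insert _ _)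
  have hx : x ∉ cmpt G' P a := fun h => by
    have : x ∈ cmpt G' P a ∩ insert x S := ⟨h, Or.inl rfl⟩
    rw [hne] at this
    exact this
  by_cases hPK : P ⊆ cmpt G' P a
  · have heq := hPK.antisymm hsub
    obtain ⟨z, hz, hzS⟩ := hS _ (cmpt_conn a) hKA (heq ▸ hB)
    exact Set.disjoint_left.1 hd hz hzS
  · obtain ⟨u, huP, hu, v, hvP, hv, huv⟩ := hP.exists_crossing ⟨a, haP, mem_cmpt a⟩ hPK
    by_cases hcase : u = y ∧ v = x
    · exact hy ⟨_, cmpt_conn a, hd, hcase.1 ▸ hu, hKA⟩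
    · exact hv (cmpt_closed hu huP hvP (deleteEdge_adj_of_ne huv
        (fun h => hx (h.1 ▸ hu)) hcase))

theorem linked_of_inter [Finite V] (h : k ≤ (A ∩ B).ncard) : Linked G A B k :=
  .of_family (ι := ↥(A ∩ B)) (by rwa [Nat.card_coe_set_eq]) (fun i => {i.1})
    (fun i => conn_singleton _) (fun i j hij => by simpa [Subtype.ext_iff] using hij)
    fun i => ⟨⟨i.1, rfl, i.2.1⟩, ⟨i.1, rfl, i.2.2⟩⟩

theorem linked_glue [Finite V] (hxy : G.Adj x y) (hle : G' ≤ G) (hS : Separates G' A B S)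
    (hx : OnSide G' A S x) (hy : OnSide G' B S y) (hk : k ≤ S.ncard + 1)
    (h1 : Linked G' A (insert x S) (S.ncard + 1)) (h2 : Linked G' B (insert y S) (S.ncard + 1)) :
    Linked G A B k := by
  have hxS : x ∉ S := fun h => by
    obtain ⟨U, -, hU, hxU, -⟩ := hx
    exact Set.disjoint_left.1 hU hxU h
  have hyS : y ∉ S := fun h => by
    obtain ⟨U, -, hU, hxU, -⟩ := hy
    exact Set.disjoint_left.1 hU hxU h
  obtain ⟨P, hP, hPd⟩ := h1.exists_onto (Set.ncard_insert_of_notMem hxS)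
  obtain ⟨Q, hQ, hQd⟩ := h2.exists_onto (Set.ncard_insert_of_notMem hyS)
  have hPside : ∀ s ∈ insert x S, ∀ v ∈ P s, v ∉ S → OnSide G' A S v := by
    intro s hs v hv hvS
    by_cases hvs : v = s
    · rcases hs with rfl | hs
      · rwa [hvs]
      · exact absurd (hvs ▸ hs) hvS
    · exact ((hP s hs).2.2.2 v hv hvs).mono (Set.subset_insert _ _)
  have hQside : ∀ s ∈ insert y S, ∀ v ∈ Q s, v ∉ S → OnSide G' B S v := by
    intro s hs v hv hvS
    by_cases hvs : v = s
    · rcases hs with rfl | hs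
      · rwa [hvs]
      · exact absurd (hvs ▸ hs) hvS
    · exact ((hQ s hs).2.2.2 v hv hvs).mono (Set.subset_insert _ _)
  have hPS : ∀ s ∈ insert x S, ∀ v ∈ P s, v ∈ S → v = s := fun s hs v hv hvS => by
    have : v ∈ P s ∩ insert x S := ⟨hv, Or.inr hvS⟩
    rwa [(hP s hs).2.1] at this
  have hQS : ∀ s ∈ insert y S, ∀ v ∈ Q s, v ∈ S → v = s := fun s hs v hv hvS => by
    have : v ∈ Q s ∩ insert y S := ⟨hv, Or.inr hvS⟩
    rwa [(hQ s hs).2.1] at this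
  have hPself : ∀ s ∈ insert x S, s ∈ P s := fun s hs => by
    have := (hP s hs).2.1.symm.subset rfl
    exact this.1
  have hQself : ∀ s ∈ insert y S, s ∈ Q s := fun s hs => by
    have := (hQ s hs).2.1.symm.subset rfl
    exact this.1
  have hPQ : ∀ s ∈ insert x S, ∀ t ∈ insert y S, (s ∈ S → t ∈ S → s ≠ t) →
      Disjoint (P s) (Q t) := by
    intro s hs t ht hne
    rw [Set.disjoint_left]
    intro v hv hv'
    by_cases hvS : v ∈ S
    · obtain rfl := hPS s hs v hv hvS
      obtain rfl := hQS t ht v hv' hvS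
      exact hne hvS hvS rfl
    · exact hS.not_onSide (hPside s hs v hv hvS) (hQside t ht v hv' hvS)
  let F : Option S → Set V := fun o => o.elim (P x ∪ Q y) fun s => P s.1 ∪ Q s.1
  have hxI : x ∈ insert x S := Or.inl rfl
  have hyI : y ∈ insert y S := Or.inl rfl
  refine Linked.of_family (ι := Option S) ?_ F ?_ ?_ ?_
  · rw [Finite.card_option, Nat.card_coe_set_eq]
    exact hk
  · rintro (_ | ⟨s, hs⟩)
    · exact ((hP x hxI).1.mono_graph hle).union_touch ((hQ y hyI).1.mono_graph hle)
        ⟨x, hPself x hxI, y, hQself y hyI, hxy⟩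
    · exact ((hP s (Or.inr hs)).1.mono_graph hle).union ((hQ s (Or.inr hs)).1.mono_graph hle)
        ⟨s, hPself s (Or.inr hs), hQself s (Or.inr hs)⟩
  · have hmix : ∀ s (hs : s ∈ S), Disjoint (P x ∪ Q y) (P s ∪ Q s) := fun s hs => by
      simp only [Set.disjoint_union_left, Set.disjoint_union_right]
      refine ⟨⟨hPd x hxI s (Or.inr hs) fun h => hxS (h ▸ hs),
        (hPQ s (Or.inr hs) y hyI fun _ h => absurd h hyS).symm⟩,
        hPQ x hxI s (Or.inr hs) fun h => absurd h hxS,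
        hQd y hyI s (Or.inr hs) fun h => hyS (h ▸ hs)⟩
    rintro (_ | ⟨s, hs⟩) (_ | ⟨t, ht⟩) hne
    · exact absurd rfl hne
    · exact hmix t ht
    · exact (hmix s hs).symm
    · have hst : s ≠ t := fun h => hne (by subst h; rfl)
      change Disjoint (P s ∪ Q s) (P t ∪ Q t)
      simp only [Set.disjoint_union_left, Set.disjoint_union_right]
      exact ⟨⟨hPd s (Or.inr hs) t (Or.inr ht) hst,
        (hPQ t (Or.inr ht) s (Or.inr hs) fun _ _ => hst.symm).symm⟩,
        hPQ s (Or.inr hs) t (Or.inr ht) fun _ _ => hst,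
        hQd s (Or.inr hs) t (Or.inr ht) hst⟩
  · rintro (_ | ⟨s, hs⟩)
    · exact ⟨(hP x hxI).2.2.1.mono (Set.inter_subset_inter_left _ Set.subset_union_left),
        (hQ y hyI).2.2.1.mono (Set.inter_subset_inter_left _ Set.subset_union_right)⟩
    · exact ⟨(hP s (Or.inr hs)).2.2.1.mono (Set.inter_subset_inter_left _ Set.subset_union_left),
        (hQ s (Or.inr hs)).2.2.1.mono (Set.inter_subset_inter_left _ Set.subset_union_right)⟩

/-- **Menger's theorem** for connected sets. -/
theorem linked_of_separates [Finite V] (k : ℕ) (G : SimpleGraph V) (A B : Set V)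
    (h : ∀ S, Separates G A B S → k ≤ S.ncard) : Linked G A B k := by
  induction hm : G.edgeSet.ncard using Nat.strong_induction_on generalizing G A B with
  | _ m ih =>
    subst hm
    by_cases hG : ∃ x y, G.Adj x y
    · obtain ⟨x, y, hxy⟩ := hG
      set G' := G.deleteEdges {s(x, y)} with hG'
      have hle : G' ≤ G := deleteEdges_le _
      have hlt : G'.edgeSet.ncard < G.edgeSet.ncard := by
        refine Set.ncard_lt_ncard ?_ (Set.toFinite _)
        refine ⟨edgeSet_mono hle, fun h => ?_⟩
        have : s(x, y) ∈ G'.edgeSet := h hxy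
        simp [hG'] at this
      by_cases hS : ∃ S, Separates G' A B S ∧ S.ncard < k
      · obtain ⟨S, hS, hSk⟩ := hS
        have hnot : ¬ Separates G A B S := fun h' => absurd (h S h') (by omega)
        obtain ⟨P, hP, hPA, hPB, hPS⟩ := exists_onSide_of_not_separates hnot
        have main : ∀ x y, G.Adj x y → G' = G.deleteEdges {s(x, y)} → OnSide G' A S x →
            OnSide G' B S y → Linked G A B k := by
          intro x y hxy hG'' hx hy
          have hsepx : ∀ T, Separates G' A (insert x S) T → k ≤ T.ncard := by
            rw [hG''] at hS hx hy ⊢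
            intro T hT
            exact h T (hS.of_side (fun h' => hS.not_onSide h' hy) hT)
          have hsepy : ∀ T, Separates G' B (insert y S) T → k ≤ T.ncard := by
            have hG3 : G' = G.deleteEdges {s(y, x)} := by rw [hG'', Sym2.eq_swap]
            rw [hG3] at hS hx hy ⊢
            intro T hT
            exact h T (hS.symm.of_side (fun h' => hS.not_onSide hx h') hT).symm
          have hk : k = S.ncard + 1 := by
            have := hsepx _ (fun P _ _ h => h)
            have := Set.ncard_insert_le x S
            omega
          exact linked_glue hxy hle hS hx hy hk.le
            (hk ▸ ih _ hlt G' A _ hsepx rfl) (hk ▸ ih _ hlt G' B _ hsepy rfl)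
        rcases exists_onSide_ends hS hP hPA hPB hPS with ⟨h1, h2⟩ | ⟨h1, h2⟩
        · exact main x y hxy rfl h1 h2
        · exact main y x hxy.symm (by rw [hG', Sym2.eq_swap]) h1 h2
      · push Not at hS
        exact (ih _ hlt G' A B hS rfl).mono_graph hle
    · push Not at hG
      refine linked_of_inter (h _ ?_)
      rintro P hP ⟨a, haP, ha⟩ ⟨b, hbP, hb⟩
      have : P ⊆ {a} := hP.subset_of_closed ⟨a, haP, rfl⟩
        fun x _ _ y _ hxy => absurd hxy (hG x y)
      obtain rfl : b = a := this hbP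
      exact ⟨b, hbP, ha, hb⟩

end Menger

/-! ### Elimination orders -/

/-- Vertex sets that can be eliminated from roots downwards with boundaries of size at most `w`. -/
inductive Elim {V : Type*} (G : SimpleGraph V) (w : ℕ) : Set V → Prop
  | empty : Elim G w ∅
  | union {C D : Set V} : Elim G w C → Elim G w D → Disjoint C D → ¬ Touch G C D →
      Elim G w (C ∪ D)
  | root {C : Set V} {v : V} : v ∉ C → Elim G w C → (Nb G (insert v C)).ncard ≤ w →
      Elim G w (insert v C)

section Elim

variable {V : Type*} {G : SimpleGraph V} {C S T : Set V} {w : ℕ} {v x : V}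

theorem Elim.exists_order (h : Elim G w C) : ∃ A : V → V → Prop,
    (∀ a b, A a b → a ∈ C ∧ b ∈ C) ∧ (∀ a ∈ C, A a a) ∧ (∀ a b c, A a b → A b c → A a c) ∧
    (∀ a b, A a b → A b a → a = b) ∧ (∀ a b c, A a c → A b c → A a b ∨ A b a) ∧
    (∀ a ∈ C, ∀ b ∈ C, G.Adj a b → A a b ∨ A b a) ∧
    ∀ a ∈ C, (Nb G (reg A a)).ncard ≤ w := by
  induction h with
  | empty => exact ⟨fun _ _ => False, by simp⟩
  | @union C D _ _ hd ht ih1 ih2 =>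
    obtain ⟨A, a1, a2, a3, a4, a5, a6, a7⟩ := ih1
    obtain ⟨B, b1, b2, b3, b4, b5, b6, b7⟩ := ih2
    have hno : ∀ x, x ∈ C → x ∈ D → False := fun x h => Set.disjoint_left.1 hd h
    have hAB : ∀ {a b c : V}, A a b → ∀ {d e : V}, B d e → (a = d ∨ a = e ∨ b = d ∨ b = e) →
        False := by
      intro a b _ h d e h' heq
      have h1 := a1 _ _ h
      have h2 := b1 _ _ h'
      rcases heq with rfl | rfl | rfl | rfl
      · exact hno _ h1.1 h2.1
      · exact hno _ h1.1 h2.2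
      · exact hno _ h1.2 h2.1
      · exact hno _ h1.2 h2.2
    refine ⟨fun a b => A a b ∨ B a b, ?_, ?_, ?_, ?_, ?_, ?_, ?_⟩
    · rintro a b (h | h)
      · exact ⟨Or.inl (a1 _ _ h).1, Or.inl (a1 _ _ h).2⟩
      · exact ⟨Or.inr (b1 _ _ h).1, Or.inr (b1 _ _ h).2⟩
    · rintro a (h | h)
      · exact Or.inl (a2 a h)
      · exact Or.inr (b2 a h)
    · rintro a b c (h | h) (h' | h')
      · exact Or.inl (a3 _ _ _ h h')
      · exact (hAB (c := a) h h' (by simp)).elim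
      · exact (hAB (c := a) h' h (by simp)).elim
      · exact Or.inr (b3 _ _ _ h h')
    · rintro a b (h | h) (h' | h')
      · exact a4 _ _ h h'
      · exact (hAB (c := a) h h' (by simp)).elim
      · exact (hAB (c := a) h' h (by simp)).elim
      · exact b4 _ _ h h'
    · rintro a b c (h | h) (h' | h')
      · exact (a5 _ _ _ h h').imp Or.inl Or.inl
      · exact (hAB (c := a) h h' (by simp)).elim
      · exact (hAB (c := a) h' h (by simp)).elim
      · exact (b5 _ _ _ h h').imp Or.inr Or.inr
    · rintro a (ha | ha) b (hb | hb) hab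
      · exact (a6 a ha b hb hab).imp Or.inl Or.inl
      · exact absurd ⟨a, ha, b, hb, hab⟩ ht
      · exact absurd ⟨b, hb, a, ha, hab.symm⟩ ht
      · exact (b6 a ha b hb hab).imp Or.inr Or.inr
    · rintro a (ha | ha)
      · have : reg (fun a b => A a b ∨ B a b) a = reg A a := by
          ext b
          exact ⟨fun h => h.elim id fun h => (hno a ha (b1 _ _ h).1).elim, Or.inl⟩
        rw [this]
        exact a7 a ha
      · have : reg (fun a b => A a b ∨ B a b) a = reg B a := by
          ext b
          exact ⟨fun h => h.elim (fun h => (hno a (a1 _ _ h).1 ha).elim) id, Or.inr⟩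
        rw [this]
        exact b7 a ha
  | @root C v hv _ hw ih =>
    obtain ⟨A, a1, a2, a3, a4, a5, a6, a7⟩ := ih
    have hv1 : ∀ b, ¬ A v b := fun b h => hv (a1 _ _ h).1
    have hv2 : ∀ b, ¬ A b v := fun b h => hv (a1 _ _ h).2
    refine ⟨fun a b => (a = v ∧ b ∈ insert v C) ∨ A a b, ?_, ?_, ?_, ?_, ?_, ?_, ?_⟩
    · rintro a b (⟨rfl, h⟩ | h)
      · exact ⟨Or.inl rfl, h⟩
      · exact ⟨Or.inr (a1 _ _ h).1, Or.inr (a1 _ _ h).2⟩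
    · rintro a (rfl | h)
      · exact Or.inl ⟨rfl, Or.inl rfl⟩
      · exact Or.inr (a2 a h)
    · rintro a b c (⟨rfl, h⟩ | h) (⟨rfl, h'⟩ | h')
      · exact Or.inl ⟨rfl, h'⟩
      · exact Or.inl ⟨rfl, Or.inr (a1 _ _ h').2⟩
      · exact absurd h (hv2 _)
      · exact Or.inr (a3 _ _ _ h h')
    · rintro a b (⟨rfl, h⟩ | h) (⟨rfl, h'⟩ | h')
      · rfl
      · exact absurd h' (hv2 _)
      · exact absurd h (hv2 _)
      · exact a4 _ _ h h'
    · rintro a b c (⟨rfl, h⟩ | h) (⟨rfl, h'⟩ | h')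
      · exact Or.inl (Or.inl ⟨rfl, Or.inl rfl⟩)
      · exact Or.inl (Or.inl ⟨rfl, Or.inr (a1 _ _ h').1⟩)
      · exact Or.inr (Or.inl ⟨rfl, Or.inr (a1 _ _ h).1⟩)
      · exact (a5 _ _ _ h h').imp Or.inr Or.inr
    · rintro a (rfl | ha) b hb hab
      · exact Or.inl (Or.inl ⟨rfl, hb⟩)
      · rcases hb with rfl | hb
        · exact Or.inr (Or.inl ⟨rfl, Or.inr ha⟩)
        · exact (a6 a ha b hb hab).imp Or.inr Or.inr
    · rintro a (rfl | ha)
      · have : reg (fun x b => (x = a ∧ b ∈ insert a C) ∨ A x b) a = insert a C := by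
          ext b
          exact ⟨fun h => h.elim (fun h => h.2) fun h => (hv1 _ h).elim, fun h => Or.inl ⟨rfl, h⟩⟩
        rw [this]
        exact hw
      · have : reg (fun a b => (a = v ∧ b ∈ insert v C) ∨ A a b) a = reg A a := by
          ext b
          exact ⟨fun h => h.elim (fun h => (hv (h.1 ▸ ha)).elim) id, Or.inr⟩
        rw [this]
        exact a7 a ha

theorem Elim.exists_treeOrd (h : Elim G w Set.univ) :
    ∃ A : V → V → Prop, TreeOrd G A ∧ WidthLE G A w := by
  obtain ⟨A, -, a2, a3, a4, a5, a6, a7⟩ := h.exists_order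
  exact ⟨A, ⟨fun a => a2 a trivial, a3, a4, a5, fun _ _ h =>
    a6 _ trivial _ trivial h⟩, fun a => Or.inl (a7 a trivial)⟩

/-- A set all of whose components can be eliminated can be eliminated. -/
theorem Elim.of_cmpt [Finite V] (h : ∀ v ∈ C, Elim G w (cmpt G C v)) : Elim G w C := by
  have key : ∀ n (D : Set V), D.ncard = n → D ⊆ C → (∀ x ∈ D, cmpt G C x ⊆ D) → Elim G w D := by
    intro n
    induction n using Nat.strong_induction_on with
    | _ n ih =>
      intro D hn hDC hD
      rcases D.eq_empty_or_nonempty with rfl | ⟨x, hx⟩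
      · exact .empty
      have hsub := hD x hx
      rw [← Set.union_sdiff_cancel hsub]
      refine .union (h x (hDC hx)) (ih _ ?_ _ rfl (Set.sdiff_subset.trans hDC) ?_)
        Set.disjoint_sdiff_right ?_
      · rw [← hn]
        exact Set.ncard_lt_ncard ⟨Set.sdiff_subset, fun h => (h hx).2 (mem_cmpt x)⟩ (Set.toFinite _)
      · rintro y ⟨hy, hyx⟩ z hz
        refine ⟨hD y hy hz, fun hzx => hyx ?_⟩
        exact ReachIn.trans hzx (ReachIn.symm hz)
      · rintro ⟨y, hy, z, ⟨hz, hzx⟩, hyz⟩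
        exact hzx (cmpt_closed hy (hDC (hsub hy)) (hDC hz) hyz)
  exact key _ C rfl le_rfl fun x hx => cmpt_subset hx

/-- Eliminating a set by first removing the vertices of `S`. -/
theorem Elim.of_sdiff [Finite V] (hSC : S ⊆ C) (h : Elim G w (C \ S))
    (hw : (Nb G C ∪ S).ncard ≤ w) : Elim G w C := by
  have key : ∀ F : Set V, F ⊆ S → Elim G w (C \ S ∪ F) := by
    intro F
    induction F, Set.toFinite F using Set.Finite.induction_on with
    | empty => intro _; simpa using h
    | @insert x F hx _ ih =>
      intro hF
      rw [Set.union_insert]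
      refine .root ?_ (ih ((Set.subset_insert _ _).trans hF)) (le_trans ?_ hw)
      · rintro (hx' | hx')
        · exact hx'.2 (hF (Or.inl rfl))
        · exact hx hx'
      · refine Set.ncard_le_ncard ?_ (Set.toFinite _)
        rintro y ⟨hy, z, hz, hzy⟩
        by_cases hyS : y ∈ S
        · exact Or.inr hyS
        refine Or.inl ⟨fun hyC => hy (Or.inr (Or.inl ⟨hyC, hyS⟩)), z, ?_, hzy⟩
        rcases hz with rfl | hz | hz
        · exact hSC (hF (Or.inl rfl))
        · exact hz.1
        · exact hSC (hF (Or.inr hz))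
  have := key S le_rfl
  rwa [Set.sdiff_union_of_subset hSC] at this

end Elim

/-! ### Trees of maximum degree three -/

/-- `T` carries a tree in `G`, with degrees `d`, built by adding leaves. -/
inductive Web {V : Type*} [DecidableEq V] (G : SimpleGraph V) : Set V → (V → ℕ) → Prop
  | single (v : V) : Web G {v} fun _ => 0
  | leaf {T : Set V} {d : V → ℕ} {x v : V} : Web G T d → x ∈ T → v ∉ T → G.Adj x v →
      Web G (insert v T) (Function.update (Function.update d x (d x + 1)) v 1)

section Web

variable {V : Type*} [DecidableEq V] {G : SimpleGraph V} {S T X : Set V} {d : V → ℕ} {v x : V}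

/-- Connected bags on a tree of maximum degree three can be grouped into many connected sets,
each with many elements of `X`. -/
theorem Web.split_bags [Finite V] (h : Web G T d) (X : Set V) (m : ℕ) (hd : ∀ v ∈ T, d v ≤ 3)
    (B : V → Set V) (hB : ∀ v ∈ T, Conn G (B v)) (hv : ∀ v ∈ T, v ∈ B v)
    (hdis : ∀ v ∈ T, ∀ w ∈ T, v ≠ w → Disjoint (B v) (B w))
    (hX : ∀ v ∈ T, (B v ∩ X).ncard + d v * m ≤ 1 + 3 * m) :
    ∃ (n : ℕ) (P : ℕ → Set V), (∀ i < n, Conn G (P i) ∧ m ≤ (P i ∩ X).ncard ∧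
      P i ⊆ ⋃ v ∈ T, B v) ∧ (∀ i < n, ∀ j < n, i ≠ j → Disjoint (P i) (P j)) ∧
      ((⋃ v ∈ T, B v) ∩ X).ncard ≤ (n + 1) * (1 + 3 * m) := by
  induction h generalizing B with
  | single v =>
    refine ⟨0, fun _ => ∅, by simp, by simp, ?_⟩
    have := hX v rfl
    simp only [Set.mem_singleton_iff, Set.iUnion_iUnion_eq_left]
    omega
  | @leaf T d x v hT hx hvT hxv ih =>
    have hxne : x ≠ v := fun h => hvT (h ▸ hx)
    have hTne : ∀ u ∈ T, u ≠ v := fun u hu h => hvT (h ▸ hu)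
    have hdx : d x + 1 ≤ 3 := by
      have := hd x (Or.inr hx)
      rwa [Function.update_of_ne hxne, Function.update_self] at this
    have hdu : ∀ u ∈ T, d u ≤ (Function.update (Function.update d x (d x + 1)) v 1) u := by
      intro u hu
      rw [Function.update_of_ne (hTne u hu)]
      by_cases hux : u = x
      · subst hux
        simp
      · rw [Function.update_of_ne hux]
    have hd' : ∀ u ∈ T, d u ≤ 3 := fun u hu => (hdu u hu).trans (hd u (Or.inr hu))
    have hXv := hX v (Or.inl rfl)
    rw [Function.update_self] at hXv
    have hXx := hX x (Or.inr hx)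
    rw [Function.update_of_ne hxne, Function.update_self] at hXx
    have hX' : ∀ u ∈ T, (B u ∩ X).ncard + d u * m ≤ 1 + 3 * m := fun u hu =>
      (Nat.add_le_add_left (Nat.mul_le_mul_right m (hdu u hu)) _).trans (hX u (Or.inr hu))
    by_cases hm : m ≤ (B v ∩ X).ncard
    · obtain ⟨n, P, hP, hPd, hn⟩ := ih hd' B (fun u hu => hB u (Or.inr hu))
        (fun u hu => hv u (Or.inr hu)) (fun u hu w hw => hdis u (Or.inr hu) w (Or.inr hw)) hX'
      have hvd : ∀ i < n, Disjoint (P i) (B v) := fun i hi => by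
        refine Set.disjoint_left.2 fun z hz hzv => ?_
        obtain ⟨u, hu, hzu⟩ := Set.mem_iUnion₂.1 ((hP i hi).2.2 hz)
        exact Set.disjoint_left.1 (hdis u (Or.inr hu) v (Or.inl rfl) (hTne u hu)) hzu hzv
      refine ⟨n + 1, fun i => if i < n then P i else B v, ?_, ?_, ?_⟩
      · intro i hi
        dsimp only
        split_ifs with hin
        · refine ⟨(hP i hin).1, (hP i hin).2.1, (hP i hin).2.2.trans ?_⟩
          exact Set.biUnion_subset_biUnion_left (Set.subset_insert _ _)
        · exact ⟨hB v (Or.inl rfl), hm, Set.subset_biUnion_of_mem (u := B) (Set.mem_insert v T)⟩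
      · intro i hi j hj hij
        dsimp only
        split_ifs with h1 h2 h2
        · exact hPd i h1 j h2 hij
        · exact hvd i h1
        · exact (hvd j h2).symm
        · omega
      · rw [Set.biUnion_insert, Set.union_inter_distrib_right]
        refine (Set.ncard_union_le _ _).trans ?_
        calc _ ≤ (1 + 3 * m) + (n + 1) * (1 + 3 * m) := by omega
          _ = _ := by ring
    · set B' := Function.update B x (B x ∪ B v) with hB'
      have hBx : B' x = B x ∪ B v := Function.update_self ..
      have hBu : ∀ u, u ≠ x → B' u = B u := fun u hu => Function.update_of_ne hu ..
      have hU : (⋃ u ∈ T, B' u) = ⋃ u ∈ insert v T, B u := by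
        ext z
        simp only [Set.mem_iUnion₂]
        constructor
        · rintro ⟨u, hu, hz⟩
          by_cases hux : u = x
          · subst hux
            rw [hBx] at hz
            exact hz.elim (fun h => ⟨u, Or.inr hu, h⟩) fun h => ⟨v, Or.inl rfl, h⟩
          · exact ⟨u, Or.inr hu, hBu u hux ▸ hz⟩
        · rintro ⟨u, rfl | hu, hz⟩
          · exact ⟨x, hx, hBx ▸ Or.inr hz⟩
          · by_cases hux : u = x
            · subst hux
              exact ⟨u, hu, hBx ▸ Or.inl hz⟩
            · exact ⟨u, hu, (hBu u hux).symm ▸ hz⟩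
      have hdx' : ∀ u ∈ T, u ≠ x → Disjoint (B x ∪ B v) (B u) := fun u hu hux =>
        Set.disjoint_union_left.2 ⟨hdis x (Or.inr hx) u (Or.inr hu) hux.symm,
          hdis v (Or.inl rfl) u (Or.inr hu) (hTne u hu).symm⟩
      rw [← hU]
      refine ih hd' B' ?_ ?_ ?_ ?_
      · intro u hu
        by_cases hux : u = x
        · subst hux
          rw [hBx]
          exact (hB u (Or.inr hu)).union_touch (hB v (Or.inl rfl))
            ⟨u, hv u (Or.inr hu), v, hv v (Or.inl rfl), hxv⟩
        · rw [hBu u hux]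
          exact hB u (Or.inr hu)
      · intro u hu
        by_cases hux : u = x
        · subst hux
          rw [hBx]
          exact Or.inl (hv u (Or.inr hu))
        · rw [hBu u hux]
          exact hv u (Or.inr hu)
      · intro u hu w hw huw
        by_cases hux : u = x
        · subst hux
          rw [hBx, hBu w huw.symm]
          exact hdx' w hw huw.symm
        · by_cases hwx : w = x
          · subst hwx
            rw [hBx, hBu u hux]
            exact (hdx' u hu hux).symm
          · rw [hBu u hux, hBu w hwx]
            exact hdis u (Or.inr hu) w (Or.inr hw) huw
      · intro u hu
        by_cases hux : u = x
        · subst hux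
          rw [hBx, Set.union_inter_distrib_right]
          have := Set.ncard_union_le (B u ∩ X) (B v ∩ X)
          have h3 : (d u + 1) * m = d u * m + m := by ring
          omega
        · rw [hBu u hux]
          exact hX' u hu

theorem Web.split [Finite V] (h : Web G T d) (hd : ∀ v ∈ T, d v ≤ 3) (hXT : X ⊆ T) (m c : ℕ)
    (hc : (c + 1) * (1 + 3 * m) ≤ X.ncard) :
    ∃ P : Fin c → Set V, (∀ i, Conn G (P i) ∧ m ≤ (P i ∩ X).ncard ∧ P i ⊆ T) ∧
      ∀ i j, i ≠ j → Disjoint (P i) (P j) := by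
  obtain ⟨n, P, hP, hPd, hn⟩ := h.split_bags X m hd (fun v => {v}) (fun v _ => conn_singleton v)
    (fun v _ => rfl) (fun v _ w _ hvw => by simpa using hvw) (fun v hv => by
      have h1 : ({v} ∩ X : Set V).ncard ≤ 1 :=
        (Set.ncard_le_ncard Set.inter_subset_left).trans (Set.ncard_singleton v).le
      have := Nat.mul_le_mul_right m (hd v hv)
      omega)
  simp only [Set.biUnion_of_singleton] at hP hn
  rw [Set.inter_eq_right.2 hXT] at hn
  have hcn : c ≤ n := by
    have := Nat.le_of_mul_le_mul_right (hc.trans hn) (by omega)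
    omega
  exact ⟨fun i => P i, fun i => hP i (by omega), fun i j hij =>
    hPd i (by omega) j (by omega) (by omega)⟩

theorem Web.attach_path (h : Web G T d) {p : ℕ → V} {l : ℕ} (hp : IsPathIn G S p l)
    (h0 : p 0 ∈ T) (hT : ∀ i, 1 ≤ i → i ≤ l → p i ∉ T) (hl : 1 ≤ l) :
    ∃ d', Web G (T ∪ p '' Set.Icc 1 l) d' ∧ (∀ v ∈ T, v ≠ p 0 → d' v = d v) ∧
      d' (p 0) = d (p 0) + 1 ∧ d' (p l) = 1 ∧ ∀ i, 1 ≤ i → i ≤ l → d' (p i) ≤ 2 := by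
  induction l, hl using Nat.le_induction with
  | base =>
    have h1 := hT 1 le_rfl le_rfl
    have hne : p 0 ≠ p 1 := fun h => h1 (h ▸ h0)
    refine ⟨Function.update (Function.update d (p 0) (d (p 0) + 1)) (p 1) 1, ?_, ?_, ?_, ?_, ?_⟩
    · rw [Set.Icc_self, Set.image_singleton, Set.union_singleton]
      exact h.leaf h0 h1 (hp.adj 0 (by omega))
    · intro v hv hv0
      have hv1 : v ≠ p 1 := fun h => h1 (h ▸ hv)
      rw [Function.update_of_ne hv1, Function.update_of_ne hv0]
    · rw [Function.update_of_ne hne, Function.update_self]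
    · rw [Function.update_self]
    · intro i hi hi'
      obtain rfl : i = 1 := by omega
      rw [Function.update_self]
      omega
  | succ l hl ih =>
    obtain ⟨d', hW, h1, h2, h3, h4⟩ := ih
      ⟨fun i hi => hp.adj i (by omega), fun i hi => hp.mem i (by omega),
        fun i hi j hj => hp.inj i (by omega) j (by omega)⟩ fun i hi hi' => hT i hi (by omega)
    have hlast : ∀ i ≤ l, p i ≠ p (l + 1) := fun i hi h => by
      have := hp.inj i (by omega) (l + 1) le_rfl h
      omega
    have hnew : p (l + 1) ∉ T ∪ p '' Set.Icc 1 l := by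
      rintro (h | ⟨i, hi, h⟩)
      · exact hT _ (by omega) le_rfl h
      · exact hlast i hi.2 h
    have hadj := hp.adj l (by omega)
    have hset : T ∪ p '' Set.Icc 1 (l + 1) = insert (p (l + 1)) (T ∪ p '' Set.Icc 1 l) := by
      rw [← Set.union_insert, ← Set.image_insert_eq]
      congr 2
      ext i
      simp only [Set.mem_Icc, Set.mem_insert_iff]
      omega
    have hpl0 : p 0 ≠ p l := fun h => by
      have := hp.inj 0 (by omega) l (by omega) h
      omega
    refine ⟨_, hset ▸ hW.leaf (Or.inr ⟨l, ⟨hl, le_rfl⟩, rfl⟩) hnew hadj, ?_, ?_, ?_, ?_⟩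
    · intro v hv hv0
      have hv1 : v ≠ p (l + 1) := fun h => hT _ (by omega) le_rfl (h ▸ hv)
      have hv2 : v ≠ p l := fun h => hT l hl (by omega) (h ▸ hv)
      rw [Function.update_of_ne hv1, Function.update_of_ne hv2, h1 v hv hv0]
    · rw [Function.update_of_ne (hlast 0 (by omega)), Function.update_of_ne hpl0, h2]
    · rw [Function.update_self]
    · intro i hi hi'
      by_cases hil : i = l + 1
      · subst hil
        rw [Function.update_self]
        omega
      · rw [Function.update_of_ne (hlast i (by omega))]
        by_cases hil' : i = l
        · subst hil'
          rw [Function.update_self, h3]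
        · have hne : p i ≠ p l := fun h => hil' (hp.inj i (by omega) l (by omega) h)
          rw [Function.update_of_ne hne]
          exact h4 i hi (by omega)

/-- Attaching disjoint paths at distinct vertices. -/
theorem Web.attach_paths [Finite V] (h : Web G T d) (F : Set V) (p : V → ℕ → V) (l : V → ℕ)
    (hp : ∀ s ∈ F, IsPathIn G Set.univ (p s) (l s) ∧ p s 0 ∈ T ∧
      (∀ i, 1 ≤ i → i ≤ l s → p s i ∉ T) ∧ 1 ≤ l s)
    (hdis : ∀ s ∈ F, ∀ t ∈ F, s ≠ t →
      Disjoint (p s '' Set.Icc 0 (l s)) (p t '' Set.Icc 0 (l t))) :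
    ∃ d', Web G (T ∪ ⋃ s ∈ F, p s '' Set.Icc 1 (l s)) d' ∧
      (∀ v ∈ T, (∀ s ∈ F, v ≠ p s 0) → d' v = d v) ∧ (∀ v ∈ T, d' v ≤ d v + 1) ∧
      (∀ s ∈ F, d' (p s (l s)) = 1) ∧ ∀ s ∈ F, ∀ i, 1 ≤ i → i ≤ l s → d' (p s i) ≤ 2 := by
  induction F, Set.toFinite F using Set.Finite.induction_on with
  | empty => exact ⟨d, by simpa using h, by simp⟩
  | @insert s F hs _ ih =>
    obtain ⟨d₁, hW, h1, h2, h3, h4⟩ := ih (fun t ht => hp t (Or.inr ht))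
      fun t ht t' ht' => hdis t (Or.inr ht) t' (Or.inr ht')
    obtain ⟨hps, hs0, hsT, hsl⟩ := hp s (Or.inl rfl)
    have hsF : ∀ t ∈ F, ∀ i ≤ l s, ∀ j ≤ l t, p s i ≠ p t j := fun t ht i hi j hj h =>
      Set.disjoint_left.1 (hdis s (Or.inl rfl) t (Or.inr ht) fun h => hs (h ▸ ht))
        ⟨i, by simpa using hi, rfl⟩ ⟨j, by simpa using hj, h.symm⟩
    obtain ⟨d₂, hW2, g1, g2, g3, g4⟩ := hW.attach_path hps (Or.inl hs0) (by
      intro i hi hi' hmem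
      rcases hmem with hmem | hmem
      · exact hsT i hi hi' hmem
      · obtain ⟨t, ht, j, hj, hij⟩ := Set.mem_iUnion₂.1 hmem
        exact hsF t ht i hi' j hj.2 hij.symm) hsl
    have hd₁ : d₁ (p s 0) = d (p s 0) := h1 _ hs0 fun t ht => hsF t ht 0 (by omega) 0 (by omega)
    refine ⟨d₂, ?_, ?_, ?_, ?_, ?_⟩
    · rw [Set.biUnion_insert, Set.union_comm (p s '' _), ← Set.union_assoc]
      exact hW2
    · intro v hv hvs
      rw [g1 v (Or.inl hv) (hvs s (Or.inl rfl)), h1 v hv fun t ht => hvs t (Or.inr ht)]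
    · intro v hv
      by_cases hvs : v = p s 0
      · rw [hvs, g2, hd₁]
      · rw [g1 v (Or.inl hv) hvs]
        exact h2 v hv
    · rintro t (rfl | ht)
      · exact g3
      · rw [g1 _ (Or.inr (Set.mem_iUnion₂.2 ⟨t, ht, l t, ⟨(hp t (Or.inr ht)).2.2.2, le_rfl⟩, rfl⟩))
          (hsF t ht 0 (by omega) _ le_rfl).symm]
        exact h3 t ht
    · rintro t (rfl | ht) i hi hi'
      · exact g4 i hi hi'
      · rw [g1 _ (Or.inr (Set.mem_iUnion₂.2 ⟨t, ht, i, ⟨hi, hi'⟩, rfl⟩))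
          (hsF t ht 0 (by omega) _ hi').symm]
        exact h4 t ht i hi hi'

end Web

/-! ### Meshes -/

/-- Disjoint connected sets `T i` pairwise joined by `k` disjoint connections through `C`. -/
structure Mesh {V : Type*} (G : SimpleGraph V) (c k : ℕ) (C : Set V) (T : Fin c → Set V) :
    Prop where
  conn : ∀ i, Conn G (T i)
  disj : ∀ i j, i ≠ j → Disjoint (T i) (T j)
  off : ∀ i, Disjoint (T i) C
  link : ∀ i j, i ≠ j → ∃ D : Fin k → Set V, (∀ a, Conn G (D a) ∧ D a ⊆ C ∧
    Touch G (D a) (T i) ∧ Touch G (D a) (T j)) ∧ ∀ a b, a ≠ b → Disjoint (D a) (D b)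

/-- The edges of `G` inside `C ∪ Y` with an end in `C`. -/
def hullGraph {V : Type*} (G : SimpleGraph V) (C Y : Set V) : SimpleGraph V where
  Adj a b := G.Adj a b ∧ a ∈ C ∪ Y ∧ b ∈ C ∪ Y ∧ (a ∈ C ∨ b ∈ C)
  symm := ⟨fun _ _ h => ⟨h.1.symm, h.2.2.1, h.2.1, h.2.2.2.symm⟩⟩
  loopless := ⟨fun a h => G.loopless.irrefl a h.1⟩

section Mesh

variable {V : Type*} {G G' : SimpleGraph V} {C S T X Y Z : Set V} {u v : V} {k : ℕ}

theorem hullGraph_le : hullGraph G C Y ≤ G := fun _ _ h => h.1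

theorem Conn.of_adj (h : Conn G S) (hG : ∀ x ∈ S, ∀ y ∈ S, G.Adj x y → G'.Adj x y) :
    Conn G' S :=
  ⟨h.1, fun a ha b hb => Relation.ReflTransGen.mono
    (p := fun x y => G'.Adj x y ∧ x ∈ S ∧ y ∈ S)
    (fun x y hxy => ⟨hG x hxy.2.1 y hxy.2.2 hxy.1, hxy.2⟩) _ _ (h.2 a ha b hb)⟩

/-- Neighbours of a component of `C \ S` lie in `S` or are neighbours of `C`. -/
theorem mem_Nb_cmpt (hu : u ∈ C \ S) {y : V} (hy : y ∈ Nb G (cmpt G (C \ S) u)) :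
    (y ∈ C ∧ y ∈ S) ∨ y ∈ Nb G C := by
  obtain ⟨hy, z, hz, hzy⟩ := hy
  have hzC := cmpt_subset hu hz
  by_cases hyC : y ∈ C
  · refine Or.inl ⟨hyC, ?_⟩
    by_contra hyS
    exact hy (cmpt_closed hz hzC ⟨hyC, hyS⟩ hzy)
  · exact Or.inr ⟨hyC, z, hzC.1, hzy⟩

theorem Conn.exists_mem_Nb_cmpt (hC : Conn G C) (hu : u ∈ C \ S) (hS : (C ∩ S).Nonempty) :
    ∃ s ∈ C, s ∈ S ∧ s ∈ Nb G (cmpt G (C \ S) u) := by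
  obtain ⟨s, hsC, hsS⟩ := hS
  obtain ⟨x, -, hx, y, hyC, hy, hxy⟩ := hC.exists_crossing (T := cmpt G (C \ S) u)
    ⟨u, hu.1, mem_cmpt u⟩ fun h => (cmpt_subset hu (h hsC)).2 hsS
  refine ⟨y, hyC, ?_, hy, x, hx, hxy⟩
  by_contra hyS
  exact hy (cmpt_closed hx (cmpt_subset hu hx) ⟨hyC, hyS⟩ hxy)

theorem ncard_cmpt_lt [Finite V] (hu : u ∈ C \ S) (hS : (C ∩ S).Nonempty) :
    (cmpt G (C \ S) u).ncard < C.ncard := by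
  obtain ⟨s, hsC, hsS⟩ := hS
  exact Set.ncard_lt_ncard ⟨(cmpt_subset hu).trans Set.sdiff_subset,
    fun h => (cmpt_subset hu (h hsC)).2 hsS⟩ (Set.toFinite _)

theorem Linked.exists_through (h : Linked (hullGraph G C (Y ∪ Z)) Y Z k) (hYC : Disjoint Y C)
    (hZC : Disjoint Z C) (hYZ : Disjoint Y Z) :
    ∃ D : Fin k → Set V, (∀ a, Conn G (D a) ∧ D a ⊆ C ∧ Touch G (D a) Y ∧ Touch G (D a) Z) ∧
      ∀ a b, a ≠ b → Disjoint (D a) (D b) := by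
  obtain ⟨P, h1, h2, h3⟩ := h
  have key : ∀ i, ∃ D ⊆ P i, Conn G D ∧ D ⊆ C ∧ Touch G D Y ∧ Touch G D Z := by
    intro i
    obtain ⟨p, l, hp, h0, hl, hY, hZ, -⟩ := (h1 i).exists_path (h3 i).1 (h3 i).2
    have hl0 : l ≠ 0 := fun h => Set.disjoint_left.1 hYZ h0 (h ▸ hl)
    have hmid : ∀ i, 1 ≤ i → i < l → p i ∈ C := fun i hi hil => by
      rcases (hp.adj i hil).2.1 with h | h | h
      · exact h
      · have := hY i hil.le h
        omega
      · have := hZ i hil.le h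
        omega
    have hl1 : l ≠ 1 := fun h => by
      subst h
      rcases (hp.adj 0 (by omega)).2.2.2 with h | h
      · exact Set.disjoint_left.1 hYC h0 h
      · exact Set.disjoint_left.1 hZC hl h
    have hlast := hp.adj (l - 1) (by omega)
    rw [show l - 1 + 1 = l by omega] at hlast
    refine ⟨p '' Set.Icc 1 (l - 1), hp.seg_subset (by omega),
      (hp.conn_seg (by omega) (by omega)).mono_graph hullGraph_le, ?_,
      ⟨p 1, ⟨1, ⟨le_rfl, by omega⟩, rfl⟩, p 0, h0, (hp.adj 0 (by omega)).1.symm⟩,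
      ⟨p (l - 1), ⟨l - 1, ⟨by omega, le_rfl⟩, rfl⟩, p l, hl, hlast.1⟩⟩
    rintro _ ⟨j, ⟨hj, hj'⟩, rfl⟩
    exact hmid j hj (by omega)
  choose D hD hD' using key
  exact ⟨D, hD', fun a b hab => (h2 a b hab).mono (hD a) (hD b)⟩

/-- Extending a web along a linkage from `Y` to a separator, for a component not adjacent to
`Y \ S`. -/
theorem Web.extend_side [Finite V] [DecidableEq V] {d : V → ℕ} {h : ℕ} (hC : Conn G C)
    (hT : Web G T d) (hd : ∀ v ∈ T, d v ≤ 3) (hTC : Disjoint T C) (hXT : Nb G C ⊆ T)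
    (hd2 : ∀ x ∈ Nb G C, d x ≤ 2) (hX : (Nb G C).ncard ≤ h) (hY : Y ⊆ Nb G C)
    (hSep : Separates (hullGraph G C (Y ∪ Z)) Y Z S)
    (hL : Linked (hullGraph G C (Y ∪ Z)) Y Z S.ncard) (hSY : S.ncard < Y.ncard)
    (hu : u ∈ C \ S) (hside : ¬ Touch G (cmpt G (C \ S) u) (Y \ S)) :
    (C ∩ S).Nonempty ∧ ∃ T' d', Web G T' d' ∧ (∀ v ∈ T', d' v ≤ 3) ∧
      Disjoint T' (cmpt G (C \ S) u) ∧ Nb G (cmpt G (C \ S) u) ⊆ T' ∧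
      (∀ x ∈ Nb G (cmpt G (C \ S) u), d' x ≤ 2) ∧ (∃ x ∈ Nb G (cmpt G (C \ S) u), d' x ≤ 1) ∧
      (Nb G (cmpt G (C \ S) u)).ncard ≤ h := by
  set K := cmpt G (C \ S) u with hK
  have hYC : ∀ y ∈ Y, y ∉ C := fun y hy => (hY hy).1
  have hCS : (C ∩ S).Nonempty := by
    by_contra hne
    have hCS' : C \ S = C := by
      rw [sdiff_eq_left, Set.disjoint_iff_inter_eq_empty]
      exact Set.not_nonempty_iff_eq_empty.1 hne
    obtain ⟨y, hy, hyS⟩ : ∃ y ∈ Y, y ∉ S := Set.exists_mem_notMem_of_ncard_lt_ncard hSY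
    obtain ⟨-, z, hz, hzy⟩ := hY hy
    refine hside ⟨z, ?_, y, ⟨hy, hyS⟩, hzy⟩
    rw [hK, hCS']
    exact hC.subset_cmpt_self le_rfl hu.1 hz
  refine ⟨hCS, ?_⟩
  have hYS : Linked (hullGraph G C (Y ∪ Z)) Y S S.ncard := by
    obtain ⟨P, h1, h2, h3⟩ := hL
    exact ⟨P, h1, h2, fun i => ⟨(h3 i).1, hSep _ (h1 i) (h3 i).1 (h3 i).2⟩⟩
  obtain ⟨P, hP, hPd⟩ := hYS.exists_onto rfl
  have hpath : ∀ s, ∃ (p : ℕ → V) (l : ℕ), s ∈ C ∩ S → IsPathIn G (P s) p l ∧ p 0 ∈ Y ∧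
      p 0 ∉ S ∧ p l = s ∧ 1 ≤ l ∧ ∀ i, 1 ≤ i → i ≤ l → p i ∈ C ∧ (i < l → p i ∉ S) := by
    intro s
    by_cases hs : s ∈ C ∩ S
    · obtain ⟨hPc, hPS, hPY, hPo⟩ := hP s hs.2
      have hsP : s ∈ P s := (hPS.symm.subset rfl).1
      obtain ⟨p, l, hp, h0, hl, hY', hs', -⟩ := hPc.exists_path hPY (B := {s}) ⟨s, hsP, rfl⟩
      have hl1 : 1 ≤ l := by
        by_contra hl0
        obtain rfl : l = 0 := by omega
        exact hYC _ h0 ((show p 0 = s from hl) ▸ hs.1)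
      have hnotS : ∀ i < l, p i ∉ S := fun i hi hiS => by
        have : p i ∈ P s ∩ S := ⟨hp.mem i hi.le, hiS⟩
        rw [hPS] at this
        have := hs' i hi.le this
        omega
      refine ⟨p, l, fun _ => ⟨hp.mono hullGraph_le le_rfl, h0, hnotS 0 (by omega), hl, hl1,
        fun i hi hil => ⟨?_, hnotS i⟩⟩⟩
      by_cases hil' : i = l
      · rw [hil', show p l = s from hl]
        exact hs.1
      have hil2 : i < l := by omega
      rcases (hp.adj i hil2).2.1 with h | h | h
      · exact h
      · have := hY' i hil h
        omega
      · have hne : p i ≠ s := fun h => hnotS i hil2 (h ▸ hs.2)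
        refine absurd ?_ (hSep.not_onSide (hPo (p i) (hp.mem i hil) hne))
        exact ⟨{p i}, conn_singleton _, by simpa using hnotS i hil2, rfl, p i, rfl, h⟩
    · exact ⟨fun _ => s, 0, fun h => absurd h hs⟩
  choose p l hpl using hpath
  obtain ⟨d', hW, w1, w2, w3, w4⟩ := hT.attach_paths (C ∩ S) p l
    (fun s hs => by
      obtain ⟨h1, h2, h3, h4, h5, h6⟩ := hpl s hs
      exact ⟨h1.mono le_rfl (Set.subset_univ _), hXT (hY h2),
        fun i hi hi' hiT => Set.disjoint_left.1 hTC hiT (h6 i hi hi').1, h5⟩)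
    (fun s hs t ht hst => (hPd s hs.2 t ht.2 hst).mono ((hpl s hs).1.seg_subset le_rfl)
      ((hpl t ht).1.seg_subset le_rfl))
  have hKC : ∀ x ∈ K, x ∈ C \ S := fun x hx => cmpt_subset hu hx
  have hNb : ∀ y ∈ Nb G K, (y ∈ C ∧ y ∈ S) ∨ (y ∈ Nb G C ∧ (y ∈ Y → y ∈ S)) := by
    intro y hy
    rcases mem_Nb_cmpt hu hy with h | h
    · exact Or.inl h
    · refine Or.inr ⟨h, fun hyY => ?_⟩
      by_contra hyS
      obtain ⟨-, z, hz, hzy⟩ := hy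
      exact hside ⟨z, hz, y, ⟨hyY, hyS⟩, hzy⟩
  refine ⟨_, d', hW, ?_, ?_, ?_, ?_, ?_, ?_⟩
  · rintro v (hv | hv)
    · by_cases hs : ∃ s ∈ C ∩ S, v = p s 0
      · obtain ⟨s, hs, rfl⟩ := hs
        have := hd2 _ (hY (hpl s hs).2.1)
        have := w2 _ hv
        omega
      · push Not at hs
        rw [w1 v hv hs]
        exact hd v hv
    · obtain ⟨s, hs, i, hi, rfl⟩ := Set.mem_iUnion₂.1 hv
      exact (w4 s hs i hi.1 hi.2).trans (by omega)
  · rw [Set.disjoint_left]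
    rintro v (hv | hv) hvK
    · exact Set.disjoint_left.1 hTC hv (hKC v hvK).1
    · obtain ⟨s, hs, i, hi, rfl⟩ := Set.mem_iUnion₂.1 hv
      obtain ⟨h1, h2, h3, h4, h5, h6⟩ := hpl s hs
      have hil : i < l s := by
        refine lt_of_le_of_ne hi.2 fun h => ?_
        rw [h, h4] at hvK
        exact (hKC s hvK).2 hs.2
      have hseg : p s '' Set.Icc 1 i ⊆ C \ S := by
        rintro _ ⟨j, hj, rfl⟩
        have hj1 := hj.1
        have hj2 := hj.2
        have := h6 j hj1 (by omega)
        exact ⟨this.1, this.2 (by omega)⟩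
      have hsub : p s '' Set.Icc 1 i ⊆ K :=
        (h1.conn_seg hi.1 hi.2).subset_cmpt hseg ⟨i, ⟨hi.1, le_rfl⟩, rfl⟩ hvK
      exact hside ⟨p s 1, hsub ⟨1, ⟨le_rfl, hi.1⟩, rfl⟩, p s 0, ⟨h2, h3⟩,
        (h1.adj 0 (by omega)).symm⟩
  · intro y hy
    rcases hNb y hy with h | h
    · refine Or.inr (Set.mem_iUnion₂.2 ⟨y, h, l y, ⟨(hpl y h).2.2.2.2.1, le_rfl⟩, ?_⟩)
      exact (hpl y h).2.2.2.1
    · exact Or.inl (hXT h.1)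
  · intro y hy
    rcases hNb y hy with h | h
    · have := w3 y h
      rw [(hpl y h).2.2.2.1] at this
      omega
    · rw [w1 y (hXT h.1) fun s hs hys => ?_]
      · exact hd2 y h.1
      · have h2 := hpl s hs
        exact h2.2.2.1 (hys ▸ h.2 (hys ▸ h2.2.1))
  · obtain ⟨s, hsC, hsS, hs⟩ := hC.exists_mem_Nb_cmpt hu hCS
    have := w3 s ⟨hsC, hsS⟩
    rw [(hpl s ⟨hsC, hsS⟩).2.2.2.1] at this
    exact ⟨s, hs, this.le⟩
  · have hsub : Nb G K ⊆ (Nb G C \ Y) ∪ S := by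
      intro y hy
      rcases hNb y hy with h | h
      · exact Or.inr h.2
      · by_cases hyY : y ∈ Y
        · exact Or.inr (h.2 hyY)
        · exact Or.inl ⟨h.1, hyY⟩
    have h1 := Set.ncard_le_ncard hsub (Set.toFinite _)
    have h2 := Set.ncard_union_le (Nb G C \ Y) S
    have h3 := Set.ncard_sdiff_add_ncard_of_subset hY (Set.toFinite _)
    omega

theorem exists_min_separator [Finite V] {A B : Set V} (h : ¬ Linked G A B k) :
    ∃ S, Separates G A B S ∧ S.ncard < k ∧ Linked G A B S.ncard := by
  have hex : ∃ n S, Separates G A B S ∧ S.ncard = n := ⟨_, B, fun P _ _ h => h, rfl⟩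
  classical
  obtain ⟨S, hS, hn⟩ := Nat.find_spec hex
  have hL : Linked G A B S.ncard := linked_of_separates _ _ _ _ fun S' hS' => by
    rw [hn]
    exact Nat.find_min' hex ⟨S', hS', rfl⟩
  refine ⟨S, hS, ?_, hL⟩
  by_contra hlt
  exact h (hL.mono_right (by omega))

theorem elim_of_web [Finite V] [DecidableEq V] {c h : ℕ} (hh : (c + 1) * (1 + 3 * k) ≤ h)
    (hM : ¬ ∃ C T, Mesh G c k C T) (C T : Set V) (d : V → ℕ) (hC : Conn G C) (hT : Web G T d)
    (hd : ∀ v ∈ T, d v ≤ 3) (hTC : Disjoint T C) (hXT : Nb G C ⊆ T)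
    (hd2 : ∀ x ∈ Nb G C, d x ≤ 2) (hd1 : ∃ x ∈ Nb G C, d x ≤ 1) (hX : (Nb G C).ncard ≤ h) :
    Elim G (h + k) C := by
  induction hn : C.ncard using Nat.strong_induction_on generalizing C T d with
  | _ n ih =>
    subst hn
    by_cases hlt : (Nb G C).ncard < h
    · obtain ⟨x, hx, hdx⟩ := hd1
      obtain ⟨hxC, v, hvC, hvx⟩ := id hx
      have hvT : v ∉ T := fun h => Set.disjoint_left.1 hTC h hvC
      have hW := hT.leaf (hXT hx) hvT hvx.symm
      have hxv : x ≠ v := fun h => hxC (h ▸ hvC)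
      have hd' : ∀ y ∈ T, (Function.update (Function.update d x (d x + 1)) v 1) y ≤ 2 ∨
          (Function.update (Function.update d x (d x + 1)) v 1) y = d y := by
        intro y hy
        have hyv : y ≠ v := fun h => hvT (h ▸ hy)
        rw [Function.update_of_ne hyv]
        by_cases hyx : y = x
        · subst hyx
          rw [Function.update_self]
          omega
        · rw [Function.update_of_ne hyx]
          exact Or.inr rfl
      refine Elim.of_sdiff (S := {v}) (by simpa using hvC) (Elim.of_cmpt fun u hu => ?_) ?_
      · have hCv : (C ∩ {v}).Nonempty := ⟨v, hvC, rfl⟩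
        have hsub : Nb G (cmpt G (C \ {v}) u) ⊆ insert v (Nb G C) := fun y hy =>
          (mem_Nb_cmpt hu hy).imp (fun h => h.2) id
        refine ih _ (ncard_cmpt_lt hu hCv) _ _ _ (cmpt_conn u) hW ?_ ?_ ?_ ?_ ?_ ?_ rfl
        · rintro y (rfl | hy)
          · rw [Function.update_self]
            omega
          · have := hd y hy
            rcases hd' y hy with h | h <;> omega
        · rw [Set.disjoint_left]
          rintro y (rfl | hy) hyK
          · exact (cmpt_subset hu hyK).2 rfl
          · exact Set.disjoint_left.1 hTC hy (cmpt_subset hu hyK).1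
        · exact hsub.trans (Set.insert_subset_insert hXT)
        · intro y hy
          rcases hsub hy with rfl | hy
          · rw [Function.update_self]
            omega
          · have := hd2 y hy
            rcases hd' y (hXT hy) with h | h <;> omega
        · obtain ⟨s, -, rfl, hs⟩ := hC.exists_mem_Nb_cmpt hu hCv
          exact ⟨s, hs, by rw [Function.update_self]⟩
        · have h1 := Set.ncard_le_ncard hsub (Set.toFinite _)
          have h2 := Set.ncard_insert_le v (Nb G C)
          omega
      · have h1 := Set.ncard_union_le (Nb G C) {v}
        have h2 := Set.ncard_singleton v
        have h3 : 1 ≤ h + k - (Nb G C).ncard := by omega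
        omega
    · obtain ⟨P, hP, hPd⟩ := hT.split hd hXT k c (by omega)
      by_cases hall : ∀ Y Z, Y ⊆ Nb G C → Z ⊆ Nb G C → Y.ncard = k → Z.ncard = k →
          Disjoint Y Z → Linked (hullGraph G C (Y ∪ Z)) Y Z k
      · refine absurd ⟨C, P, ⟨fun i => (hP i).1, hPd,
          fun i => hTC.mono_left (hP i).2.2, fun i j hij => ?_⟩⟩ hM
        obtain ⟨Y, hY, hYk⟩ := Set.exists_subset_card_eq (hP i).2.1
        obtain ⟨Z, hZ, hZk⟩ := Set.exists_subset_card_eq (hP j).2.1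
        have hYX := hY.trans Set.inter_subset_right
        have hZX := hZ.trans Set.inter_subset_right
        have hYZ : Disjoint Y Z := (hPd i j hij).mono (hY.trans Set.inter_subset_left)
          (hZ.trans Set.inter_subset_left)
        have hoff : Disjoint (Nb G C) C := Set.disjoint_left.2 fun x hx => hx.1
        obtain ⟨D, hD, hDd⟩ := (hall Y Z hYX hZX hYk hZk hYZ).exists_through
          (hoff.mono_left hYX) (hoff.mono_left hZX) hYZ
        exact ⟨D, fun a => ⟨(hD a).1, (hD a).2.1,
          (hD a).2.2.1.mono le_rfl (hY.trans Set.inter_subset_left),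
          (hD a).2.2.2.mono le_rfl (hZ.trans Set.inter_subset_left)⟩, hDd⟩
      · push Not at hall
        obtain ⟨Y, Z, hY, hZ, hYk, hZk, hYZ, hnot⟩ := hall
        obtain ⟨S, hS, hSk, hL⟩ := exists_min_separator hnot
        have hCS : C \ (C ∩ S) = C \ S := by ext; simp
        refine Elim.of_sdiff (S := C ∩ S) Set.inter_subset_left ?_ ?_
        · rw [hCS]
          refine Elim.of_cmpt fun u hu => ?_
          have hside : ¬ Touch G (cmpt G (C \ S) u) (Y \ S) ∨
              ¬ Touch G (cmpt G (C \ S) u) (Z \ S) := by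
            by_contra! hboth
            obtain ⟨⟨a, ha, y, hy, hay⟩, b, hb, z, hz, hbz⟩ := hboth
            have hKC : ∀ x ∈ cmpt G (C \ S) u, x ∈ C \ S := fun x hx => cmpt_subset hu hx
            have hK : Conn (hullGraph G C (Y ∪ Z)) (cmpt G (C \ S) u) :=
              (cmpt_conn u).of_adj fun x hx x' hx' hxx' =>
                ⟨hxx', Or.inl (hKC x hx).1, Or.inl (hKC x' hx').1, Or.inl (hKC x hx).1⟩
            have h1 := hK.insert ha (x := y)
              ⟨hay, Or.inl (hKC a ha).1, Or.inr (Or.inl hy.1), Or.inl (hKC a ha).1⟩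
            have h2 := h1.insert (Or.inr hb) (x := z)
              ⟨hbz, Or.inl (hKC b hb).1, Or.inr (Or.inr hz.1), Or.inl (hKC b hb).1⟩
            obtain ⟨w, hw, hwS⟩ := hS _ h2 ⟨y, Or.inr (Or.inl rfl), hy.1⟩ ⟨z, Or.inl rfl, hz.1⟩
            rcases hw with rfl | rfl | hw
            · exact hz.2 hwS
            · exact hy.2 hwS
            · exact (hKC w hw).2 hwS
          rcases hside with hside | hside
          · obtain ⟨hne, T', d', w1, w2, w3, w4, w5, w6, w7⟩ := hT.extend_side hC hd hTC hXT hd2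
              hX hY hS hL (by omega) hu hside
            exact ih _ (ncard_cmpt_lt hu hne) _ T' d' (cmpt_conn u) w1 w2 w3 w4 w5 w6 w7 rfl
          · rw [Set.union_comm] at hS hL
            obtain ⟨hne, T', d', w1, w2, w3, w4, w5, w6, w7⟩ := hT.extend_side hC hd hTC hXT hd2
              hX hZ hS.symm hL.symm (by omega) hu hside
            exact ih _ (ncard_cmpt_lt hu hne) _ T' d' (cmpt_conn u) w1 w2 w3 w4 w5 w6 w7 rfl
        · have h1 := Set.ncard_union_le (Nb G C) (C ∩ S)
          have h2 := Set.ncard_le_ncard (Set.inter_subset_right (s := C) (t := S)) (Set.toFinite _)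
          omega

/-- A graph without a mesh has bounded elimination width. -/
theorem elim_of_not_mesh [Finite V] {c h : ℕ} (hh : (c + 1) * (1 + 3 * k) ≤ h)
    (hM : ¬ ∃ C T, Mesh G c k C T) : Elim G (h + k) Set.univ := by
  classical
  refine Elim.of_cmpt fun v _ => ?_
  set C := cmpt G Set.univ v with hC
  have hvC : v ∈ C := mem_cmpt v
  have h1 : 1 ≤ h := le_trans (by nlinarith) hh
  have hNb : Nb G C = ∅ := by
    rw [Set.eq_empty_iff_forall_notMem]
    rintro y ⟨hy, z, hz, hzy⟩
    exact hy (cmpt_closed hz trivial trivial hzy)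
  refine Elim.of_sdiff (S := {v}) (by simpa using hvC) (Elim.of_cmpt fun u hu => ?_) ?_
  · have hCv : (C ∩ {v}).Nonempty := ⟨v, hvC, rfl⟩
    have hsub : Nb G (cmpt G (C \ {v}) u) ⊆ {v} := fun y hy =>
      (mem_Nb_cmpt hu hy).elim (fun h => h.2) fun h => by simp [hNb] at h
    refine elim_of_web hh hM _ {v} _ (cmpt_conn u) (.single v) (by simp) ?_ hsub (by simp) ?_ ?_
    · rw [Set.disjoint_singleton_left]
      exact fun h => (cmpt_subset hu h).2 rfl
    · obtain ⟨s, -, -, hs⟩ := (cmpt_conn v).exists_mem_Nb_cmpt hu hCv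
      exact ⟨s, hs, by simp⟩
    · exact (Set.ncard_le_ncard hsub).trans ((Set.ncard_singleton v).le.trans h1)
  · rw [hNb, Set.empty_union, Set.ncard_singleton]
    omega

end Mesh

/-! ### Crossing linkages -/

/-- A family of disjoint paths. -/
structure PathFam {V : Type*} {κ : Type*} (G : SimpleGraph V) (q : κ → ℕ → V) (l : κ → ℕ) :
    Prop where
  path : ∀ i, IsPathIn G Set.univ (q i) (l i)
  disj : ∀ i j a b, a ≤ l i → b ≤ l j → q i a = q j b → i = j

/-- `N` disjoint connected sets each meeting `d` disjoint paths, in the same order. -/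
structure Ladder {V : Type*} (G : SimpleGraph V) (d N : ℕ) (q : Fin d → ℕ → V) (l : Fin d → ℕ)
    (P : Fin N → Set V) : Prop where
  fam : PathFam G q l
  conn : ∀ i, Conn G (P i)
  disj : ∀ i j, i ≠ j → Disjoint (P i) (P j)
  meet : ∀ i j, ∃ a ≤ l j, q j a ∈ P i
  lt : ∀ i i', i < i' → ∀ j, ∀ a ≤ l j, ∀ b ≤ l j, q j a ∈ P i → q j b ∈ P i' → a < b

section Crossing

variable {V κ : Type*} {G G' : SimpleGraph V} {A B S P P' : Set V} {q : κ → ℕ → V} {l : κ → ℕ}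
  {k : ℕ}

theorem Linked.exists_pathFam (h : Linked G A B k) :
    ∃ (q : Fin k → ℕ → V) (l : Fin k → ℕ), PathFam G q l ∧
      (∀ i, q i 0 ∈ A) ∧ ∀ i, q i (l i) ∈ B := by
  obtain ⟨P, h1, h2, h3⟩ := h
  have := fun i => (h1 i).exists_path (h3 i).1 (h3 i).2
  choose q l hq h0 hl using this
  refine ⟨q, l, ⟨fun i => (hq i).mono le_rfl (Set.subset_univ _), fun i j a b ha hb hab => ?_⟩,
    h0, fun i => (hl i).1⟩
  by_contra hne
  exact Set.disjoint_left.1 (h2 i j hne) ((hq i).mem a ha) (hab ▸ (hq j).mem b hb)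

theorem IsPathIn.conn_seg_delete {p : ℕ → V} {m s i j : ℕ} (hp : IsPathIn G S p m) (hij : i ≤ j)
    (hj : j ≤ m) (hs : s < m) (hsij : j ≤ s ∨ s < i) :
    Conn (G.deleteEdges {s(p s, p (s + 1))}) (p '' Set.Icc i j) := by
  refine _root_.conn_seg hij fun k hk hkj => deleteEdge_adj_of_ne (hp.adj k (by omega)) ?_ ?_
  · rintro ⟨h, -⟩
    have := hp.inj k (by omega) s (by omega) h
    omega
  · rintro ⟨h, h'⟩
    have := hp.inj k (by omega) (s + 1) (by omega) h
    have := hp.inj (k + 1) (by omega) s (by omega) h'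
    omega

theorem Conn.delete {x y : V} (h : Conn G P) (hxy : ¬ (x ∈ P ∧ y ∈ P)) :
    Conn (G.deleteEdges {s(x, y)}) P :=
  h.of_adj fun _ ha _ hb hab => deleteEdge_adj_of_ne hab
    (fun h => hxy ⟨h.1 ▸ ha, h.2 ▸ hb⟩) (fun h => hxy ⟨h.2 ▸ hb, h.1 ▸ ha⟩)

theorem PathFam.exists_unique_mem [Fintype κ] [Finite V] (hq : PathFam G q l)
    (h0 : ∀ i, q i 0 ∈ A) (hl : ∀ i, q i (l i) ∈ B) {i₀ : κ} {s : ℕ} (hs : s < l i₀)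
    (hS : Separates (G.deleteEdges {s(q i₀ s, q i₀ (s + 1))}) A B S)
    (hcard : S.ncard < Fintype.card κ) :
    (∀ i, i ≠ i₀ → ∃ σ ≤ l i, q i σ ∈ S ∧ ∀ τ ≤ l i, q i τ ∈ S → τ = σ) ∧
      ∀ τ ≤ l i₀, q i₀ τ ∉ S := by
  classical
  have hmeet : ∀ i, i ≠ i₀ → ∃ σ ≤ l i, q i σ ∈ S := by
    intro i hi
    obtain ⟨_, ⟨σ, hσ, rfl⟩, hσS⟩ := hS (q i '' Set.Icc 0 (l i)) (by
      refine Conn.delete ((hq.path i).conn_seg (Nat.zero_le _) le_rfl) ?_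
      rintro ⟨⟨a, ha, hae⟩, -⟩
      exact hi (hq.disj _ _ _ _ ha.2 hs.le hae)) ⟨q i 0, ⟨0, by simp, rfl⟩, h0 i⟩
      ⟨q i (l i), ⟨l i, by simp, rfl⟩, hl i⟩
    exact ⟨σ, hσ.2, hσS⟩
  choose! σ hσ hσS using hmeet
  let F : {i // i ≠ i₀} → V := fun i => q i.1 (σ i.1)
  have hinj : Function.Injective F := fun i j hij =>
    Subtype.ext (hq.disj _ _ _ _ (hσ _ i.2) (hσ _ j.2) hij)
  have hrange : Set.range F = S := by
    refine Set.eq_of_subset_of_ncard_le ?_ ?_ (Set.toFinite _)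
    · rintro _ ⟨i, rfl⟩
      exact hσS _ i.2
    · rw [Set.ncard_range_of_injective hinj, Nat.card_eq_fintype_card,
        Fintype.card_subtype_compl, Fintype.card_subtype_eq]
      omega
  refine ⟨fun i hi => ⟨σ i, hσ i hi, hσS i hi, fun τ hτ h => ?_⟩, fun τ hτ h => ?_⟩
  · rw [← hrange] at h
    obtain ⟨j, hj⟩ := h
    have hij := hq.disj _ _ _ _ (hσ _ j.2) hτ hj
    have hj' : q j.1 (σ j.1) = q i τ := hj
    rw [hij] at hj'
    exact (hq.path i).inj _ hτ _ (hσ i hi) hj'.symm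
  · rw [← hrange] at h
    obtain ⟨j, hj⟩ := h
    exact j.2 (hq.disj _ _ _ _ (hσ _ j.2) hτ hj)

/-- A separator of `G - e`, where `e` is an edge of one path of a linkage, orders the
connected sets on the two sides of `e` along all other paths. -/
theorem PathFam.lt_of_separates [Fintype κ] [Finite V] (hq : PathFam G q l)
    (h0 : ∀ i, q i 0 ∈ A) (hl : ∀ i, q i (l i) ∈ B) {i₀ : κ} {s : ℕ} (hs : s < l i₀)
    (hS : Separates (G.deleteEdges {s(q i₀ s, q i₀ (s + 1))}) A B S)
    (hcard : S.ncard < Fintype.card κ) (hP : Conn G P) (hP' : Conn G P') (hPS : Disjoint P S)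
    (hPS' : Disjoint P' S) (hPe : ¬ (q i₀ s ∈ P ∧ q i₀ (s + 1) ∈ P))
    (hPe' : ¬ (q i₀ s ∈ P' ∧ q i₀ (s + 1) ∈ P'))
    {x y : ℕ} (hx : x ≤ s) (hxP : q i₀ x ∈ P) (hy : s < y) (hyl : y ≤ l i₀) (hyP : q i₀ y ∈ P')
    {i : κ} (hi : i ≠ i₀) {a b : ℕ} (ha : a ≤ l i) (hb : b ≤ l i) (haP : q i a ∈ P)
    (hbP : q i b ∈ P') : a < b := by
  obtain ⟨h1, h2⟩ := hq.exists_unique_mem h0 hl hs hS hcard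
  have hdel := fun u v (h : u ≤ v) h' =>
    Conn.delete (x := q i₀ s) (y := q i₀ (s + 1)) ((hq.path i).conn_seg (i := u) (j := v) h h') (by
      rintro ⟨⟨a, ha, hae⟩, -⟩
      exact hi (hq.disj _ _ _ _ (ha.2.trans h') hs.le hae))
  obtain ⟨σ, hσ, hσS, huniq⟩ := h1 i hi
  have hsideA : OnSide (G.deleteEdges {s(q i₀ s, q i₀ (s + 1))}) A S (q i a) := by
    refine ⟨P ∪ q i₀ '' Set.Icc 0 x, (hP.delete hPe).union
      ((hq.path i₀).conn_seg_delete (Nat.zero_le x) (by omega) hs (by omega))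
      ⟨q i₀ x, hxP, x, by simp, rfl⟩, ?_, Or.inl haP, ⟨q i₀ 0, Or.inr ⟨0, by simp, rfl⟩, h0 _⟩⟩
    rw [Set.disjoint_union_left]
    refine ⟨hPS, ?_⟩
    rw [Set.disjoint_left]
    rintro _ ⟨j, hj, rfl⟩
    exact h2 j (by have := hj.2; omega)
  have hsideB : OnSide (G.deleteEdges {s(q i₀ s, q i₀ (s + 1))}) B S (q i b) := by
    refine ⟨P' ∪ q i₀ '' Set.Icc y (l i₀), (hP'.delete hPe').union
      ((hq.path i₀).conn_seg_delete hyl le_rfl hs (by omega))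
      ⟨q i₀ y, hyP, y, by simpa using hyl, rfl⟩, ?_, Or.inl hbP,
      ⟨q i₀ (l i₀), Or.inr ⟨l i₀, by simpa using hyl, rfl⟩, hl _⟩⟩
    rw [Set.disjoint_union_left]
    refine ⟨hPS', ?_⟩
    rw [Set.disjoint_left]
    rintro _ ⟨j, hj, rfl⟩
    exact h2 j hj.2
  have haσ : a < σ := by
    by_contra! hle
    have hne : a ≠ σ := fun h => Set.disjoint_left.1 hPS haP (h ▸ hσS)
    refine hS.not_onSide hsideA ⟨q i '' Set.Icc a (l i), hdel _ _ ha le_rfl, ?_,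
      ⟨a, by simpa using ha, rfl⟩, ⟨q i (l i), ⟨l i, by simpa using ha, rfl⟩, hl i⟩⟩
    rw [Set.disjoint_left]
    rintro _ ⟨j, hj, rfl⟩ hjS
    have := huniq j hj.2 hjS
    have := hj.1
    omega
  have hbσ : σ < b := by
    by_contra! hle
    have hne : b ≠ σ := fun h => Set.disjoint_left.1 hPS' hbP (h ▸ hσS)
    refine hS.not_onSide (v := q i b) ⟨q i '' Set.Icc 0 b, hdel _ _ (Nat.zero_le _) hb, ?_,
      ⟨b, by simp, rfl⟩, ⟨q i 0, ⟨0, by simp, rfl⟩, h0 i⟩⟩ hsideB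
    rw [Set.disjoint_left]
    rintro _ ⟨j, hj, rfl⟩ hjS
    have h3 := hj.2
    have := huniq j (h3.trans hb) hjS
    omega
  exact haσ.trans hbσ

/-- Disjoint sets all meeting a path, sorted by their first vertices on it. -/
theorem IsPathIn.exists_sorted_hits {ι : Type*} {p : ℕ → V} {m T : ℕ} {P : ι → Set V}
    (hP : ∀ i j, i ≠ j → Disjoint (P i) (P j)) (s : Finset ι) (hs : T < s.card)
    (hmeet : ∀ i ∈ s, ∃ a ≤ m, p a ∈ P i) :
    ∃ (I : ℕ → ι) (g : ℕ → ℕ), (∀ r < T, I r ∈ s) ∧ (∀ r < T, g r ≤ m ∧ p (g r) ∈ P (I r) ∧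
      ∀ a < g r, p a ∉ P (I r)) ∧ ∀ r r', r < r' → r' < T → g r < g r' := by
  classical
  have : ∀ i ∈ s, ∃ a ≤ m, p a ∈ P i ∧ ∀ b < a, p b ∉ P i := fun i hi => by
    have h := hmeet i hi
    exact ⟨Nat.find h, (Nat.find_spec h).1, (Nat.find_spec h).2, fun b hb hbP =>
      Nat.find_min h hb ⟨hb.le.trans (Nat.find_spec h).1, hbP⟩⟩
  choose! f hfm hfP hf using this
  have hinj : Set.InjOn f s := fun i hi j hj hij => by
    by_contra hne
    exact Set.disjoint_left.1 (hP i j hne) (hfP i hi) (hij ▸ hfP j hj)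
  obtain ⟨i₁, hi₁⟩ : s.Nonempty := Finset.card_pos.1 (by omega)
  have hcard : T ≤ (s.image f).card := by rw [Finset.card_image_of_injOn hinj]; omega
  let e := (s.image f).orderEmbOfCardLe hcard
  have he : ∀ r : Fin T, ∃ i ∈ s, f i = e r := fun r => by
    simpa using (s.image f).orderEmbOfCardLe_mem hcard r
  choose J hJs hJ using he
  refine ⟨fun r => if h : r < T then J ⟨r, h⟩ else i₁, fun r => if h : r < T then e ⟨r, h⟩ else 0,
    fun r hr => ?_, fun r hr => ?_, fun r r' hrr' hr' => ?_⟩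
  · simp only [hr, dite_true]
    exact hJs _
  · simp only [hr, dite_true, ← hJ]
    exact ⟨hfm _ (hJs _), hfP _ (hJs _), hf _ (hJs _)⟩
  · simp only [hrr'.trans hr', hr', dite_true]
    exact e.strictMono hrr'

/-- If no edge outside the sets `P i` can be deleted without destroying an `m`-linkage, and many
of the sets `P i` meet more than `d` of its paths, then there is a ladder. -/
theorem exists_ladder [Finite V] {ι : Type*} {m d N T : ℕ} {q : Fin m → ℕ → V}
    {l : Fin m → ℕ} (hq : PathFam G q l) (h0 : ∀ i, q i 0 ∈ A) (hl : ∀ i, q i (l i) ∈ B)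
    {P : ι → Set V} (hP : ∀ i, Conn G (P i)) (hPd : ∀ i j, i ≠ j → Disjoint (P i) (P j))
    (hmin : ∀ x y, G.Adj x y → (∀ i, ¬ (x ∈ P i ∧ y ∈ P i)) →
      ¬ Linked (G.deleteEdges {s(x, y)}) A B m)
    (s : Finset ι) (hmeet : ∀ i ∈ s, d < {j | ∃ a ≤ l j, q j a ∈ P i}.ncard)
    (hT : T = N * m ^ d + 1) (hs : m * (T * (T * m + 1)) < s.card) :
    ∃ q l P, Ladder G d N q l P := by
  classical
  set b := T * m + 1 with hb
  have hne : ∀ i ∈ s, ∃ j, ∃ a ≤ l j, q j a ∈ P i := fun i hi =>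
    Set.nonempty_of_ncard_ne_zero (s := {j | ∃ a ≤ l j, q j a ∈ P i})
      (by have := hmeet i hi; omega)
  obtain ⟨i₁, hi₁⟩ : s.Nonempty := Finset.card_pos.1 (by omega)
  have : Nonempty (Fin m) := ⟨(hne i₁ hi₁).choose⟩
  choose! J hJ using hne
  obtain ⟨i₀, -, hi₀⟩ := Finset.exists_lt_card_fiber_of_mul_lt_card_of_maps_to
    (s := s) (t := Finset.univ) (f := J) (n := T * b) (by simp) (by simpa using hs)
  obtain ⟨I, g, hIs', hg, hgm⟩ := IsPathIn.exists_sorted_hits (p := q i₀) (m := l i₀) hPd _ hi₀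
    (by
      intro i hi
      obtain ⟨his, rfl⟩ := Finset.mem_filter.1 hi
      exact hJ i his)
  have hIs : ∀ r < T * b, I r ∈ s := fun r hr => (Finset.mem_filter.1 (hIs' r hr)).1
  have : Nonempty V := ⟨q i₀ 0⟩
  have hblk : ∀ c < T, ∀ r < b, c * b + r < T * b := fun c hc r hr => by
    nlinarith
  have hcut : ∀ j, 0 < j → j < T → ∃ S : Set V, S.ncard < m ∧
      Separates (G.deleteEdges {s(q i₀ (g (j * b) - 1), q i₀ (g (j * b) - 1 + 1))}) A B S ∧
      (∀ i, ¬ (q i₀ (g (j * b) - 1) ∈ P i ∧ q i₀ (g (j * b) - 1 + 1) ∈ P i)) ∧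
      0 < g (j * b) := by
    intro j hj hjT
    have hjb := hblk j hjT 0 (by omega)
    rw [add_zero] at hjb
    have hpos : 0 < g (j * b) :=
      (Nat.zero_le _).trans_lt (hgm 0 _ (Nat.mul_pos hj (by omega)) hjb)
    obtain ⟨h1, h2, h3⟩ := hg _ hjb
    have hsucc : g (j * b) - 1 + 1 = g (j * b) := by omega
    have hnot : ∀ i, ¬ (q i₀ (g (j * b) - 1) ∈ P i ∧ q i₀ (g (j * b) - 1 + 1) ∈ P i) := by
      rintro i ⟨hi, hi'⟩
      rw [hsucc] at hi'
      have : i = I (j * b) := by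
        by_contra hne
        exact Set.disjoint_left.1 (hPd _ _ hne) hi' h2
      exact h3 _ (by omega) (this ▸ hi)
    have hnl := hmin _ _ ((hq.path i₀).adj (g (j * b) - 1) (by omega)) hnot
    have : ∃ S, Separates (G.deleteEdges {s(q i₀ (g (j * b) - 1), q i₀ (g (j * b) - 1 + 1))})
        A B S ∧ S.ncard < m := by
      by_contra! hall
      exact hnl (linked_of_separates m _ A B hall)
    obtain ⟨S, hS, hSm⟩ := this
    exact ⟨S, hSm, hS, hnot, hpos⟩
  choose! S hSm hS hSP hgpos using hcut
  have hsel : ∀ c < T, ∃ r, c * b ≤ r ∧ r < (c + 1) * b ∧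
      ∀ j, 0 < j → j < T → Disjoint (P (I r)) (S j) := by
    intro c hc
    by_contra! hcon
    have hU : (⋃ j ∈ Finset.Ioo 0 T, S j).ncard ≤ T * m := by
      have := Fintype.ofFinite V
      have hU : ⋃ j ∈ Finset.Ioo 0 T, S j = (Finset.Ioo 0 T).biUnion fun j => (S j).toFinset := by
        simp
      rw [hU, Set.ncard_coe_finset]
      refine (Finset.card_biUnion_le_card_mul _ _ m fun j hj => ?_).trans
        (Nat.mul_le_mul_right _ (by simp))
      rw [← Set.ncard_eq_toFinset_card']
      exact (hSm j (Finset.mem_Ioo.1 hj).1 (Finset.mem_Ioo.1 hj).2).le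
    have : ∀ r ∈ Finset.Ico (c * b) ((c + 1) * b), ∃ x, x ∈ P (I r) ∧
        x ∈ ⋃ j ∈ Finset.Ioo 0 T, S j := fun r hr => by
      obtain ⟨h1, h2⟩ := Finset.mem_Ico.1 hr
      obtain ⟨j, hj, hjT, h⟩ := hcon r h1 h2
      obtain ⟨x, hx, hxS⟩ := Set.not_disjoint_iff.1 h
      exact ⟨x, hx, Set.mem_biUnion (by simpa using ⟨hj, hjT⟩) hxS⟩
    choose! x hx hxU using this
    have hle := Set.ncard_le_ncard_of_injOn (s := (Finset.Ico (c * b) ((c + 1) * b) : Set ℕ))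
      (t := ⋃ j ∈ Finset.Ioo 0 T, S j) x (fun r hr => hxU r hr) (by
        intro r hr r' hr' hrr'
        have hr1 := (Finset.mem_Ico.1 hr).2
        have hr1' := (Finset.mem_Ico.1 hr').2
        have hcb : (c + 1) * b ≤ T * b := Nat.mul_le_mul_right _ hc
        by_contra hne
        have hII : I r = I r' := by
          by_contra hII
          exact Set.disjoint_left.1 (hPd _ _ hII) (hx r hr) (hrr' ▸ hx r' hr')
        obtain ⟨-, h2, h3⟩ := hg r (by omega)
        obtain ⟨-, h2', h3'⟩ := hg r' (by omega)
        rcases lt_or_gt_of_ne hne with h | h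
        · exact h3' _ (hgm r r' h (by omega)) (hII ▸ h2)
        · exact h3 _ (hgm r' r h (by omega)) (hII ▸ h2')) (Set.toFinite _)
    rw [Set.ncard_coe_finset, Nat.card_Ico, add_mul, one_mul] at hle
    omega
  choose! r hr1 hr2 hrS using hsel
  have hrT : ∀ c < T, r c < T * b := fun c hc =>
    (hr2 c hc).trans_le (Nat.mul_le_mul_right _ hc)
  have hrm : ∀ c c', c < c' → c' < T → r c < c' * b := fun c c' h h' =>
    (hr2 c (h.trans h')).trans_le (Nat.mul_le_mul_right _ h)
  have hphi : ∀ c < T, ∃ φ : Fin d → Fin m, Function.Injective φ ∧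
      ∀ j, φ j ≠ i₀ ∧ ∃ a ≤ l (φ j), q (φ j) a ∈ P (I (r c)) := by
    intro c hc
    have h := hmeet _ (hIs _ (hrT c hc))
    have h2 : d ≤ ({j | ∃ a ≤ l j, q j a ∈ P (I (r c))} \ {i₀}).ncard := by
      have := Set.ncard_le_ncard_sdiff_add_ncard {j | ∃ a ≤ l j, q j a ∈ P (I (r c))} {i₀}
        (Set.toFinite _)
      rw [Set.ncard_singleton] at this
      omega
    rw [← Nat.card_coe_set_eq, Nat.card_eq_fintype_card] at h2
    obtain ⟨f⟩ := Function.Embedding.nonempty_of_card_le (α := Fin d)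
      (β := ↥({j | ∃ a ≤ l j, q j a ∈ P (I (r c))} \ {i₀})) (by rwa [Fintype.card_fin])
    exact ⟨fun j => (f j).1, Subtype.val_injective.comp f.injective, fun j =>
      ⟨(f j).2.2, (f j).2.1⟩⟩
  choose! φ hφi hφ using hphi
  obtain ⟨ψ, -, hψ⟩ := Finset.exists_lt_card_fiber_of_mul_lt_card_of_maps_to
    (s := Finset.range T) (t := Finset.univ) (f := φ) (n := N) (by simp)
    (by simp [hT, mul_comm N])
  let e := Finset.orderEmbOfCardLe _ hψ.le
  have he : ∀ i : Fin N, e i < T ∧ φ (e i) = ψ := fun i => by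
    simpa using Finset.orderEmbOfCardLe_mem _ hψ.le i
  refine ⟨fun j => q (ψ j), fun j => l (ψ j), fun i => P (I (r (e i))), ⟨⟨fun j => hq.path _,
    fun i j x y hx hy hxy => ?_⟩, fun i => hP _, ?_, ?_, ?_⟩⟩
  · obtain ⟨c, hc⟩ := Finset.card_pos.1 ((Nat.zero_le _).trans_lt hψ)
    obtain ⟨hc, rfl⟩ := Finset.mem_filter.1 hc
    exact hφi c (by simpa using hc) (hq.disj _ _ _ _ hx hy hxy)
  · intro i j hij
    refine hPd _ _ fun hII => ?_
    have hne := e.injective.ne hij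
    have key : ∀ c c', c < c' → c' < T → I (r c) ≠ I (r c') := fun c c' h h' hI => by
      have h1 := hrT c (h.trans h')
      have h2 := hrT c' h'
      have h3 := (hrm c c' h h').trans_le (hr1 c' h')
      exact (hg _ h2).2.2 _ (hgm _ _ h3 h2) (hI ▸ (hg _ h1).2.1)
    rcases lt_or_gt_of_ne hne with h | h
    · exact key _ _ h (he j).1 hII
    · exact key _ _ h (he i).1 hII.symm
  · intro i j
    have := hφ _ (he i).1 j
    rw [(he i).2] at this
    exact this.2
  · intro i i' hii' j x hx y hy hxP hyP
    have hc := e.strictMono hii'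
    have hcT := (he i').1
    have hj0 : 0 < e i' := by omega
    have hgp := hgpos _ hj0 hcT
    have hjb := hblk _ hcT 0 (by omega)
    rw [add_zero] at hjb
    have hlt : r (e i) < e i' * b := hrm _ _ hc hcT
    have hlt' : g (r (e i)) < g (e i' * b) := hgm _ _ hlt hjb
    have hle' : g (e i' * b) ≤ g (r (e i')) := by
      rcases (hr1 _ hcT).eq_or_lt with h | h
      · rw [h]
      · exact (hgm _ _ h (hrT _ hcT)).le
    have hne := (hφ _ hcT j).1
    rw [(he i').2] at hne
    have hgl := (hg _ hjb).1
    exact hq.lt_of_separates h0 hl (i₀ := i₀) (s := g (e i' * b) - 1) (by omega)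
      (hS _ hj0 hcT) (by simpa using hSm _ hj0 hcT) (hP _) (hP _) (hrS _ (he i).1 _ hj0 hcT)
      (hrS _ hcT _ hj0 hcT) (hSP _ hj0 hcT _) (hSP _ hj0 hcT _)
      (x := g (r (e i))) (by omega) (hg _ (hrT _ (he i).1)).2.1 (y := g (r (e i'))) (by omega)
      (hg _ (hrT _ hcT)).1 (hg _ (hrT _ hcT)).2.1 hne hx hy hxP hyP

theorem exists_minimal_linked [Finite V] {ι : Type*} {m : ℕ} (P : ι → Set V)
    (h : Linked G A B m) :
    ∃ J ≤ G, (∀ i, ∀ x ∈ P i, ∀ y ∈ P i, G.Adj x y → J.Adj x y) ∧ Linked J A B m ∧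
      ∀ x y, J.Adj x y → (∀ i, ¬ (x ∈ P i ∧ y ∈ P i)) →
        ¬ Linked (J.deleteEdges {s(x, y)}) A B m := by
  obtain ⟨J, ⟨hJ1, hJ2, hJ3⟩, hmin⟩ := (Set.toFinite {J : SimpleGraph V | J ≤ G ∧
    (∀ i, ∀ x ∈ P i, ∀ y ∈ P i, G.Adj x y → J.Adj x y) ∧ Linked J A B m}).exists_minimal
    ⟨G, le_rfl, fun _ _ _ _ _ h => h, h⟩
  refine ⟨J, hJ1, hJ2, hJ3, fun x y hxy hP hL => ?_⟩
  have hle := J.deleteEdges_le {s(x, y)}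
  have := hmin ⟨hle.trans hJ1, fun i a ha b hb hab => deleteEdge_adj_of_ne (hJ2 i a ha b hb hab)
    (fun h => hP i ⟨h.1 ▸ ha, h.2 ▸ hb⟩) (fun h => hP i ⟨h.2 ▸ hb, h.1 ▸ ha⟩), hL⟩ hle hxy
  simp at this

theorem Ladder.mono_graph {d N : ℕ} {q : Fin d → ℕ → V} {l : Fin d → ℕ} {P : Fin N → Set V}
    (h : Ladder G d N q l P) (hG : G ≤ G') : Ladder G' d N q l P :=
  ⟨⟨fun i => (h.fam.path i).mono hG le_rfl, h.fam.disj⟩, fun i => (h.conn i).mono_graph hG,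
    h.disj, h.meet, h.lt⟩

/-- The edges of `G` with both ends off `D`. -/
def awayGraph (G : SimpleGraph V) (D : Set V) : SimpleGraph V where
  Adj x y := G.Adj x y ∧ x ∉ D ∧ y ∉ D
  symm := ⟨fun _ _ h => ⟨h.1.symm, h.2.2, h.2.1⟩⟩
  loopless := ⟨fun a h => G.loopless.irrefl a h.1⟩

theorem awayGraph_le (G : SimpleGraph V) (D : Set V) : awayGraph G D ≤ G := fun _ _ h => h.1

theorem Conn.awayGraph (h : Conn G P) {D : Set V} (hD : Disjoint P D) :
    Conn (awayGraph G D) P :=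
  h.of_adj fun _ hx _ hy hxy => ⟨hxy, Set.disjoint_left.1 hD hx, Set.disjoint_left.1 hD hy⟩

theorem Conn.disjoint_of_awayGraph {D : Set V} (h : Conn (_root_.awayGraph G D) P) {x : V}
    (hx : x ∈ P) (hxD : x ∉ D) : Disjoint P D :=
  Set.disjoint_left.2 (h.subset_of_closed (T := Dᶜ) ⟨x, hx, hxD⟩ fun _ _ _ _ _ hxy => hxy.2.2)

end Crossing

/-- From sufficiently large linkages between pairs of sets one can select disjoint connecting
sets, one for each pair, unless there is a ladder. -/
theorem exists_select (d N M : ℕ) : ∃ k, ∀ (V : Type u) [Finite V] (G : SimpleGraph V)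
    (ι : Type) (I : Finset ι) (A B : ι → Set V), I.card ≤ M → (∀ a ∈ I, Linked G (A a) (B a) k) →
    (∃ D : ι → Set V, (∀ a ∈ I, Conn G (D a) ∧ (D a ∩ A a).Nonempty ∧ (D a ∩ B a).Nonempty) ∧
      ∀ a ∈ I, ∀ b ∈ I, a ≠ b → Disjoint (D a) (D b)) ∨ ∃ q l P, Ladder G d N q l P := by
  classical
  induction M with
  | zero =>
    refine ⟨0, fun V _ G ι I A B hI _ => Or.inl ⟨fun _ => ∅, ?_, ?_⟩⟩ <;>
    · obtain rfl : I = ∅ := Finset.card_eq_zero.1 (by omega)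
      simp
  | succ M ih =>
    obtain ⟨k, hk⟩ := ih
    obtain ⟨m, hm⟩ : ∃ m, m = k + d := ⟨_, rfl⟩
    obtain ⟨T, hT⟩ : ∃ T, T = N * m ^ d + 1 := ⟨_, rfl⟩
    refine ⟨max (M * (m * (T * (T * m + 1))) + 1) m, fun V _ G ι I A B hI hL => ?_⟩
    rcases I.eq_empty_or_nonempty with rfl | ⟨a₀, ha₀⟩
    · exact Or.inl ⟨fun _ => ∅, by simp, by simp⟩
    obtain ⟨P, hPc, hPd, hPm⟩ := (hL a₀ ha₀).mono_right (le_max_left _ _)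
    have hcard : (I.erase a₀).card ≤ M := by rw [Finset.card_erase_of_mem ha₀]; omega
    have hlink : ∀ a ∈ I.erase a₀, Linked G (A a) (B a) m := fun a ha =>
      (hL a (Finset.mem_of_mem_erase ha)).mono_right (le_max_right _ _)
    have : ∀ a, ∃ (J : SimpleGraph V) (q : Fin m → ℕ → V) (l : Fin m → ℕ), a ∈ I.erase a₀ →
        J ≤ G ∧ (∀ i, Conn J (P i)) ∧ (∀ x y, J.Adj x y → (∀ i, ¬ (x ∈ P i ∧ y ∈ P i)) →
        ¬ Linked (J.deleteEdges {s(x, y)}) (A a) (B a) m) ∧ PathFam J q l ∧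
        (∀ i, q i 0 ∈ A a) ∧ ∀ i, q i (l i) ∈ B a := fun a => by
      by_cases ha : a ∈ I.erase a₀
      · obtain ⟨J, hJG, hJ1, hJ2, hJ3⟩ := exists_minimal_linked P (hlink a ha)
        obtain ⟨q, l, hq, h0, hl⟩ := hJ2.exists_pathFam
        exact ⟨J, q, l, fun _ => ⟨hJG, fun i => (hPc i).of_adj (hJ1 i), hJ3, hq, h0, hl⟩⟩
      · obtain ⟨x, -⟩ := (hPc ⟨0, by omega⟩).1
        exact ⟨G, fun _ _ => x, fun _ => 0, fun h => absurd h ha⟩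
    choose J q l hJ using this
    by_cases hgood : ∃ i, ∀ a ∈ I.erase a₀, {j | ∃ x ≤ l a j, q a j x ∈ P i}.ncard ≤ d
    · obtain ⟨i, hi⟩ := hgood
      have hlink' : ∀ a ∈ I.erase a₀, Linked (awayGraph G (P i)) (A a \ P i) (B a \ P i) k := by
        intro a ha
        obtain ⟨hJG, -, -, hq, h0, hl⟩ := hJ a ha
        have hoff : ∀ j : ↥{j | ∃ x ≤ l a j, q a j x ∈ P i}ᶜ,
            Disjoint (q a j '' Set.Icc 0 (l a j)) (P i) := by
          rintro ⟨j, hj⟩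
          rw [Set.disjoint_left]
          rintro _ ⟨x, hx, rfl⟩ hxP
          exact hj ⟨x, hx.2, hxP⟩
        refine Linked.of_family (ι := ↥{j | ∃ x ≤ l a j, q a j x ∈ P i}ᶜ) ?_
          (fun j => q a j '' Set.Icc 0 (l a j)) (fun j => ?_) ?_ ?_
        · rw [Nat.card_coe_set_eq]
          have h1 := Set.ncard_add_ncard_compl {j | ∃ x ≤ l a j, q a j x ∈ P i}
          rw [Nat.card_fin] at h1
          have h2 := hi a ha
          omega
        · exact (((hq.path j).conn_seg (Nat.zero_le _) le_rfl).mono_graph hJG).awayGraph (hoff j)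
        · intro j j' hjj'
          rw [Set.disjoint_left]
          rintro _ ⟨x, hx, rfl⟩ ⟨y, hy, hxy⟩
          exact hjj' (Subtype.ext (hq.disj _ _ _ _ hx.2 hy.2 hxy.symm))
        · intro j
          have hj := Set.disjoint_left.1 (hoff j)
          have m0 : q a j 0 ∈ q a j '' Set.Icc 0 (l a j) := ⟨0, by simp, rfl⟩
          have ml : q a j (l a j) ∈ q a j '' Set.Icc 0 (l a j) := ⟨l a j, by simp, rfl⟩
          exact ⟨⟨_, m0, h0 _, hj m0⟩, ⟨_, ml, hl _, hj ml⟩⟩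
      rcases hk V (awayGraph G (P i)) ι (I.erase a₀) (fun a => A a \ P i) (fun a => B a \ P i)
        hcard hlink' with ⟨D, hD, hDd⟩ | ⟨q', l', P', h⟩
      · have hDP : ∀ a ∈ I.erase a₀, Disjoint (D a) (P i) := fun a ha => by
          obtain ⟨h1, ⟨x, hx, -, hx'⟩, -⟩ := hD a ha
          exact h1.disjoint_of_awayGraph hx hx'
        have hne : ∀ a ∈ I, a ≠ a₀ → a ∈ I.erase a₀ := fun a ha h => Finset.mem_erase.2 ⟨h, ha⟩
        refine Or.inl ⟨Function.update D a₀ (P i), fun a ha => ?_, fun a ha b hb hab => ?_⟩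
        · rcases eq_or_ne a a₀ with rfl | h
          · simpa using ⟨hPc i, hPm i⟩
          · rw [Function.update_of_ne h]
            obtain ⟨h1, h2, h3⟩ := hD a (hne a ha h)
            exact ⟨h1.mono_graph (awayGraph_le _ _),
              h2.mono (Set.inter_subset_inter_right _ Set.sdiff_subset),
              h3.mono (Set.inter_subset_inter_right _ Set.sdiff_subset)⟩
        · rcases eq_or_ne a a₀ with rfl | h
          · rw [Function.update_self, Function.update_of_ne hab.symm]
            exact (hDP b (hne b hb hab.symm)).symm
          · rcases eq_or_ne b a₀ with rfl | h'
            · rw [Function.update_self, Function.update_of_ne hab]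
              exact hDP a (hne a ha h)
            · rw [Function.update_of_ne h, Function.update_of_ne h']
              exact hDd a (hne a ha h) b (hne b hb h') hab
      · exact Or.inr ⟨q', l', P', h.mono_graph (awayGraph_le _ _)⟩
    · push Not at hgood
      choose f hf hfd using hgood
      obtain ⟨a, ha, hcard'⟩ := Finset.exists_lt_card_fiber_of_mul_lt_card_of_maps_to
        (s := Finset.univ) (t := I.erase a₀) (f := f) (n := m * (T * (T * m + 1)))
        (by simpa using hf) (by
          rw [Finset.card_univ, Fintype.card_fin]
          exact Nat.lt_succ_of_le (Nat.mul_le_mul_right _ hcard))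
      obtain ⟨hJG, hPJ, hmin, hq, h0, hl⟩ := hJ a ha
      obtain ⟨q, l, P, h⟩ := exists_ladder hq h0 hl hPJ hPd hmin _ (d := d) (N := N) (T := T)
        (fun i hi => by
          obtain ⟨-, rfl⟩ := Finset.mem_filter.1 hi
          exact hfd i) hT hcard'
      exact Or.inr ⟨q, l, P, h.mono_graph hJG⟩

/-! ### Grids and complete graphs from ladders -/

/-- `U` and `W` are adjacent, or joined by the connected set `D`. -/
def LinkedBy {V : Type*} (G : SimpleGraph V) (D U W : Set V) : Prop :=
  (D = ∅ ∧ Touch G U W) ∨ (Conn G D ∧ Touch G U D ∧ Touch G D W)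

/-- A ladder with links between its paths, in terms of the first vertices `m i j` of the rungs. -/
structure Rungs {V : Type*} (G : SimpleGraph V) (d N : ℕ) (q : Fin d → ℕ → V) (l : Fin d → ℕ)
    (Λ : SimpleGraph (Fin d)) (m : ℕ → Fin d → ℕ) (D : ℕ → Fin d → Fin d → Set V) : Prop where
  fam : PathFam G q l
  le : ∀ i < N, ∀ j, m i j ≤ l j
  mono : ∀ i i', i < i' → i' < N → ∀ j, m i j < m i' j
  joined : ∀ i, i + 1 < N → ∀ j j', Λ.Adj j j' → LinkedBy G (D i j j')
    (q j '' Set.Ico (m i j) (m (i + 1) j)) (q j' '' Set.Ico (m i j') (m (i + 1) j'))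
  off : ∀ i j j' k, ∀ a ≤ l k, q k a ∉ D i j j'
  disj : ∀ i i' j j' k k', i ≠ i' → Disjoint (D i j j') (D i' k k')

section LinkedBy

variable {V : Type*} {G : SimpleGraph V} {D U W U' W' P : Set V}

theorem LinkedBy.symm (h : LinkedBy G D U W) : LinkedBy G D W U := by
  rcases h with ⟨h, h'⟩ | ⟨h, h', h''⟩
  · exact Or.inl ⟨h, h'.symm⟩
  · exact Or.inr ⟨h, h''.symm, h'.symm⟩

theorem LinkedBy.mono (h : LinkedBy G D U W) (hU : U ⊆ U') (hW : W ⊆ W') : LinkedBy G D U' W' := by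
  rcases h with ⟨h, h'⟩ | ⟨h, h', h''⟩
  · exact Or.inl ⟨h, h'.mono hU hW⟩
  · exact Or.inr ⟨h, h'.mono hU le_rfl, h''.mono le_rfl hW⟩

theorem LinkedBy.conn (h : LinkedBy G D U W) (hU : Conn G U) : Conn G (U ∪ D) := by
  rcases h with ⟨rfl, -⟩ | ⟨h, h', -⟩
  · simpa using hU
  · exact hU.union_touch h h'

theorem LinkedBy.touch (h : LinkedBy G D U W) : Touch G (U ∪ D) W := by
  rcases h with ⟨-, h⟩ | ⟨-, -, h⟩
  · exact h.mono Set.subset_union_left le_rfl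
  · exact h.mono Set.subset_union_right le_rfl

/-- A connected set links the sets of a disjoint family that it meets. -/
theorem Conn.exists_linkedBy {κ : Type*} {Q : κ → Set V} (hP : Conn G P)
    (hQ : ∀ j, (Q j ∩ P).Nonempty) (hQd : ∀ i j, i ≠ j → Disjoint (Q i) (Q j)) {T : Set κ}
    (hT : T.Nonempty) (hT' : T ≠ Set.univ) :
    ∃ j ∈ T, ∃ j' ∉ T, ∃ D ⊆ P \ ⋃ j, Q j, LinkedBy G D (Q j ∩ P) (Q j' ∩ P) := by
  obtain ⟨t, ht⟩ := hT
  obtain ⟨t', ht'⟩ := (Set.ne_univ_iff_exists_notMem T).1 hT'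
  obtain ⟨p, l, hp, h0, hl, hA, hB, -⟩ := hP.exists_path (A := ⋃ j ∈ T, Q j)
    (B := ⋃ j ∈ Tᶜ, Q j) (by
      obtain ⟨x, hx, hxP⟩ := hQ t
      exact ⟨x, hxP, Set.mem_biUnion ht hx⟩) (by
      obtain ⟨x, hx, hxP⟩ := hQ t'
      exact ⟨x, hxP, Set.mem_biUnion ht' hx⟩)
  obtain ⟨j, hj, h0⟩ := Set.mem_iUnion₂.1 h0
  obtain ⟨j', hj', hl⟩ := Set.mem_iUnion₂.1 hl
  have hne : 0 < l := by
    rw [Nat.pos_iff_ne_zero]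
    rintro rfl
    exact Set.disjoint_left.1 (hQd j j' fun h => hj' (h ▸ hj)) h0 hl
  refine ⟨j, hj, j', hj', ?_⟩
  rcases (Nat.succ_le_of_lt hne).eq_or_lt with h | h
  · obtain rfl : l = 1 := h.symm
    exact ⟨∅, by simp, Or.inl ⟨rfl, p 0, ⟨h0, hp.mem 0 (by omega)⟩, p 1,
      ⟨hl, hp.mem 1 le_rfl⟩, hp.adj 0 (by omega)⟩⟩
  · have h : 1 < l := h
    refine ⟨p '' Set.Icc 1 (l - 1), ?_, Or.inr ⟨hp.conn_seg (by omega) (by omega),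
      ⟨p 0, ⟨h0, hp.mem 0 (by omega)⟩, p 1, ⟨1, by simp; omega, rfl⟩, hp.adj 0 (by omega)⟩,
      ⟨p (l - 1), ⟨l - 1, by simp; omega, rfl⟩, p l, ⟨hl, hp.mem l le_rfl⟩, ?_⟩⟩⟩
    · rintro _ ⟨i, hi, rfl⟩
      obtain ⟨hi1, hi2⟩ := hi
      refine ⟨hp.mem i (by omega), fun hiQ => ?_⟩
      obtain ⟨k, hk⟩ := Set.mem_iUnion.1 hiQ
      by_cases hkT : k ∈ T
      · have := hA i (by omega) (Set.mem_biUnion hkT hk)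
        omega
      · have := hB i (by omega) (Set.mem_biUnion (s := Tᶜ) hkT hk)
        omega
    · have := hp.adj (l - 1) (by omega)
      rwa [Nat.sub_add_cancel hne] at this

/-- A large connected graph contains a long path or a vertex of large degree. -/
theorem exists_path_or_star (n : ℕ) : ∃ d, 0 < d ∧ ∀ Λ : SimpleGraph (Fin d), Conn Λ Set.univ →
    (∃ p : ℕ → Fin d, (∀ i < n, ∀ j < n, p i = p j → i = j) ∧
      ∀ i, i + 1 < n → Λ.Adj (p i) (p (i + 1))) ∨
    ∃ (j : Fin d) (f : Fin n → Fin d), Function.Injective f ∧ ∀ b, Λ.Adj j (f b) := by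
  classical
  refine ⟨n ^ n + 1, Nat.succ_pos _, fun Λ hΛ => ?_⟩
  by_cases hdeg : ∃ j, n ≤ (Λ.neighborFinset j).card
  · obtain ⟨j, hj⟩ := hdeg
    obtain ⟨f⟩ := Function.Embedding.nonempty_of_card_le (α := Fin n)
      (β := ↥(Λ.neighborFinset j)) (by rwa [Fintype.card_fin, Fintype.card_coe])
    refine Or.inr ⟨j, fun b => (f b).1, Subtype.val_injective.comp f.injective, fun b =>
      (Λ.mem_neighborFinset _ _).1 (f b).2⟩
  · push Not at hdeg
    let R : ℕ → Finset (Fin (n ^ n + 1)) := fun r => Nat.rec {0}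
      (fun _ s => s.biUnion fun x => insert x (Λ.neighborFinset x)) r
    have hR : ∀ r, (R r).card ≤ n ^ r := fun r => by
      induction r with
      | zero => simp [R]
      | succ r ih =>
        rw [pow_succ]
        exact (Finset.card_biUnion_le_card_mul _ _ n fun x _ =>
          (Finset.card_insert_le _ _).trans (hdeg x)).trans (Nat.mul_le_mul_right _ ih)
    have hRm : ∀ r, R r ⊆ R (r + 1) := fun r x hx =>
      Finset.mem_biUnion.2 ⟨x, hx, Finset.mem_insert_self _ _⟩
    obtain ⟨v, hv⟩ : ∃ v, v ∉ R n := by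
      by_contra! hall
      have h := hR n
      rw [Finset.eq_univ_iff_forall.2 hall, Finset.card_univ, Fintype.card_fin] at h
      omega
    obtain ⟨p, l, hp, h0, hl, -⟩ := hΛ.exists_path (A := {0}) (B := {v}) ⟨0, by simp⟩
      ⟨v, by simp⟩
    have hpR : ∀ i ≤ l, p i ∈ R i := fun i => by
      induction i with
      | zero => exact fun _ => by simpa [R] using h0
      | succ i ih => exact fun hi => Finset.mem_biUnion.2 ⟨p i, ih (by omega),
          Finset.mem_insert_of_mem (by simpa using hp.adj i (by omega))⟩
    have hnl : n ≤ l := by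
      by_contra! hln
      have : ∀ k, R l ⊆ R (l + k) := fun k => by
        induction k with
        | zero => exact subset_rfl
        | succ k ih => exact ih.trans (hRm _)
      have h := this (n - l) (hpR l le_rfl)
      rw [Nat.add_sub_cancel' hln.le, show p l = v from hl] at h
      exact hv h
    exact Or.inl ⟨p, fun i hi j hj => hp.inj i (by omega) j (by omega),
      fun i hi => hp.adj i (by omega)⟩

end LinkedBy

section Rungs

variable {V : Type*} {G : SimpleGraph V} {d N n : ℕ} {q : Fin d → ℕ → V} {l : Fin d → ℕ}
  {P : Fin N → Set V} {Λ : SimpleGraph (Fin d)} {m : ℕ → Fin d → ℕ}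
  {D : ℕ → Fin d → Fin d → Set V}

theorem Rungs.conn (h : Rungs G d N q l Λ m D) {r s : ℕ} (hrs : r < s) (hs : s < N) (j : Fin d) :
    Conn G (q j '' Set.Ico (m r j) (m s j)) := by
  have h1 := h.mono r s hrs hs j
  have h2 := h.le s hs j
  have : Set.Ico (m r j) (m s j) = Set.Icc (m r j) (m s j - 1) := by
    ext x
    simp only [Set.mem_Ico, Set.mem_Icc]
    omega
  rw [this]
  exact (h.fam.path j).conn_seg (by omega) (by omega)

theorem Rungs.mono_le (h : Rungs G d N q l Λ m D) {r s : ℕ} (hrs : r ≤ s) (hs : s < N)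
    (j : Fin d) : m r j ≤ m s j := by
  rcases hrs.eq_or_lt with rfl | hrs
  · exact le_rfl
  · exact (h.mono r s hrs hs j).le

theorem Rungs.disjoint_seg (h : Rungs G d N q l Λ m D) {r s r' s' : ℕ} (hs : s < N)
    (hs' : s' < N) {j j' : Fin d} (hne : j = j' → s ≤ r' ∨ s' ≤ r) (hr : r ≤ s) (hr' : r' ≤ s') :
    Disjoint (q j '' Set.Ico (m r j) (m s j)) (q j' '' Set.Ico (m r' j') (m s' j')) := by
  rw [Set.disjoint_left]
  rintro _ ⟨x, hx, rfl⟩ ⟨y, hy, hxy⟩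
  have hxl := hx.2.le.trans (h.le s hs j)
  have hyl := hy.2.le.trans (h.le s' hs' j')
  obtain rfl := h.fam.disj _ _ _ _ hyl hxl hxy
  obtain rfl := (h.fam.path _).inj _ hyl _ hxl hxy
  have h1 := hx.1
  have h2 := hx.2
  have h3 := hy.1
  have h4 := hy.2
  rcases hne rfl with h | h
  · have := Rungs.mono_le ‹_› h (by omega) j'
    omega
  · have := Rungs.mono_le ‹_› h (by omega) j'
    omega

theorem Rungs.disjoint_off (h : Rungs G d N q l Λ m D) {s : ℕ} (hs : s < N) (r i : ℕ)
    (j k k' : Fin d) : Disjoint (q j '' Set.Ico (m r j) (m s j)) (D i k k') := by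
  rw [Set.disjoint_left]
  rintro _ ⟨x, hx, rfl⟩
  exact h.off _ _ _ _ _ (hx.2.le.trans (h.le s hs j))

theorem Rungs.seg_mono (h : Rungs G d N q l Λ m D) {r s i : ℕ} (hr : r ≤ i) (his : i < s)
    (hs : s < N) (j : Fin d) :
    q j '' Set.Ico (m i j) (m (i + 1) j) ⊆ q j '' Set.Ico (m r j) (m s j) :=
  Set.image_mono (Set.Ico_subset_Ico (h.mono_le hr (by omega) j) (h.mono_le his hs j))

theorem Rungs.grid (h : Rungs G d (n * n + 1) q l Λ m D) {p : ℕ → Fin d}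
    (hp : ∀ i < n, ∀ j < n, p i = p j → i = j) (hadj : ∀ i, i + 1 < n → Λ.Adj (p i) (p (i + 1))) :
    HasMinor (pathGraph n □ pathGraph n) G := by
  classical
  let seg : ℕ → ℕ → Set V := fun r a => q (p a) '' Set.Ico (m (r * n) (p a)) (m ((r + 1) * n) (p a))
  let E : ℕ → ℕ → Set V := fun r a => if a + 1 < n then D (r * n + a) (p a) (p (a + 1)) else ∅
  have hrn : ∀ r < n, (r + 1) * n < n * n + 1 := fun r hr =>
    Nat.lt_succ_of_le (Nat.mul_le_mul_right _ hr)
  have hlink : ∀ r < n, ∀ a, a + 1 < n → LinkedBy G (E r a) (seg r a) (seg r (a + 1)) := by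
    intro r hr a ha
    have h1 := hrn r hr
    rw [add_mul, one_mul] at h1
    have h2 := h.joined (r * n + a) (by omega) _ _ (hadj a ha)
    simp only [E, ha, if_true]
    exact h2.mono (h.seg_mono (by omega) (by rw [add_mul, one_mul]; omega) (hrn r hr) _)
      (h.seg_mono (by omega) (by rw [add_mul, one_mul]; omega) (hrn r hr) _)
  have hsegd : ∀ r < n, ∀ r' < n, ∀ a < n, ∀ a' < n, (r, a) ≠ (r', a') →
      Disjoint (seg r a) (seg r' a') := by
    intro r hr r' hr' a ha a' ha' hne
    refine h.disjoint_seg (hrn r hr) (hrn r' hr') (fun hpp => ?_)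
      (Nat.mul_le_mul_right _ (Nat.le_succ r)) (Nat.mul_le_mul_right _ (Nat.le_succ r'))
    have haa := hp a ha a' ha' hpp
    have : r ≠ r' := fun hrr => hne (by rw [hrr, haa])
    rcases lt_or_gt_of_ne this with h | h
    · exact Or.inl (Nat.mul_le_mul_right _ h)
    · exact Or.inr (Nat.mul_le_mul_right _ h)
  have hsegE : ∀ r < n, ∀ r' a a', Disjoint (seg r a) (E r' a') := by
    intro r hr r' a a'
    dsimp only [E]
    split_ifs
    · exact h.disjoint_off (hrn r hr) _ _ _ _ _
    · exact disjoint_bot_right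
  have hEd : ∀ r r', ∀ a < n, ∀ a' < n, (r, a) ≠ (r', a') → Disjoint (E r a) (E r' a') := by
    intro r r' a ha a' ha' hne
    dsimp only [E]
    split_ifs
    · refine h.disj _ _ _ _ _ _ fun heq => hne ?_
      have h1 : r = r' := by
        have := congrArg (· / n) heq
        simpa [Nat.mul_comm _ n, Nat.mul_add_div (by omega : 0 < n), Nat.div_eq_of_lt ha,
          Nat.div_eq_of_lt ha'] using this
      subst h1
      rw [Nat.add_left_cancel heq]
    · exact disjoint_bot_right
    · exact disjoint_bot_left
    · exact disjoint_bot_left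
  have hstep : ∀ r < n, ∀ a < n, r + 1 < n → Touch G (seg r a) (seg (r + 1) a) := by
    intro r hr a ha hr1
    have h1 := h.mono (r * n) ((r + 1) * n) (Nat.mul_lt_mul_of_pos_right (by omega) (by omega))
      (hrn r hr) (p a)
    have h2 := h.mono ((r + 1) * n) ((r + 1 + 1) * n)
      (Nat.mul_lt_mul_of_pos_right (by omega) (by omega)) (hrn _ hr1) (p a)
    have h3 := h.le _ (hrn r hr) (p a)
    refine ⟨_, ⟨m ((r + 1) * n) (p a) - 1, ⟨by omega, by omega⟩, rfl⟩, _,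
      ⟨m ((r + 1) * n) (p a), ⟨by omega, by omega⟩, rfl⟩, ?_⟩
    have := (h.fam.path (p a)).adj (m ((r + 1) * n) (p a) - 1) (by omega)
    rwa [Nat.sub_add_cancel (by omega)] at this
  refine ⟨fun x => seg x.1 x.2 ∪ E x.1 x.2, fun x => ?_, fun x y hxy => ?_, fun x y hxy => ?_⟩
  · have hc : Conn G (seg x.1 x.2) := h.conn
      (Nat.mul_lt_mul_of_pos_right (by omega) (by have := x.1.2; omega)) (hrn _ x.1.2) _
    by_cases ha : (x.2 : ℕ) + 1 < n
    · exact (hlink _ x.1.2 _ ha).conn hc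
    · simpa [E, ha] using hc
  · have hne : ((x.1 : ℕ), (x.2 : ℕ)) ≠ ((y.1 : ℕ), (y.2 : ℕ)) := fun h => hxy (by
      simp only [Prod.mk.injEq, Fin.val_inj] at h
      exact Prod.ext h.1 h.2)
    rw [Set.disjoint_union_left, Set.disjoint_union_right, Set.disjoint_union_right]
    exact ⟨⟨hsegd _ x.1.2 _ y.1.2 _ x.2.2 _ y.2.2 hne, hsegE _ x.1.2 _ _ _⟩,
      (hsegE _ y.1.2 _ _ _).symm, hEd _ _ _ x.2.2 _ y.2.2 hne⟩
  · rw [boxProd_adj, pathGraph_adj, pathGraph_adj] at hxy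
    have key : ∀ x y : Fin n × Fin n, ((x.1 : ℕ) + 1 = y.1 ∧ x.2 = y.2) ∨
        ((x.2 : ℕ) + 1 = y.2 ∧ x.1 = y.1) →
        Touch G (seg x.1 x.2 ∪ E x.1 x.2) (seg y.1 y.2 ∪ E y.1 y.2) := by
      rintro ⟨x1, x2⟩ ⟨y1, y2⟩ (⟨h1, h2⟩ | ⟨h1, h2⟩) <;> dsimp only at h1 h2 ⊢ <;> subst h2
      · have := hstep x1 x1.2 x2 x2.2 (by have := y1.2; omega)
        rw [h1] at this
        exact this.mono Set.subset_union_left Set.subset_union_left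
      · have := (hlink x1 x1.2 x2 (by have := y2.2; omega)).touch
        rw [h1] at this
        exact this.mono le_rfl Set.subset_union_left
    rcases hxy with ⟨h1 | h1, h2⟩ | ⟨h1 | h1, h2⟩
    · exact key x y (Or.inl ⟨h1, h2⟩)
    · exact (key y x (Or.inl ⟨h1, h2.symm⟩)).symm
    · exact key x y (Or.inr ⟨h1, h2⟩)
    · exact (key y x (Or.inr ⟨h1, h2.symm⟩)).symm

theorem Rungs.complete (h : Rungs G d (n * n + 1) q l Λ m D) {j : Fin d} {f : Fin n → Fin d}
    (hf : Function.Injective f) (hadj : ∀ b, Λ.Adj j (f b)) :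
    HasMinor (⊤ : SimpleGraph (Fin n)) G := by
  rcases Nat.eq_zero_or_pos n with rfl | hn
  · exact ⟨fun _ => ∅, fun w => w.elim0, fun w => w.elim0, fun w => w.elim0⟩
  let seg : Fin n → Set V := fun r => q j '' Set.Ico (m (r * n) j) (m ((r + 1) * n) j)
  let E : Fin n → Fin n → Set V := fun a b => D (a * n + b) j (f b)
  let leaf : Fin n → Set V := fun b => q (f b) '' Set.Ico (m 0 (f b)) (m (n * n) (f b))
  have hrn : ∀ r : Fin n, ((r : ℕ) + 1) * n < n * n + 1 := fun r =>
    Nat.lt_succ_of_le (Nat.mul_le_mul_right _ r.2)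
  have hlink : ∀ a b, LinkedBy G (E a b) (seg a) (leaf b) := fun a b => by
    have h1 := hrn a
    rw [add_mul, one_mul] at h1
    have hb := b.2
    have h2 := h.joined (a * n + b) (by omega) _ _ (hadj b)
    exact h2.mono (h.seg_mono (by omega) (by rw [add_mul, one_mul]; omega) (hrn a) _)
      (h.seg_mono (Nat.zero_le _) (by omega) (by omega) _)
  have hseg : ∀ a : Fin n, Conn G (seg a) := fun a =>
    h.conn (Nat.mul_lt_mul_of_pos_right (by omega) hn) (hrn a) _
  have hleaf : ∀ b, Conn G (leaf b) := fun b => h.conn (Nat.mul_pos hn hn) (by omega) _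
  have hstar : ∀ a, Conn G (seg a ∪ ⋃ b, (seg a ∪ E a b)) := fun a =>
    (hseg a).union_iUnion (fun b => (hlink a b).conn (hseg a)) fun b => Or.inl (by
      rw [Set.inter_eq_left.2 Set.subset_union_left]
      exact (hseg a).1)
  have htouch : ∀ a b, Touch G (seg a ∪ ⋃ b, (seg a ∪ E a b)) (leaf b) := fun a b =>
    (hlink a b).touch.mono ((Set.subset_iUnion (fun b => seg a ∪ E a b) b).trans
      Set.subset_union_right) le_rfl
  have hjf : ∀ b, j ≠ f b := fun b => (hadj b).ne
  refine ⟨fun a => (seg a ∪ ⋃ b, (seg a ∪ E a b)) ∪ leaf a, fun a =>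
    (hstar a).union_touch (hleaf a) (htouch a a), fun a a' haa => ?_, fun a a' _ =>
    (htouch a a').mono Set.subset_union_left Set.subset_union_right⟩
  have hne : (a : ℕ) ≠ a' := Fin.val_injective.ne haa
  have hss : Disjoint (seg a) (seg a') := h.disjoint_seg (hrn a) (hrn a') (fun _ => by
    rcases lt_or_gt_of_ne hne with h | h
    · exact Or.inl (Nat.mul_le_mul_right _ h)
    · exact Or.inr (Nat.mul_le_mul_right _ h)) (Nat.mul_le_mul_right _ (Nat.le_succ _))
      (Nat.mul_le_mul_right _ (Nat.le_succ _))
  have hsl : ∀ a b : Fin n, Disjoint (seg a) (leaf b) := fun a b =>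
    h.disjoint_seg (hrn a) (by omega) (fun h => absurd h (hjf b))
      (Nat.mul_le_mul_right _ (Nat.le_succ _)) (Nat.zero_le _)
  have hll : Disjoint (leaf a) (leaf a') := h.disjoint_seg (by omega) (by omega)
    (fun h => absurd (hf h) haa) (Nat.zero_le _) (Nat.zero_le _)
  have hsE : ∀ a b c, Disjoint (seg a) (E b c) := fun a b c => h.disjoint_off (hrn a) _ _ _ _ _
  have hlE : ∀ a b c, Disjoint (leaf a) (E b c) := fun a b c =>
    h.disjoint_off (by omega) _ _ _ _ _
  have hEE : ∀ b c, Disjoint (E a b) (E a' c) := fun b c => h.disj _ _ _ _ _ _ fun heq => by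
    have := congrArg (· / n) heq
    refine hne ?_
    simpa [Nat.mul_comm _ n, Nat.mul_add_div hn, Nat.div_eq_of_lt b.2,
          Nat.div_eq_of_lt c.2] using this
  have hEs := fun a b c => (hsE a b c).symm
  have hEl := fun a b c => (hlE a b c).symm
  have hls := fun a b => (hsl a b).symm
  simp [Set.disjoint_union_left, Set.disjoint_union_right, Set.disjoint_iUnion_left,
    Set.disjoint_iUnion_right, hss, hsl, hls, hll, hsE, hlE, hEs, hEl, hEE]

/-- A ladder with many rungs contains one whose rungs all link the same pairs of paths. -/
theorem exists_rungs (d n : ℕ) (hd : 0 < d) : ∃ N, ∀ (V : Type u) (G : SimpleGraph V) q l P,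
    Ladder G d N q l P → ∃ Λ m D, Conn Λ Set.univ ∧ Rungs G d n q l Λ m D := by
  classical
  have := Fintype.ofFinite (SimpleGraph (Fin d))
  refine ⟨Fintype.card (SimpleGraph (Fin d)) * n + 1, fun V G q l P h => ?_⟩
  let Q : Fin d → Set V := fun j => q j '' Set.Icc 0 (l j)
  have hQd : ∀ i j, i ≠ j → Disjoint (Q i) (Q j) := by
    intro i j hij
    rw [Set.disjoint_left]
    rintro _ ⟨x, hx, rfl⟩ ⟨y, hy, hxy⟩
    exact hij (h.fam.disj _ _ _ _ hx.2 hy.2 hxy.symm)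
  have hQm : ∀ i j, (Q j ∩ P i).Nonempty := fun i j => by
    obtain ⟨a, ha, haP⟩ := h.meet i j
    exact ⟨_, ⟨a, by simpa using ha, rfl⟩, haP⟩
  let Λ : Fin (Fintype.card (SimpleGraph (Fin d)) * n + 1) → SimpleGraph (Fin d) := fun i =>
    { Adj := fun j j' => j ≠ j' ∧ ∃ D ⊆ P i \ ⋃ j, Q j, LinkedBy G D (Q j ∩ P i) (Q j' ∩ P i)
      symm := ⟨fun _ _ ⟨h, D, hD, h'⟩ => ⟨h.symm, D, hD, h'.symm⟩⟩
      loopless := ⟨fun _ h => h.1 rfl⟩ }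
  have hΛ : ∀ i, Conn (Λ i) Set.univ := fun i => by
    have hc : cmpt (Λ i) Set.univ ⟨0, hd⟩ = Set.univ := by
      by_contra hne
      obtain ⟨j, hj, j', hj', D, hD, hl⟩ :=
        (h.conn i).exists_linkedBy (hQm i) hQd ⟨_, mem_cmpt _⟩ hne
      exact hj' (cmpt_closed hj trivial trivial ⟨fun h => hj' (h ▸ hj), D, hD, hl⟩)
    exact hc ▸ cmpt_conn _
  have hD : ∀ i j j', ∃ D ⊆ P i \ ⋃ j, Q j, (Λ i).Adj j j' →
      LinkedBy G D (Q j ∩ P i) (Q j' ∩ P i) := fun i j j' => by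
    by_cases hadj : (Λ i).Adj j j'
    · obtain ⟨-, D, hD, hl⟩ := hadj
      exact ⟨D, hD, fun _ => hl⟩
    · exact ⟨∅, Set.empty_subset _, fun h => absurd h hadj⟩
  choose D hDs hDl using hD
  have hm : ∀ i j, ∃ a ≤ l j, q j a ∈ P i ∧ ∀ b, q j b ∈ P i → b ≤ l j → a ≤ b := fun i j =>
    ⟨Nat.find (h.meet i j), (Nat.find_spec (h.meet i j)).1, (Nat.find_spec (h.meet i j)).2,
      fun b hb hbl => Nat.find_min' _ ⟨hbl, hb⟩⟩
  choose m hml hmP hmin using hm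
  obtain ⟨Γ, -, hΓ⟩ := Finset.exists_lt_card_fiber_of_mul_lt_card_of_maps_to
    (s := Finset.univ) (t := Finset.univ) (f := Λ) (n := n) (by simp) (by simp)
  let e := Finset.orderEmbOfCardLe _ hΓ.le
  have he : ∀ i, Λ (e i) = Γ := fun i => by simpa using Finset.orderEmbOfCardLe_mem _ hΓ.le i
  have hmm : ∀ i i', i < i' → ∀ j, m i j < m i' j := fun i i' hi j =>
    h.lt i i' hi j _ (hml _ _) _ (hml _ _) (hmP _ _) (hmP _ _)
  have hQI : ∀ i i', i < i' → ∀ j, Q j ∩ P i ⊆ q j '' Set.Ico (m i j) (m i' j) := by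
    rintro i i' hi j _ ⟨⟨a, ha, rfl⟩, haP⟩
    exact ⟨a, ⟨hmin _ _ _ haP ha.2, h.lt i i' hi j _ ha.2 _ (hml _ _) haP (hmP _ _)⟩, rfl⟩
  obtain ⟨c, hc⟩ := Finset.card_pos.1 ((Nat.zero_le _).trans_lt hΓ)
  refine ⟨Γ, fun i j => if hi : i < n then m (e ⟨i, hi⟩) j else 0,
    fun i j j' => if hi : i < n then D (e ⟨i, hi⟩) j j' else ∅, ?_, h.fam, ?_, ?_, ?_, ?_, ?_⟩
  · exact (Finset.mem_filter.1 hc).2 ▸ hΛ c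
  · intro i hi j
    simpa only [hi, dite_true] using hml _ _
  · intro i i' hii' hi' j
    simpa only [hii'.trans hi', hi', dite_true] using hmm _ _ (e.strictMono hii') j
  · intro i hi j j' hadj
    have hi' : i < n := by omega
    simp only [hi, hi', dite_true]
    have hlt : e ⟨i, hi'⟩ < e ⟨i + 1, hi⟩ := e.strictMono (Nat.lt_succ_self i)
    exact (hDl _ _ _ (by rwa [he])).mono (hQI _ _ hlt _) (hQI _ _ hlt _)
  · intro i j j' k a ha hmem
    split_ifs at hmem with hi
    · exact (hDs _ _ _ hmem).2 (Set.mem_iUnion.2 ⟨k, a, by simpa using ha, rfl⟩)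
    · exact hmem
  · intro i i' j j' k k' hii'
    split_ifs with hi hi'
    · exact (h.disj _ _ (e.injective.ne (by simpa using hii'))).mono
        ((hDs _ _ _).trans Set.sdiff_subset) ((hDs _ _ _).trans Set.sdiff_subset)
    · exact disjoint_bot_right
    · exact disjoint_bot_left
    · exact disjoint_bot_left

theorem exists_minor_of_ladder (n : ℕ) : ∃ d N, ∀ (V : Type u) (G : SimpleGraph V) q l P,
    Ladder G d N q l P →
    HasMinor (⊤ : SimpleGraph (Fin n)) G ∨ HasMinor (pathGraph n □ pathGraph n) G := by
  obtain ⟨d, hd0, hd⟩ := exists_path_or_star n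
  obtain ⟨N, hN⟩ := exists_rungs.{u} d (n * n + 1) hd0
  refine ⟨d, N, fun V G q l P h => ?_⟩
  obtain ⟨Λ, m, D, hΛ, hR⟩ := hN V G q l P h
  rcases hd Λ hΛ with ⟨p, hp, hadj⟩ | ⟨j, f, hf, hadj⟩
  · exact Or.inr (hR.grid hp hadj)
  · exact Or.inl (hR.complete hf hadj)

end Rungs

/-- Graphs excluding a complete graph and a grid have bounded elimination width. -/
theorem exists_elim (n : ℕ) : ∃ w, ∀ (V : Type u) [Finite V] (G : SimpleGraph V),
    ¬ HasMinor (⊤ : SimpleGraph (Fin n)) G → ¬ HasMinor (pathGraph n □ pathGraph n) G →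
    Elim G w Set.univ := by
  classical
  obtain ⟨d, N, hdN⟩ := exists_minor_of_ladder.{u} n
  obtain ⟨k, hk⟩ := exists_select.{u} d N (n * n)
  refine ⟨(n + 1) * (1 + 3 * k) + k, fun V _ G hK hg => ?_⟩
  refine elim_of_not_mesh (c := n) le_rfl ?_
  rintro ⟨C, T, hM⟩
  have hbad : ∀ G' ≤ G, ¬ ∃ q l P, Ladder G' d N q l P := by
    rintro G' hG' ⟨q, l, P, h⟩
    rcases hdN V G' q l P h with h | h
    · exact hK (h.mono hG')
    · exact hg (h.mono hG')
  have hle := awayGraph_le G Cᶜ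
  let I : Finset (Fin n × Fin n) := Finset.univ.filter fun x => x.1 ≠ x.2
  rcases hk V (awayGraph G Cᶜ) (Fin n × Fin n) I (fun x => {v ∈ C | Touch G {v} (T x.1)})
    (fun x => {v ∈ C | Touch G {v} (T x.2)})
    ((Finset.card_filter_le _ _).trans (by simp)) (by
      intro x hx
      obtain ⟨D, hD, hDd⟩ := hM.link x.1 x.2 (by simpa [I] using hx)
      refine ⟨D, fun a => (hD a).1.awayGraph (Set.disjoint_compl_right_iff_subset.2 (hD a).2.1),
        hDd, fun a => ?_⟩
      obtain ⟨-, h1, ⟨y, hy, z, hz, hyz⟩, ⟨y', hy', z', hz', hyz'⟩⟩ := hD a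
      exact ⟨⟨y, hy, h1 hy, y, rfl, z, hz, hyz⟩, ⟨y', hy', h1 hy', y', rfl, z', hz', hyz'⟩⟩)
    with ⟨D, hD, hDd⟩ | h
  · have hDC : ∀ x ∈ I, D x ⊆ C := fun x hx => by
      obtain ⟨h1, ⟨y, hy, hyC, -⟩, -⟩ := hD x hx
      exact Set.disjoint_compl_right_iff_subset.1
        (h1.disjoint_of_awayGraph hy (fun h => h hyC))
    have hDT : ∀ x ∈ I, Touch G (D x) (T x.1) ∧ Touch G (D x) (T x.2) := fun x hx => by
      obtain ⟨-, ⟨y, hy, -, h⟩, ⟨z, hz, -, h'⟩⟩ := hD x hx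
      exact ⟨h.mono (by simpa using hy) le_rfl, h'.mono (by simpa using hz) le_rfl⟩
    refine hK ⟨fun i => T i ∪ ⋃ j : {j // i < j}, D (i, j), fun i => ?_, fun i j hij => ?_,
      fun i j hij => ?_⟩
    · refine (hM.conn i).union_iUnion (fun j => ?_) fun j => Or.inr ?_
      · exact (hD (i, j.1) (by simpa [I] using j.2.ne)).1.mono_graph hle
      · exact (hDT (i, j.1) (by simpa [I] using j.2.ne)).1.symm
    · have hTD : ∀ i x, x ∈ I → Disjoint (T i) (D x) := fun i x hx =>
        (hM.off i).mono_right (hDC x hx)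
      rw [Set.disjoint_union_left, Set.disjoint_union_right, Set.disjoint_union_right,
        Set.disjoint_iUnion_left, Set.disjoint_iUnion_right, Set.disjoint_iUnion_left]
      refine ⟨⟨hM.disj i j hij, fun k => hTD _ _ (by simpa [I] using k.2.ne)⟩,
        fun k => (hTD _ _ (by simpa [I] using k.2.ne)).symm, fun k => ?_⟩
      rw [Set.disjoint_iUnion_right]
      exact fun k' => hDd _ (by simpa [I] using k.2.ne) _ (by simpa [I] using k'.2.ne)
        (by simp [hij])
    · have key : ∀ i j, i < j → Touch G (T i ∪ ⋃ j : {j // i < j}, D (i, j))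
          (T j ∪ ⋃ k : {k // j < k}, D (j, k)) := fun i j h =>
        (hDT (i, j) (by simpa [I] using h.ne)).2.mono
          ((Set.subset_iUnion (fun j : {j // i < j} => D (i, j)) ⟨j, h⟩).trans
            Set.subset_union_right) Set.subset_union_left
      rcases lt_or_gt_of_ne hij.ne with h | h
      · exact key i j h
      · exact (key j i h).symm
  · exact hbad _ hle h

/-! ### Sweeps -/

section Sweep

variable {V : Type u} {A A' J : Set V} {E E' F : V → V → Prop} {w w' w'' p q : List V}

/-- `x` and `y` are consecutive letters of the word `w`. -/
def Consec (w : List V) (x y : V) : Prop := [x, y] <:+: w ∨ [y, x] <:+: w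

theorem Consec.mono {x y : V} (h : Consec w x y) (hw : w <:+: w') : Consec w' x y :=
  h.imp (fun h => h.trans hw) fun h => h.trans hw

theorem Consec.symm {x y : V} (h : Consec w x y) : Consec w y x := Or.symm h

/-- A sweep leads from the word `w` to the word `w'` by deleting letters and inserting fresh
letters from `A`; every pair in the relation `E` is consecutive at some stage. -/
inductive Sweep : Set V → List V → List V → (V → V → Prop) → Prop
  | refl {A : Set V} {w : List V} {E : V → V → Prop} (hw : w.Nodup) (hA : ∀ x ∈ w, x ∉ A) (hE : ∀ x y, E x y → Consec w x y) :
      Sweep A w w E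
  | del {A : Set V} {p : List V} {a : V} {q w' : List V} {E F : V → V → Prop}
      (hw : (p ++ a :: q).Nodup) (ha : a ∉ A) (hne : p ++ q ≠ [])
      (h : Sweep A (p ++ q) w' E) (hF : ∀ x y, F x y → Consec (p ++ a :: q) x y ∨ E x y) :
      Sweep A (p ++ a :: q) w' F
  | ins {A : Set V} {p : List V} {a : V} {q w' : List V} {E F : V → V → Prop} (ha : a ∈ A) (hne : p ++ q ≠ [])
      (h : Sweep (A \ {a}) (p ++ a :: q) w' E)
      (hF : ∀ x y, F x y → Consec (p ++ q) x y ∨ E x y) :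
      Sweep A (p ++ q) w' F

theorem Sweep.nodup (h : Sweep A w w' E) : w.Nodup := by
  induction h with
  | refl hw => exact hw
  | del hw => exact hw
  | ins _ _ _ _ ih => exact (List.nodup_middle.1 ih).of_cons

theorem Sweep.not_mem (h : Sweep A w w' E) : ∀ x ∈ w, x ∉ A := by
  induction h with
  | refl _ hA => exact hA
  | del _ ha _ _ _ ih =>
    intro x hx
    rcases List.mem_append.1 hx with hx | hx
    · exact ih x (by simp [hx])
    · rcases List.mem_cons.1 hx with rfl | hx
      · exact ha
      · exact ih x (by simp [hx])
  | @ins A p a q w' E F ha _ h _ ih =>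
    intro x hx hxA
    refine ih x ?_ ⟨hxA, ?_⟩
    · rcases List.mem_append.1 hx with hx | hx <;> simp [hx]
    · rintro rfl
      exact (List.nodup_cons.1 (List.nodup_middle.1 h.nodup)).1 hx

theorem Sweep.mono (h : Sweep A w w' E) (hA : A ⊆ A') (hw : ∀ x ∈ w, x ∉ A')
    (hE : ∀ x y, E' x y → Consec w x y ∨ E x y) : Sweep A' w w' E' := by
  induction h generalizing A' E' with
  | refl h1 h2 h3 => exact .refl h1 hw fun x y h => (hE x y h).elim id (h3 x y)
  | @del A p a q w' E F h1 ha hne h hF ih =>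
    refine .del h1 (hw a (by simp)) hne (ih hA (fun x hx => hw x ?_) fun x y h => Or.inr h)
      fun x y h => (hE x y h).elim Or.inl (hF x y)
    rcases List.mem_append.1 hx with hx | hx <;> simp [hx]
  | @ins A p a q w' E F ha hne h hF ih =>
    refine .ins (hA ha) hne (ih (Set.sdiff_subset_sdiff_left hA) (fun x hx => ?_)
      fun x y h => Or.inr h) fun x y h => (hE x y h).elim Or.inl (hF x y)
    rintro ⟨hxA, hxa⟩
    refine hw x ?_ hxA
    rcases List.mem_append.1 hx with hx | hx
    · simp [hx]
    · rcases List.mem_cons.1 hx with rfl | hx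
      · exact absurd rfl hxa
      · simp [hx]

theorem Sweep.trans (h : Sweep A w w' E) (h' : Sweep A' w' w'' E') (hw : ∀ x ∈ w, x ∉ A')
    (hA : Disjoint A A') : Sweep (A ∪ A') w w'' fun x y => E x y ∨ E' x y := by
  induction h with
  | refl h1 h2 h3 =>
    exact h'.mono Set.subset_union_right
      (fun x hx h => h.elim (h2 x hx) (hw x hx)) fun x y h => h.imp (h3 x y) id
  | @del A p a q w' E F h1 ha hne h hF ih =>
    refine .del h1 (fun h => h.elim ha (hw a (by simp))) hne (ih h' (fun x hx => hw x ?_) hA)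
      fun x y h => ?_
    · rcases List.mem_append.1 hx with hx | hx <;> simp [hx]
    · rcases h with h | h
      · exact (hF x y h).imp id Or.inl
      · exact Or.inr (Or.inr h)
  | @ins A p a q w' E F ha hne h hF ih =>
    have haA' : a ∉ A' := Set.disjoint_left.1 hA ha
    have := ih h' (fun x hx => ?_) (hA.mono_left Set.sdiff_subset)
    · refine .ins (Or.inl ha) hne (this.mono (E' := fun x y => E x y ∨ E' x y) ?_ ?_
        fun x y h => Or.inr h) fun x y h => ?_
      · rintro x (hx | hx)
        · exact ⟨Or.inl hx.1, hx.2⟩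
        · exact ⟨Or.inr hx, fun h => haA' (h ▸ hx)⟩
      · rintro x hx ⟨h1 | h1, h2⟩
        · exact h.not_mem x hx ⟨h1, h2⟩
        · exact this.not_mem x hx (Or.inr h1)
      · rcases h with h | h
        · exact (hF x y h).imp id Or.inl
        · exact Or.inr (Or.inr h)
    · rcases List.mem_append.1 hx with hx | hx
      · exact hw x (by simp [hx])
      · rcases List.mem_cons.1 hx with rfl | hx
        · exact haA'
        · exact hw x (by simp [hx])

theorem Sweep.frame (h : Sweep A w w' E) (hpq : (p ++ q).Nodup)
    (hw : ∀ x ∈ p ++ q, x ∉ w ∧ x ∉ A) : Sweep A (p ++ w ++ q) (p ++ w' ++ q) E := by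
  have key : ∀ {w : List V}, w.Nodup → (∀ x ∈ p ++ q, x ∉ w) → (p ++ w ++ q).Nodup := by
    intro w h1 h2
    have : (w ++ (p ++ q)).Nodup :=
      List.nodup_append'.2 ⟨h1, hpq, fun x hx hx' => h2 x hx' hx⟩
    refine (List.Perm.nodup_iff ?_).1 this
    rw [List.append_assoc]
    exact List.perm_append_comm_assoc _ _ _
  induction h with
  | refl h1 h2 h3 =>
    refine .refl (key h1 fun x hx => (hw x hx).1) (fun x hx => ?_) fun x y h =>
      (h3 x y h).mono (List.infix_append _ _ _)
    simp only [List.mem_append] at hx hw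
    rcases hx with (hx | hx) | hx
    · exact (hw x (Or.inl hx)).2
    · exact h2 x hx
    · exact (hw x (Or.inr hx)).2
  | @del A p' a q' w' E F h1 ha hne h hF ih =>
    have := ih fun x hx => ⟨fun h => (hw x hx).1 ?_, (hw x hx).2⟩
    · have hk := key h1 fun x hx => (hw x hx).1
      have e1 : p ++ (p' ++ a :: q') ++ q = (p ++ p') ++ a :: (q' ++ q) := by simp
      have e2 : p ++ (p' ++ q') ++ q = (p ++ p') ++ (q' ++ q) := by simp
      rw [e1] at hk ⊢
      rw [e2] at this
      refine .del hk ha ?_ this fun x y h => (hF x y h).imp (fun h => h.mono ?_) id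
      · intro h
        apply hne
        simp_all
      · rw [← e1]
        exact List.infix_append _ _ _
    · rcases List.mem_append.1 h with h | h <;> simp [h]
  | @ins A p' a q' w' E F ha hne h hF ih =>
    have := ih fun x hx => ⟨fun h => ?_, fun h => (hw x hx).2 h.1⟩
    · have e1 : p ++ (p' ++ a :: q') ++ q = (p ++ p') ++ a :: (q' ++ q) := by simp
      have e2 : p ++ (p' ++ q') ++ q = (p ++ p') ++ (q' ++ q) := by simp
      rw [e1] at this
      rw [e2]
      refine .ins ha ?_ this fun x y h => (hF x y h).imp (fun h => h.mono ?_) id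
      · intro h
        apply hne
        simp_all
      · rw [← e2]
        exact List.infix_append _ _ _
    · rcases List.mem_append.1 h with h | h
      · exact (hw x hx).1 (by simp [h])
      · rcases List.mem_cons.1 h with rfl | h
        · exact (hw x hx).2 ha
        · exact (hw x hx).1 (by simp [h])

theorem Sweep.reverse (h : Sweep A w w' E) : Sweep A w.reverse w'.reverse E := by
  have key : ∀ {w : List V} {x y : V}, Consec w x y → Consec w.reverse x y := by
    rintro w x y (h | h)
    · exact Or.inr (by simpa using h.reverse)
    · exact Or.inl (by simpa using h.reverse)
  induction h with
  | refl h1 h2 h3 =>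
    exact .refl (List.nodup_reverse.2 h1) (by simpa using h2) fun x y h => key (h3 x y h)
  | @del A p' a q' w' E F h1 ha hne h hF ih =>
    have e : (p' ++ a :: q').reverse = q'.reverse ++ a :: p'.reverse := by simp
    have h2 := List.nodup_reverse.2 h1
    rw [e] at h2 ⊢
    refine .del h2 ha (by simpa [and_comm] using hne) (by simpa using ih) fun x y h => ?_
    rw [← e]
    exact (hF x y h).imp key id
  | @ins A p' a q' w' E F ha hne h hF ih =>
    have e : (p' ++ q').reverse = q'.reverse ++ p'.reverse := by simp
    rw [e]
    refine .ins ha (by simpa [and_comm] using hne) (by simpa using ih) fun x y h => ?_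
    rw [← e]
    exact (hF x y h).imp key id

/-- A sweep can be interrupted where a given pair is consecutive. -/
theorem Sweep.interrupt (h : Sweep A w w' E) {x y : V} (hxy : E x y)
    (hJ : ∀ w₁ : List V, w₁.Nodup → Consec w₁ x y → (∀ z ∈ w₁, z ∉ J) → Sweep J w₁ w₁ F)
    (hw : ∀ z ∈ w, z ∉ J) (hAJ : Disjoint A J) :
    Sweep (A ∪ J) w w' fun x y => E x y ∨ F x y := by
  induction h with
  | @refl A w E h1 h2 h3 =>
    refine ((Sweep.refl h1 h2 h3).trans (hJ _ h1 (h3 x y hxy) hw) hw hAJ)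
  | @del A p a q w' E G h1 ha hne h hF ih =>
    by_cases hc : Consec (p ++ a :: q) x y
    · rw [Set.union_comm]
      refine ((hJ _ h1 hc hw).trans (Sweep.del h1 ha hne h hF) ?_ hAJ.symm).mono le_rfl ?_
        fun x y h => Or.inr h.symm
      · exact (Sweep.del h1 ha hne h hF).not_mem
      · rintro z hz (h' | h')
        · exact hw z hz h'
        · exact (Sweep.del h1 ha hne h hF).not_mem z hz h'
    · refine .del h1 (fun h' => h'.elim ha (hw a (by simp))) hne
        (ih ((hF x y hxy).resolve_left hc) (fun z hz => hw z ?_) hAJ) fun x y h => ?_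
      · rcases List.mem_append.1 hz with h | h <;> simp [h]
      · rcases h with h | h
        · exact (hF x y h).imp id Or.inl
        · exact Or.inr (Or.inr h)
  | @ins A p a q w' E G ha hne h hF ih =>
    have hs := Sweep.ins ha hne h hF
    by_cases hc : Consec (p ++ q) x y
    · rw [Set.union_comm]
      refine ((hJ _ hs.nodup hc hw).trans hs hs.not_mem hAJ.symm).mono le_rfl ?_
        fun x y h => Or.inr h.symm
      rintro z hz (h' | h')
      · exact hw z hz h'
      · exact hs.not_mem z hz h'
    · have haJ : a ∉ J := Set.disjoint_left.1 hAJ ha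
      have h' : (A ∪ J) \ {a} = A \ {a} ∪ J := by
        rw [Set.union_sdiff_distrib, Set.sdiff_singleton_eq_self haJ]
      have hz : ∀ z ∈ p ++ a :: q, z ∉ J := by
        intro z hz
        rcases List.mem_append.1 hz with h | h
        · exact hw z (by simp [h])
        · rcases List.mem_cons.1 h with rfl | h
          · exact haJ
          · exact hw z (by simp [h])
      have h1 := ih ((hF x y hxy).resolve_left hc) hz (hAJ.mono_left Set.sdiff_subset)
      rw [← h'] at h1
      refine .ins (Or.inl ha) hne h1 fun x y h => ?_
      rcases h with h | h
      · exact (hF x y h).imp id Or.inl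
      · exact Or.inr (Or.inr h)

theorem Sweep.frame_pair {x y : V} (h : Sweep J [x, y] [x, y] F) (hw : w.Nodup)
    (hc : Consec w x y) (hJ : ∀ z ∈ w, z ∉ J) : Sweep J w w F := by
  have key : ∀ {x y : V}, Sweep J [x, y] [x, y] F → [x, y] <:+: w → Sweep J w w F := by
    rintro x y h ⟨p, q, rfl⟩
    have h1 : ([x, y] ++ (p ++ q)).Nodup := by
      refine (List.Perm.nodup_iff ?_).1 hw
      rw [List.append_assoc]
      exact List.perm_append_comm_assoc _ _ _
    rw [List.nodup_append'] at h1
    refine h.frame h1.2.1 fun z hz => ⟨fun h' => h1.2.2 h' hz, hJ z ?_⟩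
    simp only [List.mem_append] at hz ⊢
    tauto
  rcases hc with hc | hc
  · exact key h hc
  · exact key (by simpa using h.reverse) hc

theorem Sweep.splice {x y : V} (h : Sweep A w w' E) (hxy : E x y)
    (h' : Sweep J [x, y] [x, y] F) (hw : ∀ z ∈ w, z ∉ J) (hAJ : Disjoint A J) :
    Sweep (A ∪ J) w w' fun x y => E x y ∨ F x y :=
  h.interrupt hxy (fun _ h1 h2 h3 => h'.frame_pair h1 h2 h3) hw hAJ

theorem Sweep.frame_vertex {x y : V} (h : Sweep J [x, y] [x, y] F) (hw : w.Nodup)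
    (hx : x ∈ w) (hy : y ∉ w) (hJ : ∀ z ∈ w, z ∉ J) : Sweep (insert y J) w w F := by
  obtain ⟨p, q, rfl⟩ := List.append_of_mem hx
  have hyJ : y ∉ J := h.not_mem y (by simp)
  have h1 : ((p ++ [x]) ++ y :: q).Nodup := by
    rw [List.nodup_middle]
    refine List.nodup_cons.2 ⟨by simpa using hy, by simpa using hw⟩
  have h2 : Sweep J (p ++ [x] ++ y :: q) (p ++ [x] ++ y :: q) F := by
    refine h.frame_pair h1 (Or.inl ⟨p, q, by simp⟩) fun z hz => ?_
    by_cases hzy : z = y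
    · exact hzy ▸ hyJ
    · exact hJ z (by simp at hz ⊢; tauto)
  have h3 : Sweep ∅ (p ++ [x] ++ y :: q) (p ++ [x] ++ q) fun _ _ => False :=
    .del (E := fun _ _ => False) h1 (by simp) (by simp)
      (.refl (by simpa using hw) (by simp) (by simp)) (by simp)
  have h4 := h2.trans h3 (by simp) (by simp)
  have : p ++ x :: q = (p ++ [x]) ++ q := by simp
  rw [this]
  refine .ins (Set.mem_insert _ _) (by simp) ?_ fun x y h => Or.inr h
  refine h4.mono ?_ ?_ fun x y h => Or.inr (Or.inl h)
  · rw [Set.union_empty, Set.insert_sdiff_self_of_notMem hyJ]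
  · rw [Set.insert_sdiff_self_of_notMem hyJ]
    exact h2.not_mem

/-- A sweep of a part attached at a vertex can be incorporated. -/
theorem Sweep.attach {x y : V} (h : Sweep A w w' E) (h' : Sweep J [x, y] [x, y] F)
    (hne : w ≠ []) (hy : y ∉ w) (hyA : y ∉ A) (hw : ∀ z ∈ w, z ∉ J) (hAJ : Disjoint A J)
    (hx : x ∈ w ∨ (∃ z, E x z) ∨ x ∉ w ∧ x ∉ A) :
    Sweep (A ∪ J ∪ ({x, y} \ {z | z ∈ w})) w w' fun x y => E x y ∨ F x y := by
  have hyJ : y ∉ J := h'.not_mem y (by simp)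
  have hxJ : x ∉ J := h'.not_mem x (by simp)
  have hmono : ∀ {B : Set V}, B ⊆ A ∪ J ∪ ({x, y} \ {z | z ∈ w}) →
      (Sweep B w w' fun x y => E x y ∨ F x y) →
      Sweep (A ∪ J ∪ ({x, y} \ {z | z ∈ w})) w w' fun x y => E x y ∨ F x y := by
    intro B hB hs
    refine hs.mono hB (fun z hz => ?_) fun x y h => Or.inr h
    rintro ((h1 | h1) | h1)
    · exact h.not_mem z hz h1
    · exact hw z hz h1
    · exact h1.2 hz
  have hyd : y ∈ ({x, y} : Set V) \ {z | z ∈ w} := ⟨by simp, hy⟩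
  have hw2 : ∀ z ∈ w, z ∉ insert y J := by
    rintro z hz (rfl | hz')
    · exact hy hz
    · exact hw z hz hz'
  have hAJ2 : Disjoint A (insert y J) := Set.disjoint_insert_right.2 ⟨hyA, hAJ⟩
  have hin : A ∪ insert y J ⊆ A ∪ J ∪ ({x, y} \ {z | z ∈ w}) := by
    rintro z (hz | rfl | hz)
    · exact Or.inl (Or.inl hz)
    · exact Or.inr hyd
    · exact Or.inl (Or.inr hz)
  rcases hx with hx | ⟨z, hz⟩ | ⟨hx, hxA⟩
  · refine hmono hin ?_
    have := (h'.frame_vertex h.nodup hx hy hw).trans h h.not_mem hAJ2.symm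
    rw [Set.union_comm]
    refine this.mono le_rfl this.not_mem fun x y h => Or.inr h.symm
  · by_cases hzy : z = y
    · subst hzy
      exact hmono (Set.subset_union_left) (h.splice hz h' hw hAJ)
    refine hmono hin (h.interrupt hz (fun w₁ h1 h2 h3 => h'.frame_vertex h1 ?_ ?_ ?_) hw2 hAJ2)
    · rcases h2 with h2 | h2 <;> exact h2.subset (by simp)
    · exact fun hy => h3 y hy (Set.mem_insert _ _)
    · exact fun z hz h => h3 z hz (Set.mem_insert_of_mem _ h)
  · have hxy : x ≠ y := by
      rintro rfl
      exact absurd h'.nodup (by simp)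
    have hwx : (w ++ x :: []).Nodup := by
      rw [List.nodup_middle]
      exact List.nodup_cons.2 ⟨by simpa using hx, by simpa using h.nodup⟩
    have h1 : Sweep (insert y J) (w ++ x :: []) (w ++ x :: []) F := by
      refine h'.frame_vertex hwx (by simp) (by simpa [hy] using hxy.symm) fun z hz => ?_
      rcases List.mem_append.1 hz with hz | hz
      · exact hw z hz
      · rw [List.mem_singleton.1 hz]; exact hxJ
    have h2 : Sweep A (w ++ x :: []) w' E := by
      refine .del hwx hxA (by simpa using hne) ?_ fun x y h => Or.inr h
      simpa using h
    have h3 := h1.trans h2 h2.not_mem hAJ2.symm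
    have hxi : x ∉ insert y J ∪ A := by simp [hxy, hxJ, hxA]
    have h4 : Sweep (insert x (insert y J ∪ A)) (w ++ []) w' fun x y => F x y ∨ E x y := by
      refine .ins (Set.mem_insert _ _) (by simpa using hne) ?_ fun x y h => Or.inr h
      rw [Set.insert_sdiff_self_of_notMem hxi]
      exact h3
    rw [List.append_nil] at h4
    refine hmono ?_ (h4.mono le_rfl h4.not_mem fun x y h => Or.inr h.symm)
    rintro z (rfl | (rfl | hz) | hz)
    · exact Or.inr ⟨by simp, hx⟩
    · exact Or.inr hyd
    · exact Or.inl (Or.inr hz)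
    · exact Or.inl (Or.inl hz)

end Sweep

/-! ### From sweeps to grids -/

/-- The infinite quarter grid. -/
def quarterGrid : SimpleGraph (ℕ × ℕ) where
  Adj x y := (x.1 = y.1 ∧ (x.2 + 1 = y.2 ∨ y.2 + 1 = x.2)) ∨
    (x.2 = y.2 ∧ (x.1 + 1 = y.1 ∨ y.1 + 1 = x.1))
  symm := ⟨fun _ _ h => by omega⟩
  loopless := ⟨fun _ h => by omega⟩

/-- `g` restricts to a monotone surjection from `{0, …, m - 1}` to `{0, …, n - 1}`. -/
structure MonoSurj (g : ℕ → ℕ) (m n : ℕ) : Prop where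
  mono : ∀ i j, i ≤ j → j < m → g i ≤ g j
  lt : ∀ j < m, g j < n
  surj : ∀ t < n, ∃ j < m, g j = t

namespace MonoSurj

variable {g : ℕ → ℕ} {m n : ℕ} (h : MonoSurj g m n)

include h

theorem exists_step {t : ℕ} (ht : t + 1 < n) : ∃ j, j + 1 < m ∧ g j = t ∧ g (j + 1) = t + 1 := by
  classical
  obtain ⟨j₀, hj₀, h₀⟩ := h.surj t (by omega)
  have hex := h.surj (t + 1) ht
  obtain ⟨h1, h2⟩ := Nat.find_spec hex
  have h3 : j₀ < Nat.find hex := by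
    by_contra hc
    have := h.mono _ _ (not_lt.1 hc) hj₀
    omega
  refine ⟨Nat.find hex - 1, by omega, ?_, by rwa [Nat.sub_add_cancel (by omega)]⟩
  have h4 := h.mono j₀ (Nat.find hex - 1) (by omega) (by omega)
  have h5 := h.mono (Nat.find hex - 1) (Nat.find hex) (by omega) h1
  have h6 : ¬(Nat.find hex - 1 < m ∧ g (Nat.find hex - 1) = t + 1) := Nat.find_min hex (by omega)
  omega

theorem exists_cut (k : ℕ) : ∃ q ≤ m, ∀ j < m, j < q ↔ g j < k := by
  classical
  have hex : ∃ j, m ≤ j ∨ k ≤ g j := ⟨m, Or.inl le_rfl⟩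
  have hle : Nat.find hex ≤ m := Nat.find_min' hex (Or.inl le_rfl)
  refine ⟨Nat.find hex, hle, fun j hj => ⟨fun h' => ?_, fun h' => ?_⟩⟩
  · have := Nat.find_min hex h'
    omega
  · by_contra hc
    rcases Nat.find_spec hex with h1 | h1
    · omega
    · have := h.mono _ _ (not_lt.1 hc) hj
      omega

theorem reach_row {T : Set (ℕ × ℕ)} {i j j' : ℕ} (hj : j < m) (hj' : j' < m) (hg : g j = g j')
    (hT : ∀ k < m, g k = g j → (i, k) ∈ T) : ReachIn quarterGrid T (i, j) (i, j') := by
  have key : ∀ d j, j + d < m → g j = g (j + d) → (∀ k < m, g k = g j → (i, k) ∈ T) →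
      ReachIn quarterGrid T (i, j) (i, j + d) := by
    intro d
    induction d with
    | zero => exact fun j hj _ hT => .refl
    | succ d ih =>
      intro j hjd hg hT
      have h1 := h.mono j (j + d) (by omega) (by omega)
      have h2 := h.mono (j + d) (j + (d + 1)) (by omega) (by omega)
      exact (ih j (by omega) (by omega) hT).trans (.single (Or.inl ⟨rfl, Or.inl rfl⟩)
        (hT _ (by omega) (by omega)) (hT _ (by omega) (by omega)))
  rcases le_total j j' with hle | hle
  · obtain ⟨d, rfl⟩ := Nat.exists_eq_add_of_le hle
    exact key d j hj' hg hT
  · obtain ⟨d, rfl⟩ := Nat.exists_eq_add_of_le hle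
    exact (key d j' hj hg.symm (by rwa [← hg])).symm

/-- Lifting connections along a monotone surjection of columns. -/
theorem reach_lift {S : Set (ℕ × ℕ)} (hS : ∀ x ∈ S, x.2 < n) {x y : ℕ × ℕ} (hxS : x ∈ S)
    (hxy : ReachIn quarterGrid S x y) {j j' : ℕ} (hj : j < m) (hj' : j' < m) (hx : g j = x.2)
    (hy : g j' = y.2) :
    ReachIn quarterGrid {z | ∃ i, z.1 = i + 1 ∧ z.2 < m ∧ (i, g z.2) ∈ S}
      (x.1 + 1, j) (y.1 + 1, j') := by
  have hrow : ∀ z ∈ S, ∀ j < m, ∀ j' < m, g j = z.2 → g j' = z.2 →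
      ReachIn quarterGrid {z | ∃ i, z.1 = i + 1 ∧ z.2 < m ∧ (i, g z.2) ∈ S}
        (z.1 + 1, j) (z.1 + 1, j') := by
    intro z hz j hj j' hj' h1 h2
    exact h.reach_row hj hj' (h1.trans h2.symm) fun k hk h3 => ⟨z.1, rfl, hk, by rwa [h3, h1]⟩
  refine (hxy.closed (T := {y | y ∈ S ∧ ∀ j' < m, g j' = y.2 → ReachIn quarterGrid
    {z | ∃ i, z.1 = i + 1 ∧ z.2 < m ∧ (i, g z.2) ∈ S} (x.1 + 1, j) (y.1 + 1, j')})
    ⟨hxS, fun j' hj' h' => hrow x hxS j hj j' hj' hx h'⟩ ?_).2 j' hj' hy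
  rintro ⟨a, b⟩ ⟨habS, hab⟩ ⟨c, d⟩ hcdS hadj
  refine ⟨hcdS, fun j' hj' hd => ?_⟩
  have key : ∀ k < m, ∀ k' < m, g k = b → g k' = d →
      quarterGrid.Adj (a + 1, k) (c + 1, k') →
      ReachIn quarterGrid {z | ∃ i, z.1 = i + 1 ∧ z.2 < m ∧ (i, g z.2) ∈ S}
        (x.1 + 1, j) (c + 1, j') := fun k hk k' hk' h1 h2 h3 =>
    ((hab k hk h1).trans (.single h3 ⟨a, rfl, hk, by rwa [h1]⟩ ⟨c, rfl, hk', by rwa [h2]⟩)).trans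
      (hrow _ hcdS k' hk' j' hj' h2 hd)
  have hb := hS _ habS
  have hd' := hS _ hcdS
  dsimp only at hb hd' hd
  rcases hadj with ⟨h1, h2 | h2⟩ | ⟨h1, h2⟩ <;> dsimp only at h1 h2
  · obtain ⟨k, hk, h3, h4⟩ := h.exists_step (t := b) (by omega)
    exact key k (by omega) (k + 1) hk h3 (h4.trans h2) (Or.inl ⟨by simp [h1], Or.inl rfl⟩)
  · obtain ⟨k, hk, h3, h4⟩ := h.exists_step (t := d) (by omega)
    exact key (k + 1) hk k (by omega) (h4.trans h2) h3 (Or.inl ⟨by simp [h1], Or.inr rfl⟩)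
  · exact key j' hj' j' hj' (hd.trans h1.symm) hd (Or.inr ⟨rfl, by dsimp only; omega⟩)

end MonoSurj

section Layout

variable {V : Type u} {A A' : Set V} {E F : V → V → Prop} {w w' : List V}

/-- A labelling `l` of an `r × m` grid by letters with connected label classes, whose first row
spells the word `w` with repetitions, and in which pairs related by `E` are adjacent. -/
structure IsLayout (r m : ℕ) (l : ℕ → ℕ → V) (f : ℕ → ℕ) (A : Set V) (w : List V)
    (E : V → V → Prop) : Prop where
  pos : 0 < r
  surj : MonoSurj f m w.length
  top : ∀ j < m, w[f j]? = some (l 0 j)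
  mem : ∀ i < r, ∀ j < m, l i j ∈ w ∨ l i j ∈ A
  conn : ∀ i < r, ∀ j < m, ∀ i' < r, ∀ j' < m, l i j = l i' j' →
    ReachIn quarterGrid {x | x.1 < r ∧ x.2 < m ∧ l x.1 x.2 = l i j} (i, j) (i', j')
  adj : ∀ x y, E x y → ∃ i < r, ∃ j < m, ∃ i' < r, ∃ j' < m,
    quarterGrid.Adj (i, j) (i', j') ∧ l i j = x ∧ l i' j' = y

theorem MonoSurj.exists_consec {m : ℕ} {f : ℕ → ℕ} (hf : MonoSurj f m w.length) {l : ℕ → V}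
    (hl : ∀ j < m, w[f j]? = some (l j)) {x y : V} (h : Consec w x y) :
    ∃ j < m, ∃ j' < m, quarterGrid.Adj (0, j) (0, j') ∧ l j = x ∧ l j' = y := by
  have key : ∀ {x y : V}, [x, y] <:+: w → ∃ j, j + 1 < m ∧ l j = x ∧ l (j + 1) = y := by
    rintro x y ⟨p, q, rfl⟩
    obtain ⟨j, hj, h1, h2⟩ := hf.exists_step (t := p.length) (by simp)
    have h3 := hl j (by omega)
    have h4 := hl (j + 1) hj
    rw [h1] at h3
    rw [h2] at h4
    refine ⟨j, hj, ?_, ?_⟩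
    · simpa using h3.symm
    · simpa using h4.symm
  rcases h with h | h
  · obtain ⟨j, hj, h1, h2⟩ := key h
    exact ⟨j, by omega, j + 1, hj, Or.inl ⟨rfl, Or.inl rfl⟩, h1, h2⟩
  · obtain ⟨j, hj, h1, h2⟩ := key h
    exact ⟨j + 1, hj, j, by omega, Or.inl ⟨rfl, Or.inr rfl⟩, h2, h1⟩

/-- Adding a row on top of a layout whose columns have been duplicated. -/
def addRow (l₀ : ℕ → V) (l : ℕ → ℕ → V) (s : ℕ → ℕ) : ℕ → ℕ → V
  | 0, j => l₀ j
  | i + 1, j => l i (s j)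

theorem IsLayout.addRow {r m m' : ℕ} {l : ℕ → ℕ → V} {f f' s : ℕ → ℕ} {l₀ : ℕ → V}
    (h : IsLayout r m l f A w E) (hs : MonoSurj s m' m) (hf : MonoSurj f' m' w'.length)
    (hw : w'.Nodup) (htop : ∀ j < m', w'[f' j]? = some (l₀ j))
    (hblock : ∀ j < m', (∃ k < m', f' k = f' j ∧ l₀ k = l 0 (s k)) ∨ (l₀ j ∉ w ∧ l₀ j ∉ A))
    (hmem : ∀ x, x ∈ w ∨ x ∈ A → x ∈ w' ∨ x ∈ A')
    (hF : ∀ x y, F x y → Consec w' x y ∨ E x y) :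
    IsLayout (r + 1) m' (_root_.addRow l₀ l s) f' A' w' F := by
  have hl₀ : ∀ j < m', ∀ k < m', f' j = f' k → l₀ j = l₀ k := by
    intro j hj k hk hjk
    have h1 := htop j hj
    rw [hjk, htop k hk] at h1
    exact (Option.some.inj h1).symm
  have low : ∀ i < r, ∀ j < m', ∀ i' < r, ∀ j' < m', l i (s j) = l i' (s j') →
      ReachIn quarterGrid {x | x.1 < r + 1 ∧ x.2 < m' ∧ _root_.addRow l₀ l s x.1 x.2 = l i (s j)}
        (i + 1, j) (i' + 1, j') := by
    intro i hi j hj i' hi' j' hj' hl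
    refine (hs.reach_lift (S := {x | x.1 < r ∧ x.2 < m ∧ l x.1 x.2 = l i (s j)})
      (fun x hx => hx.2.1) ⟨hi, hs.lt j hj, rfl⟩
      (h.conn i hi _ (hs.lt j hj) i' hi' _ (hs.lt j' hj') hl) hj hj' rfl rfl).mono le_rfl ?_
    rintro ⟨a, b⟩ ⟨k, hk, hb, hS⟩
    dsimp only at hk hb
    subst hk
    exact ⟨by have := hS.1; dsimp only at this ⊢; omega, hb, hS.2.2⟩
  have row : ∀ j < m', ∀ j' < m', f' j = f' j' →
      ReachIn quarterGrid {x | x.1 < r + 1 ∧ x.2 < m' ∧ _root_.addRow l₀ l s x.1 x.2 = l₀ j}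
        (0, j) (0, j') := fun j hj j' hj' hff =>
    hf.reach_row hj hj' hff fun k hk hk' => ⟨by simp, hk, hl₀ _ hk _ hj hk'⟩
  have mix : ∀ j < m', ∀ i' < r, ∀ j' < m', l₀ j = l i' (s j') →
      ReachIn quarterGrid {x | x.1 < r + 1 ∧ x.2 < m' ∧ _root_.addRow l₀ l s x.1 x.2 = l₀ j}
        (0, j) (i' + 1, j') := by
    intro j hj i' hi' j' hj' hl
    rcases hblock j hj with ⟨k, hk, hkj, hlk⟩ | ⟨h1, h2⟩
    · have h1 : l₀ j = l 0 (s k) := (hl₀ _ hk _ hj hkj).symm.trans hlk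
      have h2 := low 0 h.pos k hk i' hi' j' hj' (h1.symm.trans hl)
      rw [← h1] at h2
      refine ((row j hj k hk hkj.symm).trans (.single
        (b := (0 + 1, k)) (Or.inr ⟨rfl, Or.inl rfl⟩) ?_ ?_)).trans h2
      · exact ⟨by simp, hk, hl₀ _ hk _ hj hkj⟩
      · exact ⟨by have := h.pos; simpa using this, hk, h1.symm⟩
    · have := h.mem i' hi' _ (hs.lt j' hj')
      rw [← hl] at this
      exact (this.elim h1 h2).elim
  refine ⟨by omega, hf, htop, ?_, ?_, ?_⟩
  · rintro (_ | i) hi j hj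
    · exact Or.inl (List.mem_of_getElem? (htop j hj))
    · exact hmem _ (h.mem i (by omega) _ (hs.lt j hj))
  · rintro (_ | i) hi j hj (_ | i') hi' j' hj' hl
    · refine row j hj j' hj' ?_
      have h1 := htop j hj
      have h2 := htop j' hj'
      have hl : l₀ j = l₀ j' := hl
      rw [← hl, ← h1] at h2
      exact ((List.getElem?_inj (hf.lt j' hj') hw).1 h2).symm
    · exact mix j hj i' (by omega) j' hj' hl
    · have hl : l i (s j) = l₀ j' := hl
      have := mix j' hj' i (by omega) j hj hl.symm
      rw [← hl] at this
      exact this.symm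
    · exact low i (by omega) j hj i' (by omega) j' hj' hl
  · intro x y hxy
    rcases hF x y hxy with hc | hE
    · obtain ⟨j, hj, j', hj', h1, h2, h3⟩ := hf.exists_consec htop hc
      exact ⟨0, by omega, j, hj, 0, by omega, j', hj', h1, h2, h3⟩
    · obtain ⟨i, hi, j, hj, i', hi', j', hj', h1, h2, h3⟩ := h.adj x y hE
      have key : ∀ k < m', ∀ k' < m', s k = j → s k' = j' →
          quarterGrid.Adj (i + 1, k) (i' + 1, k') →
          ∃ a < r + 1, ∃ b < m', ∃ a' < r + 1, ∃ b' < m', quarterGrid.Adj (a, b) (a', b') ∧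
            _root_.addRow l₀ l s a b = x ∧ _root_.addRow l₀ l s a' b' = y := by
        intro k hk k' hk' e1 e2 hadj
        refine ⟨i + 1, by omega, k, hk, i' + 1, by omega, k', hk', hadj, ?_, ?_⟩
        · exact (congrArg (l i) e1).trans h2
        · exact (congrArg (l i') e2).trans h3
      rcases h1 with ⟨h1, h4 | h4⟩ | ⟨h1, h4⟩ <;> dsimp only at h1 h4
      · obtain ⟨k, hk, h5, h6⟩ := hs.exists_step (t := j) (by omega)
        exact key k (by omega) (k + 1) hk h5 (h6.trans h4) (Or.inl ⟨by simp [h1], Or.inl rfl⟩)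
      · obtain ⟨k, hk, h5, h6⟩ := hs.exists_step (t := j') (by omega)
        exact key (k + 1) hk k (by omega) (h6.trans h4) h5 (Or.inl ⟨by simp [h1], Or.inr rfl⟩)
      · obtain ⟨k, hk, h5⟩ := hs.surj j hj
        exact key k hk k hk h5 (h5.trans h1) (Or.inr ⟨rfl, by dsimp only; omega⟩)

theorem Sweep.exists_layout (h : Sweep A w w' E) (hne : w ≠ []) :
    ∃ r m l f, IsLayout r m l f A w E := by
  induction h with
  | @refl A w E h1 h2 h3 =>
    obtain ⟨d, _⟩ := List.exists_mem_of_ne_nil _ hne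
    have hid : MonoSurj id w.length w.length :=
      ⟨fun _ _ h _ => h, fun _ h => h, fun t ht => ⟨t, ht, rfl⟩⟩
    have htop : ∀ j < w.length, w[id j]? = some (w[j]?.getD d) := fun j hj => by simp [hj]
    refine ⟨1, w.length, fun _ j => w[j]?.getD d, id, by omega, hid, htop, ?_, ?_, ?_⟩
    · intro i hi j hj
      exact Or.inl (List.mem_of_getElem? (htop j hj))
    · intro i hi j hj i' hi' j' hj' hl
      obtain rfl : i = 0 := by omega
      obtain rfl : i' = 0 := by omega
      obtain rfl : j = j' := by
        have h4 := htop j hj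
        rw [hl, ← htop j' hj'] at h4
        exact (List.getElem?_inj hj h1).1 h4
      exact .refl
    · intro x y hxy
      obtain ⟨j, hj, j', hj', h4, h5, h6⟩ := hid.exists_consec htop (h3 x y hxy)
      exact ⟨0, by omega, j, hj, 0, by omega, j', hj', h4, h5, h6⟩
  | @del A p a q w' E F h1 ha hne' h hF ih =>
    obtain ⟨r, m, l, f, L⟩ := ih hne'
    obtain ⟨c, hc, hcut⟩ := L.surj.exists_cut p.length
    have hlen : (p ++ q).length = p.length + q.length := by simp
    have hlen' : (p ++ a :: q).length = p.length + q.length + 1 := by simp; omega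
    have hpq : 0 < (p ++ q).length := List.length_pos_iff.2 hne'
    obtain ⟨hmono, hlt, hsurj⟩ := L.surj
    have hm : 0 < m := by
      obtain ⟨j, hj, -⟩ := hsurj 0 hpq
      omega
    have ha' : a ∉ p ++ q := (List.nodup_cons.1 (List.nodup_middle.1 h1)).1
    refine ⟨r + 1, m + 1, _, fun j => if j < c then f j else if j = c then p.length else
      f (j - 1) + 1, L.addRow (s := fun j => if j < c then j else j - 1)
        (l₀ := fun j => if j = c then a else l 0 (if j < c then j else j - 1)) ?_ ?_ h1 ?_ ?_ ?_ hF⟩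
    · refine ⟨fun i j hij hj => ?_, fun j hj => ?_, fun t ht => ?_⟩
      · split_ifs <;> omega
      · split_ifs <;> omega
      · by_cases htc : t < c
        · exact ⟨t, by omega, by simp [htc]⟩
        · exact ⟨t + 1, by omega, by rw [if_neg (by omega)]; simp⟩
    · refine ⟨fun i j hij hj => ?_, fun j hj => ?_, fun t ht => ?_⟩
      · have h2 := hcut i
        have h3 := hcut (j - 1)
        split_ifs
        · exact hmono _ _ hij (by omega)
        · have := (h2 (by omega)).1 (by omega)
          omega
        · have := hmono i (j - 1) (by omega) (by omega)
          omega
        · omega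
        · omega
        · omega
        · omega
        · omega
        · have := hmono (i - 1) (j - 1) (by omega) (by omega)
          omega
      · have h2 := hlt j
        have h3 := hlt (j - 1)
        split_ifs <;> omega
      · rcases lt_trichotomy t p.length with h2 | h2 | h2
        · obtain ⟨j, hj, h3⟩ := hsurj t (by omega)
          exact ⟨j, by omega, by rw [if_pos ((hcut j hj).2 (by omega)), h3]⟩
        · exact ⟨c, by omega, by simp [h2]⟩
        · obtain ⟨j, hj, h3⟩ := hsurj (t - 1) (by omega)
          have h4 := hcut j hj
          exact ⟨j + 1, by omega, by
            rw [if_neg (by omega), if_neg (by omega), Nat.add_sub_cancel]; omega⟩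
    · intro j hj
      split_ifs with h2 h3 h3
      · omega
      · have h4 := L.top j (by omega)
        have h5 := (hcut j (by omega)).1 h2
        rw [List.getElem?_append, if_pos h5] at h4 ⊢
        exact h4
      · simp
      · have h4 := L.top (j - 1) (by omega)
        have h5 := hcut (j - 1) (by omega)
        rw [List.getElem?_append, if_neg (by omega)] at h4 ⊢
        rw [← h4, show f (j - 1) + 1 - p.length = f (j - 1) - p.length + 1 by omega,
          List.getElem?_cons_succ]
    · intro j hj
      by_cases hjc : j = c
      · exact Or.inr ⟨by simpa [hjc] using ha', by simpa [hjc] using ha⟩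
      · exact Or.inl ⟨j, hj, rfl, by simp [hjc]⟩
    · rintro x (hx | hx)
      · exact Or.inl (by simp at hx ⊢; tauto)
      · exact Or.inr hx
  | @ins A p a q w' E F ha hne' h hF ih =>
    obtain ⟨r, m, l, f, L⟩ := ih (by simp)
    obtain ⟨d, _⟩ := List.exists_mem_of_ne_nil _ hne'
    have hs := Sweep.ins ha hne' h hF
    have hpq : 0 < (p ++ q).length := List.length_pos_iff.2 hne'
    have hlen : (p ++ q).length = p.length + q.length := by simp
    have hlen' : (p ++ a :: q).length = p.length + q.length + 1 := by simp; omega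
    have hsj := L.surj
    obtain ⟨hmono, hlt, hsurj⟩ := L.surj
    have hf' : MonoSurj (fun j => if f j < p.length then f j else f j - 1) m (p ++ q).length := by
      refine ⟨fun i j hij hj => ?_, fun j hj => ?_, fun t ht => ?_⟩
      · have := hmono i j hij hj
        split_ifs <;> omega
      · have := hlt j hj
        split_ifs <;> omega
      · by_cases h2 : t < p.length
        · obtain ⟨j, hj, h3⟩ := hsurj t (by omega)
          exact ⟨j, hj, by rw [h3, if_pos h2]⟩
        · obtain ⟨j, hj, h3⟩ := hsurj (t + 1) (by omega)
          exact ⟨j, hj, by rw [h3, if_neg (by omega)]; rfl⟩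
    refine ⟨r + 1, m, _, _, L.addRow (s := id)
      (l₀ := fun j => (p ++ q)[if f j < p.length then f j else f j - 1]?.getD d)
      ⟨fun _ _ h _ => h, fun _ h => h, fun t ht => ⟨t, ht, rfl⟩⟩ hf' hs.nodup ?_ ?_ ?_ hF⟩
    · intro j hj
      have := hf'.lt j hj
      rw [List.getElem?_eq_getElem this]
      rfl
    · intro j hj
      left
      have h6 := hf'.lt j hj
      have key : ∀ k < m, f k ≠ p.length →
          (p ++ q)[if f k < p.length then f k else f k - 1]?.getD d = l 0 k := by
        intro k hk hkp
        have h3 := L.top k hk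
        have h4 : (p ++ q)[if f k < p.length then f k else f k - 1]? = some (l 0 k) := by
          rw [← h3]
          split_ifs with h2
          · rw [List.getElem?_append, if_pos h2, List.getElem?_append, if_pos h2]
          · rw [List.getElem?_append, if_neg (by omega), List.getElem?_append, if_neg h2,
              show f k - p.length = f k - 1 - p.length + 1 by omega, List.getElem?_cons_succ]
        rw [h4]
        rfl
      generalize (if f j < p.length then f j else f j - 1) = t at h6
      by_cases h2 : t < p.length
      · obtain ⟨k, hk, h3⟩ := hsurj t (by omega)
        exact ⟨k, hk, by rw [h3, if_pos h2], key k hk (by omega)⟩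
      · obtain ⟨k, hk, h3⟩ := hsurj (t + 1) (by omega)
        exact ⟨k, hk, by rw [h3, if_neg (by omega)]; rfl, key k hk (by omega)⟩
    · rintro x (hx | hx)
      · simp only [List.mem_append, List.mem_cons] at hx ⊢
        rcases hx with hx | rfl | hx
        · exact Or.inl (Or.inl hx)
        · exact Or.inr ha
        · exact Or.inl (Or.inr hx)
      · exact Or.inr hx.1

theorem Sweep.exists_grid_minor {G : SimpleGraph V} (h : Sweep A w w' E) (hne : w ≠ [])
    (hE : ∀ x, ∃ y, E x y ∨ E y x) (hG : ∀ x y, G.Adj x y → E x y) :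
    ∃ n : ℕ, HasMinor G (pathGraph n □ pathGraph n) := by
  obtain ⟨r, m, l, f, L⟩ := h.exists_layout hne
  have hin : ∀ {n i j : ℕ}, max r m = n → i < r → j < m → i < n ∧ j < n := by
    intro n i j hn hi hj
    omega
  refine ⟨max r m, ?_⟩
  generalize hn : max r m = n
  have adj : ∀ {x y : Fin n × Fin n}, quarterGrid.Adj (x.1.val, x.2.val) (y.1.val, y.2.val) →
      (pathGraph n □ pathGraph n).Adj x y := by
    intro x y hxy
    rw [boxProd_adj, pathGraph_adj, pathGraph_adj]
    rcases hxy with ⟨h1, h2⟩ | ⟨h1, h2⟩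
    · exact Or.inr ⟨h2, Fin.ext h1⟩
    · exact Or.inl ⟨h2, Fin.ext h1⟩
  refine ⟨fun x => {z | z.1.val < r ∧ z.2.val < m ∧ l z.1.val z.2.val = x}, fun x => ⟨?_, ?_⟩,
    fun x y hxy => ?_, fun x y hxy => ?_⟩
  · obtain ⟨y, h | h⟩ := hE x
    · obtain ⟨i, hi, j, hj, -, -, -, -, -, h1, -⟩ := L.adj _ _ h
      exact ⟨(⟨i, (hin hn hi hj).1⟩, ⟨j, (hin hn hi hj).2⟩), hi, hj, h1⟩
    · obtain ⟨-, -, -, -, i, hi, j, hj, -, -, h1⟩ := L.adj _ _ h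
      exact ⟨(⟨i, (hin hn hi hj).1⟩, ⟨j, (hin hn hi hj).2⟩), hi, hj, h1⟩
  · rintro a ⟨ha1, ha2, ha3⟩ b ⟨hb1, hb2, hb3⟩
    have := L.conn _ ha1 _ ha2 _ hb1 _ hb2 (ha3.trans hb3.symm)
    refine (this.closed (T := {y | (y.1 < r ∧ y.2 < m ∧ l y.1 y.2 = x) ∧
      ∀ b : Fin n × Fin n, (b.1.val, b.2.val) = y →
        ReachIn (pathGraph n □ pathGraph n)
          {z | z.1.val < r ∧ z.2.val < m ∧ l z.1.val z.2.val = x} a b}) ?_ ?_).2 b rfl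
    · refine ⟨⟨ha1, ha2, ha3⟩, fun b hb => ?_⟩
      obtain ⟨h1, h2⟩ := Prod.mk.inj hb
      obtain rfl : b = a := Prod.ext (Fin.ext h1) (Fin.ext h2)
      exact .refl
    · rintro ⟨i, j⟩ ⟨⟨h1, h2, h3⟩, hy⟩ ⟨i', j'⟩ ⟨h1', h2', h3'⟩ hadj
      dsimp only at h1 h2 h3 h1' h2' h3'
      refine ⟨⟨h1', h2', h3'.trans ha3⟩, fun b hb => ?_⟩
      refine (hy (⟨i, (hin hn h1 h2).1⟩, ⟨j, (hin hn h1 h2).2⟩) rfl).trans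
        (.single (adj (hb ▸ hadj)) ⟨h1, h2, h3⟩ ?_)
      obtain ⟨rfl, rfl⟩ := Prod.mk.inj hb
      exact ⟨h1', h2', h3'.trans ha3⟩
  · exact Set.disjoint_left.2 fun z hz hz' => hxy (hz.2.2.symm.trans hz'.2.2)
  · obtain ⟨i, hi, j, hj, i', hi', j', hj', h1, h2, h3⟩ := L.adj _ _ (hG x y hxy)
    exact ⟨(⟨i, (hin hn hi hj).1⟩, ⟨j, (hin hn hi hj).2⟩), ⟨hi, hj, h2⟩,
      (⟨i', (hin hn hi' hj').1⟩, ⟨j', (hin hn hi' hj').2⟩), ⟨hi', hj', h3⟩, adj h1⟩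

end Layout

/-! ### Graphs with a rim that behaves like the boundary of a disc -/

/-- `G` has neither of the two Kuratowski graphs as a minor. -/
def NoKuratowski {V : Type*} (G : SimpleGraph V) : Prop :=
  ¬ HasMinor (⊤ : SimpleGraph (Fin 5)) G ∧ ¬ HasMinor (completeBipartiteGraph (Fin 3) (Fin 3)) G

/-- The vertices `c 0, …, c (n - 1)` form a cycle of `G` (an edge if `n = 2`). -/
structure Rim {V : Type*} (G : SimpleGraph V) (c : ℕ → V) (n : ℕ) : Prop where
  two_le : 2 ≤ n
  inj : ∀ i < n, ∀ j < n, c i = c j → i = j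
  adj : ∀ i, i + 1 < n → G.Adj (c i) (c (i + 1))
  close : G.Adj (c (n - 1)) (c 0)

/-- No two disjoint connected sets cross on the rim. -/
def NoCross {V : Type*} (G : SimpleGraph V) (c : ℕ → V) (n : ℕ) : Prop :=
  ∀ i j k l, i < j → j < k → k < l → l < n → ∀ P Q, Conn G P → Conn G Q → Disjoint P Q →
    c i ∈ P → c k ∈ P → c j ∈ Q → c l ∈ Q → False

/-- No two disjoint connected sets off the rim are adjacent to the same three rim vertices. -/
def NoTri {V : Type*} (G : SimpleGraph V) (c : ℕ → V) (n : ℕ) : Prop :=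
  ∀ i j k, i < j → j < k → k < n → ∀ P Q, Conn G P → Conn G Q → Disjoint P Q →
    (∀ t < n, c t ∉ P) → (∀ t < n, c t ∉ Q) →
    (∀ t, t = i ∨ t = j ∨ t = k → Touch G P {c t} ∧ Touch G Q {c t}) → False

/-- A graph with a rim satisfying the conditions of a graph drawn in a disc. -/
structure Soc {V : Type*} (G : SimpleGraph V) (c : ℕ → V) (n : ℕ) : Prop where
  rim : Rim G c n
  noKuratowski : NoKuratowski G
  noCross : NoCross G c n
  noTri : NoTri G c n

/-- The vertices of the rim, in order. -/
def word {V : Type*} (c : ℕ → V) (n : ℕ) : List V := (List.range n).map c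

/-- There is a sweep of `G` from the whole rim to its closing edge. -/
def Sweepable {V : Type*} (G : SimpleGraph V) (c : ℕ → V) (n : ℕ) : Prop :=
  Sweep {x | x ∈ G.support ∧ ∀ k < n, c k ≠ x} (word c n) [c 0, c (n - 1)] G.Adj

section

variable {V : Type u} {G G' : SimpleGraph V} {c : ℕ → V} {n : ℕ} {P Q D : Set V} {x y : V}

theorem mem_word : x ∈ word c n ↔ ∃ k < n, c k = x := by
  simp [word]

theorem Rim.nodup_word (h : Rim G c n) : (word c n).Nodup := by
  refine List.Nodup.map_on (fun i hi j hj e => ?_) List.nodup_range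
  exact h.inj i (List.mem_range.1 hi) j (List.mem_range.1 hj) e

/-- The edges with an end in `D`. -/
def touchGraph {V : Type*} (G : SimpleGraph V) (D : Set V) : SimpleGraph V where
  Adj a b := G.Adj a b ∧ (a ∈ D ∨ b ∈ D)
  symm := ⟨fun _ _ h => ⟨h.1.symm, h.2.symm⟩⟩
  loopless := ⟨fun a h => G.loopless.irrefl a h.1⟩

theorem touchGraph_le (G : SimpleGraph V) (D : Set V) : touchGraph G D ≤ G := fun _ _ h => h.1

theorem edges_lt [Finite V] (hle : G' ≤ G) {a b : V} (h : G.Adj a b) (h' : ¬ G'.Adj a b) :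
    G'.edgeSet.ncard < G.edgeSet.ncard := by
  refine Set.ncard_lt_ncard ⟨edgeSet_subset_edgeSet.2 hle, fun hs => h' ?_⟩ (Set.toFinite _)
  exact hs (show s(a, b) ∈ G.edgeSet from h)

theorem edges_lt_of_two [Finite V] (hle : G' ≤ G ⊔ edge x y) {a b a' b' : V} (h₁ : G.Adj a b)
    (h₂ : G.Adj a' b') (hne : s(a, b) ≠ s(a', b')) (h₁' : ¬ G'.Adj a b) (h₂' : ¬ G'.Adj a' b') :
    G'.edgeSet.ncard < G.edgeSet.ncard := by
  have hsub : G'.edgeSet ⊆ insert s(x, y) (G.edgeSet \ {s(a, b), s(a', b')}) := by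
    intro e
    induction e with
    | h p q =>
      intro hpq
      have h1 : G'.Adj p q := hpq
      rcases hle h1 with h2 | h2
      · refine Or.inr ⟨h2, ?_⟩
        rintro (h3 | h3)
        · exact h₁' (by rw [← mem_edgeSet, ← h3]; exact hpq)
        · exact h₂' (by rw [← mem_edgeSet, ← h3]; exact hpq)
      · exact Or.inl ((adj_edge _ _).1 h2).1.symm
  have h3 := Set.ncard_le_ncard hsub (Set.toFinite _)
  have h4 := Set.ncard_insert_le s(x, y) (G.edgeSet \ {s(a, b), s(a', b')})
  have h5 : ({s(a, b), s(a', b')} : Set (Sym2 V)) ⊆ G.edgeSet := by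
    rintro e (rfl | rfl)
    exacts [h₁, h₂]
  have h6 := Set.ncard_sdiff h5 (Set.toFinite _)
  rw [Set.ncard_pair hne] at h6
  have h7 := Set.ncard_le_ncard h5 (Set.toFinite _)
  rw [Set.ncard_pair hne] at h7
  omega

/-- All edges of `G'` are edges of `G`, or join `x` to `y`; the latter can be simulated in `G` by
the connected set `D`, which no edge of `G'` touches. -/
structure Repl {V : Type*} (G G' : SimpleGraph V) (D : Set V) (x y : V) : Prop where
  adj : ∀ a b, G'.Adj a b → G.Adj a b ∨ D.Nonempty ∧ (a = x ∧ b = y ∨ a = y ∧ b = x)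
  off : ∀ a b, G'.Adj a b → a ∉ D
  conn : D.Nonempty → Conn G D
  touch_left : D.Nonempty → Touch G D {x}
  touch_right : D.Nonempty → Touch G D {y}

theorem Repl.of_le (h : G' ≤ G) (x y : V) : Repl G G' ∅ x y :=
  ⟨fun _ _ hab => Or.inl (h hab), fun _ _ _ => id, fun h => absurd h (by simp),
    fun h => absurd h (by simp), fun h => absurd h (by simp)⟩

theorem Repl.symm (h : Repl G G' D x y) : Repl G G' D y x :=
  ⟨fun a b hab => (h.adj a b hab).imp_right fun h' => ⟨h'.1, h'.2.symm⟩, h.off, h.conn,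
    h.touch_right, h.touch_left⟩

/-- Add `D` to the sets containing `x`. -/
def absorb {V : Type*} (D : Set V) (x : V) (P : Set V) : Set V := {v | v ∈ P ∨ v ∈ D ∧ x ∈ P}

theorem absorb_disjoint (hPQ : Disjoint P Q) (hP : Disjoint P D) (hQ : Disjoint Q D) :
    Disjoint (absorb D x P) (absorb D x Q) := by
  rw [Set.disjoint_left] at *
  rintro v (h1 | h1) (h2 | h2)
  · exact hPQ h1 h2
  · exact hP h1 h2.1
  · exact hQ h2 h1.1
  · exact hPQ h1.2 h2.2

theorem Repl.conn_absorb (h : Repl G G' D x y) (hP : Conn G' P) : Conn G (absorb D x P) := by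
  have key : ∀ a ∈ P, ∀ b, ReachIn G' P a b → ReachIn G (absorb D x P) a b := by
    intro a ha b hab
    induction hab with
    | refl => exact .refl
    | tail h1 h2 ih =>
      obtain ⟨h2, hp, hq⟩ := h2
      refine ih.trans ?_
      rcases h.adj _ _ h2 with h3 | ⟨hD, h3⟩
      · exact ReachIn.single h3 (Or.inl hp) (Or.inl hq)
      · have hx : x ∈ P := by rcases h3 with ⟨rfl, rfl⟩ | ⟨rfl, rfl⟩ <;> assumption
        have hDP : D ⊆ absorb D x P := fun v hv => Or.inr ⟨hv, hx⟩
        obtain ⟨d, hd, _, rfl, hdx⟩ := h.touch_left hD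
        obtain ⟨d', hd', _, rfl, hdy⟩ := h.touch_right hD
        have h4 : ReachIn G (absorb D _ P) d d' := ((h.conn hD).2 d hd d' hd').mono le_rfl hDP
        rcases h3 with ⟨rfl, rfl⟩ | ⟨rfl, rfl⟩
        · exact ((ReachIn.single hdx.symm (Or.inl hp) (hDP hd)).trans h4).trans
            (ReachIn.single hdy (hDP hd') (Or.inl hq))
        · exact ((ReachIn.single hdy.symm (Or.inl hp) (hDP hd')).trans h4.symm).trans
            (ReachIn.single hdx (hDP hd) (Or.inl hq))
  obtain ⟨a, ha⟩ := hP.nonempty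
  refine conn_of_root (Or.inl ha : a ∈ absorb D x P) ?_
  rintro b (hb | ⟨hb, hx⟩)
  · exact key a ha b (hP.2 a ha b hb)
  · have hDP : D ⊆ absorb D x P := fun v hv => Or.inr ⟨hv, hx⟩
    obtain ⟨d, hd, _, rfl, hdx⟩ := h.touch_left ⟨b, hb⟩
    exact ((key a ha _ (hP.2 a ha _ hx)).trans
      (ReachIn.single hdx.symm (Or.inl hx) (hDP hd))).trans
        (((h.conn ⟨b, hb⟩).2 d hd b hb).mono le_rfl hDP)

theorem Repl.disjoint (h : Repl G G' D x y) (hP : Conn G' P) {v : V} (hv : v ∈ P) (hvD : v ∉ D) :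
    Disjoint P D := by
  have : P ⊆ Dᶜ := hP.subset_of_closed ⟨v, hv, hvD⟩
    fun a _ _ b _ hab => h.off _ _ hab.symm
  exact Set.disjoint_left.2 fun a ha haD => this ha haD

theorem Repl.disjoint_of_touch (h : Repl G G' D x y) (hP : Conn G' P) (hPQ : Touch G' P Q) :
    Disjoint P D := by
  obtain ⟨a, ha, b, _, hab⟩ := hPQ
  exact h.disjoint hP ha (h.off _ _ hab)

theorem Repl.touch_absorb (h : Repl G G' D x y) (hPQ : Touch G' P Q) :
    Touch G (absorb D x P) (absorb D x Q) := by
  obtain ⟨a, ha, b, hb, hab⟩ := hPQ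
  rcases h.adj _ _ hab with h1 | ⟨hD, ⟨rfl, rfl⟩ | ⟨rfl, rfl⟩⟩
  · exact ⟨a, Or.inl ha, b, Or.inl hb, h1⟩
  · obtain ⟨d, hd, _, rfl, hdy⟩ := h.touch_right hD
    exact ⟨d, Or.inr ⟨hd, ha⟩, _, Or.inl hb, hdy⟩
  · obtain ⟨d, hd, _, rfl, hdy⟩ := h.touch_right hD
    exact ⟨_, Or.inl ha, d, Or.inr ⟨hd, hb⟩, hdy.symm⟩

theorem Repl.touch_vertex (h : Repl G G' D x y) {z : V} (hPz : Touch G' P {z})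
    (hz : y ∈ P → z ≠ x) : Touch G (absorb D x P) {z} := by
  obtain ⟨a, ha, _, rfl, hab⟩ := hPz
  rcases h.adj _ _ hab with h1 | ⟨hD, ⟨rfl, rfl⟩ | ⟨rfl, rfl⟩⟩
  · exact ⟨a, Or.inl ha, _, rfl, h1⟩
  · obtain ⟨d, hd, _, rfl, hdy⟩ := h.touch_right hD
    exact ⟨d, Or.inr ⟨hd, ha⟩, _, rfl, hdy⟩
  · exact absurd rfl (hz ha)

theorem Repl.hasMinor {W : Type*} {F : SimpleGraph W} (h : Repl G G' D x y)
    (hF : ∀ w, ∃ w', F.Adj w w') (hm : HasMinor F G') : HasMinor F G := by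
  obtain ⟨B, h1, h2, h3⟩ := hm
  have hd : ∀ w, Disjoint (B w) D := by
    intro w
    obtain ⟨w', hw⟩ := hF w
    exact h.disjoint_of_touch (h1 w) (h3 hw)
  exact ⟨fun w => absorb D x (B w), fun w => h.conn_absorb (h1 w),
    fun w w' hw => absorb_disjoint (h2 w w' hw) (hd w) (hd w'), fun w w' hw => h.touch_absorb (h3 hw)⟩

theorem NoKuratowski.repl (hG : NoKuratowski G) (h : Repl G G' D x y) : NoKuratowski G' := by
  refine ⟨fun hm => hG.1 (h.hasMinor (fun w => ?_) hm), fun hm => hG.2 (h.hasMinor (fun w => ?_) hm)⟩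
  · exact ⟨w + 1, by simp⟩
  · rcases w with w | w
    · exact ⟨Sum.inr 0, by simp⟩
    · exact ⟨Sum.inl 0, by simp⟩

theorem Soc.repl (hS : Soc G c n) (h : Repl G G' D x y) {f : ℕ → ℕ} {n' : ℕ}
    (hf : ∀ i j, i < j → j < n' → f i < f j) (hn : ∀ i < n', f i < n)
    (hR : Rim G' (fun i => c (f i)) n')
    (hiso : ∀ t < n, (∃ i < n', f i = t) ∨ ∀ b, ¬ G'.Adj (c t) b)
    (hD : ((∃ i < n', c (f i) = x) ∧ ∃ i < n', c (f i) = y) ∨ ∀ t < n, c t ∉ D) :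
    Soc G' (fun i => c (f i)) n' := by
  have hne : ∀ i < n', ∀ j < n', i ≠ j → c (f i) ≠ c (f j) :=
    fun i hi j hj hij he => hij (hR.inj i hi j hj he)
  refine ⟨hR, hS.noKuratowski.repl h, ?_, ?_⟩
  · intro i j k l hij hjk hkl hl P Q hP hQ hPQ hi hk hj hl'
    have hoff : ∀ i < n', ∀ b, c (f i) ∈ b → ∀ j < n', c (f j) ∈ b → i ≠ j → Conn G' b →
        Disjoint b D := by
      intro i hi b hib j hj hjb hij hb
      obtain ⟨p, hp, hpi, q, hq, _, hpq⟩ := hb.exists_crossing (T := {c (f i)}) ⟨_, hib, rfl⟩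
        (fun hs => hne i hi j hj hij (hs hjb).symm)
      exact h.disjoint hb hp (h.off _ _ hpq)
    exact hS.noCross _ _ _ _ (hf i j hij (by omega)) (hf j k hjk (by omega)) (hf k l hkl hl) (hn l hl)
      _ _ (h.conn_absorb hP) (h.conn_absorb hQ)
      (absorb_disjoint hPQ (hoff i (by omega) _ hi k (by omega) hk (by omega) hP)
        (hoff j (by omega) _ hj l (by omega) hl' (by omega) hQ))
      (Or.inl hi) (Or.inl hk) (Or.inl hj) (Or.inl hl')
  · have main : ∀ {x y : V}, Repl G G' D x y → ((∃ i < n', c (f i) = x) → ∃ i < n', c (f i) = y) →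
        ((∃ i < n', c (f i) = x) ∨ ∀ t < n, c t ∉ D) → NoTri G' (fun i => c (f i)) n' := by
      intro x y h hxy hD i j k hij hjk hk P Q hP hQ hPQ hPo hQo hT
      have hi := hT i (Or.inl rfl)
      have off : ∀ {P}, Conn G' P → (∀ t < n', c (f t) ∉ P) → Touch G' P {c (f i)} →
          ∀ t < n, c t ∉ absorb D x P := by
        rintro P hP hPo hPi t ht (h1 | ⟨h1, h2⟩)
        · rcases hiso t ht with ⟨i, hi, rfl⟩ | h3
          · exact hPo i hi h1
          · have : P ⊆ {c t}ᶜ := by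
              obtain ⟨a, ha, b, _, hab⟩ := hPi
              refine hP.subset_of_closed ⟨a, ha, fun hac => h3 b ?_⟩ fun a _ _ b _ hab hbc => h3 a ?_
              · exact hac ▸ hab
              · exact hbc ▸ hab.symm
            exact this h1 rfl
        · rcases hD with ⟨i, hi, rfl⟩ | h3
          · exact hPo i hi h2
          · exact h3 t ht h1
      have tch : ∀ {P}, (∀ t < n', c (f t) ∉ P) → ∀ t < n', Touch G' P {c (f t)} →
          Touch G (absorb D x P) {c (f t)} := by
        intro P hPo t ht hPt
        refine h.touch_vertex hPt fun hy he => ?_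
        obtain ⟨s, hs, hse⟩ := hxy ⟨t, ht, he⟩
        exact hPo s hs (hse ▸ hy)
      refine hS.noTri (f i) (f j) (f k) (hf i j hij (by omega)) (hf j k hjk hk) (hn k hk) _ _
        (h.conn_absorb hP) (h.conn_absorb hQ)
        (absorb_disjoint hPQ (h.disjoint_of_touch hP hi.1) (h.disjoint_of_touch hQ hi.2))
        (off hP hPo hi.1) (off hQ hQo hi.2) ?_
      rintro t (rfl | rfl | rfl)
      · exact ⟨tch hPo i (by omega) hi.1, tch hQo i (by omega) hi.2⟩
      · have := hT j (by tauto)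
        exact ⟨tch hPo j (by omega) this.1, tch hQo j (by omega) this.2⟩
      · have := hT k (by tauto)
        exact ⟨tch hPo k (by omega) this.1, tch hQo k (by omega) this.2⟩
    by_cases hx : ∃ i < n', c (f i) = x
    · by_cases hy : ∃ i < n', c (f i) = y
      · exact main h (fun _ => hy) (Or.inl hx)
      · exact main h.symm (fun h' => absurd h' hy) (Or.inr (hD.resolve_left fun h' => hy h'.2))
    · exact main h (fun h' => absurd h' hx) (Or.inr (hD.resolve_left fun h' => hx h'.1))

theorem Soc.of_edge (hK : NoKuratowski G) (h : G.Adj x y) :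
    Soc G (fun k => if k = 0 then x else y) 2 := by
  refine ⟨⟨le_rfl, ?_, ?_, by simpa using h.symm⟩, hK, ?_, ?_⟩
  · intro i hi j hj hij
    have := h.ne
    have := h.ne'
    interval_cases i <;> interval_cases j <;> simp_all
  · intro i hi
    have : i = 0 := by omega
    simpa [this] using h
  · intro i j k l hij hjk hkl hl
    omega
  · intro i j k hij hjk hk
    omega

theorem Sweepable.of_edge (h : Sweepable G (fun k => if k = 0 then x else y) 2) :
    Sweep {z | z ∈ G.support ∧ z ≠ x ∧ z ≠ y} [x, y] [x, y] G.Adj := by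
  have h' : Sweep _ [x, y] [x, y] G.Adj := h
  refine h'.mono (fun z hz => ⟨hz.1, ?_, ?_⟩) ?_ fun _ _ => Or.inr
  · exact fun e => hz.2 0 (by omega) (by simp [e])
  · exact fun e => hz.2 1 (by omega) (by simp [e])
  · intro z hz hz'
    simp only [List.mem_cons, List.not_mem_nil, or_false] at hz
    rcases hz with rfl | rfl
    · exact hz'.2.1 rfl
    · exact hz'.2.2 rfl

/-- The induction hypothesis: graphs with a rim that have fewer edges are sweepable. -/
def SweepableBelow {V : Type*} (m : ℕ) : Prop :=
  ∀ (G : SimpleGraph V) (c : ℕ → V) (n : ℕ), Soc G c n → G.edgeSet.ncard < m → Sweepable G c n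

theorem Rim.away (h : Rim G c n) (hD : ∀ t < n, c t ∉ D) (hG : ∀ a b, a ∉ D → b ∉ D →
    G.Adj a b → G'.Adj a b) : Rim G' c n := by
  have := h.two_le
  exact ⟨h.two_le, h.inj, fun i hi => hG _ _ (hD _ (by omega)) (hD _ hi) (h.adj i hi),
    hG _ _ (hD _ (by omega)) (hD _ (by omega)) h.close⟩

theorem Soc.sweepable_of_pendant [Finite V] (h : Soc G c n)
    (ih : SweepableBelow (V := V) G.edgeSet.ncard) (hD : ∀ t < n, c t ∉ D)
    (hs : (D ∩ G.support).Nonempty) {x₀ : V} (hN : Nb G D ⊆ {x₀}) : Sweepable G c n := by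
  have h2 := h.rim.two_le
  obtain ⟨x, y, hy, hxy, hx⟩ : ∃ x y, y ∈ D ∧ G.Adj x y ∧ Nb G D ⊆ {x} := by
    by_cases hne : (Nb G D).Nonempty
    · obtain ⟨x, hx⟩ := hne
      obtain ⟨y, hy, hyx⟩ := hx.2
      refine ⟨x, y, hy, hyx.symm, ?_⟩
      rw [hN hx]
      exact hN
    · obtain ⟨d, hd, e, hde⟩ := hs
      exact ⟨e, d, hd, hde.symm, fun z hz => absurd ⟨z, hz⟩ hne⟩
  have hrim : ∀ {a b}, G.Adj a b → a ∉ D → b ∈ D → a = x :=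
    fun hab ha hb => hx ⟨ha, _, hb, hab.symm⟩
  have h1 : Sweepable (touchGraph G D) (fun k => if k = 0 then x else y) 2 := by
    refine ih _ _ _ (Soc.of_edge (h.noKuratowski.repl (Repl.of_le (touchGraph_le G D) x y))
      ⟨hxy, Or.inr hy⟩) (edges_lt (touchGraph_le G D) h.rim.close ?_)
    rintro ⟨-, h3 | h3⟩
    · exact hD _ (by omega) h3
    · exact hD _ (by omega) h3
  have h3 : Sweepable (awayGraph G D) c n := by
    refine ih _ _ _ (h.repl (f := id) (Repl.of_le (awayGraph_le G D) x y) (fun i j hij _ => hij)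
      (fun i hi => hi) (h.rim.away hD fun a b ha hb hab => ⟨hab, ha, hb⟩)
      (fun t ht => Or.inl ⟨t, ht, rfl⟩) (Or.inr fun t _ => id)) (edges_lt (awayGraph_le G D) hxy ?_)
    exact fun h3 => h3.2.2 hy
  have hyw : ∀ k < n, c k ≠ y := fun k hk e => hD k hk (e ▸ hy)
  have hA : y ∉ (awayGraph G D).support := fun ⟨b, hb⟩ => hb.2.1 hy
  have h4 := Sweep.attach h3 h1.of_edge ?_ (fun hyw' => ?_) (fun hyA => hA hyA.1) ?_ ?_ ?_
  · refine h4.mono ?_ ?_ ?_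
    · rintro z ((⟨hz, hz'⟩ | ⟨⟨b, hb⟩, hz1, hz2⟩) | ⟨hz, hz'⟩)
      · obtain ⟨b, hb⟩ := hz
        exact ⟨⟨b, hb.1⟩, hz'⟩
      · refine ⟨⟨b, hb.1⟩, fun k hk e => hz1 ?_⟩
        rcases hb.2 with h5 | h5
        · exact absurd (e ▸ h5) (hD k hk)
        · exact hrim hb.1 (e ▸ hD k hk) h5
      · refine ⟨?_, fun k hk e => hz' (mem_word.2 ⟨k, hk, e⟩)⟩
        rcases hz with rfl | rfl
        · exact ⟨_, hxy⟩
        · exact ⟨_, hxy.symm⟩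
    · intro z hz hz'
      obtain ⟨k, hk, e⟩ := mem_word.1 hz
      exact hz'.2 k hk e
    · intro a b hab
      by_cases ha : a ∈ D
      · exact Or.inr (Or.inr ⟨hab, Or.inl ha⟩)
      · by_cases hb : b ∈ D
        · exact Or.inr (Or.inr ⟨hab, Or.inr hb⟩)
        · exact Or.inr (Or.inl ⟨hab, ha, hb⟩)
  · exact List.ne_nil_of_mem (mem_word.2 ⟨0, by omega, rfl⟩)
  · obtain ⟨k, hk, e⟩ := mem_word.1 hyw'
    exact hyw k hk e
  · intro z hz hz'
    obtain ⟨k, hk, rfl⟩ := mem_word.1 hz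
    obtain ⟨⟨b, hb⟩, hz1, -⟩ := hz'
    rcases hb.2 with h5 | h5
    · exact hD k hk h5
    · exact hz1 (hrim hb.1 (hD k hk) h5)
  · rw [Set.disjoint_left]
    rintro z ⟨⟨b, hb⟩, -⟩ ⟨⟨b', hb'⟩, hz1, -⟩
    rcases hb'.2 with h5 | h5
    · exact hb.2.1 h5
    · exact hz1 (hrim hb'.1 hb.2.1 h5)
  · by_cases hxw : x ∈ word c n
    · exact Or.inl hxw
    · by_cases hxs : x ∈ (awayGraph G D).support
      · exact Or.inr (Or.inl hxs)
      · exact Or.inr (Or.inr ⟨hxw, fun h => hxs h.1⟩)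

theorem Soc.sweepable_of_pair [Finite V] (h : Soc G c n)
    (ih : SweepableBelow (V := V) G.edgeSet.ncard) (hDc : Conn G D) (hD : ∀ t < n, c t ∉ D)
    (hxy : x ≠ y) (hN : Nb G D = {x, y})
    (hc : (G.Adj x y ∧ ∃ a b, G.Adj a b ∧ a ∉ D ∧ b ∉ D ∧ s(a, b) ≠ s(x, y)) ∨
      ∃ D₂, Conn G D₂ ∧ Disjoint D₂ D ∧ x ∉ D₂ ∧ y ∉ D₂ ∧ Touch G D₂ {x} ∧ Touch G D₂ {y}) :
    Sweepable G c n := by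
  have h2 := h.rim.two_le
  have hNb : ∀ {a b}, G.Adj a b → a ∉ D → b ∈ D → a = x ∨ a = y :=
    fun {a b} hab ha hb => hN.subset (⟨ha, b, hb, hab.symm⟩ : a ∈ Nb G D)
  obtain ⟨hxD, dx, hdx, hdxx⟩ : x ∈ Nb G D := by rw [hN]; exact Or.inl rfl
  obtain ⟨hyD, dy, hdy, hdyy⟩ : y ∈ Nb G D := by rw [hN]; exact Or.inr rfl
  have hedge : (edge x y).Adj x y := (edge_adj x y x y).2 ⟨Or.inl ⟨rfl, rfl⟩, hxy⟩
  have hsup : ∀ {a b}, (edge x y).Adj a b → (a = x ∧ b = y ∨ a = y ∧ b = x) :=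
    fun hab => ((edge_adj _ _ _ _).1 hab).1
  have h1 : Sweepable (touchGraph G D ⊔ edge x y) (fun k => if k = 0 then x else y) 2 := by
    rcases hc with ⟨hG, a, b, hab, ha, hb, hne⟩ | ⟨D₂, hD₂, hDD, hx2, hy2, htx, hty⟩
    · have hle : touchGraph G D ⊔ edge x y ≤ G := by
        refine sup_le (touchGraph_le G D) fun p q hpq => ?_
        rcases hsup hpq with ⟨rfl, rfl⟩ | ⟨rfl, rfl⟩
        exacts [hG, hG.symm]
      refine ih _ _ _ (Soc.of_edge (h.noKuratowski.repl (Repl.of_le hle x y)) (Or.inr hedge))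
        (edges_lt hle hab ?_)
      rintro (⟨-, h3 | h3⟩ | h3)
      · exact ha h3
      · exact hb h3
      · exact hne ((adj_edge _ _).1 h3).1.symm
    · have hrep : Repl G (touchGraph G D ⊔ edge x y) D₂ x y := by
        refine ⟨fun a b hab => ?_, fun a b hab => ?_, fun _ => hD₂, fun _ => htx, fun _ => hty⟩
        · rcases hab with hab | hab
          · exact Or.inl hab.1
          · exact Or.inr ⟨hD₂.nonempty, hsup hab⟩
        · rcases hab with hab | hab
          · by_cases haD : a ∈ D
            · exact fun ha2 => Set.disjoint_left.1 hDD ha2 haD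
            · rcases hab.2 with h3 | h3
              · exact absurd h3 haD
              · rcases hNb hab.1 haD h3 with rfl | rfl <;> assumption
          · rcases hsup hab with ⟨rfl, rfl⟩ | ⟨rfl, rfl⟩ <;> assumption
      refine ih _ _ _ (Soc.of_edge (h.noKuratowski.repl hrep) (Or.inr hedge)) ?_
      obtain ⟨p, hp, _, rfl, hpx⟩ := htx
      obtain ⟨q, hq, _, rfl, hqy⟩ := hty
      refine edges_lt_of_two (sup_le_sup_right (touchGraph_le G D) _) hpx hqy ?_
        (fun h3 => hrep.off _ _ h3 hp) (fun h3 => hrep.off _ _ h3 hq)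
      rw [ne_eq, Sym2.eq_iff]
      rintro (⟨rfl, rfl⟩ | ⟨rfl, rfl⟩)
      · exact hxy rfl
      · exact hy2 hp
  have h3 : Sweepable (awayGraph G D ⊔ edge x y) c n := by
    have hrep : Repl G (awayGraph G D ⊔ edge x y) D x y := by
      refine ⟨fun a b hab => ?_, fun a b hab => ?_, fun _ => hDc, fun _ => ⟨_, hdx, _, rfl, hdxx⟩,
        fun _ => ⟨_, hdy, _, rfl, hdyy⟩⟩
      · rcases hab with hab | hab
        · exact Or.inl hab.1
        · exact Or.inr ⟨hDc.nonempty, hsup hab⟩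
      · rcases hab with hab | hab
        · exact hab.2.1
        · rcases hsup hab with ⟨rfl, rfl⟩ | ⟨rfl, rfl⟩ <;> assumption
    refine ih _ _ _ (h.repl (f := id) hrep (fun i j hij _ => hij)
      (fun i hi => hi) (h.rim.away hD fun a b ha hb hab => Or.inl ⟨hab, ha, hb⟩)
      (fun t ht => Or.inl ⟨t, ht, rfl⟩) (Or.inr hD)) ?_
    refine edges_lt_of_two (sup_le_sup_right (awayGraph_le G D) _) hdxx hdyy ?_
      (fun h3 => hrep.off _ _ h3 hdx) (fun h3 => hrep.off _ _ h3 hdy)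
    rw [ne_eq, Sym2.eq_iff]
    rintro (⟨rfl, rfl⟩ | ⟨rfl, rfl⟩)
    · exact hxy rfl
    · exact hyD hdx
  have htz : ∀ {z}, z ∈ (touchGraph G D ⊔ edge x y).support → z ≠ x → z ≠ y → z ∈ D := by
    rintro z ⟨b, hb | hb⟩ hzx hzy
    · by_contra hzD
      rcases hb.2 with h5 | h5
      · exact hzD h5
      · rcases hNb hb.1 hzD h5 with rfl | rfl <;> contradiction
    · rcases hsup hb with ⟨rfl, rfl⟩ | ⟨rfl, rfl⟩ <;> contradiction
  have h4 := Sweep.splice h3 (Or.inr hedge : (awayGraph G D ⊔ edge x y).Adj x y) h1.of_edge ?_ ?_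
  · refine h4.mono ?_ ?_ ?_
    · rintro z (⟨⟨b, hb | hb⟩, hz'⟩ | ⟨⟨b, hb | hb⟩, hz1, hz2⟩)
      · exact ⟨⟨b, hb.1⟩, hz'⟩
      · rcases hsup hb with ⟨rfl, rfl⟩ | ⟨rfl, rfl⟩
        exacts [⟨⟨_, hdxx.symm⟩, hz'⟩, ⟨⟨_, hdyy.symm⟩, hz'⟩]
      · exact ⟨⟨b, hb.1⟩, fun k hk e => hD k hk (e ▸ htz ⟨b, Or.inl hb⟩ hz1 hz2)⟩
      · rcases hsup hb with ⟨rfl, rfl⟩ | ⟨rfl, rfl⟩ <;> contradiction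
    · intro z hz hz'
      obtain ⟨k, hk, e⟩ := mem_word.1 hz
      exact hz'.2 k hk e
    · intro a b hab
      by_cases ha : a ∈ D
      · exact Or.inr (Or.inr (Or.inl ⟨hab, Or.inl ha⟩))
      · by_cases hb : b ∈ D
        · exact Or.inr (Or.inr (Or.inl ⟨hab, Or.inr hb⟩))
        · exact Or.inr (Or.inl (Or.inl ⟨hab, ha, hb⟩))
  · intro z hz hz'
    obtain ⟨k, hk, rfl⟩ := mem_word.1 hz
    exact hD k hk (htz hz'.1 hz'.2.1 hz'.2.2)
  · rw [Set.disjoint_left]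
    rintro z ⟨⟨b, hb | hb⟩, -⟩ ⟨hz, hz1, hz2⟩
    · exact hb.2.1 (htz hz hz1 hz2)
    · rcases hsup hb with ⟨rfl, rfl⟩ | ⟨rfl, rfl⟩ <;> contradiction

theorem Soc.sweepable_of_separation [Finite V] (h : Soc G c n)
    (ih : SweepableBelow (V := V) G.edgeSet.ncard) (hDc : Conn G D) (hD : ∀ t < n, c t ∉ D)
    (hs : (D ∩ G.support).Nonempty) (hN : Nb G D ⊆ {x, y})
    (hc : (G.Adj x y ∧ ∃ a b, G.Adj a b ∧ a ∉ D ∧ b ∉ D ∧ s(a, b) ≠ s(x, y)) ∨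
      ∃ D₂, Conn G D₂ ∧ Disjoint D₂ D ∧ x ∉ D₂ ∧ y ∉ D₂ ∧ Touch G D₂ {x} ∧ Touch G D₂ {y}) :
    Sweepable G c n := by
  by_cases hxy : x = y
  · exact h.sweepable_of_pendant ih hD hs (x₀ := x) (by simpa [hxy] using hN)
  by_cases hx : x ∈ Nb G D
  · by_cases hy : y ∈ Nb G D
    · refine h.sweepable_of_pair ih hDc hD hxy (hN.antisymm ?_) hc
      rintro z (rfl | rfl) <;> assumption
    · refine h.sweepable_of_pendant ih hD hs (x₀ := x) fun z hz => ?_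
      rcases hN hz with rfl | rfl
      · rfl
      · exact absurd hz hy
  · refine h.sweepable_of_pendant ih hD hs (x₀ := y) fun z hz => ?_
    rcases hN hz with rfl | rfl
    · exact absurd hz hx
    · rfl

end

section

variable {V : Type u} {G G' : SimpleGraph V} {c : ℕ → V} {n : ℕ} {P Q D : Set V} {x y : V}

theorem Conn.shrink {a b t : V} (hP : Conn G P) (ha : a ∈ P) (hb : b ∈ P) (ht : t ∈ P)
    (hta : t ≠ a) (htb : t ≠ b) :
    ∃ P', P' ⊂ P ∧ Conn G P' ∧ a ∈ P' ∧ (b ∈ P' ∨ t ∈ P') := by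
  have haP : a ∈ P \ {t} := ⟨ha, fun h => hta h.symm⟩
  have hA := cmpt_subset (G := G) haP
  by_cases hbA : b ∈ cmpt G (P \ {t}) a
  · exact ⟨_, ⟨fun z hz => (hA hz).1, fun hs => (hA (hs ht)).2 rfl⟩, cmpt_conn a, mem_cmpt a,
      Or.inl hbA⟩
  · refine ⟨Insert.insert t (cmpt G (P \ {t}) a), ⟨?_, fun hs => ?_⟩, ?_, Or.inr (mem_cmpt a),
      Or.inr (Or.inl rfl)⟩
    · rintro z (rfl | hz)
      exacts [ht, (hA hz).1]
    · rcases hs hb with h | h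
      exacts [htb h.symm, hbA h]
    · obtain ⟨p, hp, hpA, q, hq, hqA, hpq⟩ := hP.exists_crossing (T := cmpt G (P \ {t}) a)
        ⟨a, ha, mem_cmpt a⟩ fun hs => hbA (hs hb)
      have hqt : q = t := by
        by_contra hqt
        exact hqA (cmpt_closed hpA (hA hpA) ⟨hq, hqt⟩ hpq)
      subst hqt
      exact (cmpt_conn a).insert hpA hpq

theorem noCross_of_exact [Finite V] (hc : ∀ i < n, ∀ j < n, c i = c j → i = j)
    (h : ∀ i j k l, i < j → j < k → k < l → l < n → ∀ P Q, Conn G P → Conn G Q → Disjoint P Q →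
      (∀ t < n, c t ∈ P ↔ t = i ∨ t = k) → (∀ t < n, c t ∈ Q ↔ t = j ∨ t = l) → False) :
    NoCross G c n := by
  have main : ∀ N i j k l, i < j → j < k → k < l → l < n → ∀ P Q, P.ncard + Q.ncard = N →
      Conn G P → Conn G Q → Disjoint P Q → c i ∈ P → c k ∈ P → c j ∈ Q → c l ∈ Q → False := by
    intro N
    induction N using Nat.strong_induction_on with
    | _ N ih =>
      intro i j k l hij hjk hkl hl P Q hN hP hQ hPQ hi hk hj hl'
      have hne : ∀ s < n, ∀ t < n, s ≠ t → c s ≠ c t := fun s hs t ht hst e => hst (hc s hs t ht e)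
      have hdis : ∀ s t, c s ∈ P → c t ∈ Q → s ≠ t := by
        rintro s _ hs ht rfl
        exact Set.disjoint_left.1 hPQ hs ht
      refine h i j k l hij hjk hkl hl P Q hP hQ hPQ (fun t ht => ⟨fun htP => ?_, ?_⟩)
        fun t ht => ⟨fun htQ => ?_, ?_⟩
      · by_contra hcon
        push Not at hcon
        have h1 := hdis t j htP hj
        have h2 := hdis t l htP hl'
        by_cases h3 : j < t ∧ t < l
        · obtain ⟨P', hP', hP'c, hi', hk'⟩ := hP.shrink hi hk htP (hne _ ht _ (by omega) hcon.1)
            (hne _ ht _ (by omega) hcon.2)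
          have h4 := Set.ncard_lt_ncard hP' (Set.toFinite _)
          rcases hk' with hk' | hk'
          · exact ih _ (by omega) i j k l hij hjk hkl hl P' Q rfl hP'c hQ
              (hPQ.mono_left hP'.subset) hi' hk' hj hl'
          · exact ih _ (by omega) i j t l hij h3.1 h3.2 hl P' Q rfl hP'c hQ
              (hPQ.mono_left hP'.subset) hi' hk' hj hl'
        · obtain ⟨P', hP', hP'c, hk', hi'⟩ := hP.shrink hk hi htP (hne _ ht _ (by omega) hcon.2)
            (hne _ ht _ (by omega) hcon.1)
          have h4 := Set.ncard_lt_ncard hP' (Set.toFinite _)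
          rcases hi' with hi' | hi'
          · exact ih _ (by omega) i j k l hij hjk hkl hl P' Q rfl hP'c hQ
              (hPQ.mono_left hP'.subset) hi' hk' hj hl'
          · by_cases h5 : t < j
            · exact ih _ (by omega) t j k l h5 hjk hkl hl P' Q rfl hP'c hQ
                (hPQ.mono_left hP'.subset) hi' hk' hj hl'
            · exact ih _ (by omega) j k l t hjk hkl (by omega) ht Q P' rfl hQ hP'c
                (hPQ.mono_left hP'.subset).symm hj hl' hk' hi'
      · rintro (rfl | rfl) <;> assumption
      · by_contra hcon
        push Not at hcon
        have h1 := hdis i t hi htQ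
        have h2 := hdis k t hk htQ
        by_cases h3 : i < t ∧ t < k
        · obtain ⟨Q', hQ', hQ'c, hl'', hj'⟩ := hQ.shrink hl' hj htQ (hne _ ht _ (by omega) hcon.2)
            (hne _ ht _ (by omega) hcon.1)
          have h4 := Set.ncard_lt_ncard hQ' (Set.toFinite _)
          rcases hj' with hj' | hj'
          · exact ih _ (by omega) i j k l hij hjk hkl hl P Q' rfl hP hQ'c
              (hPQ.mono_right hQ'.subset) hi hk hj' hl''
          · exact ih _ (by omega) i t k l h3.1 h3.2 hkl hl P Q' rfl hP hQ'c
              (hPQ.mono_right hQ'.subset) hi hk hj' hl''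
        · obtain ⟨Q', hQ', hQ'c, hj', hl''⟩ := hQ.shrink hj hl' htQ (hne _ ht _ (by omega) hcon.1)
            (hne _ ht _ (by omega) hcon.2)
          have h4 := Set.ncard_lt_ncard hQ' (Set.toFinite _)
          rcases hl'' with hl'' | hl''
          · exact ih _ (by omega) i j k l hij hjk hkl hl P Q' rfl hP hQ'c
              (hPQ.mono_right hQ'.subset) hi hk hj' hl''
          · by_cases h5 : t < i
            · exact ih _ (by omega) t i j k h5 hij hjk (by omega) Q' P rfl hQ'c hP
                (hPQ.mono_right hQ'.subset).symm hl'' hj' hi hk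
            · exact ih _ (by omega) i j k t hij hjk (by omega) ht P Q' rfl hP hQ'c
                (hPQ.mono_right hQ'.subset) hi hk hj' hl''
      · rintro (rfl | rfl) <;> assumption
  exact fun i j k l hij hjk hkl hl P Q => main _ i j k l hij hjk hkl hl P Q rfl

/-- If a vertex of the rim has no chord and no neighbour off the rim, it can be dropped. -/
theorem Soc.sweepable_of_free [Finite V] (h : Soc G c n)
    (ih : SweepableBelow (V := V) G.edgeSet.ncard) (hn : 3 ≤ n)
    (hN : ∀ b, G.Adj (c 0) b → b = c 1 ∨ b = c (n - 1)) : Sweepable G c n := by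
  have hne : ∀ s < n, ∀ t < n, s ≠ t → c s ≠ c t :=
    fun s hs t ht hst e => hst (h.rim.inj s hs t ht e)
  have h01 : G.Adj (c 0) (c 1) := h.rim.adj 0 (by omega)
  have h0n : G.Adj (c 0) (c (n - 1)) := h.rim.close.symm
  have hedge : (edge (c 1) (c (n - 1))).Adj (c 1) (c (n - 1)) :=
    (edge_adj _ _ _ _).2 ⟨Or.inl ⟨rfl, rfl⟩, hne _ (by omega) _ (by omega) (by omega)⟩
  have hsup : ∀ {a b}, (edge (c 1) (c (n - 1))).Adj a b →
      (a = c 1 ∧ b = c (n - 1) ∨ a = c (n - 1) ∧ b = c 1) := fun hab => ((edge_adj _ _ _ _).1 hab).1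
  have hoff : ∀ a b, (awayGraph G {c 0} ⊔ edge (c 1) (c (n - 1))).Adj a b → a ∉ ({c 0} : Set V) := by
    rintro a b (hab | hab)
    · exact hab.2.1
    · rcases hsup hab with ⟨rfl, rfl⟩ | ⟨rfl, rfl⟩
      · exact hne _ (by omega) _ (by omega) (by omega)
      · exact hne _ (by omega) _ (by omega) (by omega)
  have hrep : Repl G (awayGraph G {c 0} ⊔ edge (c 1) (c (n - 1))) {c 0} (c 1) (c (n - 1)) := by
    refine ⟨fun a b hab => hab.imp (fun h => h.1) fun h => ⟨⟨_, rfl⟩, hsup h⟩, hoff,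
      fun _ => conn_singleton _, fun _ => ⟨_, rfl, _, rfl, h01⟩, fun _ => ⟨_, rfl, _, rfl, h0n⟩⟩
  have h1 : Sweepable (awayGraph G {c 0} ⊔ edge (c 1) (c (n - 1))) (fun i => c (i + 1)) (n - 1) := by
    refine ih _ _ _ (h.repl hrep (f := fun i => i + 1) (fun i j hij _ => by omega)
      (fun i hi => by omega) ⟨by omega, fun i hi j hj e => ?_, fun i hi => ?_, ?_⟩ (fun t ht => ?_)
      (Or.inl ⟨⟨0, by omega, rfl⟩, n - 2, by omega, by congr 1; omega⟩)) ?_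
    · have := h.rim.inj _ (by omega) _ (by omega) e
      omega
    · refine Or.inl ⟨h.rim.adj (i + 1) (by omega), ?_, ?_⟩
      · exact hne _ (by omega) _ (by omega) (by omega)
      · exact hne _ (by omega) _ (by omega) (by omega)
    · rw [show n - 1 - 1 + 1 = n - 1 by omega]
      exact Or.inr hedge.symm
    · rcases t with _ | t
      · exact Or.inr fun b hb => hoff _ _ hb rfl
      · exact Or.inl ⟨t, by omega, rfl⟩
    · refine edges_lt_of_two (sup_le_sup_right (awayGraph_le G _) _) h01 h0n ?_
        (fun h3 => hoff _ _ h3 rfl) (fun h3 => hoff _ _ h3 rfl)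
      rw [ne_eq, Sym2.eq_iff]
      rintro (⟨-, e⟩ | ⟨e, -⟩)
      · exact hne _ (by omega) _ (by omega) (by omega) e
      · exact hne _ (by omega) _ (by omega) (by omega) e
  have hw : word c n = [c 0] ++ word (fun i => c (i + 1)) (n - 1) ++ [] := by
    rw [word, word, show n = n - 1 + 1 by omega, List.range_succ_eq_map]
    simp
  have hnd : ([c 0] ++ c 1 :: [c (n - 1)] : List V).Nodup := by
    have h1 := hne 0 (by omega) 1 (by omega) (by omega)
    have h2 := hne 0 (by omega) (n - 1) (by omega) (by omega)
    have h3 := hne 1 (by omega) (n - 1) (by omega) (by omega)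
    simp [h1, h2, h3]
  have h2 : Sweep {x | x ∈ (awayGraph G {c 0} ⊔ edge (c 1) (c (n - 1))).support ∧
      ∀ k < n - 1, c (k + 1) ≠ x} (word c n) ([c 0] ++ [c 1, c (n - 1)] ++ [])
      (awayGraph G {c 0} ⊔ edge (c 1) (c (n - 1))).Adj := by
    rw [hw]
    have h3 : Sweep {x | x ∈ (awayGraph G {c 0} ⊔ edge (c 1) (c (n - 1))).support ∧
      ∀ k < n - 1, c (k + 1) ≠ x} _ ([c 0] ++ [c 1, c (n - 1 - 1 + 1)] ++ []) _ :=
      h1.frame (p := [c 0]) (q := []) (by simp) ?_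
    · rwa [show n - 1 - 1 + 1 = n - 1 by omega] at h3
    · intro x hx
      simp only [List.append_nil, List.mem_singleton] at hx
      subst hx
      refine ⟨fun hx => ?_, fun ⟨⟨b, hb⟩, _⟩ => hoff _ _ hb rfl⟩
      obtain ⟨k, hk, e⟩ := mem_word.1 hx
      exact hne _ (by omega) _ (by omega) (by omega) e
  have h3 : Sweep ∅ ([c 0] ++ c 1 :: [c (n - 1)]) ([c 0] ++ [c (n - 1)])
      (fun x y => Consec [c 0, c 1, c (n - 1)] x y ∨ Consec [c 0, c (n - 1)] x y) := by
    refine Sweep.del hnd (by simp) (by simp) (Sweep.refl (E := Consec [c 0, c (n - 1)]) ?_ (by simp)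
      fun x y => id) fun x y => id
    have h2 := hne 0 (by omega) (n - 1) (by omega) (by omega)
    simp [h2]
  refine Sweep.mono (Sweep.trans h2 h3 (by simp) (by simp)) ?_ ?_ ?_
  · rintro z (⟨⟨b, hb⟩, hz⟩ | hz)
    · have hz' : ∀ k < n, c k ≠ z := by
        rintro (_ | k) hk e
        · exact hoff _ _ hb e.symm
        · exact hz k (by omega) e
      rcases hb with hb | hb
      · exact ⟨⟨b, hb.1⟩, hz'⟩
      · rcases hsup hb with ⟨rfl, rfl⟩ | ⟨rfl, rfl⟩
        · exact absurd rfl (hz' 1 (by omega))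
        · exact absurd rfl (hz' (n - 1) (by omega))
    · exact absurd hz (by simp)
  · intro z hz hz'
    obtain ⟨k, hk, e⟩ := mem_word.1 hz
    exact hz'.2 k hk e
  · have key : ∀ b, G.Adj (c 0) b → Consec [c 0, c 1, c (n - 1)] (c 0) b ∨
        Consec [c 0, c (n - 1)] (c 0) b := by
      intro b hb
      rcases hN b hb with rfl | rfl
      · exact Or.inl (Or.inl ⟨[], [c (n - 1)], rfl⟩)
      · exact Or.inr (Or.inl ⟨[], [], rfl⟩)
    intro a b hab
    by_cases ha : a = c 0
    · subst ha
      exact Or.inr (Or.inr (key b hab))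
    · by_cases hb : b = c 0
      · subst hb
        exact Or.inr (Or.inr ((key a hab.symm).imp Consec.symm Consec.symm))
      · exact Or.inr (Or.inl (Or.inl ⟨hab, ha, hb⟩))

theorem Soc.sweepable_of_link [Finite V] (h : Soc G c n)
    (ih : SweepableBelow (V := V) G.edgeSet.ncard) {j : ℕ} (hj : 2 ≤ j) (hjn : j < n)
    (hB : (∃ B, Conn G B ∧ (∀ t < n, c t ∉ B) ∧ Touch G B {c 0} ∧ Touch G B {c j} ∧
        ∀ i, 1 ≤ i → i < j → ∀ B, Conn G B → (∀ t < n, c t ∉ B) → Touch G B {c 0} →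
          ¬ Touch G B {c i}) ∨ j + 1 < n ∧ G.Adj (c 0) (c j)) : Sweepable G c n := by
  have hne : ∀ s < n, ∀ t < n, s ≠ t → c s ≠ c t :=
    fun s hs t ht hst e => hst (h.rim.inj s hs t ht e)
  set Z : Set V := {z | ∀ t < n, t = 0 ∨ j ≤ t → c t ≠ z} with hZ
  have hcZ : ∀ t, 1 ≤ t → t < j → c t ∈ Z := fun t h1 h2 s hs hs' =>
    hne s hs t (by omega) (by omega)
  set K := cmpt G Z (c 1) with hK
  have hKZ : K ⊆ Z := cmpt_subset (hcZ 1 le_rfl (by omega))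
  have hcK : ∀ t, 1 ≤ t → t < j → c t ∈ K := by
    intro t h1
    induction t, h1 using Nat.le_induction with
    | base => exact fun _ => mem_cmpt _
    | succ t h1 ih =>
      intro h2
      exact cmpt_closed (ih (by omega)) (hcZ t h1 (by omega)) (hcZ _ (by omega) h2)
        (h.rim.adj t (by omega))
  have hKc : ∀ t < n, t = 0 ∨ j ≤ t → c t ∉ K := fun t h1 h2 h3 => hKZ h3 t h1 h2 rfl
  have hc0 := hKc 0 (by omega) (Or.inl rfl)
  have hcj := hKc j hjn (Or.inr le_rfl)
  have hNbZ : ∀ {z}, z ∈ Nb G K → ∃ t < n, (t = 0 ∨ j ≤ t) ∧ c t = z := by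
    rintro z ⟨hz, k, hk, hkz⟩
    by_contra hcon
    push Not at hcon
    exact hz (cmpt_closed hk (hKZ hk) (fun t h1 h2 => hcon t h1 h2) hkz)
  have hNb : ∀ {Q}, Conn G Q → Disjoint Q K → c 0 ∈ Q → c j ∈ Q →
      (∀ t < n, c t ∈ Q → t = 0 ∨ t = j) → ∀ z ∈ Nb G K, z = c 0 ∨ z = c j := by
    intro Q hQ hQK h0 hjQ hQo z hz
    obtain ⟨t, ht, h1, rfl⟩ := hNbZ hz
    obtain ⟨hzK, k, hk, hkz⟩ := hz
    by_contra hcon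
    push Not at hcon
    have h2 : t ≠ 0 := fun e => hcon.1 (by rw [e])
    have h3 : t ≠ j := fun e => hcon.2 (by rw [e])
    refine h.noCross 0 1 j t (by omega) (by omega) (by omega) ht Q (insert (c t) K) hQ
      ((cmpt_conn _).insert hk hkz) ?_ h0 hjQ (Or.inr (hcK 1 le_rfl (by omega))) (Or.inl rfl)
    rw [Set.disjoint_left] at *
    rintro a ha (rfl | ha')
    · have := hQo t ht ha
      omega
    · exact hQK ha ha'
  have hedge : (edge (c 0) (c j)).Adj (c 0) (c j) :=
    (edge_adj _ _ _ _).2 ⟨Or.inl ⟨rfl, rfl⟩, hne _ (by omega) _ (by omega) (by omega)⟩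
  have hsup : ∀ {a b}, (edge (c 0) (c j)).Adj a b →
      (a = c 0 ∧ b = c j ∨ a = c j ∧ b = c 0) := fun hab => ((edge_adj _ _ _ _).1 hab).1
  have hsoc : ∀ {D}, Repl G (touchGraph G K ⊔ edge (c 0) (c j)) D (c 0) (c j) →
      (∀ z ∈ Nb G K, z = c 0 ∨ z = c j) →
      Soc (touchGraph G K ⊔ edge (c 0) (c j)) (fun i => c (id i)) (j + 1) := by
    intro D hrep hN
    refine h.repl hrep (f := id) (fun i j hij _ => hij) (fun i hi => show i < n by omega)
      ⟨by omega, fun i hi j hj e => ?_, fun i hi => ?_, ?_⟩ (fun t ht => ?_)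
      (Or.inl ⟨⟨0, by omega, rfl⟩, j, by omega, rfl⟩)
    · exact h.rim.inj _ (by simp at hi ⊢; omega) _ (by simp at hj ⊢; omega) e
    · refine Or.inl ⟨h.rim.adj i (by omega), ?_⟩
      by_cases hi0 : i = 0
      · exact Or.inr (hcK (i + 1) (by omega) (by omega))
      · exact Or.inl (hcK i (by omega) (by omega))
    · exact Or.inr hedge.symm
    · by_cases htj : t < j + 1
      · exact Or.inl ⟨t, htj, rfl⟩
      · refine Or.inr fun b hb => ?_
        rcases hb with hb | hb
        · have h1 := hKc t ht (by omega)
          rcases hN _ ⟨h1, b, hb.2.resolve_left h1, hb.1.symm⟩ with e | e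
          · exact hne _ ht _ (by omega) (by omega) e
          · exact hne _ ht _ (by omega) (by omega) e
        · rcases hsup hb with ⟨e, -⟩ | ⟨e, -⟩
          · exact hne _ ht _ (by omega) (by omega) e
          · exact hne _ ht _ (by omega) (by omega) e
  obtain ⟨hN, h1⟩ : (∀ z ∈ Nb G K, z = c 0 ∨ z = c j) ∧
      Sweepable (touchGraph G K ⊔ edge (c 0) (c j)) c (j + 1) := by
    rcases hB with ⟨B, hBc, hBo, hB0, hBj, hmin⟩ | ⟨hj', hadj⟩
    · have hBK : Disjoint B K := by
        rw [Set.disjoint_left]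
        intro b hb hbK
        have hbo : b ∈ {z | ∀ t < n, c t ≠ z} := fun t ht e => hBo t ht (e ▸ hb)
        have hTo := cmpt_subset (G := G) hbo
        obtain ⟨p, hp, hpT, q, hq, hqT, hpq⟩ := (cmpt_conn (G := G) (S := Z) (c 1)).exists_crossing
          (T := cmpt G {z | ∀ t < n, c t ≠ z} b) ⟨b, hbK, mem_cmpt b⟩
          fun hs => hTo (hs (mem_cmpt _)) 1 (by omega) rfl
        obtain ⟨t, ht, rfl⟩ : ∃ t < n, c t = q := by
          by_contra hcon
          push Not at hcon
          exact hqT (cmpt_closed hpT (hTo hpT) hcon hpq)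
        have htj : ¬ (t = 0 ∨ j ≤ t) := fun hcon => hKc t ht hcon hq
        refine hmin t (by omega) (by omega) (cmpt G {z | ∀ t < n, c t ≠ z} b ∪ B)
          ((cmpt_conn b).union hBc ⟨b, mem_cmpt b, hb⟩) ?_ (hB0.mono Set.subset_union_right le_rfl)
          ⟨p, Or.inl hpT, _, rfl, hpq⟩
        rintro s hs (h1 | h1)
        exacts [hTo h1 s hs rfl, hBo s hs h1]
      have hN : ∀ z ∈ Nb G K, z = c 0 ∨ z = c j := by
        refine hNb (Q := insert (c 0) (insert (c j) B)) ?_ ?_ (Or.inl rfl) (Or.inr (Or.inl rfl)) ?_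
        · obtain ⟨p, hp, _, rfl, hp0⟩ := hB0
          obtain ⟨q, hq, _, rfl, hqj⟩ := hBj
          exact (hBc.insert hq hqj).insert (Or.inr hp) hp0
        · rw [Set.disjoint_left]
          rintro a (rfl | rfl | ha) haK
          exacts [hc0 haK, hcj haK, Set.disjoint_left.1 hBK ha haK]
        · rintro t ht (e | e | e)
          · exact Or.inl (h.rim.inj _ ht _ (by omega) e)
          · exact Or.inr (h.rim.inj _ ht _ hjn e)
          · exact absurd e (hBo t ht)
      have hrep : Repl G (touchGraph G K ⊔ edge (c 0) (c j)) B (c 0) (c j) := by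
        refine ⟨fun a b hab => ?_, fun a b hab haB => ?_, fun _ => hBc, fun _ => hB0, fun _ => hBj⟩
        · exact hab.imp (fun h => h.1) fun h => ⟨hBc.nonempty, hsup h⟩
        · rcases hab with hab | hab
          · have haK := Set.disjoint_left.1 hBK haB
            rcases hN _ ⟨haK, b, hab.2.resolve_left haK, hab.1.symm⟩ with rfl | rfl
            exacts [hBo 0 (by omega) haB, hBo j hjn haB]
          · rcases hsup hab with ⟨rfl, rfl⟩ | ⟨rfl, rfl⟩
            exacts [hBo 0 (by omega) haB, hBo j hjn haB]
      refine ⟨hN, ih _ _ _ (hsoc hrep hN) ?_⟩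
      obtain ⟨p, hp, _, rfl, hp0⟩ := hB0
      obtain ⟨q, hq, _, rfl, hqj⟩ := hBj
      refine edges_lt_of_two (sup_le_sup_right (touchGraph_le G _) _) hp0 hqj ?_
        (fun h3 => hrep.off _ _ h3 hp) (fun h3 => hrep.off _ _ h3 hq)
      rw [ne_eq, Sym2.eq_iff]
      rintro (⟨-, e⟩ | ⟨rfl, -⟩)
      · exact hne _ (by omega) _ (by omega) (by omega) e
      · exact hBo _ (by omega) hp
    · have hN : ∀ z ∈ Nb G K, z = c 0 ∨ z = c j := by
        refine hNb (Q := {c 0, c j}) (conn_pair hadj) ?_ (Or.inl rfl) (Or.inr rfl) ?_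
        · rw [Set.disjoint_left]
          rintro a (rfl | rfl) haK
          exacts [hc0 haK, hcj haK]
        · rintro t ht (e | e)
          · exact Or.inl (h.rim.inj _ ht _ (by omega) e)
          · exact Or.inr (h.rim.inj _ ht _ hjn e)
      have hle : touchGraph G K ⊔ edge (c 0) (c j) ≤ G := by
        refine sup_le (touchGraph_le G _) fun p q hpq => ?_
        rcases hsup hpq with ⟨rfl, rfl⟩ | ⟨rfl, rfl⟩
        exacts [hadj, hadj.symm]
      refine ⟨hN, ih _ _ _ (hsoc (Repl.of_le hle _ _) hN) (edges_lt hle h.rim.close ?_)⟩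
      have h1 := hKc (n - 1) (by omega) (by omega)
      rintro (⟨-, h3 | h3⟩ | h3)
      · exact h1 h3
      · exact hc0 h3
      · rcases hsup h3 with ⟨e, -⟩ | ⟨e, -⟩
        · exact hne _ (by omega) _ (by omega) (by omega) e
        · exact hne _ (by omega) _ (by omega) (by omega) e
  have hoff : ∀ a b, (awayGraph G K ⊔ edge (c 0) (c j)).Adj a b → a ∉ K := by
    rintro a b (hab | hab)
    · exact hab.2.1
    · rcases hsup hab with ⟨rfl, rfl⟩ | ⟨rfl, rfl⟩ <;> assumption
  have h1K := hcK 1 le_rfl (by omega)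
  have hjK := hcK (j - 1) (by omega) (by omega)
  have h01 : G.Adj (c 1) (c 0) := (h.rim.adj 0 (by omega)).symm
  have hjj : G.Adj (c (j - 1)) (c j) := by
    have := h.rim.adj (j - 1) (by omega)
    rwa [show j - 1 + 1 = j by omega] at this
  have hrep : Repl G (awayGraph G K ⊔ edge (c 0) (c j)) K (c 0) (c j) := by
    refine ⟨fun a b hab => hab.imp (fun h => h.1) fun h => ⟨⟨_, h1K⟩, hsup h⟩, hoff,
      fun _ => cmpt_conn _, fun _ => ⟨_, h1K, _, rfl, h01⟩, fun _ => ⟨_, hjK, _, rfl, hjj⟩⟩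
  set f : ℕ → ℕ := fun i => if i = 0 then 0 else i + j - 1 with hf
  have hf0 : f 0 = 0 := rfl
  have hfs : ∀ i, f (i + 1) = i + j := fun i => by simp [hf]
  have h2 : Sweepable (awayGraph G K ⊔ edge (c 0) (c j)) (fun i => c (f i)) (n - j + 1) := by
    have hfm : ∀ i k, i < k → k < n - j + 1 → f i < f k := by
      intro i k hik hk
      obtain ⟨k, rfl⟩ := Nat.exists_eq_succ_of_ne_zero (by omega : k ≠ 0)
      rcases i with _ | i
      · rw [hf0, Nat.succ_eq_add_one, hfs]
        omega
      · rw [hfs, Nat.succ_eq_add_one, hfs]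
        omega
    have hfn : ∀ i < n - j + 1, f i < n := by
      rintro (_ | i) hi
      · rw [hf0]
        omega
      · rw [hfs]
        omega
    refine ih _ _ _ (h.repl hrep hfm hfn
      ⟨by omega, fun i hi k hk e => ?_, fun i hi => ?_, ?_⟩ (fun t ht => ?_)
      (Or.inl ⟨⟨0, by omega, rfl⟩, 1, by omega, by rw [hfs]; simp⟩)) ?_
    · have h3 := h.rim.inj _ (hfn i hi) _ (hfn k hk) e
      rcases lt_trichotomy i k with h4 | h4 | h4
      · exact absurd h3 (hfm _ _ h4 hk).ne
      · exact h4
      · exact absurd h3 (hfm _ _ h4 hi).ne'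
    · rcases i with _ | i
      · rw [hfs, hf0, zero_add]
        exact Or.inr hedge
      · rw [hfs, hfs]
        refine Or.inl ⟨?_, hKc _ (by omega) (by omega), hKc _ (by omega) (by omega)⟩
        have := h.rim.adj (i + j) (by omega)
        rwa [show i + 1 + j = i + j + 1 by omega]
    · by_cases hjn' : j = n - 1
      · rw [hf0, show n - j + 1 - 1 = 0 + 1 by omega, hfs, zero_add]
        exact Or.inr hedge.symm
      · rw [hf0, show n - j + 1 - 1 = (n - j - 1) + 1 by omega, hfs,
          show n - j - 1 + j = n - 1 by omega]
        exact Or.inl ⟨h.rim.close, hKc _ (by omega) (by omega), hc0⟩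
    · by_cases h3 : t = 0
      · exact Or.inl ⟨0, by omega, by rw [hf0, h3]⟩
      · by_cases h4 : j ≤ t
        · exact Or.inl ⟨t - j + 1, by omega, by rw [hfs]; omega⟩
        · exact Or.inr fun b hb => hoff _ _ hb (hcK t (by omega) (by omega))
    · refine edges_lt_of_two (sup_le_sup_right (awayGraph_le G _) _) h01 hjj ?_
        (fun h3 => hoff _ _ h3 h1K) (fun h3 => hoff _ _ h3 hjK)
      rw [ne_eq, Sym2.eq_iff]
      rintro (⟨-, e⟩ | ⟨-, e⟩)
      · exact hne _ (by omega) _ (by omega) (by omega) e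
      · exact hne _ (by omega) _ (by omega) (by omega) e
  set q : List V := (List.range (n - j - 1)).map fun i => c (j + 1 + i) with hq
  have hmq : ∀ {z}, z ∈ q → ∃ t < n, j < t ∧ c t = z := by
    intro z hz
    obtain ⟨i, hi, rfl⟩ := List.mem_map.1 hz
    have := List.mem_range.1 hi
    exact ⟨_, by omega, by omega, rfl⟩
  have hw : word c n = [] ++ word c (j + 1) ++ q := by
    rw [word, show n = (j + 1) + (n - j - 1) by omega, List.range_add, List.map_append,
      List.map_map]
    rfl
  have hw' : word (fun i => c (f i)) (n - j + 1) = [] ++ [c 0, c j] ++ q := by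
    rw [word, show n - j + 1 = 2 + (n - j - 1) by omega, List.range_add, List.map_append,
      List.map_map]
    have e : List.map (fun i => c (f i)) (List.range 2) = [c 0, c j] := by
      simp [List.range_succ, hf]
    rw [e, hq]
    simp only [List.nil_append, List.append_cancel_left_eq, List.map_inj_left, Function.comp]
    intro a _
    rw [show 2 + a = (a + 1) + 1 by omega, hfs, show a + 1 + j = j + 1 + a by omega]
  have hsK : ∀ {z}, z ∈ (touchGraph G K ⊔ edge (c 0) (c j)).support → z ≠ c 0 → z ≠ c j → z ∈ K := by
    rintro z ⟨b, hb | hb⟩ hz0 hzj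
    · by_contra hzK
      rcases hN _ ⟨hzK, b, hb.2.resolve_left hzK, hb.1.symm⟩ with e | e
      exacts [hz0 e, hzj e]
    · rcases hsup hb with ⟨e, -⟩ | ⟨e, -⟩
      exacts [absurd e hz0, absurd e hzj]
  have h3 := Sweep.frame (p := []) (q := q) h1 ?_ ?_
  · rw [show j + 1 - 1 = j from rfl, ← hw', ← hw] at h3
    have h4 := h3.trans h2 ?_ ?_
    · have e : c (f (n - j + 1 - 1)) = c (n - 1) := by
        congr 1
        rw [show n - j + 1 - 1 = n - j - 1 + 1 by omega, hfs]
        omega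
      dsimp only at h4
      rw [e, hf0] at h4
      refine h4.mono ?_ ?_ ?_
      · rintro z (⟨hz, hz'⟩ | ⟨⟨b, hb⟩, hz⟩)
        · have hzK := hsK hz (fun e => hz' 0 (by omega) e.symm) fun e => hz' j (by omega) e.symm
          refine ⟨?_, fun t ht e => ?_⟩
          · obtain ⟨b, hb | hb⟩ := hz
            · exact ⟨b, hb.1⟩
            · rcases hsup hb with ⟨e, -⟩ | ⟨e, -⟩
              exacts [absurd e.symm (hz' 0 (by omega)), absurd e.symm (hz' j (by omega))]
          · by_cases htj : t < j + 1
            · exact hz' t htj e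
            · exact hKc t ht (by omega) (e ▸ hzK)
        · have hz0 : c 0 ≠ z := hz 0 (by omega)
          have hzj : c j ≠ z := by
            have := hz 1 (by omega)
            rwa [show f 1 = j by rw [show (1 : ℕ) = 0 + 1 from rfl, hfs, zero_add]] at this
          refine ⟨?_, fun t ht e => ?_⟩
          · rcases hb with hb | hb
            · exact ⟨b, hb.1⟩
            · rcases hsup hb with ⟨e, -⟩ | ⟨e, -⟩
              exacts [absurd e.symm hz0, absurd e.symm hzj]
          · by_cases h5 : t = 0
            · exact hz0 (h5 ▸ e)
            · by_cases htj : t < j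
              · exact hoff _ _ hb (e ▸ hcK t (by omega) htj)
              · refine hz (t - j + 1) (by omega) ?_
                rw [hfs, show t - j + j = t by omega, e]
      · intro z hz hz'
        obtain ⟨k, hk, e⟩ := mem_word.1 hz
        exact hz'.2 k hk e
      · intro a b hab
        by_cases ha : a ∈ K
        · exact Or.inr (Or.inl (Or.inl ⟨hab, Or.inl ha⟩))
        · by_cases hb : b ∈ K
          · exact Or.inr (Or.inl (Or.inl ⟨hab, Or.inr hb⟩))
          · exact Or.inr (Or.inr (Or.inl ⟨hab, ha, hb⟩))
    · rintro x hx ⟨⟨b, hb⟩, hx'⟩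
      obtain ⟨t, ht, rfl⟩ := mem_word.1 hx
      by_cases h5 : t = 0
      · exact hx' 0 (by omega) (show c (f 0) = c t by rw [hf0, h5])
      · by_cases htj : t < j
        · exact hoff _ _ hb (hcK t (by omega) htj)
        · refine hx' (t - j + 1) (by omega) (show c (f (t - j + 1)) = c t from ?_)
          rw [hfs, show t - j + j = t by omega]
    · rw [Set.disjoint_left]
      rintro z ⟨hz, hz'⟩ ⟨⟨b, hb⟩, -⟩
      exact hoff _ _ hb (hsK hz (fun e => hz' 0 (by omega) e.symm) fun e => hz' j (by omega) e.symm)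
  · have := h.rim.nodup_word
    rw [hw] at this
    exact this.sublist (by simp)
  · intro x hx
    obtain ⟨t, ht, htj, rfl⟩ := hmq (by simpa using hx)
    refine ⟨fun hx => ?_, fun hxA => ?_⟩
    · obtain ⟨k, hk, e⟩ := mem_word.1 hx
      exact hne _ (by omega) _ (by omega) (by omega) e
    · exact hKc t ht (by omega) (hsK hxA.1 (hne _ (by omega) _ (by omega) (by omega))
        (hne _ (by omega) _ (by omega) (by omega)))

end

section

variable {V : Type u} {G G' : SimpleGraph V} {c r : ℕ → V} {n m : ℕ} {M : Set V} {x y : V}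

theorem Rim.conn_Icc (h : Rim G r n) {i j : ℕ} (hij : i ≤ j) (hj : j < n) :
    Conn G (r '' Set.Icc i j) :=
  _root_.conn_seg hij fun k _ hk => h.adj k (by omega)

theorem Rim.disjoint_image (h : Rim G r n) {S T : Set ℕ} (hS : ∀ t ∈ S, t < n)
    (hT : ∀ t ∈ T, t < n) (hST : Disjoint S T) : Disjoint (r '' S) (r '' T) := by
  rw [Set.disjoint_left] at *
  rintro _ ⟨s, hs, rfl⟩ ⟨t, ht, e⟩
  exact hST hs (h.inj _ (hT t ht) _ (hS s hs) e ▸ ht)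

theorem Rim.not_mem_image (h : Rim G r n) {S : Set ℕ} (hS : ∀ t ∈ S, t < n) {i : ℕ} (hi : i < n)
    (hiS : i ∉ S) : r i ∉ r '' S := by
  rintro ⟨t, ht, e⟩
  exact hiS (h.inj _ (hS t ht) _ hi e ▸ ht)

/-- The indices up to `m` outside the interval from `a` to `b`. -/
def outer (m a b : ℕ) : Set ℕ := {t | t ≤ m ∧ (t < a ∨ b < t)}

theorem Rim.conn_outer (h : Rim G r (m + 1)) {a b : ℕ} (hab : a ≤ b) (hb : b ≤ m)
    (hne : 0 < a ∨ b < m) :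
    Conn G (r '' outer m a b) ∧ Touch G (r '' outer m a b) {r a} ∧
      Touch G (r '' outer m a b) {r b} := by
  have hlo : 0 < a → r '' Set.Icc 0 (a - 1) ⊆ r '' outer m a b := fun ha =>
    Set.image_mono fun t ht => ⟨by have := ht.2; omega, Or.inl (by have := ht.2; omega)⟩
  have hhi : b < m → r '' Set.Icc (b + 1) m ⊆ r '' outer m a b := fun hb =>
    Set.image_mono fun t ht => ⟨ht.2, Or.inr ht.1⟩
  have hclose : G.Adj (r m) (r 0) := h.close
  refine ⟨?_, ?_, ?_⟩
  · by_cases ha : 0 < a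
    · by_cases hbm : b < m
      · have h1 : r '' outer m a b = r '' Set.Icc (b + 1) m ∪ r '' Set.Icc 0 (a - 1) := by
          rw [← Set.image_union]
          congr 1
          ext t
          simp only [outer, Set.mem_ofPred_eq, Set.mem_union, Set.mem_Icc]
          omega
        rw [h1]
        exact (h.conn_Icc (by omega) (by omega)).union_touch (h.conn_Icc (by omega) (by omega))
          ⟨_, ⟨m, ⟨by omega, le_rfl⟩, rfl⟩, _, ⟨0, ⟨le_rfl, by omega⟩, rfl⟩, hclose⟩
      · have h1 : outer m a b = Set.Icc 0 (a - 1) := by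
          ext t
          simp only [outer, Set.mem_ofPred_eq, Set.mem_Icc]
          omega
        rw [h1]
        exact h.conn_Icc (by omega) (by omega)
    · have h1 : outer m a b = Set.Icc (b + 1) m := by
        ext t
        simp only [outer, Set.mem_ofPred_eq, Set.mem_Icc]
        omega
      rw [h1]
      exact h.conn_Icc (by omega) (by omega)
  · by_cases ha : 0 < a
    · refine ⟨r (a - 1), ⟨a - 1, ⟨by omega, by omega⟩, rfl⟩, _, rfl, ?_⟩
      have := h.adj (a - 1) (by omega)
      rwa [Nat.sub_add_cancel ha] at this
    · obtain rfl : a = 0 := by omega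
      exact ⟨r m, ⟨m, ⟨le_rfl, by omega⟩, rfl⟩, _, rfl, hclose⟩
  · by_cases hbm : b < m
    · exact ⟨r (b + 1), ⟨b + 1, ⟨by omega, by omega⟩, rfl⟩, _, rfl, (h.adj b (by omega)).symm⟩
    · obtain rfl : b = m := by omega
      exact ⟨r 0, ⟨0, ⟨by omega, by omega⟩, rfl⟩, _, rfl, hclose.symm⟩

/-- A chordless path `r 0, …, r m` from `c 0` to `c 1` inside the disc, together with the side `M`
of this path that contains the rest of the rim. -/
structure Lens {V : Type*} (G : SimpleGraph V) (c : ℕ → V) (n : ℕ) (r : ℕ → V) (m : ℕ)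
    (M : Set V) : Prop where
  soc : Soc G c n
  rim : Rim G r (m + 1)
  two_le : 2 ≤ m
  start : r 0 = c 0
  finish : r m = c 1
  chord : ∀ i j, i < j → j ≤ m → G.Adj (r i) (r j) → j = i + 1 ∨ i = 0 ∧ j = m
  not_mem : ∀ i ≤ m, r i ∉ M
  mem : ∀ t, 2 ≤ t → t < n → c t ∈ M
  reach : ∀ a ∈ M, ∀ b ∈ M, ReachIn G M a b
  support : M ⊆ G.support
  closed : ∀ x ∈ M, ∀ y, G.Adj x y → y ∈ M ∨ ∃ i ≤ m, r i = y
  inside : ∀ i k j, i < k → k < j → j ≤ m → ∀ B, Conn G B → Disjoint B M → (∀ t ≤ m, r t ∉ B) →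
    Touch G B {r i} → Touch G B {r j} → ¬ Touch G M {r k}
  nonempty : (∃ x ∈ G.support, x ∉ M ∧ ∀ t ≤ m, r t ≠ x) → M.Nonempty

theorem Lens.off (h : Lens G c n r m M) {t : ℕ} (ht : t < n) {z : V} (hzM : z ∉ M)
    (hz : ∀ i ≤ m, r i ≠ z) : c t ≠ z := by
  rintro rfl
  rcases t with _ | _ | t
  · exact hz 0 (by omega) h.start
  · exact hz m le_rfl h.finish
  · exact hzM (h.mem _ (by omega) ht)

theorem Soc.exists_lens [Finite V] (h : Soc G c n) {D : Set V} (hD : Conn G D)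
    (hDc : ∀ t < n, c t ∉ D) (h0 : Touch G D {c 0}) (h1 : Touch G D {c 1}) :
    ∃ r m M, Lens G c n r m M := by
  have hn := h.rim.two_le
  have h01 : G.Adj (c 0) (c 1) := h.rim.adj 0 (by omega)
  set H := G.deleteEdges {s(c 0, c 1)} with hH
  have hHG : H ≤ G := deleteEdges_le _
  have hHadj : ∀ {a b}, H.Adj a b ↔ G.Adj a b ∧ s(a, b) ≠ s(c 0, c 1) := by
    intro a b
    rw [hH, deleteEdges_adj]
    rfl
  have hHadj' : ∀ {a b}, G.Adj a b → a ≠ c 0 → a ≠ c 1 → H.Adj a b := fun hab ha hb =>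
    hHadj.2 ⟨hab, fun e => by
      rcases Sym2.eq_iff.1 e with ⟨e, -⟩ | ⟨e, -⟩
      exacts [ha e, hb e]⟩
  let good : Set V → Prop := fun M => M ⊆ G.support ∧ (∀ a ∈ M, ∀ b ∈ M, ReachIn G M a b) ∧
    (∀ t, 2 ≤ t → t < n → c t ∈ M) ∧ ∃ D, Conn H D ∧ c 0 ∈ D ∧ c 1 ∈ D ∧ Disjoint D M
  have hgood : good (c '' {t | 2 ≤ t ∧ t < n}) := by
    refine ⟨?_, ?_, fun t h2 ht => ⟨t, ⟨h2, ht⟩, rfl⟩, Insert.insert (c 0) (Insert.insert (c 1) D),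
      ?_, Or.inl rfl, Or.inr (Or.inl rfl), ?_⟩
    · rintro _ ⟨t, ⟨h2, ht⟩, rfl⟩
      have := h.rim.adj (t - 1) (by omega)
      rw [Nat.sub_add_cancel (by omega)] at this
      exact ⟨_, this.symm⟩
    · rintro _ ⟨s, ⟨h2, hs⟩, rfl⟩ _ ⟨t, ⟨h2', ht⟩, rfl⟩
      have h3 := (h.rim.conn_Icc (i := 2) (j := n - 1) (by omega) (by omega)).2 (c s)
        ⟨s, ⟨h2, by omega⟩, rfl⟩ (c t) ⟨t, ⟨h2', by omega⟩, rfl⟩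
      exact h3.mono le_rfl (Set.image_mono fun k hk => ⟨hk.1, by have := hk.2; omega⟩)
    · have hDH : ∀ a ∈ D, ∀ b, G.Adj a b → H.Adj a b := fun a ha b hab =>
        hHadj' hab (fun e => hDc 0 (by omega) (e ▸ ha)) fun e => hDc 1 (by omega) (e ▸ ha)
      obtain ⟨p, hp, _, rfl, hp0⟩ := h0
      obtain ⟨q, hq, _, rfl, hq1⟩ := h1
      exact ((hD.of_adj fun a ha b _ => hDH a ha b).insert hq (hDH q hq _ hq1)).insert
        (Or.inr hp) (hDH p hp _ hp0)
    · rw [Set.disjoint_left]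
      rintro a ha ⟨t, ⟨h2, ht⟩, rfl⟩
      rcases ha with e | e | ha
      · have := h.rim.inj _ ht _ (by omega) e
        omega
      · have := h.rim.inj _ ht _ (by omega) e
        omega
      · exact hDc t ht ha
  obtain ⟨M, ⟨hMs, hMr, hMc, D', hD', hD0, hD1, hDM⟩, hmax⟩ :=
    (Set.toFinite {M | good M}).exists_maximalFor Set.ncard _ ⟨_, hgood⟩
  have hmax' : ∀ z ∉ M, z ∈ G.support → ((∃ a ∈ M, G.Adj a z) ∨ M = ∅) →
      ∀ D, Conn H D → c 0 ∈ D → c 1 ∈ D → Disjoint D M → z ∈ D := by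
    intro z hz hzs hza E hE hE0 hE1 hEM
    by_contra hzE
    have h2 : good (Insert.insert z M) := by
      refine ⟨?_, ?_, fun t h2 ht => Or.inr (hMc t h2 ht), E, hE, hE0, hE1, ?_⟩
      · rintro a (rfl | ha)
        exacts [hzs, hMs ha]
      · rcases hza with ⟨a, ha, haz⟩ | rfl
        · exact (Conn.insert ⟨⟨a, ha⟩, hMr⟩ ha haz).2
        · have := (conn_singleton (G := G) z).2
          simpa using this
      · rw [Set.disjoint_left]
        rintro a ha (rfl | ha')
        exacts [hzE ha, Set.disjoint_left.1 hEM ha ha']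
    have h3 := hmax h2 (Set.ncard_le_ncard (Set.subset_insert _ _) (Set.toFinite _))
    have h4 := Set.ncard_insert_of_notMem hz (Set.toFinite _)
    omega
  obtain ⟨r, m, hr, hr0, hrm, -, -, hch⟩ := hD'.exists_path (A := {c 0}) (B := {c 1})
    ⟨_, hD0, rfl⟩ ⟨_, hD1, rfl⟩
  have hr0 : r 0 = c 0 := hr0
  have hrm : r m = c 1 := hrm
  have hm0 : m ≠ 0 := by
    rintro rfl
    exact h01.ne (hr0.symm.trans hrm)
  have hm1 : m ≠ 1 := by
    rintro rfl
    have h2 := hr.adj 0 (by omega)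
    rw [zero_add, hr0, hrm] at h2
    exact (hHadj.1 h2).2 rfl
  have hrM : ∀ i ≤ m, r i ∉ M := fun i hi => Set.disjoint_left.1 hDM (hr.mem i hi)
  have hrim : Rim G r (m + 1) :=
    ⟨by omega, fun i hi j hj e => hr.inj i (by omega) j (by omega) e,
      fun i hi => hHG (hr.adj i (by omega)), by
        rw [Nat.add_sub_cancel, hr0, hrm]
        exact h01.symm⟩
  have hrC : Conn H (r '' Set.Icc 0 m) := hr.conn_seg (Nat.zero_le _) le_rfl
  have hrMd : Disjoint (r '' Set.Icc 0 m) M := by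
    rw [Set.disjoint_left]
    rintro _ ⟨i, hi, rfl⟩
    exact hrM i hi.2
  have hr0' : c 0 ∈ r '' Set.Icc 0 m := ⟨0, ⟨le_rfl, Nat.zero_le _⟩, hr0⟩
  have hrm' : c 1 ∈ r '' Set.Icc 0 m := ⟨m, ⟨Nat.zero_le _, le_rfl⟩, hrm⟩
  refine ⟨r, m, M, h, hrim, by omega, hr0, hrm, fun i j hij hj hadj => ?_, hrM, hMc, hMr, hMs,
    fun x hx y hxy => ?_, ?_, ?_⟩
  · by_cases he : s(r i, r j) = s(c 0, c 1)
    · rw [← hr0, ← hrm] at he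
      rcases Sym2.eq_iff.1 he with ⟨e1, e2⟩ | ⟨e1, e2⟩
      · exact Or.inr ⟨hr.inj _ (by omega) _ (by omega) e1, hr.inj _ hj _ le_rfl e2⟩
      · have := hr.inj _ (by omega) _ le_rfl e1
        omega
    · exact Or.inl (hch i j hij.le hj (hHadj.2 ⟨hadj, he⟩))
  · by_contra! hcon
    obtain ⟨i, hi, e⟩ := hmax' y hcon.1 ⟨_, hxy.symm⟩ (Or.inl ⟨x, hx, hxy⟩) _ hrC hr0' hrm' hrMd
    exact hcon.2 i hi.2 e
  · intro i k j hik hkj hj B hB hBM hBr hBi hBj hMk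
    obtain ⟨a, ha, _, rfl, hak⟩ := hMk
    have hBH : ∀ a ∈ B, ∀ b, G.Adj a b → H.Adj a b := fun a ha b hab =>
      hHadj' hab (fun e => hBr 0 (by omega) (by rwa [hr0, ← e]))
        fun e => hBr m le_rfl (by rwa [hrm, ← e])
    obtain ⟨p, hp, _, rfl, hpi⟩ := hBi
    obtain ⟨q, hq, _, rfl, hqj⟩ := hBj
    have h2 := hmax' (r k) (hrM k (by omega)) ⟨a, hak.symm⟩ (Or.inl ⟨a, ha, hak⟩)
      (r '' Set.Icc 0 i ∪ B ∪ r '' Set.Icc j m) ?_ (Or.inl (Or.inl ⟨0, ⟨le_rfl, by omega⟩, hr0⟩))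
      (Or.inr ⟨m, ⟨by omega, le_rfl⟩, hrm⟩) ?_
    · rcases h2 with (⟨t, ht, e⟩ | h2) | ⟨t, ht, e⟩
      · have h3 := hr.inj t (by have := ht.2; omega) k (by omega) e
        have := ht.2
        omega
      · exact hBr k (by omega) h2
      · have h3 := hr.inj t ht.2 k (by omega) e
        have := ht.1
        omega
    · refine ((hr.conn_seg (Nat.zero_le _) (by omega)).union_touch
        (hB.of_adj fun a ha b _ => hBH a ha b) ?_).union_touch (hr.conn_seg hj le_rfl) ?_
      · exact ⟨_, ⟨i, ⟨by omega, le_rfl⟩, rfl⟩, p, hp, (hBH p hp _ hpi).symm⟩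
      · exact ⟨q, Or.inr hq, _, ⟨j, ⟨le_rfl, hj⟩, rfl⟩, hBH q hq _ hqj⟩
    · rw [Set.disjoint_left]
      rintro z ((⟨t, ht, rfl⟩ | hz) | ⟨t, ht, rfl⟩)
      · exact hrM t (by have := ht.2; omega)
      · exact Set.disjoint_left.1 hBM hz
      · exact hrM t ht.2
  · rintro ⟨x, hxs, hxM, hx⟩
    by_contra hM
    obtain ⟨i, hi, e⟩ := hmax' x hxM hxs (Or.inr (Set.not_nonempty_iff_eq_empty.1 hM)) _ hrC
      hr0' hrm' hrMd
    exact hx i hi.2 e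

end

section

variable {V : Type u} {G G' : SimpleGraph V} {c r : ℕ → V} {n m : ℕ} {M : Set V} {x y : V}

/-- A vertex outside both sides of a lens can be split off by a pendant piece or by a pair of
separating vertices. -/
theorem Lens.sweepable_of_extra [Finite V] (h : Lens G c n r m M)
    (ih : SweepableBelow (V := V) G.edgeSet.ncard) (hxs : x ∈ G.support) (hxM : x ∉ M)
    (hxr : ∀ i ≤ m, r i ≠ x) : Sweepable G c n := by
  classical
  set X : Set V := {z | z ∉ M ∧ ∀ i ≤ m, r i ≠ z} with hX
  have hxX : x ∈ X := ⟨hxM, hxr⟩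
  have hsub : ∀ {y}, y ∈ X → cmpt G X y ⊆ X := fun hy => cmpt_subset hy
  have hNb : ∀ {y}, y ∈ X → ∀ z ∈ Nb G (cmpt G X y), ∃ i ≤ m, r i = z := by
    rintro y hy z ⟨hz, b, hb, hbz⟩
    by_contra hcon
    push Not at hcon
    by_cases hzM : z ∈ M
    · rcases h.closed z hzM b hbz.symm with h1 | ⟨i, hi, e⟩
      · exact (hsub hy hb).1 h1
      · exact (hsub hy hb).2 i hi e
    · exact hz (cmpt_closed hb (hsub hy hb) ⟨hzM, hcon⟩ hbz)
  have hc : ∀ t < n, c t ∉ X := fun t ht hct => h.off ht hct.1 hct.2 rfl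
  have hinside : ∀ {y}, y ∈ X → ∀ i k j, i < k → k < j → j ≤ m → Touch G (cmpt G X y) {r i} →
      Touch G (cmpt G X y) {r j} → ¬ Touch G M {r k} := fun hy i k j hik hkj hj =>
    h.inside i k j hik hkj hj _ (cmpt_conn _)
      (Set.disjoint_left.2 fun b hb => (hsub hy hb).1) fun t ht hb => (hsub hy hb).2 t ht rfl
  by_cases hone : ∃ x₀, Nb G (cmpt G X x) ⊆ {x₀}
  · obtain ⟨x₀, hx₀⟩ := hone
    exact h.soc.sweepable_of_pendant ih (fun t ht hct => hc t ht (hsub hxX hct))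
      ⟨x, mem_cmpt x, hxs⟩ hx₀
  set I : Finset ℕ := {i ∈ Finset.range (m + 1) | Touch G (cmpt G X x) {r i}} with hI
  have hmemI : ∀ {i}, i ∈ I ↔ i ≤ m ∧ Touch G (cmpt G X x) {r i} := by
    intro i
    rw [hI, Finset.mem_filter, Finset.mem_range, Nat.lt_succ_iff]
  have hIne : I.Nonempty := by
    by_contra hcon
    refine hone ⟨x, fun z hz => ?_⟩
    obtain ⟨i, hi, rfl⟩ := hNb hxX z hz
    obtain ⟨-, b, hb, hbz⟩ := hz
    exact absurd ⟨i, hmemI.2 ⟨hi, b, hb, _, rfl, hbz⟩⟩ hcon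
  obtain ⟨i, hiI, hmin⟩ : ∃ i ∈ I, ∀ t ∈ I, i ≤ t := ⟨I.min' hIne, I.min'_mem _, I.min'_le⟩
  obtain ⟨j, hjI, hmax⟩ : ∃ j ∈ I, ∀ t ∈ I, t ≤ j := ⟨I.max' hIne, I.max'_mem _, I.le_max'⟩
  have hij : i < j := by
    by_contra hcon
    refine hone ⟨r i, fun z hz => ?_⟩
    obtain ⟨t, ht, rfl⟩ := hNb hxX z hz
    obtain ⟨-, b, hb, hbz⟩ := hz
    have htI : t ∈ I := hmemI.2 ⟨ht, b, hb, _, rfl, hbz⟩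
    have h1 := hmin t htI
    have h2 := hmax t htI
    obtain rfl : t = i := by omega
    rfl
  obtain ⟨him, hxi⟩ := hmemI.1 hiI
  obtain ⟨hjm, hxj⟩ := hmemI.1 hjI
  obtain ⟨a, hai, ha, hai'⟩ : ∃ a ≤ i, (a = 0 ∨ Touch G M {r a}) ∧
      ∀ k, a < k → k ≤ i → ¬ Touch G M {r k} := by
    have h0 : ∃ a ≤ i, (a = 0 ∨ Touch G M {r a}) := ⟨0, by omega, Or.inl rfl⟩
    refine ⟨Nat.findGreatest (fun a => a = 0 ∨ Touch G M {r a}) i, Nat.findGreatest_le _,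
      Nat.findGreatest_spec (P := fun a => a = 0 ∨ Touch G M {r a}) (Nat.zero_le _) (Or.inl rfl),
      fun k hk hki hcon => Nat.findGreatest_is_greatest hk hki (Or.inr hcon)⟩
  obtain ⟨b, ⟨hjb, hbm, hb⟩, hb'⟩ : ∃ b, (j ≤ b ∧ b ≤ m ∧ (b = m ∨ Touch G M {r b})) ∧
      ∀ k, j ≤ k → k < b → ¬ Touch G M {r k} := by
    have h0 : ∃ b, j ≤ b ∧ b ≤ m ∧ (b = m ∨ Touch G M {r b}) := ⟨m, hjm, le_rfl, Or.inl rfl⟩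
    have h1 := Nat.find_spec h0
    exact ⟨Nat.find h0, h1, fun k hk hkb hcon =>
      Nat.find_min h0 hkb ⟨hk, by omega, Or.inr hcon⟩⟩
  have hfree : ∀ k, a < k → k < b → ¬ Touch G M {r k} := by
    intro k hak hkb
    by_cases h1 : k ≤ i
    · exact hai' k hak h1
    · by_cases h2 : j ≤ k
      · exact hb' k h2 hkb
      · exact hinside hxX i k j (by omega) (by omega) hjm hxi hxj
  set T : Set V := {z | (∃ s, a < s ∧ s < b ∧ r s = z) ∨
    z ∈ X ∧ ∀ t ≤ m, Touch G (cmpt G X z) {r t} → a ≤ t ∧ t ≤ b} with hT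
  have hTM : ∀ z ∈ T, z ∉ M ∧ ∀ w ∈ M, ¬ G.Adj z w := by
    rintro z (⟨s, has, hsb, rfl⟩ | ⟨hz, -⟩)
    · exact ⟨h.not_mem s (by omega), fun w hw hzw => hfree s has hsb ⟨w, hw, _, rfl, hzw.symm⟩⟩
    · refine ⟨hz.1, fun w hw hzw => ?_⟩
      rcases h.closed w hw z hzw.symm with h1 | ⟨i, hi, e⟩
      exacts [hz.1 h1, hz.2 i hi e]
  have hra : ∀ i ≤ m, r i ∈ T → a < i ∧ i < b := by
    rintro i hi (⟨s, has, hsb, e⟩ | ⟨hz, -⟩)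
    · have := h.rim.inj _ (by omega) _ (by omega) e
      omega
    · exact absurd rfl (hz.2 i hi)
  set S : Set V := {z | z ∉ M ∧ z ≠ r a ∧ z ≠ r b} with hS
  have hxT : x ∈ T := Or.inr ⟨hxX, fun t ht hxt => by
    have h1 := hmin t (hmemI.2 ⟨ht, hxt⟩)
    have h2 := hmax t (hmemI.2 ⟨ht, hxt⟩)
    omega⟩
  have hxS : x ∈ S := ⟨hxM, (hxr a (by omega)).symm, (hxr b (by omega)).symm⟩
  have hDT : cmpt G S x ⊆ T := by
    intro d hd
    refine ReachIn.closed hd hxT ?_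
    rintro p hp q ⟨hqM, hqa, hqb⟩ hpq
    by_cases hqr : ∃ t ≤ m, r t = q
    · obtain ⟨t, ht, rfl⟩ := hqr
      have hta : t ≠ a := fun e => hqa (by rw [e])
      have htb : t ≠ b := fun e => hqb (by rw [e])
      suffices h1 : a ≤ t ∧ t ≤ b from Or.inl ⟨t, by omega, by omega, rfl⟩
      rcases hp with ⟨s, has, hsb, rfl⟩ | ⟨hpX, hp⟩
      · rcases lt_trichotomy s t with h1 | rfl | h1
        · have := h.chord s t h1 ht hpq
          omega
        · omega
        · have := h.chord t s h1 (by omega) hpq.symm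
          omega
      · exact hp t ht ⟨p, mem_cmpt p, _, rfl, hpq⟩
    · push Not at hqr
      have hqX : q ∈ X := ⟨hqM, hqr⟩
      rcases hp with ⟨s, has, hsb, rfl⟩ | ⟨hpX, hp⟩
      · have hqs : Touch G (cmpt G X q) {r s} := ⟨q, mem_cmpt q, _, rfl, hpq.symm⟩
        refine Or.inr ⟨hqX, fun t ht hqt => ⟨?_, ?_⟩⟩
        · by_contra hcon
          exact hinside hqX t a s (by omega) has (by omega) hqt hqs (ha.resolve_left (by omega))
        · by_contra hcon
          exact hinside hqX s b t hsb (by omega) ht hqs hqt (hb.resolve_left (by omega))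
      · have hqp : q ∈ cmpt G X p := cmpt_closed (mem_cmpt p) hpX hqX hpq
        exact Or.inr ⟨hqX, by rwa [cmpt_eq_of_mem hqp]⟩
  have hDN : Nb G (cmpt G S x) ⊆ {r a, r b} := by
    rintro z ⟨hz, d, hd, hdz⟩
    by_contra hcon
    refine hz (cmpt_closed hd (cmpt_subset hxS hd) ⟨fun hzM => ?_, fun e => hcon (Or.inl e),
      fun e => hcon (Or.inr e)⟩ hdz)
    exact (hTM d (hDT hd)).2 z hzM hdz
  refine h.soc.sweepable_of_separation ih (cmpt_conn (G := G) (S := S) x) (fun t ht hct => ?_)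
    ⟨x, mem_cmpt x, hxs⟩ hDN ?_
  · have h1 := (hTM _ (hDT hct)).1
    refine h.off ht h1 (fun i hi e => ?_) rfl
    have h2 := hra i hi (by rw [e]; exact hDT hct)
    rcases t with _ | _ | t
    · have := h.rim.inj i (by omega) 0 (by omega) (e.trans h.start.symm)
      omega
    · have := h.rim.inj i (by omega) m (by omega) (e.trans h.finish.symm)
      omega
    · exact h1 (h.mem _ (by omega) ht)
  · by_cases hab : a = 0 ∧ b = m
    · obtain ⟨rfl, rfl⟩ := hab
      left
      have hn := h.soc.rim.two_le
      obtain ⟨z, hz⟩ := h.nonempty ⟨x, hxs, hxM, hxr⟩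
      obtain ⟨z', hzz'⟩ := h.support hz
      refine ⟨?_, z, z', hzz', fun hd => (hTM _ (hDT hd)).1 hz,
        fun hd => (hTM _ (hDT hd)).2 z hz hzz'.symm, fun e => ?_⟩
      · rw [h.start, h.finish]
        exact h.soc.rim.adj 0 (by omega)
      · rcases Sym2.eq_iff.1 e with ⟨rfl, -⟩ | ⟨rfl, -⟩
        exacts [h.not_mem _ (by omega) hz, h.not_mem _ le_rfl hz]
    · right
      have ho : ∀ t ∈ outer m a b, t < m + 1 := fun t ht => Nat.lt_succ_of_le ht.1
      obtain ⟨h1, h2, h3⟩ := h.rim.conn_outer (a := a) (b := b) (by omega) hbm (by omega)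
      refine ⟨_, h1, ?_, ?_, ?_, h2, h3⟩
      · rw [Set.disjoint_left]
        rintro _ ⟨t, ht, rfl⟩ hd
        have := hra t ht.1 (hDT hd)
        have := ht.2
        omega
      · exact h.rim.not_mem_image ho (by omega) fun ht => by have := ht.2; omega
      · exact h.rim.not_mem_image ho (by omega) fun ht => by have := ht.2; omega

end

section

variable {V : Type u} {G G' : SimpleGraph V} {c r : ℕ → V} {n m : ℕ} {M P D D₁ D₂ : Set V}
  {a b x y : V}

theorem NoKuratowski.not_five (h : NoKuratowski G) {A B C D E : Set V}
    (hc : ∀ X ∈ [A, B, C, D, E], Conn G X) (hd : [A, B, C, D, E].Pairwise Disjoint)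
    (ht : [A, B, C, D, E].Pairwise (Touch G)) : False := by
  refine h.1 ⟨fun i => [A, B, C, D, E].get i, fun i => hc _ (List.get_mem _ _), fun i j hij => ?_,
    fun i j hij => ?_⟩
  · rcases lt_or_gt_of_ne hij with h1 | h1
    · exact List.pairwise_iff_get.1 hd i j h1
    · exact (List.pairwise_iff_get.1 hd j i h1).symm
  · rcases lt_or_gt_of_ne hij.ne with h1 | h1
    · exact List.pairwise_iff_get.1 ht i j h1
    · exact (List.pairwise_iff_get.1 ht j i h1).symm

theorem NoKuratowski.not_three_three (h : NoKuratowski G) {A B C D E F : Set V}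
    (hc : ∀ X ∈ [A, B, C, D, E, F], Conn G X) (hd : [A, B, C, D, E, F].Pairwise Disjoint)
    (ht : ∀ X ∈ [A, B, C], ∀ Y ∈ [D, E, F], Touch G X Y) : False := by
  have hget : ∀ i : Fin 3, [A, B, C].get i ∈ [A, B, C] := fun i => List.get_mem _ _
  have hget' : ∀ i : Fin 3, [D, E, F].get i ∈ [D, E, F] := fun i => List.get_mem _ _
  have hd' : ([A, B, C] ++ [D, E, F]).Pairwise Disjoint := hd
  rw [List.pairwise_append] at hd'
  have key : ∀ l : List (Set V), l.Pairwise Disjoint → ∀ i j : Fin l.length, i ≠ j →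
      Disjoint (l.get i) (l.get j) := by
    intro l hl i j hij
    rcases lt_or_gt_of_ne hij with h1 | h1
    · exact List.pairwise_iff_get.1 hl i j h1
    · exact (List.pairwise_iff_get.1 hl j i h1).symm
  have hall : ∀ X, X ∈ [A, B, C] ∨ X ∈ [D, E, F] → Conn G X := fun X hX =>
    hc X (show X ∈ [A, B, C] ++ [D, E, F] from List.mem_append.2 hX)
  refine h.2 ⟨Sum.elim [A, B, C].get [D, E, F].get, ?_, ?_, ?_⟩
  · rintro (i | i)
    exacts [hall _ (Or.inl (hget i)), hall _ (Or.inr (hget' i))]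
  · rintro (i | i) (j | j) hij
    · exact key _ hd'.1 i j fun e => hij (by rw [e])
    · exact hd'.2.2 _ (hget i) _ (hget' j)
    · exact (hd'.2.2 _ (hget j) _ (hget' i)).symm
    · exact key _ hd'.2.1 i j fun e => hij (by rw [e])
  · rintro (i | i) (j | j) hij
    · simp at hij
    · exact ht _ (hget i) _ (hget' j)
    · exact (ht _ (hget j) _ (hget' i)).symm
    · simp at hij

theorem Conn.subset_support (hD : Conn G D) (h : Touch G D {x}) : D ⊆ G.support := by
  intro d hd
  by_cases hs : D ⊆ {d}
  · obtain ⟨z, hz, w, -, hzw⟩ := h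
    obtain rfl : z = d := hs hz
    exact ⟨w, hzw⟩
  · obtain ⟨z, -, hz, w, -, -, hzw⟩ := hD.exists_crossing (T := {d}) ⟨d, hd, rfl⟩ hs
    obtain rfl : z = d := hz
    exact ⟨w, hzw⟩

theorem Conn.exists_link (hP : Conn G P) (ha : a ∈ P) (hb : b ∈ P) (hab : a ≠ b)
    (hn : ¬ G.Adj a b) :
    ∃ D ⊆ P, a ∉ D ∧ b ∉ D ∧ Conn G D ∧ Touch G D {a} ∧ Touch G D {b} := by
  obtain ⟨p, l, hp, h0, hl, -, -, -⟩ := hP.exists_path (A := {a}) (B := {b}) ⟨_, ha, rfl⟩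
    ⟨_, hb, rfl⟩
  have h0 : p 0 = a := h0
  have hl : p l = b := hl
  subst h0 hl
  have hl0 : l ≠ 0 := by
    rintro rfl
    exact hab rfl
  have hl1 : l ≠ 1 := by
    rintro rfl
    exact hn (hp.adj 0 (by omega))
  have hnot : ∀ i ≤ l, (i = 0 ∨ i = l) → p i ∉ p '' Set.Icc 1 (l - 1) := by
    rintro i hi hi' ⟨t, ht, e⟩
    have h1 := ht.1
    have h2 := ht.2
    have := hp.inj t (by omega) i hi e
    omega
  refine ⟨p '' Set.Icc 1 (l - 1), ?_, hnot 0 (by omega) (by omega), hnot l (by omega) (by omega),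
    hp.conn_seg (by omega) (by omega), ⟨p 1, ⟨1, ⟨le_rfl, by omega⟩, rfl⟩, _, rfl,
      (hp.adj 0 (by omega)).symm⟩, ⟨p (l - 1), ⟨l - 1, ⟨by omega, le_rfl⟩, rfl⟩, _, rfl, ?_⟩⟩
  · rintro _ ⟨t, ht, rfl⟩
    exact hp.mem t (by have := ht.2; omega)
  · have := hp.adj (l - 1) (by omega)
    rwa [Nat.sub_add_cancel (by omega)] at this

theorem Conn.exists_stem (hP : Conn G P) (ha : a ∈ P) (hb : b ∈ P) (hab : a ≠ b) :
    ∃ D ⊆ P, a ∉ D ∧ b ∈ D ∧ Conn G D ∧ Touch G D {a} := by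
  have hbP : b ∈ P \ {a} := ⟨hb, fun h => hab h.symm⟩
  have hD := cmpt_subset (G := G) hbP
  refine ⟨cmpt G (P \ {a}) b, fun z hz => (hD hz).1, fun h => (hD h).2 rfl, mem_cmpt b,
    cmpt_conn b, ?_⟩
  obtain ⟨p, -, hp, q, hq, hqD, hpq⟩ := hP.exists_crossing (T := cmpt G (P \ {a}) b)
    ⟨b, hb, mem_cmpt b⟩ fun hs => (hD (hs ha)).2 rfl
  obtain rfl : q = a := by
    by_contra hqa
    exact hqD (cmpt_closed hp (hD hp) ⟨hq, hqa⟩ hpq)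
  exact ⟨p, hp, _, rfl, hpq⟩

theorem Rim.touch_Icc (h : Rim G r n) {i j k : ℕ} (hij : i ≤ j) (hjk : j < k) (hk : k < n) :
    Touch G (r '' Set.Icc i j) (r '' Set.Icc (j + 1) k) :=
  ⟨_, ⟨j, ⟨hij, le_rfl⟩, rfl⟩, _, ⟨j + 1, ⟨le_rfl, hjk⟩, rfl⟩, h.adj j (by omega)⟩

theorem Touch.image {X : Set V} {S : Set ℕ} {t : ℕ} (h : Touch G X {r t}) (ht : t ∈ S) :
    Touch G X (r '' S) :=
  h.mono le_rfl (Set.singleton_subset_iff.2 ⟨_, ht, rfl⟩)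

theorem disjoint_image_of_not_mem {X : Set V} {S : Set ℕ} (h : ∀ t ∈ S, r t ∉ X) :
    Disjoint (r '' S) X :=
  Set.disjoint_left.2 fun _ ⟨t, ht, e⟩ hX => h t ht (e ▸ hX)

theorem disjoint_Icc_Icc {a b a' b' : ℕ} (h : b < a') : Disjoint (Set.Icc a b) (Set.Icc a' b') :=
  Set.disjoint_left.2 fun _ ht ht' => (ht.2.trans_lt (h.trans_le ht'.1)).false

theorem disjoint_Icc_outer {a b a' b' : ℕ} (ha : a' ≤ a) (hb : b ≤ b') :
    Disjoint (Set.Icc a b) (outer m a' b') :=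
  Set.disjoint_left.2 fun _ ⟨h1, h2⟩ ⟨_, h3⟩ => by omega

theorem Rim.not_cross (h : Rim G r (m + 1)) (hK : NoKuratowski G)
    (hM : ∀ a ∈ M, ∀ b ∈ M, ReachIn G M a b) (hr : ∀ i ≤ m, r i ∉ M) {i j k l : ℕ} (hij : i < j)
    (hjk : j < k) (hkl : k < l) (hl : l ≤ m) (h₁ : Conn G D₁) (h₂ : Conn G D₂) (h₁M : D₁ ⊆ M)
    (h₂M : D₂ ⊆ M) (hd : Disjoint D₁ D₂) (hi₁ : Touch G D₁ {r i}) (hk₁ : Touch G D₁ {r k})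
    (hj₂ : Touch G D₂ {r j}) (hl₂ : Touch G D₂ {r l}) : False := by
  obtain ⟨D, hDc, h₁D, hDM, hDd, hDt⟩ := Conn.enlarge (G := G) (S := M)
    ⟨h₁.1.mono h₁M, hM⟩ h₁ h₂ h₁M h₂M hd
  obtain ⟨o1, o2, o3⟩ := h.conn_outer (a := i) (b := l - 1) (by omega) (by omega) (by omega)
  have hrM : ∀ {S : Set ℕ}, (∀ t ∈ S, t < m + 1) → ∀ {X}, X ⊆ M → Disjoint (r '' S) X :=
    fun hS _ hX => disjoint_image_of_not_mem fun t ht htX =>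
      hr t (Nat.le_of_lt_succ (hS t ht)) (hX htX)
  have hI : ∀ {a b}, b < m + 1 → ∀ t ∈ Set.Icc a b, t < m + 1 := fun hb t ht => ht.2.trans_lt hb
  have hO : ∀ {a b}, ∀ t ∈ outer m a b, t < m + 1 := fun t ht => Nat.lt_succ_of_le ht.1
  have t1 := h.touch_Icc (i := i) (j := j - 1) (k := k - 1) (by omega) (by omega) (by omega)
  have t2 := h.touch_Icc (i := j) (j := k - 1) (k := l - 1) (by omega) (by omega) (by omega)
  rw [Nat.sub_add_cancel (by omega)] at t1 t2
  refine hK.not_three_three (A := r '' Set.Icc i (j - 1)) (B := r '' Set.Icc k (l - 1)) (C := D₂)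
    (D := r '' Set.Icc j (k - 1)) (E := r '' outer m i (l - 1)) (F := D) ?_ ?_ ?_
  · simp only [List.mem_cons, List.not_mem_nil, or_false]
    rintro X (rfl | rfl | rfl | rfl | rfl | rfl)
    exacts [h.conn_Icc (by omega) (by omega), h.conn_Icc (by omega) (by omega), h₂,
      h.conn_Icc (by omega) (by omega), o1, hDc]
  · simp only [List.pairwise_cons, List.mem_cons, List.not_mem_nil, or_false, forall_eq_or_imp,
      forall_eq, false_imp_iff, implies_true, List.Pairwise.nil, and_true]
    refine ⟨⟨h.disjoint_image (hI (by omega)) (hI (by omega)) (disjoint_Icc_Icc (by omega)),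
      hrM (hI (by omega)) h₂M,
      h.disjoint_image (hI (by omega)) (hI (by omega)) (disjoint_Icc_Icc (by omega)),
      h.disjoint_image (hI (by omega)) hO (disjoint_Icc_outer (by omega) (by omega)), hrM (hI (by omega)) hDM⟩,
      ⟨hrM (hI (by omega)) h₂M,
      (h.disjoint_image (hI (by omega)) (hI (by omega)) (disjoint_Icc_Icc (by omega))).symm,
      h.disjoint_image (hI (by omega)) hO (disjoint_Icc_outer (by omega) (by omega)), hrM (hI (by omega)) hDM⟩,
      ⟨(hrM (hI (by omega)) h₂M).symm, (hrM hO h₂M).symm, hDd.symm⟩,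
      ⟨h.disjoint_image (hI (by omega)) hO (disjoint_Icc_outer (by omega) (by omega)), hrM (hI (by omega)) hDM⟩,
      hrM hO hDM⟩
  · have hD₁ : ∀ {X}, Touch G D₁ X → Touch G D X := fun hX => hX.mono h₁D le_rfl
    simp only [List.mem_cons, List.not_mem_nil, or_false, forall_eq_or_imp, forall_eq]
    refine ⟨⟨t1, Touch.symm (o2.image ⟨le_rfl, by omega⟩),
        Touch.symm ((hD₁ hi₁).image ⟨le_rfl, by omega⟩)⟩,
      ⟨t2.symm, Touch.symm (o3.image ⟨by omega, le_rfl⟩),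
        Touch.symm ((hD₁ hk₁).image ⟨le_rfl, by omega⟩)⟩,
      hj₂.image ⟨le_rfl, by omega⟩, hl₂.image ⟨hl, by omega⟩, hDt.symm⟩

theorem Rim.not_tri (h : Rim G r (m + 1)) (hK : NoKuratowski G)
    (hM : ∀ a ∈ M, ∀ b ∈ M, ReachIn G M a b) (hr : ∀ i ≤ m, r i ∉ M) {i j k : ℕ} (hij : i < j)
    (hjk : j < k) (hk : k ≤ m) (h₁ : Conn G D₁) (h₂ : Conn G D₂) (h₁M : D₁ ⊆ M)
    (h₂M : D₂ ⊆ M) (hd : Disjoint D₁ D₂)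
    (ht : ∀ t, t = i ∨ t = j ∨ t = k → Touch G D₁ {r t} ∧ Touch G D₂ {r t}) : False := by
  obtain ⟨D, hDc, h₁D, hDM, hDd, hDt⟩ := Conn.enlarge (G := G) (S := M)
    ⟨h₁.1.mono h₁M, hM⟩ h₁ h₂ h₁M h₂M hd
  obtain ⟨o1, o2, o3⟩ := h.conn_outer (a := i) (b := k - 1) (by omega) (by omega) (by omega)
  have hrM : ∀ {S : Set ℕ}, (∀ t ∈ S, t < m + 1) → ∀ {X}, X ⊆ M → Disjoint (r '' S) X :=
    fun hS _ hX => disjoint_image_of_not_mem fun t ht htX =>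
      hr t (Nat.le_of_lt_succ (hS t ht)) (hX htX)
  have hI : ∀ {a b}, b < m + 1 → ∀ t ∈ Set.Icc a b, t < m + 1 := fun hb t ht => ht.2.trans_lt hb
  have hO : ∀ {a b}, ∀ t ∈ outer m a b, t < m + 1 := fun t ht => Nat.lt_succ_of_le ht.1
  have t1 := h.touch_Icc (i := i) (j := j - 1) (k := k - 1) (by omega) (by omega) (by omega)
  rw [Nat.sub_add_cancel (by omega)] at t1
  have key : ∀ {S : Set ℕ} {t}, (t = i ∨ t = j ∨ t = k) → t ∈ S →
      Touch G D (r '' S) ∧ Touch G D₂ (r '' S) := fun ht' hS =>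
    ⟨((ht _ ht').1.image hS).mono h₁D le_rfl, (ht _ ht').2.image hS⟩
  have k1 := key (S := Set.Icc i (j - 1)) (Or.inl rfl) ⟨le_rfl, by omega⟩
  have k2 := key (S := Set.Icc j (k - 1)) (Or.inr (Or.inl rfl)) ⟨le_rfl, by omega⟩
  have k3 := key (S := outer m i (k - 1)) (Or.inr (Or.inr rfl)) ⟨hk, by omega⟩
  refine hK.not_five (A := D) (B := D₂) (C := r '' Set.Icc i (j - 1))
    (D := r '' Set.Icc j (k - 1)) (E := r '' outer m i (k - 1)) ?_ ?_ ?_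
  · simp only [List.mem_cons, List.not_mem_nil, or_false]
    rintro X (rfl | rfl | rfl | rfl | rfl)
    exacts [hDc, h₂, h.conn_Icc (by omega) (by omega), h.conn_Icc (by omega) (by omega), o1]
  · simp only [List.pairwise_cons, List.mem_cons, List.not_mem_nil, or_false, forall_eq_or_imp,
      forall_eq, false_imp_iff, implies_true, List.Pairwise.nil, and_true]
    exact ⟨⟨hDd, (hrM (hI (by omega)) hDM).symm, (hrM (hI (by omega)) hDM).symm,
      (hrM hO hDM).symm⟩, ⟨(hrM (hI (by omega)) h₂M).symm, (hrM (hI (by omega)) h₂M).symm,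
      (hrM hO h₂M).symm⟩, ⟨h.disjoint_image (hI (by omega)) (hI (by omega)) (disjoint_Icc_Icc (by omega)),
      h.disjoint_image (hI (by omega)) hO (disjoint_Icc_outer (by omega) (by omega))⟩,
      h.disjoint_image (hI (by omega)) hO (disjoint_Icc_outer (by omega) (by omega))⟩
  · simp only [List.pairwise_cons, List.mem_cons, List.not_mem_nil, or_false, forall_eq_or_imp,
      forall_eq, false_imp_iff, implies_true, List.Pairwise.nil, and_true]
    exact ⟨⟨hDt, k1.1, k2.1, k3.1⟩, ⟨k1.2, k2.2, k3.2⟩,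
      ⟨t1, Touch.symm (o2.image ⟨le_rfl, by omega⟩)⟩, Touch.symm (o3.image ⟨by omega, le_rfl⟩)⟩

end

section

variable {V : Type u} {G G' : SimpleGraph V} {c r : ℕ → V} {n m : ℕ} {M P Q D D₁ D₂ : Set V}
  {a b x y : V}

theorem Lens.eq_of_eq (h : Lens G c n r m M) {t i : ℕ} (ht : t < n) (hi : i ≤ m)
    (e : c t = r i) : t = 0 ∧ i = 0 ∨ t = 1 ∧ i = m := by
  rcases t with _ | _ | t
  · exact Or.inl ⟨rfl, h.rim.inj _ (by omega) _ (by omega) (e.symm.trans h.start.symm)⟩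
  · exact Or.inr ⟨rfl, h.rim.inj _ (by omega) _ (by omega) (e.symm.trans h.finish.symm)⟩
  · exact absurd (e ▸ h.mem _ (by omega) ht) (h.not_mem i hi)

theorem Lens.off_of_off (h : Lens G c n r m M) (hr : ∀ i ≤ m, r i ∉ D)
    (hc : ∀ t, 2 ≤ t → t < n → c t ∉ D) : ∀ t < n, c t ∉ D := by
  rintro (_ | _ | t) ht
  · exact h.start ▸ hr 0 (by omega)
  · exact h.finish ▸ hr m le_rfl
  · exact hc _ (by omega) ht

theorem Conn.subset_of_cover (hD : Conn G D) (ht : Touch G D {x})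
    (hM : ∀ x ∈ G.support, x ∈ M ∨ ∃ i ≤ m, r i = x)
    (hr : ∀ i ≤ m, r i ∉ D) : D ⊆ M := by
  intro d hd
  rcases hM d (hD.subset_support ht hd) with h1 | ⟨i, hi, rfl⟩
  · exact h1
  · exact absurd hd (hr i hi)

/-- No connected set on the far side of a lens joins its two ends if another one, disjoint from it,
joins the inside of the path to the rim. -/
theorem Lens.not_span (h : Lens G c n r m M) (hD : Conn G D) (hDM : D ⊆ M)
    (hDc : ∀ t, 2 ≤ t → t < n → c t ∉ D) (h0 : Touch G D {c 0}) (h1 : Touch G D {c 1})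
    (hQ : Conn G Q) (hDQ : Disjoint D Q) {j s : ℕ} (hj : 0 < j) (hjm : j < m)
    (hs : 2 ≤ s) (hsn : s < n) (hQr : ∀ t ≤ m, r t ∈ Q ↔ t = j)
    (hQc : ∀ t, 2 ≤ t → t < n → (c t ∈ Q ↔ t = s)) : False := by
  have hc := h.soc.rim
  have hne : ∀ s < n, ∀ t < n, s ≠ t → c s ≠ c t := fun s hs t ht hst e => hst (hc.inj s hs t ht e)
  obtain ⟨q, l, hq, hq0, hql, -, -, -⟩ := hQ.exists_path (A := {r j}) (B := {c s})
    ⟨_, (hQr j hjm.le).2 rfl, rfl⟩ ⟨_, (hQc s hs hsn).2 rfl, rfl⟩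
  have hq0 : q 0 = r j := hq0
  have hql : q l = c s := hql
  have hl0 : 0 < l := by
    rcases Nat.eq_zero_or_pos l with rfl | hl
    · exact absurd (hq0 ▸ hql ▸ h.mem s hs hsn) (h.not_mem j hjm.le)
    · exact hl
  have hQrim : ∀ t < n, c t ∈ Q → t = s := by
    rintro (_ | _ | t) ht htQ
    · have := (hQr 0 (by omega)).1 (h.start ▸ htQ)
      omega
    · have := (hQr m le_rfl).1 (h.finish ▸ htQ)
      omega
    · exact (hQc _ (by omega) ht).1 htQ
  have hc0M : c 0 ∉ M := h.start ▸ h.not_mem 0 (by omega)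
  have hc1M : c 1 ∉ M := h.finish ▸ h.not_mem m le_rfl
  set ρ : Set V := r '' Set.Icc 1 (m - 1) with hρ
  set ω : Set V := c '' Set.Icc 2 (n - 1) with hω
  have hρc : Conn G ρ := h.rim.conn_Icc (by omega) (by omega)
  have hωc : Conn G ω := hc.conn_Icc (by omega) (by omega)
  have hjρ : q 0 ∈ ρ := ⟨j, ⟨hj, by omega⟩, hq0.symm⟩
  have hsω : q l ∈ ω := ⟨s, ⟨hs, by omega⟩, hql.symm⟩
  have hρM : ∀ x ∈ ρ, x ∉ M := by
    rintro _ ⟨t, ht, rfl⟩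
    exact h.not_mem t (by have := ht.2; omega)
  have hωM : ω ⊆ M := by
    rintro _ ⟨t, ht, rfl⟩
    exact h.mem t ht.1 (by have := ht.2; omega)
  have hρrim : ∀ t < n, c t ∉ ρ := by
    rintro t ht ⟨i, ⟨hi, hi'⟩, e⟩
    have := h.eq_of_eq ht (by omega) e.symm
    omega
  have hρ0 : G.Adj (r 1) (c 0) := h.start ▸ (h.rim.adj 0 (by omega)).symm
  have hρ1 : G.Adj (r (m - 1)) (c 1) := by
    have := h.rim.adj (m - 1) (by omega)
    rwa [Nat.sub_add_cancel (by omega), h.finish] at this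
  have hr1 : r 1 ∈ ρ := ⟨1, ⟨le_rfl, by omega⟩, rfl⟩
  have hrm : r (m - 1) ∈ ρ := ⟨m - 1, ⟨by omega, le_rfl⟩, rfl⟩
  have hqQ : ∀ {t}, t ≤ l → q t ∈ Q := fun ht => hq.mem _ ht
  have hqω : ∀ {t}, t ≤ l → q t ∈ ω → t = l := by
    rintro t ht ⟨u, ⟨hu, hu'⟩, e⟩
    have : u = s := hQrim u (by omega) (e ▸ hqQ ht)
    subst this
    exact hq.inj t ht l le_rfl (e.symm.trans hql.symm)
  have hqρ : ∀ {t}, t ≤ l → q t ∈ ρ → t = 0 := by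
    rintro t ht ⟨u, ⟨hu, hu'⟩, e⟩
    have : u = j := (hQr u (by omega)).1 (e ▸ hqQ ht)
    subst this
    exact hq.inj t ht 0 (by omega) (e.symm.trans hq0.symm)
  have hqc : ∀ {i j}, i ≤ j → j ≤ l → Conn G (q '' Set.Icc i j) := fun hij hj => hq.conn_seg hij hj
  set Q' : Set V := q '' Set.Icc 0 l with hQ'
  have hQ'Q : Q' ⊆ Q := by
    rintro _ ⟨t, ht, rfl⟩
    exact hqQ ht.2
  obtain ⟨d, hd⟩ := hD.1
  have hDS : D ⊆ M \ (Q' ∪ ω) := by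
    rintro x hx
    refine ⟨hDM hx, ?_⟩
    rintro (h2 | ⟨t, ht, rfl⟩)
    · exact Set.disjoint_left.1 hDQ hx (hQ'Q h2)
    · exact hDc t ht.1 (by have := ht.2; omega) hx
  set E := cmpt G (M \ (Q' ∪ ω)) d with hE
  have hES : E ⊆ M \ (Q' ∪ ω) := cmpt_subset (hDS hd)
  have hEc : Conn G E := cmpt_conn d
  have hDE : D ⊆ E := hD.subset_cmpt_self hDS hd
  have hE0 : Touch G E {c 0} := h0.mono hDE le_rfl
  have hE1 : Touch G E {c 1} := h1.mono hDE le_rfl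
  have hEρ : Disjoint ρ E := Set.disjoint_left.2 fun x hx hxE => hρM x hx (hES hxE).1
  have hEQ : Disjoint Q' E := Set.disjoint_left.2 fun x hx hxE => (hES hxE).2 (Or.inl hx)
  have hEω : ∀ t, 2 ≤ t → t < n → c t ∉ E := fun t ht htn hcE =>
    (hES hcE).2 (Or.inr ⟨t, ⟨ht, by omega⟩, rfl⟩)
  have hErim : ∀ t < n, c t ∉ E := h.off_of_off (fun i hi hE => h.not_mem i hi (hES hE).1) hEω
  have hρQ' : Conn G (ρ ∪ Q') := hρc.union (hqc (Nat.zero_le _) le_rfl)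
    ⟨_, hjρ, 0, ⟨le_rfl, Nat.zero_le _⟩, rfl⟩
  have hsQ' : c s ∈ Q' := ⟨l, ⟨Nat.zero_le _, le_rfl⟩, hql⟩
  obtain ⟨p, -, hp, z, hzM, hzE, hpz⟩ := Conn.exists_crossing (G := G) (S := M) (T := E)
    ⟨⟨d, hDM hd⟩, h.reach⟩ ⟨d, hDM hd, hDE hd⟩
    fun hs' => (hES (hs' (h.mem s hs hsn))).2 (Or.inl hsQ')
  have hz : z ∈ Q' ∪ ω := by
    by_contra hcon
    exact hzE (cmpt_closed hp (hES hp) ⟨hzM, hcon⟩ hpz)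
  by_cases hzω : z ∈ ω
  · obtain ⟨t, ⟨ht2, htn⟩, rfl⟩ := hzω
    have hEt : Touch G E {c t} := ⟨p, hp, _, rfl, hpz⟩
    rcases lt_trichotomy t s with hts | rfl | hts
    · obtain ⟨a, ha, _, rfl, ha0⟩ := hE0
      obtain ⟨b, hb, _, rfl, hbt⟩ := hEt
      refine h.soc.noCross 0 1 t s (by omega) (by omega) hts hsn
        (Insert.insert (c 0) (Insert.insert (c t) E)) (Insert.insert (c 1) (ρ ∪ Q'))
        ((hEc.insert hb hbt).insert (Or.inr ha) ha0) (hρQ'.insert (Or.inl hrm) hρ1) ?_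
        (Or.inl rfl) (Or.inr (Or.inl rfl)) (Or.inl rfl) (Or.inr (Or.inr hsQ'))
      rw [Set.disjoint_left]
      rintro x (rfl | rfl | hx) (e | h2 | h2)
      · exact hne _ (by omega) _ (by omega) (by omega) e
      · exact hρrim _ (by omega) h2
      · have := hQrim _ (by omega) (hQ'Q h2)
        omega
      · exact hne _ (by omega) _ (by omega) (by omega) e
      · exact hρrim _ (by omega) h2
      · have := hQrim _ (by omega) (hQ'Q h2)
        omega
      · subst e
        exact hc1M (hES hx).1
      · exact Set.disjoint_left.1 hEρ h2 hx
      · exact Set.disjoint_left.1 hEQ h2 hx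
    · refine h.soc.noTri 0 1 t (by omega) (by omega) hsn E (ρ ∪ q '' Set.Icc 0 (l - 1)) hEc
        (hρc.union (hqc (Nat.zero_le _) (by omega)) ⟨_, hjρ, 0, ⟨le_rfl, Nat.zero_le _⟩, rfl⟩) ?_
        hErim ?_ ?_
      · rw [Set.disjoint_left]
        rintro x hx (h2 | ⟨u, hu, rfl⟩)
        · exact Set.disjoint_left.1 hEρ h2 hx
        · exact Set.disjoint_left.1 hEQ ⟨u, ⟨hu.1, by have := hu.2; omega⟩, rfl⟩ hx
      · rintro u hu (h2 | ⟨w, hw, e⟩)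
        · exact hρrim u hu h2
        · have hw2 := hw.2
          have hut : u = t := hQrim u hu (e ▸ hqQ (by omega))
          subst hut
          have := hq.inj w (by omega) l le_rfl (e.trans hql.symm)
          omega
      · rintro u (rfl | rfl | rfl)
        · exact ⟨hE0, r 1, Or.inl hr1, _, rfl, hρ0⟩
        · exact ⟨hE1, r (m - 1), Or.inl hrm, _, rfl, hρ1⟩
        · refine ⟨hEt, q (l - 1), Or.inr ⟨l - 1, ⟨Nat.zero_le _, le_rfl⟩, rfl⟩, _, rfl, ?_⟩
          have := hq.adj (l - 1) (by omega)
          rwa [Nat.sub_add_cancel hl0, hql] at this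
    · obtain ⟨a, ha, _, rfl, ha1⟩ := hE1
      obtain ⟨b, hb, _, rfl, hbt⟩ := hEt
      refine h.soc.noCross 0 1 s t (by omega) (by omega) hts (by omega)
        (Insert.insert (c 0) (ρ ∪ Q')) (Insert.insert (c 1) (Insert.insert (c t) E))
        (hρQ'.insert (Or.inl hr1) hρ0) ((hEc.insert hb hbt).insert (Or.inr ha) ha1) ?_
        (Or.inl rfl) (Or.inr (Or.inr hsQ')) (Or.inl rfl) (Or.inr (Or.inl rfl))
      rw [Set.disjoint_right]
      rintro x (rfl | rfl | hx) (e | h2 | h2)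
      · exact hne _ (by omega) _ (by omega) (by omega) e
      · exact hρrim _ (by omega) h2
      · have := hQrim _ (by omega) (hQ'Q h2)
        omega
      · exact hne _ (by omega) _ (by omega) (by omega) e
      · exact hρrim _ (by omega) h2
      · have := hQrim _ (by omega) (hQ'Q h2)
        omega
      · subst e
        exact hc0M (hES hx).1
      · exact Set.disjoint_left.1 hEρ h2 hx
      · exact Set.disjoint_left.1 hEQ h2 hx
  · obtain ⟨a, ha, rfl⟩ := hz.resolve_right hzω
    have hal : a < l := lt_of_le_of_ne ha.2 fun e => hzω (e ▸ hsω)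
    have ha0 : 0 < a := Nat.pos_of_ne_zero fun e => hρM _ (e ▸ hjρ) hzM
    have hqa : ∀ {x}, x ∈ Q → ∀ t < n, t ≠ s → x ≠ c t := fun hx t ht hts e =>
      hts (hQrim t ht (e ▸ hx))
    have hQQ : ∀ {i j}, j ≤ l → ∀ x ∈ q '' Set.Icc i j, x ∈ Q := by
      rintro i j hj _ ⟨t, ht, rfl⟩
      exact hqQ (ht.2.trans hj)
    have hpt : ∀ {t}, t < n → t ≠ s → ∀ {i j}, j ≤ l → c t ∉ ρ ∪ q '' Set.Icc i j := by
      rintro t ht hts i j hj (h2 | h2)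
      · exact hρrim t ht h2
      · exact hqa (hQQ hj _ h2) t ht hts rfl
    have hpt' : ∀ {t}, t < 2 → ∀ {i j}, j ≤ l → c t ∉ ω ∪ q '' Set.Icc i j := by
      rintro t ht i j hj (⟨u, hu, e⟩ | h2)
      · have := hu.1
        have := hu.2
        have := hc.inj u (by omega) t (by omega) e
        omega
      · exact hqa (hQQ hj _ h2) t (by omega) (by omega) rfl
    have hqinj : ∀ {i j}, j ≤ l → ∀ {t}, t ≤ l → q t ∈ q '' Set.Icc i j → i ≤ t ∧ t ≤ j := by
      rintro i j hj t ht ⟨u, hu, e⟩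
      obtain rfl := hq.inj u (hu.2.trans hj) t ht e
      exact hu
    refine h.soc.noKuratowski.not_three_three (A := {c 0}) (B := {c 1}) (C := {q a})
      (D := ρ ∪ q '' Set.Icc 0 (a - 1)) (E := E) (F := ω ∪ q '' Set.Icc (a + 1) l) ?_ ?_ ?_
    · simp only [List.mem_cons, List.not_mem_nil, or_false]
      rintro X (rfl | rfl | rfl | rfl | rfl | rfl)
      · exact conn_singleton _
      · exact conn_singleton _
      · exact conn_singleton _
      · exact hρc.union (hqc (Nat.zero_le _) (by omega)) ⟨_, hjρ, 0, ⟨le_rfl, Nat.zero_le _⟩, rfl⟩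
      · exact hEc
      · exact hωc.union (hqc (by omega) le_rfl) ⟨_, hsω, l, ⟨by omega, le_rfl⟩, rfl⟩
    · simp only [List.pairwise_cons, List.mem_cons, List.not_mem_nil, or_false, forall_eq_or_imp,
        forall_eq, false_imp_iff, implies_true, List.Pairwise.nil, and_true,
        Set.disjoint_singleton_left, Set.mem_singleton_iff]
      refine ⟨⟨hne _ (by omega) _ (by omega) (by omega), (hqa (hqQ hal.le) _ (by omega)
        (by omega)).symm, hpt (by omega) (by omega) (by omega), hErim _ (by omega),
        hpt' (by omega) le_rfl⟩, ⟨(hqa (hqQ hal.le) _ (by omega) (by omega)).symm,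
        hpt (by omega) (by omega) (by omega), hErim _ (by omega), hpt' (by omega) le_rfl⟩,
        ⟨?_, hzE, ?_⟩, ⟨?_, ?_⟩, ?_⟩
      · rintro (h2 | h2)
        · have := hqρ hal.le h2
          omega
        · have := hqinj (by omega) hal.le h2
          omega
      · rintro (h2 | h2)
        · exact hzω h2
        · have := hqinj le_rfl hal.le h2
          omega
      · rw [Set.disjoint_left]
        rintro x (h2 | ⟨t, ht, rfl⟩) hx
        · exact Set.disjoint_left.1 hEρ h2 hx
        · exact Set.disjoint_left.1 hEQ ⟨t, ⟨ht.1, by have := ht.2; omega⟩, rfl⟩ hx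
      · rw [Set.disjoint_left]
        rintro x (h2 | ⟨t, ht, rfl⟩) (h3 | h3)
        · exact hρM _ h2 (hωM h3)
        · obtain ⟨t, ht, rfl⟩ := h3
          have := hqρ ht.2 h2
          have := ht.1
          omega
        · have h4 := ht.2
          have := hqω (by omega) h3
          omega
        · have h4 := ht.2
          have := hqinj le_rfl (by omega) h3
          omega
      · rw [Set.disjoint_left]
        rintro x hx (h2 | ⟨t, ht, rfl⟩)
        · exact (hES hx).2 (Or.inr h2)
        · exact Set.disjoint_left.1 hEQ ⟨t, ⟨Nat.zero_le _, ht.2⟩, rfl⟩ hx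
    · simp only [List.mem_cons, List.not_mem_nil, or_false, forall_eq_or_imp, forall_eq]
      refine ⟨⟨⟨_, rfl, _, Or.inl hr1, hρ0.symm⟩, hE0.symm, _, rfl, c (n - 1),
        Or.inl ⟨n - 1, ⟨by omega, le_rfl⟩, rfl⟩, hc.close.symm⟩,
        ⟨⟨_, rfl, _, Or.inl hrm, hρ1.symm⟩, hE1.symm, _, rfl, c 2,
        Or.inl ⟨2, ⟨le_rfl, by omega⟩, rfl⟩, hc.adj 1 (by omega)⟩,
        ⟨_, rfl, q (a - 1), Or.inr ⟨a - 1, ⟨Nat.zero_le _, le_rfl⟩, rfl⟩, ?_⟩,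
        ⟨_, rfl, p, hp, hpz.symm⟩, _, rfl, q (a + 1), Or.inr ⟨a + 1, ⟨le_rfl, hal⟩, rfl⟩,
        hq.adj a hal⟩
      have := hq.adj (a - 1) (by omega)
      rw [Nat.sub_add_cancel ha0] at this
      exact this.symm

end

/-- A lens covering the whole graph, and the graph `G'` in which the edge from `c 0` to `c 1` is
removed, unless this edge closes the rim of the other side. -/
structure Peel {V : Type*} (G G' : SimpleGraph V) (c : ℕ → V) (n : ℕ) (r : ℕ → V) (m : ℕ)
    (M : Set V) : Prop where
  lens : Lens G c n r m M
  cover : ∀ x ∈ G.support, x ∈ M ∨ ∃ i ≤ m, r i = x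
  le : G' ≤ G
  adj : ∀ a b, G.Adj a b → s(a, b) ≠ s(c 0, c 1) → G'.Adj a b
  two : n = 2 → G'.Adj (c 0) (c 1)
  three : 3 ≤ n → ¬ G'.Adj (c 0) (c 1)

/-- The rim of the far side of a lens. -/
def farRim {V : Type*} (c r : ℕ → V) (m : ℕ) : ℕ → V := fun t => if t ≤ m then r t else c (t - m + 1)

section

variable {V : Type u} {G G' : SimpleGraph V} {c r : ℕ → V} {n m : ℕ} {M P Q D D₁ D₂ : Set V}
  {a b x y : V}

theorem farRim_of_le {t : ℕ} (ht : t ≤ m) : farRim c r m t = r t := if_pos ht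

theorem farRim_add {t : ℕ} (ht : 2 ≤ t) : farRim c r m (t + m - 1) = c t := by
  rw [farRim, if_neg (by omega)]
  congr 1
  omega

theorem farRim_cases {t : ℕ} (ht : t < m + n - 1) :
    t ≤ m ∨ ∃ s, 2 ≤ s ∧ s < n ∧ t = s + m - 1 := by
  by_cases h : t ≤ m
  · exact Or.inl h
  · exact Or.inr ⟨t - m + 1, by omega, by omega, by omega⟩

theorem Lens.farRim_inj (h : Lens G c n r m M) : ∀ i < m + n - 1, ∀ j < m + n - 1,
    farRim c r m i = farRim c r m j → i = j := by
  have hm := h.two_le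
  intro i hi j hj e
  rcases farRim_cases hi with hi' | ⟨s, hs, hsn, rfl⟩ <;>
    rcases farRim_cases hj with hj' | ⟨s', hs', hsn', rfl⟩
  · rw [farRim_of_le hi', farRim_of_le hj'] at e
    exact h.rim.inj _ (by omega) _ (by omega) e
  · rw [farRim_of_le hi', farRim_add hs'] at e
    have := h.eq_of_eq hsn' hi' e.symm
    omega
  · rw [farRim_of_le hj', farRim_add hs] at e
    have := h.eq_of_eq hsn hj' e
    omega
  · rw [farRim_add hs, farRim_add hs'] at e
    have := h.soc.rim.inj _ hsn _ hsn' e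
    omega

theorem Peel.rim (h : Peel G G' c n r m M) : Rim G' (farRim c r m) (m + n - 1) := by
  have hm := h.lens.two_le
  have hc := h.lens.soc.rim
  have hn := hc.two_le
  refine ⟨by omega, h.lens.farRim_inj, fun i hi => ?_, ?_⟩
  · by_cases him : i + 1 ≤ m
    · rw [farRim_of_le (by omega), farRim_of_le him]
      refine h.adj _ _ (h.lens.rim.adj i (by omega)) fun e => ?_
      rw [← h.lens.start, ← h.lens.finish] at e
      rcases Sym2.eq_iff.1 e with ⟨e1, e2⟩ | ⟨e1, e2⟩
      · have := h.lens.rim.inj _ (by omega) _ (by omega) e1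
        have := h.lens.rim.inj _ (by omega) _ (by omega) e2
        omega
      · have := h.lens.rim.inj _ (by omega) _ (by omega) e1
        omega
    · have h1 : farRim c r m i = c (i - m + 1) := by
        by_cases h2 : i = m
        · subst h2
          rw [farRim_of_le le_rfl, Nat.sub_self, h.lens.finish]
        · rw [farRim, if_neg (by omega)]
      rw [h1, farRim, if_neg him, show i + 1 - m + 1 = i - m + 1 + 1 by omega]
      refine h.adj _ _ (hc.adj _ (by omega)) fun e => ?_
      rcases Sym2.eq_iff.1 e with ⟨e1, -⟩ | ⟨e1, e2⟩
      · have := hc.inj _ (by omega) _ (by omega) e1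
        omega
      · have := hc.inj _ (by omega) _ (by omega) e2
        omega
  · rw [farRim_of_le (Nat.zero_le m), h.lens.start]
    rcases hn.eq_or_lt with rfl | hn
    · rw [farRim_of_le (by omega), show m + 2 - 1 - 1 = m by omega, h.lens.finish]
      exact (h.two rfl).symm
    · rw [show m + n - 1 - 1 = n - 1 + m - 1 by omega, farRim_add (by omega)]
      refine h.adj _ _ hc.close fun e => ?_
      rcases Sym2.eq_iff.1 e with ⟨e1, -⟩ | ⟨e1, -⟩
      · have := hc.inj _ (by omega) _ (by omega) e1
        omega
      · have := hc.inj _ (by omega) _ (by omega) e1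
        omega

theorem Peel.exists_link (h : Peel G G' c n r m M) (hP : Conn G' P) {i k : ℕ} (hik : i + 2 ≤ k)
    (hk : k ≤ m) (hn : 0 < i ∨ k < m ∨ 3 ≤ n) (hPr : ∀ t ≤ m, r t ∈ P ↔ t = i ∨ t = k) :
    ∃ D ⊆ P, Conn G D ∧ D ⊆ M ∧ Touch G D {r i} ∧ Touch G D {r k} := by
  obtain ⟨D, hDP, hi, hk', hD, hDi, hDk⟩ := hP.exists_link ((hPr i (by omega)).2 (Or.inl rfl))
    ((hPr k hk).2 (Or.inr rfl))
    (fun e => by have := h.lens.rim.inj _ (by omega) _ (by omega) e; omega) fun hadj => by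
      rcases h.lens.chord i k (by omega) hk (h.le hadj) with h1 | ⟨rfl, rfl⟩
      · omega
      · rw [h.lens.start, h.lens.finish] at hadj
        exact h.three (by omega) hadj
  have hDG := hD.mono_graph h.le
  have hDi := hDi.mono_graph h.le
  refine ⟨D, hDP, hDG, hDG.subset_of_cover hDi h.cover fun t ht htD => ?_, hDi,
    hDk.mono_graph h.le⟩
  rcases (hPr t ht).1 (hDP htD) with rfl | rfl
  exacts [hi htD, hk' htD]

theorem Peel.not_cross_one (h : Peel G G' c n r m M) (hP : Conn G' P) (hQ : Conn G Q)
    (hPQ : Disjoint P Q) {i j k s : ℕ} (hij : i < j) (hjk : j < k) (hk : k ≤ m) (hs : 2 ≤ s)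
    (hsn : s < n) (hPr : ∀ t ≤ m, r t ∈ P ↔ t = i ∨ t = k)
    (hPc : ∀ t, 2 ≤ t → t < n → c t ∉ P) (hQr : ∀ t ≤ m, r t ∈ Q ↔ t = j)
    (hQc : ∀ t, 2 ≤ t → t < n → (c t ∈ Q ↔ t = s)) : False := by
  have hl := h.lens
  have hc := hl.soc.rim
  obtain ⟨D₁, hD₁P, hD₁, hD₁M, hD₁i, hD₁k⟩ := h.exists_link hP (by omega) hk (by omega) hPr
  have hD₁c : ∀ t, 2 ≤ t → t < n → c t ∉ D₁ := fun t h2 ht htD => hPc t h2 ht (hD₁P htD)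
  have hD₁Q := hPQ.mono_left hD₁P
  by_cases hspan : i = 0 ∧ k = m
  · obtain ⟨rfl, rfl⟩ := hspan
    rw [hl.start] at hD₁i
    rw [hl.finish] at hD₁k
    exact hl.not_span hD₁ hD₁M hD₁c hD₁i hD₁k hQ hD₁Q hij hjk hs hsn hQr hQc
  obtain ⟨D, hDQ, hjD, hsD, hD, hDj⟩ := hQ.exists_stem ((hQr j (by omega)).2 rfl)
    ((hQc s hs hsn).2 rfl) fun e => hl.not_mem j (by omega) (e ▸ hl.mem s hs hsn)
  have hDM : D ⊆ M := hD.subset_of_cover hDj h.cover fun t ht htD => by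
    obtain rfl := (hQr t ht).1 (hDQ htD)
    exact hjD htD
  have harc : ∀ {a b}, 2 ≤ a → a ≤ s → s ≤ b → b < n → Conn G (D ∪ c '' Set.Icc a b) ∧
      D ∪ c '' Set.Icc a b ⊆ M ∧ Disjoint D₁ (D ∪ c '' Set.Icc a b) := by
    intro a b ha has hsb hb
    refine ⟨hD.union (hc.conn_Icc (by omega) hb) ⟨_, hsD, s, ⟨has, hsb⟩, rfl⟩, ?_, ?_⟩
    · rintro x (hx | ⟨t, ht, rfl⟩)
      exacts [hDM hx, hl.mem t (ha.trans ht.1) (ht.2.trans_lt hb)]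
    · rw [Set.disjoint_left]
      rintro x hx (hx' | ⟨t, ht, rfl⟩)
      · exact Set.disjoint_left.1 hD₁Q hx (hDQ hx')
      · exact hD₁c t (ha.trans ht.1) (ht.2.trans_lt hb) hx
  by_cases hi : 0 < i
  · obtain ⟨h1, h2, h3⟩ := harc hs le_rfl (by omega : s ≤ n - 1) (by omega)
    refine hl.rim.not_cross hl.soc.noKuratowski hl.reach hl.not_mem hi hij hjk hk h1 hD₁ h2 hD₁M
      h3.symm ?_ (hDj.mono Set.subset_union_left le_rfl) hD₁i hD₁k
    rw [hl.start]
    exact ⟨c (n - 1), Or.inr ⟨n - 1, ⟨by omega, le_rfl⟩, rfl⟩, _, rfl, hc.close⟩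
  · obtain ⟨h1, h2, h3⟩ := harc le_rfl hs le_rfl hsn
    refine hl.rim.not_cross hl.soc.noKuratowski hl.reach hl.not_mem hij hjk
      (by omega : k < m) le_rfl hD₁ h1 hD₁M h2 h3 hD₁i hD₁k
      (hDj.mono Set.subset_union_left le_rfl) ?_
    rw [hl.finish]
    exact ⟨c 2, Or.inr ⟨2, ⟨le_rfl, hs⟩, rfl⟩, _, rfl, (hc.adj 1 (by omega)).symm⟩

theorem Peel.noCross [Finite V] (h : Peel G G' c n r m M) :
    NoCross G' (farRim c r m) (m + n - 1) := by
  have hl := h.lens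
  have hm := hl.two_le
  refine noCross_of_exact hl.farRim_inj fun i j k l hij hjk hkl hln P Q hP' hQ' hPQ hPe hQe => ?_
  have hP := hP'.mono_graph h.le
  have hQ := hQ'.mono_graph h.le
  have conv : ∀ {P : Set V} {i k}, (∀ t < m + n - 1, farRim c r m t ∈ P ↔ t = i ∨ t = k) →
      (∀ t ≤ m, r t ∈ P ↔ t = i ∨ t = k) ∧
      ∀ t, 2 ≤ t → t < n → (c t ∈ P ↔ t + m - 1 = i ∨ t + m - 1 = k) := by
    intro P i k hPe
    have hn := hl.soc.rim.two_le
    refine ⟨fun t ht => ?_, fun t h2 ht => ?_⟩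
    · rw [← hPe t (by omega), farRim_of_le ht]
    · rw [← hPe _ (by omega), farRim_add h2]
  obtain ⟨hPr, hPc⟩ := conv hPe
  obtain ⟨hQr, hQc⟩ := conv hQe
  have hlo : ∀ {R : Set V} {i}, Conn G R → i ≤ m → r i ∈ R →
      Conn G (R ∪ r '' Set.Icc 0 i) ∧ c 0 ∈ R ∪ r '' Set.Icc 0 i := fun hR hi hiR =>
    ⟨hR.union (hl.rim.conn_Icc (Nat.zero_le _) (by omega)) ⟨_, hiR, _, ⟨Nat.zero_le _, le_rfl⟩, rfl⟩,
      Or.inr ⟨0, ⟨le_rfl, Nat.zero_le _⟩, hl.start⟩⟩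
  rcases farRim_cases hln with hlm | ⟨u, hu, hun, rfl⟩
  · obtain ⟨D₁, hD₁P, hD₁, hD₁M, hD₁i, hD₁k⟩ :=
      h.exists_link hP' (by omega) (by omega) (by omega) hPr
    obtain ⟨D₂, hD₂Q, hD₂, hD₂M, hD₂j, hD₂l⟩ :=
      h.exists_link hQ' (by omega) (by omega) (by omega) hQr
    exact hl.rim.not_cross hl.soc.noKuratowski hl.reach hl.not_mem hij hjk hkl hlm hD₁ hD₂ hD₁M
      hD₂M (hPQ.mono hD₁P hD₂Q) hD₁i hD₁k hD₂j hD₂l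
  have huQ : c u ∈ Q := (hQc u hu hun).2 (Or.inr rfl)
  rcases farRim_cases (hkl.trans hln) with hkm | ⟨s, hs, hsn, rfl⟩
  · refine h.not_cross_one hP' hQ hPQ hij hjk hkm hu hun hPr (fun t h2 ht htP => ?_)
      (fun t ht => ?_) fun t h2 ht => ?_
    · have := (hPc t h2 ht).1 htP
      omega
    · rw [hQr t ht]
      omega
    · rw [hQc t h2 ht]
      omega
  have hsP : c s ∈ P := (hPc s hs hsn).2 (Or.inr rfl)
  rcases farRim_cases (hjk.trans (hkl.trans hln)) with hjm | ⟨t, ht, htn, rfl⟩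
  · obtain ⟨h1, h2⟩ := hlo hP (by omega) ((hPr i (by omega)).2 (Or.inl rfl))
    refine hl.soc.noCross 0 1 s u (by omega) (by omega) (by omega) hun (P ∪ r '' Set.Icc 0 i)
      (Q ∪ r '' Set.Icc j m) h1 (hQ.union (hl.rim.conn_Icc hjm (by omega))
        ⟨_, (hQr j hjm).2 (Or.inl rfl), _, ⟨le_rfl, hjm⟩, rfl⟩) ?_ h2 (Or.inl hsP)
      (Or.inr ⟨m, ⟨hjm, le_rfl⟩, hl.finish⟩) (Or.inl huQ)
    rw [Set.disjoint_left]
    rintro x (hx | ⟨a, ⟨ha, ha'⟩, rfl⟩) (hx' | ⟨b, ⟨hb, hb'⟩, e⟩)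
    · exact Set.disjoint_left.1 hPQ hx hx'
    · have := (hPr b hb').1 (e ▸ hx)
      omega
    · have := (hQr a (by omega)).1 hx'
      omega
    · have := hl.rim.inj _ (by omega) _ (by omega) e
      omega
  have htQ : c t ∈ Q := (hQc t ht htn).2 (Or.inl rfl)
  rcases farRim_cases (hij.trans (hjk.trans (hkl.trans hln))) with him | ⟨w, hw, hwn, rfl⟩
  · obtain ⟨h1, h2⟩ := hlo hP him ((hPr i him).2 (Or.inl rfl))
    refine hl.soc.noCross 0 t s u (by omega) (by omega) (by omega) hun (P ∪ r '' Set.Icc 0 i)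
      Q h1 hQ ?_ h2 (Or.inl hsP) htQ huQ
    rw [Set.disjoint_left]
    rintro x (hx | ⟨a, ⟨ha, ha'⟩, rfl⟩) hx'
    · exact Set.disjoint_left.1 hPQ hx hx'
    · have := (hQr a (by omega)).1 hx'
      omega
  · exact hl.soc.noCross w t s u (by omega) (by omega) (by omega) hun P Q hP hQ hPQ
      ((hPc w hw hwn).2 (Or.inl rfl)) hsP htQ huQ

theorem Peel.noTri (h : Peel G G' c n r m M) : NoTri G' (farRim c r m) (m + n - 1) := by
  have hl := h.lens
  have hm := hl.two_le
  have hc := hl.soc.rim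
  have hn := hc.two_le
  intro i j k hij hjk hkn P Q hP hQ hPQ hPo hQo ht
  replace hP := hP.mono_graph h.le
  replace hQ := hQ.mono_graph h.le
  have conv : ∀ {P : Set V}, (∀ t < m + n - 1, farRim c r m t ∉ P) → (∀ t ≤ m, r t ∉ P) ∧
      ∀ t, 2 ≤ t → t < n → c t ∉ P := by
    refine fun hPo => ⟨fun t ht => ?_, fun t h2 ht => ?_⟩
    · rw [← farRim_of_le (c := c) (r := r) ht]
      exact hPo t (by omega)
    · rw [← farRim_add (c := c) (r := r) (m := m) h2]
      exact hPo _ (by omega)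
  have hPr := (conv hPo).1
  have hQr := (conv hQo).1
  have hPc := hl.off_of_off hPr (conv hPo).2
  have hQc := hl.off_of_off hQr (conv hQo).2
  replace ht : ∀ t, t = i ∨ t = j ∨ t = k → Touch G P {farRim c r m t} ∧
      Touch G Q {farRim c r m t} := fun t h1 =>
    ⟨(ht t h1).1.mono_graph h.le, (ht t h1).2.mono_graph h.le⟩
  have hPM : P ⊆ M := hP.subset_of_cover (ht i (Or.inl rfl)).1 h.cover hPr
  have hQM : Q ⊆ M := hQ.subset_of_cover (ht i (Or.inl rfl)).2 h.cover hQr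
  have hi := ht i (Or.inl rfl)
  have hj := ht j (Or.inr (Or.inl rfl))
  have hk := ht k (Or.inr (Or.inr rfl))
  have hM : ∀ {S : Set ℕ}, (∀ t ∈ S, t ≤ m) → ∀ {X}, X ⊆ M → Disjoint X (r '' S) :=
    fun hS _ hX => (disjoint_image_of_not_mem fun t ht htX => hl.not_mem t (hS t ht) (hX htX)).symm
  have hO : ∀ {a b}, ∀ t ∈ outer m a b, t ≤ m := fun t ht => ht.1
  have hcM : ∀ {a b}, 2 ≤ a → b < n → c '' Set.Icc a b ⊆ M := by
    rintro a b ha hb _ ⟨t, ht, rfl⟩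
    exact hl.mem t (ha.trans ht.1) (ht.2.trans_lt hb)
  have hcd : ∀ {X}, (∀ t < n, c t ∉ X) → ∀ {a b}, b < n → Disjoint X (c '' Set.Icc a b) :=
    fun hX _ _ hb => (disjoint_image_of_not_mem fun t ht => hX t (ht.2.trans_lt hb)).symm
  have hlast : ∀ {a b s}, 0 < a → 2 ≤ s → s < n →
      Touch G (r '' outer m a b) (c '' Set.Icc s (n - 1)) := fun ha hs hsn =>
    ⟨_, ⟨0, ⟨Nat.zero_le _, Or.inl ha⟩, hl.start⟩, _, ⟨n - 1, ⟨by omega, le_rfl⟩, rfl⟩,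
      hc.close.symm⟩
  have hfirst : ∀ {a b s}, b < m → 2 ≤ s → s < n →
      Touch G (r '' outer m a b) (c '' Set.Icc 2 s) := fun hb hs hsn =>
    ⟨_, ⟨m, ⟨le_rfl, Or.inr hb⟩, hl.finish⟩, _, ⟨2, ⟨le_rfl, hs⟩, rfl⟩, hc.adj 1 (by omega)⟩
  have hrO : ∀ {t a b}, t ≤ m → a ≤ t → t ≤ b → r t ∉ r '' outer m a b := by
    intro t a b htm ha hb
    exact hl.rim.not_mem_image (fun u hu => Nat.lt_succ_of_le hu.1) (by omega)
      fun hu => by have := hu.2; omega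
  rcases farRim_cases hkn with hkm | ⟨u, hu, hun, rfl⟩
  · refine hl.rim.not_tri hl.soc.noKuratowski hl.reach hl.not_mem hij hjk hkm hP hQ hPM hQM hPQ
      fun t h1 => ?_
    have := ht t h1
    rwa [farRim_of_le (by omega)] at this
  rw [farRim_add hu] at hk
  rcases farRim_cases (hjk.trans hkn) with hjm | ⟨s, hs, hsn, rfl⟩
  · rw [farRim_of_le hjm] at hj
    rw [farRim_of_le (by omega)] at hi
    by_cases hspan : i = 0 ∧ j = m
    · obtain ⟨rfl, rfl⟩ := hspan
      rw [hl.start] at hi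
      rw [hl.finish] at hj
      refine hl.soc.noTri 0 1 u (by omega) (by omega) hun P Q hP hQ hPQ hPc hQc ?_
      rintro t (rfl | rfl | rfl) <;> assumption
    obtain ⟨o1, o2, o3⟩ := hl.rim.conn_outer (a := i) (b := j) (by omega) hjm (by omega)
    refine hl.soc.noKuratowski.not_three_three (A := P) (B := Q) (C := r '' outer m i j)
      (D := {r i}) (E := {r j}) (F := c '' Set.Icc 2 (n - 1)) ?_ ?_ ?_
    · simp only [List.mem_cons, List.not_mem_nil, or_false]
      rintro X (rfl | rfl | rfl | rfl | rfl | rfl)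
      exacts [hP, hQ, o1, conn_singleton _, conn_singleton _, hc.conn_Icc (by omega) (by omega)]
    · simp only [List.pairwise_cons, List.mem_cons, List.not_mem_nil, or_false, forall_eq_or_imp,
        forall_eq, false_imp_iff, implies_true, List.Pairwise.nil, and_true,
        Set.disjoint_singleton_left, Set.disjoint_singleton_right, Set.mem_singleton_iff]
      refine ⟨⟨hPQ, hM hO hPM, hPr i (by omega), hPr j hjm, hcd hPc (by omega)⟩,
        ⟨hM hO hQM, hQr i (by omega), hQr j hjm, hcd hQc (by omega)⟩,
        ⟨hrO (by omega) le_rfl hij.le, hrO hjm hij.le le_rfl,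
          (hM hO (hcM le_rfl (by omega))).symm⟩,
        ⟨fun e => ?_, fun e => hl.not_mem i (by omega) (hcM le_rfl (by omega) e)⟩,
        fun e => hl.not_mem j hjm (hcM le_rfl (by omega) e)⟩
      have := hl.rim.inj _ (by omega) _ (by omega) e
      omega
    · simp only [List.mem_cons, List.not_mem_nil, or_false, forall_eq_or_imp, forall_eq]
      refine ⟨⟨hi.1, hj.1, hk.1.image ⟨hu, by omega⟩⟩, ⟨hi.2, hj.2, hk.2.image ⟨hu, by omega⟩⟩, o2, o3,
        ?_⟩
      by_cases h1 : 0 < i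
      · exact hlast h1 le_rfl (by omega)
      · exact hfirst (by omega) (by omega) (by omega)
  rw [farRim_add hs] at hj
  rcases farRim_cases (hij.trans (hjk.trans hkn)) with him | ⟨w, hw, hwn, rfl⟩
  · rw [farRim_of_le him] at hi
    by_cases hi0 : i = 0
    · subst hi0
      rw [hl.start] at hi
      refine hl.soc.noTri 0 s u (by omega) (by omega) hun P Q hP hQ hPQ hPc hQc ?_
      rintro t (rfl | rfl | rfl) <;> assumption
    by_cases him' : i = m
    · subst him'
      rw [hl.finish] at hi
      refine hl.soc.noTri 1 s u (by omega) (by omega) hun P Q hP hQ hPQ hPc hQc ?_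
      rintro t (rfl | rfl | rfl) <;> assumption
    obtain ⟨o1, o2, -⟩ := hl.rim.conn_outer (a := i) (b := i) le_rfl him (by omega)
    refine hl.soc.noKuratowski.not_three_three (A := P) (B := Q) (C := r '' outer m i i)
      (D := {r i}) (E := c '' Set.Icc 2 s) (F := c '' Set.Icc (s + 1) (n - 1)) ?_ ?_ ?_
    · simp only [List.mem_cons, List.not_mem_nil, or_false]
      rintro X (rfl | rfl | rfl | rfl | rfl | rfl)
      exacts [hP, hQ, o1, conn_singleton _, hc.conn_Icc (by omega) (by omega),
        hc.conn_Icc (by omega) (by omega)]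
    · simp only [List.pairwise_cons, List.mem_cons, List.not_mem_nil, or_false, forall_eq_or_imp,
        forall_eq, false_imp_iff, implies_true, List.Pairwise.nil, and_true,
        Set.disjoint_singleton_left, Set.disjoint_singleton_right]
      refine ⟨⟨hPQ, hM hO hPM, hPr i him, hcd hPc (by omega), hcd hPc (by omega)⟩,
        ⟨hM hO hQM, hQr i him, hcd hQc (by omega), hcd hQc (by omega)⟩,
        ⟨hrO him le_rfl le_rfl, (hM hO (hcM le_rfl (by omega))).symm,
          (hM hO (hcM (by omega) (by omega))).symm⟩,
        ⟨fun e => hl.not_mem i him (hcM le_rfl (by omega) e),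
          fun e => hl.not_mem i him (hcM (by omega) (by omega) e)⟩,
        hc.disjoint_image (fun t ht => ht.2.trans_lt hsn) (fun t ht => by have := ht.2; omega)
          (disjoint_Icc_Icc (Nat.lt_succ_self s))⟩
    · simp only [List.mem_cons, List.not_mem_nil, or_false, forall_eq_or_imp, forall_eq]
      exact ⟨⟨hi.1, hj.1.image ⟨hs, le_rfl⟩, hk.1.image ⟨by omega, by omega⟩⟩,
        ⟨hi.2, hj.2.image ⟨hs, le_rfl⟩, hk.2.image ⟨by omega, by omega⟩⟩, o2,
        hfirst (by omega) hs hsn, hlast (by omega) (by omega) (by omega)⟩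
  · rw [farRim_add hw] at hi
    refine hl.soc.noTri w s u (by omega) (by omega) hun P Q hP hQ hPQ hPc hQc ?_
    rintro t (rfl | rfl | rfl) <;> assumption

theorem Peel.soc [Finite V] (h : Peel G G' c n r m M) :
    Soc G' (farRim c r m) (m + n - 1) :=
  ⟨h.rim, h.lens.soc.noKuratowski.repl (Repl.of_le h.le (c 0) (c 0)), h.noCross, h.noTri⟩

end

section

variable {V : Type u} {G G' : SimpleGraph V} {c r : ℕ → V} {n m : ℕ} {M : Set V}

theorem Sweep.insert_list {p q l : List V} (h : (p ++ (l ++ q)).Nodup) (hne : p ++ q ≠ []) :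
    Sweep {x | x ∈ l} (p ++ q) (p ++ (l ++ q)) (Consec (p ++ q)) := by
  induction l generalizing p with
  | nil => exact Sweep.refl h (fun _ _ h => List.not_mem_nil h) fun _ _ => id
  | cons a l ih =>
    have key := ih (p := p ++ [a]) (by simpa using h) (by simp)
    simp only [List.append_assoc, List.singleton_append] at key
    have hd := List.nodup_append.1 h
    simp only [List.cons_append, List.nodup_cons, List.mem_append, not_or] at hd
    refine Sweep.ins (a := a) List.mem_cons_self hne (key.mono (fun x hx => ⟨List.mem_cons_of_mem _ hx,
      fun e => hd.2.1.1.1 (e ▸ hx)⟩) (fun x hx hx' => ?_) fun _ _ => Or.inr) fun _ _ => Or.inl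
    exact key.not_mem x hx ((List.mem_cons.1 hx'.1).resolve_left hx'.2)

theorem Peel.sweepable (h : Peel G G' c n r m M) (h' : Sweepable G' (farRim c r m) (m + n - 1)) :
    Sweepable G c n := by
  have hl := h.lens
  have hm := hl.two_le
  have hc := hl.soc.rim
  have hn := hc.two_le
  obtain ⟨s, rfl⟩ : ∃ s, n = s + 1 + 1 := ⟨n - 2, by omega⟩
  obtain ⟨k, rfl⟩ : ∃ k, m = k + 1 := ⟨m - 1, by omega⟩
  set l := (List.range k).map fun i => r (i + 1) with hdl
  set q := (List.range (s + 1)).map fun i => c (i + 1) with hq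
  have hw : word c (s + 1 + 1) = [c 0] ++ q := by
    rw [word, List.range_succ_eq_map, List.map_cons, List.map_map]
    rfl
  have hfw : word (farRim c r (k + 1)) (k + 1 + (s + 1 + 1) - 1) = [c 0] ++ (l ++ q) := by
    rw [show k + 1 + (s + 1 + 1) - 1 = k + (s + 1) + 1 by omega, word, List.range_succ_eq_map,
      List.map_cons, List.map_map, List.range_add, List.map_append, List.map_map,
      farRim_of_le (by omega), hl.start, List.singleton_append]
    congr 2
    · exact List.map_congr_left fun i hi =>
        farRim_of_le (Nat.succ_le_succ (List.mem_range.1 hi).le)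
    · refine List.map_congr_left fun i _ => ?_
      show farRim c r (k + 1) (k + i + 1) = c (i + 1)
      rcases i with _ | i
      · rw [farRim_of_le (by omega)]
        exact hl.finish
      · rw [← farRim_add (c := c) (r := r) (m := k + 1) (by omega : 2 ≤ i + 1 + 1)]
        congr 1
        omega
  have he : farRim c r (k + 1) (k + 1 + (s + 1 + 1) - 1 - 1) = c (s + 1) := by
    rcases s with _ | s
    · rw [farRim_of_le (by omega)]
      exact hl.finish
    · rw [← farRim_add (c := c) (r := r) (m := k + 1) (by omega : 2 ≤ s + 1 + 1)]
      congr 1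
      omega
  have h2 := h'
  rw [Sweepable, hfw, he, farRim_of_le (Nat.zero_le _), hl.start] at h2
  have h1 := Sweep.insert_list (p := [c 0]) (l := l) (q := q) h2.nodup (by simp)
  have hlm : ∀ x ∈ l, ∃ i, 1 ≤ i ∧ i ≤ k ∧ r i = x := by
    intro x hx
    obtain ⟨i, hi, rfl⟩ := List.mem_map.1 hx
    exact ⟨i + 1, by omega, List.mem_range.1 hi, rfl⟩
  rw [Sweepable, hw]
  refine (h1.trans h2 (fun x hx => h2.not_mem x ?_) ?_).mono ?_ ?_ ?_
  · rcases List.mem_append.1 hx with hx | hx <;> simp only [List.mem_append, hx, true_or, or_true]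
  · rw [Set.disjoint_left]
    exact fun x hx => h2.not_mem x (List.mem_append_right _ (List.mem_append_left _ hx))
  · rintro x (hx | hx)
    · obtain ⟨i, hi, hik, rfl⟩ := hlm x hx
      refine ⟨⟨_, hl.rim.adj i (by omega)⟩, fun t ht e => ?_⟩
      have := hl.eq_of_eq ht (by omega) e
      omega
    · refine ⟨hx.1.imp fun y hy => h.le hy, fun t ht => ?_⟩
      rcases t with _ | _ | t
      · exact hl.start ▸ farRim_of_le (c := c) (r := r) (Nat.zero_le (k + 1)) ▸ hx.2 0 (by omega)
      · exact hl.finish ▸ farRim_of_le (c := c) (r := r) (le_refl (k + 1)) ▸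
          hx.2 (k + 1) (by omega)
      · rw [← farRim_add (c := c) (r := r) (m := k + 1) (by omega : 2 ≤ t + 1 + 1)]
        exact hx.2 _ (by omega)
  · intro x hx hx'
    obtain ⟨t, ht, e⟩ := mem_word.1 (hw ▸ hx)
    exact hx'.2 t ht e
  · intro x y hxy
    by_cases e : s(x, y) = s(c 0, c 1)
    · have h0 : Consec ([c 0] ++ q) (c 0) (c 1) := by
        refine Or.inl ⟨[], q.tail, ?_⟩
        rw [hq, List.range_succ_eq_map]
        rfl
      rcases Sym2.eq_iff.1 e with ⟨rfl, rfl⟩ | ⟨rfl, rfl⟩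
      exacts [Or.inl h0, Or.inl h0.symm]
    · exact Or.inr (Or.inr (h.adj x y hxy e))

theorem Soc.sweepable_of_lens [Finite V] (h : Soc G c n)
    (ih : SweepableBelow (V := V) G.edgeSet.ncard)
    (ih' : n = 2 → ∀ c' n', 3 ≤ n' → Soc G c' n' → Sweepable G c' n')
    (hl : Lens G c n r m M) : Sweepable G c n := by
  by_cases hx : ∃ x ∈ G.support, x ∉ M ∧ ∀ i ≤ m, r i ≠ x
  · obtain ⟨x, hxs, hxM, hxr⟩ := hx
    exact hl.sweepable_of_extra ih hxs hxM hxr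
  have hcov : ∀ x ∈ G.support, x ∈ M ∨ ∃ i ≤ m, r i = x := fun x hxs => by
    by_contra! hcon
    exact hx ⟨x, hxs, hcon⟩
  have h01 := h.rim.adj 0 h.rim.two_le
  have hm := hl.two_le
  rcases h.rim.two_le.eq_or_lt with h2 | h3
  · have hp : Peel G G c n r m M :=
      ⟨hl, hcov, le_rfl, fun _ _ h _ => h, fun _ => h01, fun _ => by omega⟩
    exact hp.sweepable (ih' h2.symm _ _ (by omega) hp.soc)
  · have hp : Peel G (G.deleteEdges {s(c 0, c 1)}) c n r m M :=
      ⟨hl, hcov, deleteEdges_le _, fun _ _ h e => deleteEdges_adj.2 ⟨h, e⟩,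
        fun _ => by omega, fun _ hadj => (deleteEdges_adj.1 hadj).2 rfl⟩
    exact hp.sweepable (ih _ _ _ hp.soc (edges_lt hp.le h01 (hp.three h3)))

theorem Soc.sweepable_step [Finite V] (h : Soc G c n)
    (ih : SweepableBelow (V := V) G.edgeSet.ncard)
    (ih' : n = 2 → ∀ c' n', 3 ≤ n' → Soc G c' n' → Sweepable G c' n') : Sweepable G c n := by
  classical
  have hn := h.rim.two_le
  set Link : ℕ → Prop := fun j =>
    ∃ B, Conn G B ∧ (∀ t < n, c t ∉ B) ∧ Touch G B {c 0} ∧ Touch G B {c j} with hLink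
  by_cases h1 : Link 1
  · obtain ⟨B, hB, hBc, hB0, hB1⟩ := h1
    obtain ⟨r, m, M, hl⟩ := h.exists_lens hB hBc hB0 hB1
    exact h.sweepable_of_lens ih ih' hl
  by_cases hj : ∃ j, 1 ≤ j ∧ j < n ∧ Link j
  · obtain ⟨hj1, hjn, B, hB, hBc, hB0, hBj⟩ := Nat.find_spec hj
    have h2 : 2 ≤ Nat.find hj := by
      by_contra hlt
      exact h1 ((show Nat.find hj = 1 by omega) ▸ (Nat.find_spec hj).2.2)
    exact h.sweepable_of_link ih h2 hjn (Or.inl ⟨B, hB, hBc, hB0, hBj, fun i hi hij B hB hBc h0 h1 =>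
      Nat.find_min hj hij ⟨hi, by omega, B, hB, hBc, h0, h1⟩⟩)
  have pendant : ∀ x ∈ G.support, (∀ t < n, c t ≠ x) →
      (∀ B, Conn G B → (∀ t < n, c t ∉ B) → x ∈ B → ∃ t₀, ∀ t < n, Touch G B {c t} → t = t₀) →
      Sweepable G c n := by
    intro x hxs hxc hB
    have hS : ∀ t < n, c t ∉ cmpt G {z | ∀ t < n, c t ≠ z} x :=
      fun t ht hct => cmpt_subset (S := {z | ∀ t < n, c t ≠ z}) hxc hct t ht rfl
    obtain ⟨t₀, ht₀⟩ := hB _ (cmpt_conn x) hS (mem_cmpt x)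
    refine h.sweepable_of_pendant ih hS ⟨x, mem_cmpt x, hxs⟩ (x₀ := c t₀) ?_
    rintro y ⟨hy, z, hz, hzy⟩
    by_cases hyc : ∀ t < n, c t ≠ y
    · exact absurd (cmpt_closed hz (cmpt_subset (S := {z | ∀ t < n, c t ≠ z}) hxc hz) hyc hzy) hy
    · push Not at hyc
      obtain ⟨t, ht, rfl⟩ := hyc
      rw [ht₀ t ht ⟨z, hz, _, rfl, hzy⟩]
      rfl
  by_cases hoff : ∃ b, G.Adj (c 0) b ∧ ∀ t < n, c t ≠ b
  · obtain ⟨b, hb, hbc⟩ := hoff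
    refine pendant b ⟨_, hb.symm⟩ hbc fun B hB hBc hbB => ⟨0, fun t ht htB => ?_⟩
    by_contra h0
    exact hj ⟨t, by omega, ht, B, hB, hBc, ⟨b, hbB, _, rfl, hb.symm⟩, htB⟩
  rcases hn.eq_or_lt with rfl | h3
  · by_cases hx : ∃ x ∈ G.support, ∀ t < 2, c t ≠ x
    · obtain ⟨x, hxs, hxc⟩ := hx
      refine pendant x hxs hxc fun B hB hBc _ => ⟨1, fun t ht ⟨z, hz, y, hy, hzy⟩ => ?_⟩
      by_contra h0
      obtain rfl : t = 0 := by omega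
      rw [Set.mem_singleton_iff.1 hy] at hzy
      exact hoff ⟨z, hzy.symm, fun t ht e => hBc t ht (e ▸ hz)⟩
    · have hend : ∀ x ∈ G.support, x = c 0 ∨ x = c 1 := by
        intro x hxs
        by_contra! hcon
        exact hx ⟨x, hxs, fun t ht e => by interval_cases t <;> simp_all⟩
      refine Sweep.refl h.rim.nodup_word (fun x hx hx' => ?_) fun x y hxy => ?_
      · obtain ⟨t, ht, e⟩ := mem_word.1 hx
        exact hx'.2 t ht e
      · have h0 : Consec [c 0, c 1] (c 0) (c 1) := Or.inl (List.infix_refl _)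
        rcases hend x ⟨_, hxy⟩ with rfl | rfl <;> rcases hend y ⟨_, hxy.symm⟩ with rfl | rfl
        exacts [absurd rfl hxy.ne, h0, h0.symm, absurd rfl hxy.ne]
  by_cases hch : ∃ j, 2 ≤ j ∧ j + 1 < n ∧ G.Adj (c 0) (c j)
  · obtain ⟨j, hj2, hjn, hadj⟩ := hch
    exact h.sweepable_of_link ih hj2 (by omega) (Or.inr ⟨hjn, hadj⟩)
  refine h.sweepable_of_free ih h3 fun b hb => ?_
  by_contra! hcon
  refine hoff ⟨b, hb, ?_⟩
  rintro t ht rfl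
  have : t ≠ 0 := by
    rintro rfl
    exact hb.ne rfl
  have : t ≠ 1 := by
    rintro rfl
    exact hcon.1 rfl
  have : t ≠ n - 1 := by
    rintro rfl
    exact hcon.2 rfl
  exact hch ⟨t, by omega, by omega, hb⟩

theorem Soc.sweepable [Finite V] (h : Soc G c n) : Sweepable G c n := by
  induction hk : G.edgeSet.ncard using Nat.strong_induction_on generalizing G c n with
  | _ k ih =>
    subst hk
    have ih' : SweepableBelow (V := V) G.edgeSet.ncard := fun G' c' n' h' hlt => ih _ hlt h' rfl
    exact h.sweepable_step ih' fun _ c' n' h3 h' => h'.sweepable_step ih' fun h2 => by omega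

/-- Vertices outside of `A` can be added to a sweep. -/
theorem Sweep.add_finset {A : Set V} {s t : V} {E : V → V → Prop} (h : Sweep A [s, t] [s, t] E)
    (F : Finset V) (hs : s ∉ F) (ht : t ∉ F) (hA : ∀ x ∈ F, x ∉ A) :
    Sweep (A ∪ F) [s, t] [s, t] (fun x y => E x y ∨ x = t ∧ y ∈ F) := by
  classical
  induction F using Finset.induction with
  | empty => simpa using h
  | insert a F ha ih =>
    simp only [Finset.mem_insert, not_or] at hs ht
    have key := ih hs.2 ht.2 fun x hx => hA x (Finset.mem_insert_of_mem hx)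
    have hst := key.nodup
    have haA := hA a (Finset.mem_insert_self a F)
    have hsub : A ∪ F ⊆ (A ∪ ↑(Insert.insert a F)) \ {a} := by
      rintro x (hx | hx)
      · exact ⟨Or.inl hx, fun e => haA (e ▸ hx)⟩
      · exact ⟨Or.inr (Finset.mem_insert_of_mem hx), fun e => ha (e ▸ hx)⟩
    refine Sweep.ins (p := [s, t]) (q := []) (Or.inr (Finset.mem_insert_self a F)) (by simp)
      (Sweep.del (p := [s, t]) (q := []) (F := fun x y => E x y ∨ x = t ∧ y ∈ Insert.insert a F)
        (by simp_all [eq_comm]) (by simp) (by simp) (key.mono hsub (fun x hx hx' => ?_)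
        fun _ _ => Or.inr) ?_) fun _ _ => Or.inr
    · obtain ⟨hx' | hx', hxa⟩ := hx'
      · exact key.not_mem x hx (Or.inl hx')
      · exact key.not_mem x hx (Or.inr ((Finset.mem_insert.1 hx').resolve_left hxa))
    · rintro x y (h | ⟨rfl, hy⟩)
      · exact Or.inr (Or.inl h)
      · rcases Finset.mem_insert.1 hy with rfl | hy
        exacts [Or.inl (Or.inl ⟨[s], [], rfl⟩), Or.inr (Or.inr ⟨rfl, hy⟩)]

theorem NoKuratowski.exists_grid_minor [Fintype V] (hG : NoKuratowski G) :
    ∃ n, HasMinor G (pathGraph n □ pathGraph n) := by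
  classical
  by_cases h : ∃ s t, G.Adj s t
  · obtain ⟨s, t, hst⟩ := h
    have key := (Soc.of_edge hG hst).sweepable.of_edge.add_finset
      (Finset.univ.filter (· ∉ G.support))
      (fun h => (Finset.mem_filter.1 h).2 ⟨t, hst⟩) (fun h => (Finset.mem_filter.1 h).2 ⟨s, hst.symm⟩)
      fun x hx hx' => (Finset.mem_filter.1 hx).2 hx'.1
    refine key.exists_grid_minor (by simp) (fun x => ?_) fun _ _ => Or.inl
    by_cases hx : x ∈ G.support
    · exact hx.imp fun y hy => Or.inl (Or.inl hy)
    · exact ⟨t, Or.inr (Or.inr ⟨rfl, Finset.mem_filter.2 ⟨Finset.mem_univ x, hx⟩⟩)⟩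
  · push Not at h
    exact ⟨Fintype.card V, HasMinor.of_embedding
      ⟨fun x => (Fintype.equivFin V x, Fintype.equivFin V x), fun x y e => by simpa using e⟩
      fun a b hab => absurd hab (h a b)⟩

end

theorem hasMinor_grid_of_le {n₀ n : ℕ} (h : n₀ ≤ n) :
    HasMinor (pathGraph n₀ □ pathGraph n₀) (pathGraph n □ pathGraph n) := by
  refine HasMinor.of_embedding ((Fin.castLEEmb h).prodMap (Fin.castLEEmb h)) fun a b hab => ?_
  simpa [boxProd_adj, pathGraph_adj, Fin.ext_iff] using hab

theorem hasMinor_top_of_card_le {W : Type v} [Fintype W] (H : SimpleGraph W) {n : ℕ}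
    (h : Fintype.card W ≤ n) : HasMinor H (⊤ : SimpleGraph (Fin n)) :=
  HasMinor.of_embedding ((Fintype.equivFin W).toEmbedding.trans (Fin.castLEEmb h))
    fun _ _ hab => (top_adj _ _).2 fun e => hab.ne (Function.Embedding.injective _ e)

/-- **Theorem.** For every planar graph `H` and every positive integer `N₀`, there exists a
positive integer `N` such that for every `H`-minor free graph `G`, every 2-list-assignment
`L` of `G`, and every pre-`L`-coloring `c₀` (with domain `S`) of `G` with weak diameter in
`G` at most `N₀`, `c₀` can be extended to an `L`-coloring of `G` with weak diameter in `G`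
at most `N`. -/
theorem planar_minor_free_precoloring_extension_weak_diameter
    {W : Type v} [Fintype W] (H : SimpleGraph W) (hH : IsPlanar H)
    (N₀ : ℕ) (hN₀ : 0 < N₀) :
    ∃ N : ℕ, 0 < N ∧
      ∀ (V : Type u) [Fintype V] (G : SimpleGraph V),
        ¬ IsMinor H G →
        ∀ L : V → Finset ℕ,
          (∀ x, (L x).Nonempty) →
          (∀ x, (L x).card = 2) →
          ∀ (S : Set V) (c₀ : V → ℕ),
            (∀ x ∈ S, c₀ x ∈ L x) →
            HasWeakDiamLE G S c₀ N₀ →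
            ∃ c : V → ℕ, (∀ x, c x ∈ L x) ∧ (∀ x ∈ S, c x = c₀ x) ∧
              HasWeakDiamLE G Set.univ c N := by
  obtain ⟨n₀, hn₀⟩ := NoKuratowski.exists_grid_minor (G := H)
    ⟨isMinor_iff.not.1 hH.1, isMinor_iff.not.1 hH.2⟩
  obtain ⟨w, hw⟩ := exists_elim.{u} (max n₀ (Fintype.card W))
  obtain ⟨N, hN⟩ := exists_extension_of_width.{u} w N₀
  refine ⟨N + 1, N.succ_pos, fun V _ G hG L _ hL S c₀ hc₀ hd => ?_⟩
  rw [isMinor_iff] at hG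
  obtain ⟨A, hA, hAw⟩ := (hw V G (fun h => hG ((hasMinor_top_of_card_le H (le_max_right _ _)).trans h))
    fun h => hG ((hn₀.trans (hasMinor_grid_of_le (le_max_left _ _))).trans h)).exists_treeOrd
  obtain ⟨c, h1, h2, h3⟩ := hN V G A hA hAw L hL S c₀ hc₀ hd
  exact ⟨c, h1, h2, fun a b hab => (h3 a b hab).trans N.le_succ⟩
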